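/- Let S be a special subvariety of Y(1)ⁿ and (U_q)_{q∈Q} a parametric family of constructible subsets of S. Then (unconditionally) there is a finite collection 𝒮 of proper special subvarieties of S such that for every q ∈ Q and every strongly atypical component X of U_q in S, there is T₀ ∈ 𝒮 satisfying: (a) X ⊆ T₀; (b) dim X ≤ dim(U_q ∩ T₀) + dim spcl(X) − dim T₀ (X is a typical component of U_q ∩ spcl(X) inside T₀); and (c) dim(U_q ∩ T₀) > dim U_q + dim T₀ − dim S (the intersection U_q ∩ T₀ is atypical in S). -/

import Mathlib

noncomputable section

namespace ModularJPaper

/-! ### Basic objects: the upper half-plane, Möbius actions, the modular `j`-function -/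

/-- The complex upper half-plane, as a subset of `ℂ`. -/
def HH : Set ℂ := {z : ℂ | 0 < z.im}

/-- The Möbius action of a complex 2×2 matrix on `ℂ`. -/
def moeb (g : Matrix (Fin 2) (Fin 2) ℂ) (z : ℂ) : ℂ :=
  (g 0 0 * z + g 0 1) / (g 1 0 * z + g 1 1)

/-- A rational 2×2 matrix viewed as a complex one. -/
def qmat (g : Matrix (Fin 2) (Fin 2) ℚ) : Matrix (Fin 2) (Fin 2) ℂ :=
  g.map (fun a => (a : ℂ))

/-- An integer 2×2 matrix viewed as a complex one. -/
def zmat (g : Matrix (Fin 2) (Fin 2) ℤ) : Matrix (Fin 2) (Fin 2) ℂ :=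
  g.map (fun a => (a : ℂ))

/-- `IsModularJ j` says that `j : ℂ → ℂ` restricts on the upper half-plane to *the*
modular `j`-function: it is holomorphic on `ℍ`, invariant under `SL₂(ℤ)`, and has a
Fourier expansion `j(z) = q⁻¹ + 744 + ∑_{k ≥ 1} a_k q^k` with `q = exp(2πiz)`.
(These properties determine `j` uniquely on `ℍ`.) -/
structure IsModularJ (j : ℂ → ℂ) : Prop where
  holo : DifferentiableOn ℂ j HH
  invariant : ∀ g : Matrix (Fin 2) (Fin 2) ℤ, g.det = 1 → ∀ z ∈ HH, j (moeb (zmat g) z) = j z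
  fourier : ∃ a : ℕ → ℂ, ∀ z ∈ HH,
    HasSum (fun k : ℕ => a k * Complex.exp (2 * (Real.pi : ℂ) * Complex.I * z) ^ (k + 1))
      (j z - (Complex.exp (2 * (Real.pi : ℂ) * Complex.I * z))⁻¹ - 744)

/-! ### Algebraic sets, Zariski closure, irreducibility, dimension -/

/-- `V` is an algebraic subset of `ℂ^ι` (the common zero set of a family of polynomials). -/
def IsAlgSet {ι : Type*} (V : Set (ι → ℂ)) : Prop :=
  ∃ P : Set (MvPolynomial ι ℂ), V = {x | ∀ p ∈ P, MvPolynomial.eval x p = 0}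

/-- `V` is an algebraic subset of `ℂ^ι` defined by polynomials with coefficients in `L`. -/
def IsAlgSetOver {ι : Type*} (L : Set ℂ) (V : Set (ι → ℂ)) : Prop :=
  ∃ P : Set (MvPolynomial ι ℂ),
    (∀ p ∈ P, ∀ m : ι →₀ ℕ, MvPolynomial.coeff m p ∈ L) ∧
    V = {x | ∀ p ∈ P, MvPolynomial.eval x p = 0}

/-- The Zariski closure of a subset of `ℂ^ι`. -/
def zcl {ι : Type*} (S : Set (ι → ℂ)) : Set (ι → ℂ) :=
  ⋂₀ {T | IsAlgSet T ∧ S ⊆ T}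

/-- Irreducibility (in the Zariski topology) of a subset of `ℂ^ι`. -/
def IsIrr {ι : Type*} (S : Set (ι → ℂ)) : Prop :=
  S.Nonempty ∧ ∀ V W : Set (ι → ℂ), IsAlgSet V → IsAlgSet W → S ⊆ V ∪ W → S ⊆ V ∨ S ⊆ W

/-- The dimension of (the Zariski closure of) a subset of `ℂ^ι`: the supremum of the
lengths of strictly increasing chains of irreducible algebraic subsets of its closure. -/
def adim {ι : Type*} (S : Set (ι → ℂ)) : ℕ :=
  sSup {k : ℕ | ∃ c : Fin (k + 1) → Set (ι → ℂ), StrictMono c ∧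
    ∀ i, IsAlgSet (c i) ∧ IsIrr (c i) ∧ c i ⊆ zcl S}

/-- `X` is an irreducible component of (the Zariski closure of) the set `A`. -/
def IsIrrCompOf {ι : Type*} (X A : Set (ι → ℂ)) : Prop :=
  IsAlgSet X ∧ IsIrr X ∧ X ⊆ zcl A ∧
    ∀ Y : Set (ι → ℂ), IsAlgSet Y → IsIrr Y → Y ⊆ zcl A → X ⊆ Y → X = Y

/-- Constructible subsets of `ℂ^ι`: finite unions of differences of algebraic sets. -/
def IsConstr {ι : Type*} (S : Set (ι → ℂ)) : Prop :=
  ∃ (k : ℕ) (A B : Fin k → Set (ι → ℂ)),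
    (∀ i, IsAlgSet (A i) ∧ IsAlgSet (B i)) ∧ S = ⋃ i, A i \ B i

/-- No coordinate is constant on `V`. -/
def NoConstCoord {ι : Type*} (V : Set (ι → ℂ)) : Prop :=
  ∀ (i : ι) (c : ℂ), ∃ v ∈ V, v i ≠ c

/-- The fibre of a parametric family `F ⊆ ℂ^ι × ℂ^κ` over the parameter `q`. -/
def fib {ι κ : Type*} (F : Set ((ι ⊕ κ) → ℂ)) (q : κ → ℂ) : Set (ι → ℂ) :=
  {s | Sum.elim s q ∈ F}

/-! ### Transcendence degree and finitely generated subfields of `ℂ` -/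

/-- The transcendence degree `tr.deg_K K(v)` of the field generated over `K` by the
coordinates of the tuple `v`: the maximal size of a subfamily of `v` that is
algebraically independent over `K`. -/
def trdegF (K : Subfield ℂ) {ι : Type*} (v : ι → ℂ) : ℕ :=
  sSup {k : ℕ | ∃ t : Finset ι, t.card = k ∧ AlgebraicIndependent K (fun i : t => v i.1)}

/-- `K` is a finitely generated subfield of `ℂ`. -/
def FGField (K : Subfield ℂ) : Prop :=
  ∃ s : Finset ℂ, K = Subfield.closure ↑s

/-! ### The set Σ of quadratic points, `GL₂⁺(ℚ)`-orbits, special points -/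

/-- `Σ`: the quadratic points of the upper half-plane. -/
def SigmaSet : Set ℂ := {z | z ∈ HH ∧ (minpoly ℚ z).natDegree = 2}

/-- `x` and `y` are related by the Möbius action of an element of `G = GL₂⁺(ℚ)`. -/
def GRel (x y : ℂ) : Prop :=
  ∃ g : Matrix (Fin 2) (Fin 2) ℚ, 0 < g.det ∧ moeb (qmat g) x = y

/-- The `GL₂⁺(ℚ)`-orbit of `x`. -/
def Gorb (x : ℂ) : Set ℂ := {y | GRel x y}

/-- `dim_G(z | C)`: the number of distinct `G`-orbits of coordinates of the tuple `z`
which contain no element of `C`. -/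
def dimG {ι : Type*} (z : ι → ℂ) (C : Set ℂ) : ℕ :=
  Set.ncard {S : Set ℂ | ∃ i : ι, S = Gorb (z i) ∧ ∀ c ∈ C, ¬ GRel (z i) c}

/-- `w` is a special point (singular modulus): `w = j(τ)` for a quadratic `τ ∈ ℍ`. -/
def IsSpecialPt (j : ℂ → ℂ) (w : ℂ) : Prop := ∃ τ ∈ SigmaSet, w = j τ

/-- The zero set of the modular polynomial `Φ_N`, described via the modular
correspondence: `Φ_N(x,y) = 0` iff `x = j(z)` and `y = j(gz)` for some `z ∈ ℍ` and
some primitive integer matrix `g` of determinant `N`. -/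
def PhiRel (j : ℂ → ℂ) (N : ℕ) (x y : ℂ) : Prop :=
  ∃ z ∈ HH, ∃ g : Matrix (Fin 2) (Fin 2) ℤ, g.det = (N : ℤ) ∧
    Nat.gcd (Int.gcd (g 0 0) (g 0 1)) (Int.gcd (g 1 0) (g 1 1)) = 1 ∧
    x = j z ∧ y = j (moeb (zmat g) z)

/-! ### Special, weakly special and Möbius subvarieties -/

/-- An algebraic set cut out by modular relations `Φ_N(Y_i, Y_k) = 0` and by equations
`Y_i = τ` with `τ` a special point. -/
def IsSpecialBase {ι : Type*} (j : ℂ → ℂ) (B : Set (ι → ℂ)) : Prop :=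
  ∃ (R : Set (ι × ι × ℕ)) (E : Set (ι × ℂ)),
    (∀ r ∈ R, 1 ≤ r.2.2) ∧ (∀ e ∈ E, IsSpecialPt j e.2) ∧
    B = {y | (∀ r ∈ R, PhiRel j r.2.2 (y r.1) (y r.2.1)) ∧ ∀ e ∈ E, y e.1 = e.2}

/-- A special subvariety of `Y(1)^ι`: an irreducible component of an algebraic set cut
out by modular relations and special-point constant equations. -/
def IsSpecial {ι : Type*} (j : ℂ → ℂ) (T : Set (ι → ℂ)) : Prop :=
  ∃ B, IsSpecialBase j B ∧ IsIrrCompOf T B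

/-- A weakly special subvariety of `Y(1)^ι`: an irreducible component of an algebraic
set cut out by modular relations and arbitrary constant equations. -/
def IsWSpecial {ι : Type*} (j : ℂ → ℂ) (T : Set (ι → ℂ)) : Prop :=
  ∃ (R : Set (ι × ι × ℕ)) (E : Set (ι × ℂ)), (∀ r ∈ R, 1 ≤ r.2.2) ∧
    IsIrrCompOf T {y | (∀ r ∈ R, PhiRel j r.2.2 (y r.1) (y r.2.1)) ∧ ∀ e ∈ E, y e.1 = e.2}

/-- A weakly special subvariety of complexity at most `N`: only modular polynomials
`Φ_M` with `M ≤ N` are needed to define it. -/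
def IsWSpecialLE {ι : Type*} (j : ℂ → ℂ) (N : ℕ) (T : Set (ι → ℂ)) : Prop :=
  ∃ (R : Set (ι × ι × ℕ)) (E : Set (ι × ℂ)), (∀ r ∈ R, 1 ≤ r.2.2 ∧ r.2.2 ≤ N) ∧
    IsIrrCompOf T {y | (∀ r ∈ R, PhiRel j r.2.2 (y r.1) (y r.2.1)) ∧ ∀ e ∈ E, y e.1 = e.2}

/-- A basic special subvariety: a special subvariety with no constant coordinates. -/
def IsBasicSpecial {ι : Type*} (j : ℂ → ℂ) (T : Set (ι → ℂ)) : Prop :=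
  IsSpecial j T ∧ NoConstCoord T

/-- The special closure of `X`: the smallest special subvariety containing `X`. -/
def spcl {ι : Type*} (j : ℂ → ℂ) (X : Set (ι → ℂ)) : Set (ι → ℂ) :=
  ⋂₀ {T | IsSpecial j T ∧ X ⊆ T}

/-- The weakly special closure of `X`. -/
def wspcl {ι : Type*} (j : ℂ → ℂ) (X : Set (ι → ℂ)) : Set (ι → ℂ) :=
  ⋂₀ {T | IsWSpecial j T ∧ X ⊆ T}

/-- The Möbius relation `M_g(x,y) = y(cx+d) - (ax+b) = 0` attached to a 2×2 matrix. -/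
def MrelC (g : Matrix (Fin 2) (Fin 2) ℂ) (x y : ℂ) : Prop :=
  y * (g 1 0 * x + g 1 1) - (g 0 0 * x + g 0 1) = 0

/-- A 2×2 matrix is non-scalar. -/
def NonScalar (g : Matrix (Fin 2) (Fin 2) ℂ) : Prop :=
  ¬ (g 0 1 = 0 ∧ g 1 0 = 0 ∧ g 0 0 = g 1 1)

/-- A Möbius subvariety of `ℂ^ι`: cut out by finitely many relations `M_g(X_i, X_k) = 0`
with `g` non-scalar in `GL₂(ℂ)`. -/
def IsMoebius {ι : Type*} (M : Set (ι → ℂ)) : Prop :=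
  ∃ (D : Finset (ι × ι)) (f : ι × ι → Matrix (Fin 2) (Fin 2) ℂ),
    (∀ p ∈ D, (f p).det ≠ 0 ∧ NonScalar (f p)) ∧
    M = {x | ∀ p ∈ D, MrelC (f p) (x p.1) (x p.2)}

/-- A Möbius subvariety of `ℂ^ι` defined by matrices in `G = GL₂⁺(ℚ)`. -/
def IsMoebiusQpos {ι : Type*} (M : Set (ι → ℂ)) : Prop :=
  ∃ (D : Finset (ι × ι)) (f : ι × ι → Matrix (Fin 2) (Fin 2) ℚ),
    (∀ p ∈ D, 0 < (f p).det ∧ NonScalar (qmat (f p))) ∧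
    M = {x | ∀ p ∈ D, MrelC (qmat (f p)) (x p.1) (x p.2)}

/-- A Möbius subvariety of `ℂ^ι` defined over `ℚ` (rational invertible non-scalar
matrices). -/
def IsMoebiusRat {ι : Type*} (M : Set (ι → ℂ)) : Prop :=
  ∃ (D : Finset (ι × ι)) (f : ι × ι → Matrix (Fin 2) (Fin 2) ℚ),
    (∀ p ∈ D, (f p).det ≠ 0 ∧ NonScalar (qmat (f p))) ∧
    M = {x | ∀ p ∈ D, MrelC (qmat (f p)) (x p.1) (x p.2)}

/-! ### The two-sorted space `ℂⁿ × Y(1)ⁿ`, broadness, freeness, (EC) -/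

/-- The coordinate projection `Pr_i : ℂⁿ × Y(1)ⁿ → ℂ^ℓ × Y(1)^ℓ` attached to a tuple
`i₁ < ⋯ < i_ℓ`. -/
def prSum {n ℓ : ℕ} (i : Fin ℓ → Fin n) (v : (Fin n ⊕ Fin n) → ℂ) : (Fin ℓ ⊕ Fin ℓ) → ℂ :=
  Sum.elim (fun k => v (Sum.inl (i k))) (fun k => v (Sum.inr (i k)))

/-- `V ⊆ ℂⁿ × Y(1)ⁿ` is broad: `dim Pr_i(V) ≥ ℓ` for every tuple `i₁ < ⋯ < i_ℓ`. -/
def Broad {n : ℕ} (V : Set ((Fin n ⊕ Fin n) → ℂ)) : Prop :=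
  ∀ (ℓ : ℕ) (i : Fin ℓ → Fin n), 1 ≤ ℓ → StrictMono i → ℓ ≤ adim (prSum i '' V)

/-- `V ⊆ ℂⁿ × Y(1)ⁿ` is modularly free: `V` is not contained in `ℂⁿ × T` for any proper
special subvariety `T` of `Y(1)ⁿ`. -/
def ModularlyFree {n : ℕ} (j : ℂ → ℂ) (V : Set ((Fin n ⊕ Fin n) → ℂ)) : Prop :=
  ∀ T : Set (Fin n → ℂ), IsSpecial j T → T ≠ Set.univ →
    ¬ V ⊆ {v | (fun k => v (Sum.inr k)) ∈ T}

/-- `V ⊆ ℂⁿ × Y(1)ⁿ` is free. -/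
def Free {n : ℕ} (j : ℂ → ℂ) (V : Set ((Fin n ⊕ Fin n) → ℂ)) : Prop :=
  NoConstCoord V ∧
  (∀ M : Set (Fin n → ℂ), IsMoebiusQpos M → M ≠ Set.univ →
    ¬ V ⊆ {v | (fun k => v (Sum.inl k)) ∈ M}) ∧
  ModularlyFree j V

/-- The graph `E_jⁿ ⊆ ℂⁿ × Y(1)ⁿ` of the `j`-function. -/
def Ej (j : ℂ → ℂ) (n : ℕ) : Set ((Fin n ⊕ Fin n) → ℂ) :=
  {v | (∀ k, v (Sum.inl k) ∈ HH) ∧ ∀ k, v (Sum.inr k) = j (v (Sum.inl k))}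

/-- `V` satisfies (EC): `V ∩ E_jⁿ` is Zariski dense in `V`. -/
def SatisfiesEC {n : ℕ} (j : ℂ → ℂ) (V : Set ((Fin n ⊕ Fin n) → ℂ)) : Prop :=
  V ⊆ zcl (V ∩ Ej j n)

/-! ### MSCD and MZP -/

/-- The modular Schanuel conjecture with derivatives. -/
def MSCD (j : ℂ → ℂ) : Prop :=
  ∀ (n : ℕ) (z : Fin n → ℂ), (∀ i, z i ∈ HH) →
    3 * dimG z SigmaSet ≤
      trdegF ⊥ (fun p : Fin 4 × Fin n =>
        ![z, j ∘ z, deriv j ∘ z, deriv (deriv j) ∘ z] p.1 p.2)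

/-- `X` is an atypical component of `W ⊆ Y(1)ⁿ`: an irreducible component of `W ∩ T`,
for some special subvariety `T`, with `dim X > dim W + dim T − n`. -/
def IsAtypComp {n : ℕ} (j : ℂ → ℂ) (W X : Set (Fin n → ℂ)) : Prop :=
  ∃ T, IsSpecial j T ∧ IsIrrCompOf X (W ∩ T) ∧
    (adim W : ℤ) + (adim T : ℤ) - (n : ℤ) < (adim X : ℤ)

/-- The modular Zilber–Pink conjecture: every subvariety of `Y(1)ⁿ` has finitely many
maximal atypical components. -/
def MZP (j : ℂ → ℂ) : Prop :=
  ∀ (n : ℕ) (W : Set (Fin n → ℂ)), IsAlgSet W →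
    {X | IsAtypComp j W X ∧ ∀ X', IsAtypComp j W X' → X ⊆ X' → X = X'}.Finite

/-! ### `j`-derivations, `jcl`, `C_j`, `dim^j` -/

/-- A `j`-derivation on `ℂ`. -/
def IsJDeriv (j : ℂ → ℂ) (D : ℂ → ℂ) : Prop :=
  (∀ a b : ℂ, D (a + b) = D a + D b) ∧
  (∀ a b : ℂ, D (a * b) = a * D b + b * D a) ∧
  (∀ z ∈ HH, ∀ k : ℕ, D (deriv^[k] j z) = deriv^[k + 1] j z * D z)

/-- The `j`-closure of a subset of `ℂ`. -/
def jcl (j : ℂ → ℂ) (A : Set ℂ) : Set ℂ :=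
  {x | ∀ D : ℂ → ℂ, IsJDeriv j D → (∀ a ∈ A, D a = 0) → D x = 0}

/-- `C_j = jcl(∅)`. -/
def Cj (j : ℂ → ℂ) : Set ℂ := jcl j ∅

/-- `dim^j(A|B) ≥ n`. -/
def dimjGE (j : ℂ → ℂ) (A B : Set ℂ) (n : ℕ) : Prop :=
  ∃ (a : Fin n → ℂ) (D : Fin n → ℂ → ℂ),
    (∀ i, a i ∈ jcl j A) ∧
    (∀ i, IsJDeriv j (D i) ∧ ∀ b ∈ B, D i b = 0) ∧
    (∀ i k, D i (a k) = if i = k then 1 else 0)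

/-- `dim^j(A|B)`, the relative dimension in the pregeometry `jcl`. -/
def dimj (j : ℂ → ℂ) (A B : Set ℂ) : ℕ := sSup {n | dimjGE j A B n}

/-- `V ⊆ ℂⁿ × Y(1)ⁿ` (broad) has no `C_j`-factors. -/
def NoCjFactors {n : ℕ} (j : ℂ → ℂ) (V : Set ((Fin n ⊕ Fin n) → ℂ)) : Prop :=
  ∀ (ℓ : ℕ) (i : Fin ℓ → Fin n), 1 ≤ ℓ → StrictMono i →
    ℓ < adim (prSum i '' V) ∨
    (adim (prSum i '' V) = ℓ ∧ ¬ IsAlgSetOver (Cj j) (zcl (prSum i '' V)))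

/-- A tuple `t ∈ ℍ^m` is convenient for `j`:
`tr.deg_ℚ ℚ(t, J(t)) = 3 dim_G(t|Σ) + dim^j(t)`. -/
def ConvenientTuple (j : ℂ → ℂ) {m : ℕ} (t : Fin m → ℂ) : Prop :=
  (∀ i, t i ∈ HH) ∧
  trdegF ⊥ (fun p : Fin 4 × Fin m =>
      ![t, j ∘ t, deriv j ∘ t, deriv (deriv j) ∘ t] p.1 p.2)
    = 3 * dimG t SigmaSet + dimj j (Set.range t) ∅

/-! ### Iterates of `j` -/

/-- The iterates of `j`: `jIt j 0 = id`, `jIt j (n+1) = j ∘ jIt j n`; so `j_n = jIt j n`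
for `n ≥ 1`. -/
def jIt (j : ℂ → ℂ) : ℕ → ℂ → ℂ
  | 0 => id
  | n + 1 => j ∘ jIt j n

/-- The domain `ℍ_n` of `j_n`: `ℍ₁ = ℍ`, `ℍ_{n+1} = {z ∈ ℍ_n : j_n(z) ∈ ℍ}`. -/
def HHn (j : ℂ → ℂ) : ℕ → Set ℂ
  | 0 => Set.univ
  | n + 1 => {z ∈ HHn j n | jIt j n z ∈ HH}

/-! ### The space `ℂⁿ × Y₂(1)ⁿ` with derivatives -/

/-- The projection `PR_i : ℂⁿ × Y₂(1)ⁿ → ℂ^ℓ × Y₂(1)^ℓ`. -/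
def prJ {n ℓ : ℕ} (i : Fin ℓ → Fin n) (v : (Fin n ⊕ Fin n × Fin 3) → ℂ) :
    (Fin ℓ ⊕ Fin ℓ × Fin 3) → ℂ :=
  Sum.elim (fun k => v (Sum.inl (i k))) (fun p => v (Sum.inr (i p.1, p.2)))

/-- `V ⊆ ℂⁿ × Y₂(1)ⁿ` is `J`-broad: `dim PR_i(V) ≥ 3ℓ` for all `i`. -/
def JBroad {n : ℕ} (V : Set ((Fin n ⊕ Fin n × Fin 3) → ℂ)) : Prop :=
  ∀ (ℓ : ℕ) (i : Fin ℓ → Fin n), 1 ≤ ℓ → StrictMono i → 3 * ℓ ≤ adim (prJ i '' V)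

/-- `V ⊆ ℂⁿ × Y₂(1)ⁿ` is `J`-free. -/
def JFree {n : ℕ} (j : ℂ → ℂ) (V : Set ((Fin n ⊕ Fin n × Fin 3) → ℂ)) : Prop :=
  NoConstCoord V ∧
  (∀ M : Set (Fin n → ℂ), IsMoebiusRat M → M ≠ Set.univ →
    ¬ V ⊆ {v | (fun k => v (Sum.inl k)) ∈ M}) ∧
  (∀ T : Set (Fin n → ℂ), IsSpecial j T → T ≠ Set.univ →
    ¬ V ⊆ {v | (fun k => v (Sum.inr (k, 0))) ∈ T})

/-- The graph `E_Jⁿ ⊆ ℂⁿ × Y₂(1)ⁿ` of `J = (j, j′, j″)`. -/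
def EJ (j : ℂ → ℂ) (n : ℕ) : Set ((Fin n ⊕ Fin n × Fin 3) → ℂ) :=
  {v | (∀ k, v (Sum.inl k) ∈ HH) ∧ ∀ k : Fin n,
      v (Sum.inr (k, 0)) = j (v (Sum.inl k)) ∧
      v (Sum.inr (k, 1)) = deriv j (v (Sum.inl k)) ∧
      v (Sum.inr (k, 2)) = deriv (deriv j) (v (Sum.inl k))}

/-- `V ⊆ ℂⁿ × Y₂(1)ⁿ` (J-broad) has no `C_j`-factors. -/
def NoCjFactorsJ {n : ℕ} (j : ℂ → ℂ) (V : Set ((Fin n ⊕ Fin n × Fin 3) → ℂ)) : Prop :=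
  ∀ (ℓ : ℕ) (i : Fin ℓ → Fin n), 1 ≤ ℓ → StrictMono i →
    3 * ℓ < adim (prJ i '' V) ∨
    (adim (prJ i '' V) = 3 * ℓ ∧ ¬ IsAlgSetOver (Cj j) (zcl (prJ i '' V)))

section

/-! ### Extending derivations of fields -/

lemma exists_derivation_of_formallySmooth {A K : Type*} [CommRing A] [Field K] [Algebra A K]
    [Algebra.FormallySmooth A K] (f : A →+* TrivSqZeroExt K K)
    (hf : ∀ a, (f a).fst = algebraMap A K a) :
    ∃ D : Derivation ℤ K K, ∀ a, D (algebraMap A K a) = (f a).snd := by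
  let _ : Algebra A (TrivSqZeroExt K K) := f.toAlgebra
  let g : TrivSqZeroExt K K →ₐ[A] K :=
    { (TrivSqZeroExt.fstHom ℤ K K).toRingHom with
      commutes' := fun a => hf a }
  have hg : Function.Surjective g := fun x => ⟨TrivSqZeroExt.inl x, rfl⟩
  have hk : IsNilpotent (RingHom.ker (g : TrivSqZeroExt K K →+* K)) := by
    refine ⟨2, ?_⟩
    have h0 : RingHom.ker (g : TrivSqZeroExt K K →+* K) * RingHom.ker (g : TrivSqZeroExt K K →+* K)
        ≤ ⊥ := by
      refine Ideal.mul_le.2 fun a ha b hb => ?_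
      have ha' : a.fst = 0 := ha
      have hb' : b.fst = 0 := hb
      rw [Ideal.mem_bot]
      ext
      · simp [ha']
      · simp [ha', hb']
    rw [Ideal.zero_eq_bot, eq_bot_iff]
    convert h0 using 1
    exact sq (RingHom.ker (g : TrivSqZeroExt K K →+* K))
  let s := Algebra.FormallySmooth.liftOfSurjective (AlgHom.id A K) g hg hk
  have hs : ∀ x, (s x).fst = x := fun x =>
    Algebra.FormallySmooth.liftOfSurjective_apply (AlgHom.id A K) g hg hk x
  refine ⟨Derivation.mk' { toFun := fun x => (s x).snd, map_add' := by simp, map_smul' := by simp }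
    (fun a b => by simp [hs, mul_comm]), fun a => ?_⟩
  change (s (algebraMap A K a)).snd = _
  rw [s.commutes]; rfl

lemma formallyEtale_mvPolynomial {σ L K : Type*} [Field L] [Field K] [CharZero K] [Algebra L K]
    {g : σ → K} (hg : IsTranscendenceBasis L g) :
    letI : Algebra (MvPolynomial σ L) K := (MvPolynomial.aeval g).toAlgebra
    Algebra.FormallyEtale (MvPolynomial σ L) K := by
  let _ : Algebra (MvPolynomial σ L) K := (MvPolynomial.aeval g).toAlgebra
  have hinj : Function.Injective (algebraMap (MvPolynomial σ L) K) := hg.1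
  have : FaithfulSMul (MvPolynomial σ L) K :=
    (faithfulSMul_iff_algebraMap_injective _ _).2 hinj
  let _ : Algebra (FractionRing (MvPolynomial σ L)) K := FractionRing.liftAlgebra _ _
  have : IsScalarTower (MvPolynomial σ L) (FractionRing (MvPolynomial σ L)) K :=
    FractionRing.isScalarTower_liftAlgebra _ _
  have : CharZero (FractionRing (MvPolynomial σ L)) :=
    ((algebraMap (FractionRing (MvPolynomial σ L)) K).charZero_iff
      (algebraMap (FractionRing (MvPolynomial σ L)) K).injective).2 inferInstance
  have : Algebra.IsAlgebraic (MvPolynomial σ L) K := by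
    have : IsScalarTower L (MvPolynomial σ L) K := IsScalarTower.of_algebraMap_eq (fun x => by
      change _ = MvPolynomial.aeval g (MvPolynomial.C x)
      simp)
    have h1 := hg.isAlgebraic
    constructor
    intro x
    have h2 := h1.isAlgebraic x
    obtain ⟨p, hp, hpx⟩ := h2
    let e := hg.1.aevalEquiv
    refine ⟨p.map e.symm.toRingEquiv.toRingHom, ?_, ?_⟩
    · rwa [Ne, Polynomial.map_eq_zero_iff]
      exact e.symm.injective
    · rw [Polynomial.aeval_def, Polynomial.eval₂_map, ← hpx, Polynomial.aeval_def]
      congr 1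
      ext y
      change MvPolynomial.aeval g (e.symm y) = y
      rw [← hg.1.algebraMap_aevalEquiv (e.symm y)]
      simp [e]
  have : Algebra.IsAlgebraic (FractionRing (MvPolynomial σ L)) K :=
    Algebra.IsAlgebraic.extendScalars
      (IsFractionRing.injective (MvPolynomial σ L) (FractionRing (MvPolynomial σ L)))
  have : Algebra.FormallyEtale (FractionRing (MvPolynomial σ L)) K :=
    Algebra.FormallyEtale.of_isSeparable _ _
  have : Algebra.FormallyEtale (MvPolynomial σ L) (FractionRing (MvPolynomial σ L)) :=
    Algebra.FormallyEtale.of_isLocalization (nonZeroDivisors (MvPolynomial σ L))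
  exact Algebra.FormallyEtale.comp (MvPolynomial σ L) (FractionRing (MvPolynomial σ L)) K

/-- Any derivation of the base field extends to `K` with prescribed values on a transcendence
basis. -/
lemma exists_derivation_extension {σ L K : Type*} [Field L] [Field K] [CharZero K] [Algebra L K]
    {g : σ → K} (hg : IsTranscendenceBasis L g) (D : Derivation ℤ L K) (v : σ → K) :
    ∃ D' : Derivation ℤ K K, (∀ a, D' (algebraMap L K a) = D a) ∧ ∀ i, D' (g i) = v i := by
  let _ : Algebra (MvPolynomial σ L) K := (MvPolynomial.aeval g).toAlgebra
  have := formallyEtale_mvPolynomial hg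
  let f₀ : L →+* TrivSqZeroExt K K :=
    { toFun := fun a => TrivSqZeroExt.inl (algebraMap L K a) + TrivSqZeroExt.inr (D a)
      map_one' := by simp
      map_zero' := by simp
      map_add' := fun a b => by ext <;> simp
      map_mul' := fun a b => by
        ext
        · simp
        · simp only [TrivSqZeroExt.snd_add, TrivSqZeroExt.snd_inl, TrivSqZeroExt.snd_inr,
            TrivSqZeroExt.snd_mul, TrivSqZeroExt.fst_add, TrivSqZeroExt.fst_inl,
            TrivSqZeroExt.fst_inr, Derivation.leibniz, Algebra.smul_def, smul_eq_mul,
            MulOpposite.smul_eq_mul_unop, MulOpposite.unop_op, Algebra.algebraMap_self_apply]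
          ring }
  let f : MvPolynomial σ L →+* TrivSqZeroExt K K :=
    MvPolynomial.eval₂Hom f₀ (fun i => TrivSqZeroExt.inl (g i) + TrivSqZeroExt.inr (v i))
  have hf : ∀ a, (f a).fst = algebraMap (MvPolynomial σ L) K a := by
    intro a
    have : ((TrivSqZeroExt.fstHom ℤ K K).toRingHom).comp f = algebraMap (MvPolynomial σ L) K := by
      apply MvPolynomial.ringHom_ext
      · intro r
        have : algebraMap (MvPolynomial σ L) K (MvPolynomial.C r) = algebraMap L K r :=
          MvPolynomial.aeval_C g r
        simp [f, f₀, this]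
      · intro i
        have : algebraMap (MvPolynomial σ L) K (MvPolynomial.X i) = g i :=
          MvPolynomial.aeval_X g i
        simp [f, this]
    exact RingHom.congr_fun this a
  obtain ⟨D', hD'⟩ := exists_derivation_of_formallySmooth f hf
  refine ⟨D', fun a => ?_, fun i => ?_⟩
  · have h := hD' (MvPolynomial.C a)
    have h2 : algebraMap (MvPolynomial σ L) K (MvPolynomial.C a) = algebraMap L K a :=
      MvPolynomial.aeval_C g a
    rw [h2] at h
    simp [h, f, f₀]
  · have h := hD' (MvPolynomial.X i)
    have h2 : algebraMap (MvPolynomial σ L) K (MvPolynomial.X i) = g i :=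
      MvPolynomial.aeval_X g i
    rw [h2] at h
    simp [h, f]

/-- A derivation over `ℤ` killing `k` is a derivation over `k`. -/
def Derivation.ofConst {k K : Type*} [Field k] [Field K] [Algebra k K] (D : Derivation ℤ K K)
    (h : ∀ a, D (algebraMap k K a) = 0) : Derivation k K K :=
  Derivation.mk' { toFun := D, map_add' := map_add D,
                   map_smul' := fun a x => by simp [Algebra.smul_def, h] } (fun a b => by simp)

@[simp] lemma Derivation.ofConst_apply {k K : Type*} [Field k] [Field K] [Algebra k K]
    (D : Derivation ℤ K K) (h : ∀ a, D (algebraMap k K a) = 0) (x : K) :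
    Derivation.ofConst D h x = D x := rfl

lemma exists_derivation_of_algebraicIndependent {ι k K : Type*} [Field k] [Field K] [CharZero K]
    [Algebra k K] {x : ι → K} (hx : AlgebraicIndependent k x) (v : ι → K) :
    ∃ D : Derivation k K K, ∀ i, D (x i) = v i := by
  classical
  obtain ⟨t, hst, ht⟩ := exists_isTranscendenceBasis_superset hx.to_subtype_range
  obtain ⟨D, hD, hv⟩ := exists_derivation_extension (g := ((↑) : t → K)) ht (0 : Derivation ℤ k K)
    (fun y => if h : ∃ i, x i = y then v h.choose else 0)
  refine ⟨Derivation.ofConst D (by simpa using hD), fun i => ?_⟩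
  have h : ∃ i', x i' = x i := ⟨i, rfl⟩
  have h2 := hv ⟨x i, hst ⟨i, rfl⟩⟩
  simp only [h, dite_true] at h2
  rw [Derivation.ofConst_apply, h2, hx.injective h.choose_spec]

lemma exists_derivation_ne_zero {k K : Type*} [Field k] [Field K] [CharZero K]
    [Algebra k K] {a : K} (ha : Transcendental k a) :
    ∃ D : Derivation k K K, D a = 1 := by
  obtain ⟨D, hD⟩ := exists_derivation_of_algebraicIndependent
    (x := fun _ : Unit => a) (algebraicIndependent_unique_type_iff.2 ha) (fun _ => 1)
  exact ⟨D, hD ()⟩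

lemma isAlgebraic_of_forall_derivation {k K : Type*} [Field k] [Field K] [CharZero K]
    [Algebra k K] {a : K} (h : ∀ D : Derivation k K K, D a = 0) : IsAlgebraic k a := by
  by_contra hc
  obtain ⟨D, hD⟩ := exists_derivation_ne_zero (k := k) (K := K) hc
  simp [h D] at hD

/-- A derivation vanishing on the base vanishes on algebraic elements. -/
lemma derivation_eq_zero_of_isAlgebraic {k K : Type*} [Field k] [Field K] [CharZero k]
    [Algebra k K] (D : Derivation k K K) {a : K} (ha : IsAlgebraic k a) : D a = 0 := by
  have hs : (minpoly k a).Separable := (minpoly.irreducible ha.isIntegral).separable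
  have h := D.map_aeval (minpoly k a) a
  rw [minpoly.aeval, map_zero, smul_eq_mul] at h
  exact (mul_eq_zero.1 h.symm).resolve_left (hs.aeval_derivative_ne_zero (minpoly.aeval k a))

end

section

section RationalRiccati

open Polynomial

lemma riccati_reduced {k : Type*} [Field k] [CharZero k] {p q q2 : k[X]}
    (hqdef : q = X * ((X - 1) * q2)) (hpq : IsCoprime p q) (hq : q.Monic)
    (hmain : 144 * (derivative p * q - p * derivative q + p ^ 2)
      + (36 * X ^ 2 - 41 * X + 32) * q2 ^ 2 = 0) : False := by
  have hq0 : q.eval 0 = 0 := by simp [hqdef]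
  have hq1 : q.eval 1 = 0 := by simp [hqdef]
  have hX1 : (X - 1 : k[X]).Monic := by simpa using monic_X_sub_C (1 : k)
  have hm : (X * (X - 1) : k[X]).Monic := monic_X.mul hX1
  have hq2 : q2.Monic := by
    rw [hqdef, ← mul_assoc] at hq
    exact hm.of_mul_monic_left hq
  have hdX : natDegree (X - 1 : k[X]) = 1 := by simpa using natDegree_X_sub_C (1 : k)
  have hdq : q.natDegree = q2.natDegree + 2 := by
    rw [hqdef, ← mul_assoc, hm.natDegree_mul hq2, monic_X.natDegree_mul hX1, natDegree_X, hdX]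
    ring
  have hder : derivative q = (2 * X - 1) * q2 + X * (X - 1) * derivative q2 := by
    rw [hqdef]
    simp only [derivative_mul, derivative_X, derivative_sub, derivative_one]
    ring
  set m := q2.natDegree with hmdef
  obtain ⟨u, v, huv⟩ := hpq
  have hp0 : p.eval 0 ≠ 0 := by
    intro h0
    have := congrArg (eval 0) huv
    simp [h0, hq0] at this
  have hp1 : p.eval 1 ≠ 0 := by
    intro h0
    have := congrArg (eval 1) huv
    simp [h0, hq1] at this
  have e0 : 144 * (p.eval 0 * q2.eval 0 + p.eval 0 ^ 2) + 32 * q2.eval 0 ^ 2 = 0 := by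
    have h1 := congrArg (eval 0) hmain
    rw [hder] at h1
    simp only [eval_add, eval_mul, eval_pow, eval_sub, eval_X, eval_one, eval_ofNat,
      eval_zero, hq0] at h1
    linear_combination h1
  have e1 : 144 * (- p.eval 1 * q2.eval 1 + p.eval 1 ^ 2) + 27 * q2.eval 1 ^ 2 = 0 := by
    have h1 := congrArg (eval 1) hmain
    rw [hder] at h1
    simp only [eval_add, eval_mul, eval_pow, eval_sub, eval_X, eval_one, eval_ofNat,
      eval_zero, hq1] at h1
    linear_combination h1
  have hc0 : q2.eval 0 ≠ 0 := by
    intro h0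
    rw [h0] at e0
    exact hp0 (by simpa using e0)
  have hc1 : q2.eval 1 ≠ 0 := by
    intro h0
    rw [h0] at e1
    exact hp1 (by simpa using e1)
  have hdvd : q2 ∣ p - derivative q := by
    have h1 : IsCoprime q2 p := ⟨v * (X * (X - 1)), u, by linear_combination huv - v * hqdef⟩
    refine h1.dvd_of_dvd_mul_left ?_
    refine ⟨-(derivative p * (X * (X - 1)) + C (144⁻¹) * (36 * X ^ 2 - 41 * X + 32) * q2), ?_⟩
    have hC : (144 : k[X]) * C (144⁻¹) = 1 := by
      rw [← map_ofNat C 144, ← C_mul, mul_inv_cancel₀ (by norm_num), C_1]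
    linear_combination C (144⁻¹) * hmain -
      (derivative p * q - p * derivative q + p ^ 2) * hC - derivative p * hqdef
  have hqd' : (derivative q).natDegree ≤ m + 1 := by
    refine (natDegree_derivative_le _).trans ?_
    omega
  have h36 : natDegree (36 * X ^ 2 - 41 * X + 32 : k[X]) ≤ 2 := by compute_degree
  have h36c : coeff (36 * X ^ 2 - 41 * X + 32 : k[X]) 2 = 36 := by
    simp [coeff_X, coeff_ofNat_mul, coeff_X_pow]
  have hdp : p.natDegree ≤ m + 1 := by
    by_contra hcon
    push Not at hcon
    set d := p.natDegree with hd
    have h1 := congrArg (fun f => coeff f (d + d)) hmain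
    have t1 : natDegree (derivative p * q) < d + d := by
      refine natDegree_mul_le.trans_lt ?_
      have := natDegree_derivative_le p
      omega
    have t2 : natDegree (p * derivative q) < d + d := by
      refine natDegree_mul_le.trans_lt ?_
      omega
    have t3 : natDegree ((36 * X ^ 2 - 41 * X + 32) * q2 ^ 2 : k[X]) < d + d := by
      refine natDegree_mul_le.trans_lt ?_
      have := natDegree_pow_le (p := q2) (n := 2)
      omega
    simp only [coeff_add, coeff_ofNat_mul, coeff_sub, coeff_eq_zero_of_natDegree_lt t1,
      coeff_eq_zero_of_natDegree_lt t2, coeff_eq_zero_of_natDegree_lt t3, coeff_zero] at h1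
    rw [sq p, coeff_mul_add_eq_of_natDegree_le hd.le hd.le] at h1
    have h2 : p.coeff d = 0 := by
      rw [hd]; simpa using h1
    rw [hd, coeff_natDegree, leadingCoeff_eq_zero] at h2
    rw [h2] at hp0
    simp at hp0
  have hqc : q.coeff (m + 2) = 1 := by rw [← hdq]; exact hq.coeff_natDegree
  have hqc' : (derivative q).coeff (m + 1) = m + 2 := by
    rw [coeff_derivative, show m + 1 + 1 = m + 2 from rfl, hqc]
    push_cast; ring
  set c := p.coeff (m + 1) with hc
  have hc2 : c = 1 / 2 := by
    have h1 := congrArg (fun f => coeff f ((m + 1) + (m + 1))) hmain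
    have t1 : coeff (derivative p * q) ((m + 1) + (m + 1)) = c * (m + 1) := by
      have : (m + 1) + (m + 1) = m + (m + 2) := by ring
      rw [this, coeff_mul_add_eq_of_natDegree_le ((natDegree_derivative_le _).trans (by omega)) hdq.le,
        coeff_derivative, hqc, mul_one]
    have t2 : coeff (p * derivative q) ((m + 1) + (m + 1)) = c * (m + 2) := by
      rw [coeff_mul_add_eq_of_natDegree_le hdp hqd', hqc']
    have t3 : coeff ((36 * X ^ 2 - 41 * X + 32) * q2 ^ 2 : k[X]) ((m + 1) + (m + 1)) = 36 := by
      have e : (m + 1) + (m + 1) = 2 + (m + m) := by ring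
      rw [e, sq q2, coeff_mul_add_eq_of_natDegree_le h36 (natDegree_mul_le.trans (le_refl _)), h36c,
        coeff_mul_add_eq_of_natDegree_le le_rfl le_rfl, coeff_natDegree, hq2.leadingCoeff]
      ring
    simp only [coeff_add, coeff_ofNat_mul, coeff_sub, t1, t2, t3, coeff_zero] at h1
    rw [sq p, coeff_mul_add_eq_of_natDegree_le hdp hdp, ← hc] at h1
    have h2 : 36 * (2 * c - 1) ^ 2 = 0 := by linear_combination h1
    have h3 : 2 * c - 1 = 0 := by simpa using h2
    linear_combination h3 / 2
  obtain ⟨g, hg⟩ := hdvd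
  have hdg : g.natDegree ≤ 1 := by
    by_cases hg0 : g = 0
    · simp [hg0]
    have h1 : (p - derivative q).natDegree ≤ m + 1 :=
      (natDegree_sub_le _ _).trans (max_le hdp hqd')
    rw [hg, hq2.natDegree_mul' hg0] at h1
    omega
  have hg1 : g.coeff 1 = c - (m + 2) := by
    have h1 := congrArg (fun f => coeff f (m + 1)) hg
    simp only [coeff_sub, hqc', ← hc] at h1
    rw [coeff_mul_add_eq_of_natDegree_le le_rfl hdg, coeff_natDegree, hq2.leadingCoeff] at h1
    rw [h1, one_mul]
  rw [eq_X_add_C_of_natDegree_le_one hdg] at hg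
  have g0 := congrArg (eval 0) hg
  have g1 := congrArg (eval 1) hg
  rw [hder] at g0 g1
  simp only [eval_add, eval_mul, eval_sub, eval_X, eval_one, eval_ofNat, eval_C, hg1, hc2] at g0 g1
  set β := g.coeff 0
  have f0 : p.eval 0 = (β - 1) * q2.eval 0 := by linear_combination g0
  have f1 : p.eval 1 = (1 + (1 / 2 - (m + 2)) + β) * q2.eval 1 := by linear_combination g1
  rw [f0] at e0
  rw [f1] at e1
  have k0 : (3 * (β - 1) + 1) * (3 * (β - 1) + 2) = 0 := by
    refine (mul_eq_zero.1 (?_ : (q2.eval 0) ^ 2 * _ = 0)).resolve_left (pow_ne_zero 2 hc0)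
    linear_combination e0 / 16
  have k1 : (4 * (1 + (1 / 2 - (m + 2)) + β) - 1) * (4 * (1 + (1 / 2 - (m + 2)) + β) - 3) = 0 := by
    refine (mul_eq_zero.1 (?_ : (q2.eval 1) ^ 2 * _ = 0)).resolve_left (pow_ne_zero 2 hc1)
    linear_combination e1 / 9
  rcases mul_eq_zero.1 k0 with k0 | k0 <;> rcases mul_eq_zero.1 k1 with k1 | k1
  · have : ((12 * m : ℕ) : k) = ((-1 : ℤ) : k) := by
      push_cast; linear_combination 4 * k0 - 3 * k1
    have : (12 * m : ℤ) = -1 := by exact_mod_cast this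
    omega
  · have : ((12 * m : ℕ) : k) = ((-7 : ℤ) : k) := by
      push_cast; linear_combination 4 * k0 - 3 * k1
    have : (12 * m : ℤ) = -7 := by exact_mod_cast this
    omega
  · have : ((12 * m : ℕ) : k) = ((-5 : ℤ) : k) := by
      push_cast; linear_combination 4 * k0 - 3 * k1
    have : (12 * m : ℤ) = -5 := by exact_mod_cast this
    omega
  · have : ((12 * m : ℕ) : k) = ((-11 : ℤ) : k) := by
      push_cast; linear_combination 4 * k0 - 3 * k1
    have : (12 * m : ℤ) = -11 := by exact_mod_cast this
    omega

/-- The Riccati equation of the modular curve has no rational solution `p / q`. -/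
lemma not_rational_riccati {k : Type*} [Field k] [CharZero k] {p q : k[X]} (hpq : IsCoprime p q)
    (hq : q.Monic) :
    144 * X ^ 2 * (X - 1) ^ 2 * (derivative p * q - p * derivative q + p ^ 2)
      + (36 * X ^ 2 - 41 * X + 32) * q ^ 2 ≠ 0 := by
  intro h
  have hq0 : q.eval 0 = 0 := by
    have := congrArg (eval 0) h
    simpa using this
  have hq1 : q.eval 1 = 0 := by
    have h1 := congrArg (eval 1) h
    simp only [eval_add, eval_mul, eval_pow, eval_sub, eval_X, eval_one, eval_ofNat,
      eval_zero] at h1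
    have h2 : (27 : k) * (q.eval 1) ^ 2 = 0 := by linear_combination h1
    simpa using h2
  obtain ⟨q1, rfl⟩ : X ∣ q := by
    have := dvd_iff_isRoot.2 (show IsRoot q 0 from hq0)
    simpa using this
  obtain ⟨q2, rfl⟩ : (X - 1) ∣ q1 := by
    have h1 : q1.eval 1 = 0 := by simpa using hq1
    have := dvd_iff_isRoot.2 (show IsRoot q1 1 from h1)
    simpa using this
  refine riccati_reduced rfl hpq hq ?_
  have h1 : (X ^ 2 * (X - 1) ^ 2 : k[X]) ≠ 0 :=
    mul_ne_zero (pow_ne_zero 2 X_ne_zero) (pow_ne_zero 2 (by simpa using X_sub_C_ne_zero (1 : k)))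
  refine mul_left_cancel₀ h1 ?_
  rw [mul_zero, ← h]
  generalize derivative (X * ((X - 1) * q2)) = r
  ring

end RationalRiccati

end

section

open WithZero IsDedekindDomain IntermediateField

section Places

variable {k F : Type*} [Field k] [Field F] [Algebra k F]

/-- A discrete valuation, trivial on the residue field `k`, together with a derivation `θ` which
looks like `t d/dt` for a uniformizer `t`. -/
structure IsTame (v : Valuation F ℤᵐ⁰) (θ : Derivation k F F) : Prop where
  const : ∀ c : k, c ≠ 0 → v (algebraMap k F c) = 1
  res : ∀ f, v f ≤ 1 → ∃ c : k, v (f - algebraMap k F c) < 1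
  small : ∀ f, v f ≤ 1 → v (θ f) < 1
  ord : ∀ f, f ≠ 0 → v (θ f / f + ((log (v f) : ℤ) : F)) < 1

lemma IsTame.of_uniformizer [CharZero k] {v : Valuation F ℤᵐ⁰}
    (const : ∀ c : k, c ≠ 0 → v (algebraMap k F c) = 1)
    (res : ∀ f, v f ≤ 1 → ∃ c : k, v (f - algebraMap k F c) < 1)
    {t : F} (ht : v t = exp (-1)) (δ : Derivation k F F) (hδ : δ t ≠ 0)
    {C : ℤᵐ⁰} (hC : ∀ f, v f ≤ 1 → v (δ f) ≤ C) :
    ∃ θ, IsTame (k := k) v θ := by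
  have ht0 : t ≠ 0 := by
    rintro rfl
    rw [map_zero] at ht
    exact exp_ne_zero ht.symm
  set θ : Derivation k F F := (t / δ t) • δ with hθ
  have hθt : θ t = t := by simp [hθ, hδ]
  have hb : ∃ N : ℕ, ∀ f, v f ≤ 1 → v (θ f) ≤ exp (N : ℤ) := by
    set C' := v (t / δ t) * C
    have h1 : ∀ f, v f ≤ 1 → v (θ f) ≤ C' := by
      intro f hf
      simp only [hθ, Derivation.smul_apply, smul_eq_mul, map_mul]
      exact mul_le_mul_right (hC f hf) _
    refine ⟨(log C').toNat, fun f hf => (h1 f hf).trans ?_⟩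
    by_cases hC0 : C' = 0
    · simp [hC0]
    · rw [← log_le_iff_le_exp hC0]
      exact Int.self_le_toNat _
  have step : ∀ f, v f ≤ 1 → ∃ g, v g ≤ 1 ∧ θ f = t * g + t * θ g := by
    intro f hf
    obtain ⟨c, hc⟩ := res f hf
    refine ⟨(f - algebraMap k F c) / t, ?_, ?_⟩
    · rw [map_div₀, ht]
      by_cases h0 : v (f - algebraMap k F c) = 0
      · simp [h0]
      · rw [← log_le_log (by simp [h0]) one_ne_zero, log_div h0 (by simp)]
        rw [← log_lt_log h0 one_ne_zero] at hc
        simp at hc ⊢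
        omega
    · have : f = algebraMap k F c + t * ((f - algebraMap k F c) / t) := by
        field_simp; ring
      conv_lhs => rw [this]
      rw [map_add, Derivation.map_algebraMap, zero_add, Derivation.leibniz, hθt, smul_eq_mul,
        smul_eq_mul]
      ring
  obtain ⟨N, hN⟩ := hb
  have hdown : ∀ N : ℕ, (∀ f, v f ≤ 1 → v (θ f) ≤ exp (N : ℤ)) → ∀ f, v f ≤ 1 → v (θ f) < 1 := by
    intro N
    have key : ∀ M : ℤ, (∀ f, v f ≤ 1 → v (θ f) ≤ exp M) →
        ∀ f, v f ≤ 1 → v (θ f) ≤ max (exp (-1)) (exp (M - 1)) := by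
      intro M hM f hf
      obtain ⟨g, hg, e⟩ := step f hf
      rw [e]
      refine (v.map_add _ _).trans (max_le_max ?_ ?_)
      · rw [map_mul, ht]
        exact mul_le_of_le_one_right' hg
      · rw [map_mul, ht]
        refine (mul_le_mul_right (hM g hg) _).trans (le_of_eq ?_)
        rw [← exp_add]; ring_nf
    induction N with
    | zero =>
      intro h f hf
      refine lt_of_le_of_lt (key 0 (by simpa using h) f hf) ?_
      rw [← exp_zero]
      simp [-exp_zero, -exp_neg, exp_lt_exp]
    | succ N ih =>
      intro h
      refine ih fun f hf => (key _ h f hf).trans (max_le ?_ ?_) <;>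
        rw [exp_le_exp] <;> push_cast <;> omega
  have small := hdown N hN
  refine ⟨θ, const, res, small, fun f hf => ?_⟩
  have hvf : v f ≠ 0 := by simpa using hf
  set n : ℤ := - log (v f) with hn
  set u := f / t ^ n with hu
  have htn : t ^ n ≠ 0 := zpow_ne_zero _ ht0
  have hvu : v u = 1 := by
    rw [hu, map_div₀, map_zpow₀, ht, ← exp_zsmul, div_eq_one_iff_eq (by simp)]
    simp [hn, exp_log hvf]
  have hu0 : u ≠ 0 := by rintro h; simp [h] at hvu
  have e : θ f / f + ((log (v f) : ℤ) : F) = θ u / u := by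
    have hf' : f = t ^ n * u := by rw [hu]; field_simp
    have hd : θ f = t ^ n * θ u + u * (n * t ^ n) := by
      rw [hf', Derivation.leibniz, Derivation.leibniz_zpow, hθt, smul_eq_mul, smul_eq_mul,
        smul_eq_mul, zsmul_eq_mul, zpow_sub_one₀ ht0 n]
      field_simp
    have hl : ((log (v f) : ℤ) : F) = - (n : F) := by rw [hn]; push_cast; ring
    rw [hl, hd, hf']
    field_simp
    ring
  rw [e, map_div₀, hvu, div_one]
  exact small u hvu.le

lemma isPrincipalIdealRing_adjoin_singleton (s : F) :
    IsPrincipalIdealRing (Algebra.adjoin k {s}) := by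
  let f : Polynomial k →+* Algebra.adjoin k {s} :=
    ((Polynomial.aeval (⟨s, Algebra.self_mem_adjoin_singleton k s⟩ : Algebra.adjoin k {s}) :
      Polynomial k →ₐ[k] Algebra.adjoin k {s}) : Polynomial k →+* Algebra.adjoin k {s})
  refine IsPrincipalIdealRing.of_surjective f ?_
  rintro ⟨x, hx⟩
  have hx' := hx
  rw [Algebra.adjoin_singleton_eq_range_aeval] at hx'
  obtain ⟨p, hp⟩ := hx'
  refine ⟨p, Subtype.ext (Eq.trans ?_ hp)⟩
  exact (Polynomial.aeval_algHom_apply (Algebra.adjoin k {s}).val _ p).symm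

lemma mem_range_algebraMap_of_isAlgebraic [IsAlgClosed k] {t : F} (h : IsAlgebraic k t) :
    ∃ c : k, algebraMap k F c = t :=
  minpoly.mem_range_of_degree_eq_one k t
    (IsAlgClosed.degree_eq_one_of_irreducible k (minpoly.irreducible h.isIntegral))

lemma exists_isTame_heightOneSpectrum [IsAlgClosed k] [CharZero k] (B : Type*) [CommRing B]
    [IsDedekindDomain B] [Algebra B F] [IsFractionRing B F] [Algebra k B] [IsScalarTower k B F]
    [Algebra.FiniteType k B] (v : HeightOneSpectrum B) :
    ∃ θ, IsTame (k := k) (v.valuation F) θ := by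
  have hcF : CharZero F := ((algebraMap k F).charZero_iff (algebraMap k F).injective).1 ‹_›
  have hle : ∀ b : B, v.valuation F (algebraMap B F b) ≤ 1 := v.valuation_le_one
  have hconst1 : ∀ c : k, v.valuation F (algebraMap k F c) ≤ 1 := fun c => by
    rw [IsScalarTower.algebraMap_apply k B F]
    exact hle _
  have hconst : ∀ c : k, c ≠ 0 → v.valuation F (algebraMap k F c) = 1 := by
    intro c hc
    refine le_antisymm (hconst1 c) ?_
    have h3 : v.valuation F (algebraMap k F c) * v.valuation F (algebraMap k F c⁻¹) = 1 := by
      rw [← map_mul, ← map_mul, mul_inv_cancel₀ hc, map_one, map_one]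
    rw [← h3]
    exact mul_le_of_le_one_right' (hconst1 c⁻¹)
  have hfr : ∀ f : F, v.valuation F f ≤ 1 → ∃ a b : B, v.valuation F (algebraMap B F b) = 1 ∧
      algebraMap B F b ≠ 0 ∧ f = algebraMap B F a / algebraMap B F b := by
    intro f hf
    obtain ⟨a, ⟨b, hb⟩, e⟩ := v.exists_primeCompl_mul_eq_of_integer f hf
    have hb1 : v.valuation F (algebraMap B F b) = 1 :=
      (HeightOneSpectrum.valuation_eq_one_iff_notMem v).2 hb
    have hb0 : algebraMap B F b ≠ 0 := by rintro h; rw [h] at hb1; simp at hb1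
    exact ⟨a, b, hb1, hb0, (eq_div_iff hb0).2 e⟩
  have hresB : ∀ b : B, ∃ c : k, v.valuation F (algebraMap B F b - algebraMap k F c) < 1 := by
    intro b
    have h3 : v.asIdeal.IsMaximal := v.isMaximal
    let _ : Field (B ⧸ v.asIdeal) := Ideal.Quotient.field _
    have h4 : Module.Finite k (B ⧸ v.asIdeal) := finite_of_finite_type_of_isJacobsonRing _ _
    obtain ⟨c, hc⟩ := (IsAlgClosed.algebraMap_bijective_of_isIntegral
      (k := k) (K := B ⧸ v.asIdeal)).2 (Ideal.Quotient.mk _ b)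
    refine ⟨c, ?_⟩
    have h5 : b - algebraMap k B c ∈ v.asIdeal := Ideal.Quotient.eq.1 hc.symm
    rw [IsScalarTower.algebraMap_apply k B F, ← map_sub]
    exact (HeightOneSpectrum.valuation_lt_one_iff_mem (K := F) v _).2 h5
  obtain ⟨t, ht⟩ := v.valuation_exists_uniformizer F
  have htr : Transcendental k t := by
    intro h
    obtain ⟨c, rfl⟩ := mem_range_algebraMap_of_isAlgebraic h
    by_cases hc : c = 0
    · rw [hc, map_zero, map_zero] at ht
      exact exp_ne_zero ht.symm
    · rw [hconst c hc, ← exp_zero, exp_inj] at ht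
      omega
  obtain ⟨δ, hδt⟩ := exists_derivation_ne_zero htr
  obtain ⟨C, hC⟩ : ∃ C : ℤᵐ⁰, ∀ b : B, v.valuation F (δ (algebraMap B F b)) ≤ C := by
    obtain ⟨G, hG⟩ := (‹Algebra.FiniteType k B›).out
    refine ⟨G.sup fun b => v.valuation F (δ (algebraMap B F b)), fun b => ?_⟩
    have hb : b ∈ Algebra.adjoin k (G : Set B) := hG ▸ Algebra.mem_top
    induction hb using Algebra.adjoin_induction with
    | mem b hb => exact Finset.le_sup (f := fun b : B => v.valuation F (δ (algebraMap B F b))) hb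
    | algebraMap r =>
      rw [← IsScalarTower.algebraMap_apply k B F, Derivation.map_algebraMap, map_zero]
      exact bot_le
    | add b c _ _ h1 h2 =>
      rw [map_add, map_add]
      exact (Valuation.map_add _ _ _).trans (max_le h1 h2)
    | mul b c _ _ h1 h2 =>
      rw [map_mul, Derivation.leibniz, smul_eq_mul, smul_eq_mul]
      refine (Valuation.map_add _ _ _).trans (max_le ?_ ?_) <;> rw [map_mul]
      · exact (mul_le_of_le_one_left' (hle b)).trans h2
      · exact (mul_le_of_le_one_left' (hle c)).trans h1
  refine IsTame.of_uniformizer hconst ?_ ht δ (by simp [hδt]) (C := C) ?_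
  · intro f hf
    obtain ⟨a, b, hb, hb0, rfl⟩ := hfr f hf
    obtain ⟨c, hc⟩ := hresB a
    obtain ⟨d, hd⟩ := hresB b
    have hd0 : d ≠ 0 := by
      rintro rfl
      rw [map_zero, sub_zero, hb] at hd
      exact lt_irrefl _ hd
    have hd0' : algebraMap k F d ≠ 0 := by simpa using hd0
    refine ⟨c / d, ?_⟩
    have e : algebraMap B F a / algebraMap B F b - algebraMap k F (c / d) =
        ((algebraMap B F a - algebraMap k F c) - algebraMap k F (c / d) *
          (algebraMap B F b - algebraMap k F d)) / algebraMap B F b := by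
      rw [map_div₀]
      field_simp
      ring
    rw [e, map_div₀, hb, div_one]
    refine (Valuation.map_sub _ _ _).trans_lt (max_lt hc ?_)
    rw [map_mul]
    exact (mul_le_of_le_one_left' (hconst1 _)).trans_lt hd
  · intro f hf
    obtain ⟨a, b, hb, hb0, rfl⟩ := hfr f hf
    have e : δ (algebraMap B F a / algebraMap B F b) = (δ (algebraMap B F a) -
        algebraMap B F a / algebraMap B F b * δ (algebraMap B F b)) / algebraMap B F b := by
      have h1 : algebraMap B F a / algebraMap B F b * algebraMap B F b = algebraMap B F a :=
        div_mul_cancel₀ _ hb0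
      have h2 := congrArg δ h1
      rw [Derivation.leibniz, smul_eq_mul, smul_eq_mul] at h2
      rw [eq_div_iff hb0]
      linear_combination h2
    rw [e, map_div₀, hb, div_one]
    refine (Valuation.map_sub _ _ _).trans (max_le (hC a) ?_)
    rw [map_mul]
    exact (mul_le_of_le_one_left' hf).trans (hC b)

open scoped algebraAdjoinAdjoin in
/-- The finite places of a function field, together with their tame derivations. -/
lemma exists_tame [IsAlgClosed k] [CharZero k] {s : F} (hs : Transcendental k s)
    [FiniteDimensional k⟮s⟯ F] :
    ∃ P : Set (Valuation F ℤᵐ⁰), (∀ v ∈ P, v s ≤ 1 ∧ ∃ θ, IsTame (k := k) v θ) ∧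
      (∀ f, (∀ v ∈ P, v f ≤ 1) → IsIntegral (Algebra.adjoin k {s}) f) ∧ ∃ v ∈ P, v s < 1 := by
  have hcs : CharZero k⟮s⟯ := ((algebraMap k k⟮s⟯).charZero_iff (algebraMap k k⟮s⟯).injective).1 ‹_›
  have := isPrincipalIdealRing_adjoin_singleton (k := k) s
  have hsA : s ∈ Algebra.adjoin k {s} := Algebra.self_mem_adjoin_singleton k s
  have hfA : Algebra.FiniteType k (Algebra.adjoin k {s}) := (Subalgebra.fg_iff_finiteType _).1
    ⟨{s}, by simp⟩
  have hmem : ∀ x ∈ Algebra.adjoin k {s}, ∃ p : Polynomial k, Polynomial.aeval s p = x := by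
    intro x hx
    rw [Algebra.adjoin_singleton_eq_range_aeval] at hx
    exact hx
  have hded : IsDedekindDomain (integralClosure (Algebra.adjoin k {s}) F) :=
    integralClosure.isDedekindDomain _ k⟮s⟯ F
  have hfrac : IsFractionRing (integralClosure (Algebra.adjoin k {s}) F) F :=
    integralClosure.isFractionRing_of_finite_extension k⟮s⟯ F
  have hfin : Module.Finite (Algebra.adjoin k {s}) (integralClosure (Algebra.adjoin k {s}) F) :=
    IsIntegralClosure.finite _ k⟮s⟯ F _
  have hft : Algebra.FiniteType k (integralClosure (Algebra.adjoin k {s}) F) :=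
    Algebra.FiniteType.trans hfA inferInstance
  have hs0 : s ≠ 0 := by
    rintro rfl
    exact hs isAlgebraic_zero
  have hint : ∀ f, (∀ v : HeightOneSpectrum (integralClosure (Algebra.adjoin k {s}) F),
      v.valuation F f ≤ 1) → IsIntegral (Algebra.adjoin k {s}) f := by
    intro f hf
    obtain ⟨b, rfl⟩ := HeightOneSpectrum.mem_integers_of_valuation_le_one F f hf
    exact b.2
  refine ⟨Set.range fun v : HeightOneSpectrum (integralClosure (Algebra.adjoin k {s}) F) =>
    v.valuation F, ?_, fun f hf => hint f fun v => hf _ ⟨v, rfl⟩, ?_⟩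
  · rintro _ ⟨v, rfl⟩
    exact ⟨v.valuation_le_one (algebraMap (Algebra.adjoin k {s}) _ ⟨s, hsA⟩),
      exists_isTame_heightOneSpectrum _ v⟩
  · by_contra hcon
    push Not at hcon
    have h1 : IsIntegral (Algebra.adjoin k {s}) s⁻¹ := hint _ fun v => by
      rw [map_inv₀]
      exact inv_le_one_of_one_le₀ (hcon _ ⟨v, rfl⟩)
    have h2 : IsIntegral (Algebra.adjoin k {s}) (AdjoinSimple.gen k s)⁻¹ := by
      rw [← isIntegral_algebraMap_iff (B := F) (algebraMap k⟮s⟯ F).injective, map_inv₀]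
      exact h1
    obtain ⟨⟨y, hyA⟩, hy⟩ := IsIntegrallyClosed.isIntegral_iff.1 h2
    have hy' : y = s⁻¹ := by simpa using congrArg (algebraMap k⟮s⟯ F) hy
    obtain ⟨p, rfl⟩ := hmem y hyA
    have h3 : Polynomial.aeval s (Polynomial.X * p - 1) = 0 := by
      simp only [map_sub, map_mul, Polynomial.aeval_X, map_one]
      rw [hy', mul_inv_cancel₀ hs0, sub_self]
    have h4 := (transcendental_iff.1 hs) _ h3
    have h5 := congrArg (Polynomial.eval 0) h4
    simp at h5

end Places

end

section

open WithZero IntermediateField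

section GlobalPlaces

variable {k F : Type*} [Field k] [Field F] [Algebra k F]

lemma mem_valuationSubring_of_isIntegral_adjoin {V : ValuationSubring F}
    (hk : ∀ c : k, algebraMap k F c ∈ V) {s f : F} (hs : s ∈ V)
    (hf : IsIntegral (Algebra.adjoin k {s}) f) : f ∈ V := by
  have hle : ∀ a ∈ Algebra.adjoin k {s}, a ∈ V := by
    intro a ha
    induction ha using Algebra.adjoin_induction with
    | mem a ha => rw [Set.mem_singleton_iff.1 ha]; exact hs
    | algebraMap r => exact hk r
    | add a b _ _ h1 h2 => exact V.add_mem _ _ h1 h2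
    | mul a b _ _ h1 h2 => exact V.mul_mem _ _ h1 h2
  let g : Algebra.adjoin k {s} →+* V :=
    { toFun := fun a => ⟨a, hle a a.2⟩
      map_one' := rfl
      map_mul' := fun _ _ => rfl
      map_zero' := rfl
      map_add' := fun _ _ => rfl }
  have h1 : IsIntegral V f := hf.map_of_comp_eq g (RingHom.id F) rfl
  obtain ⟨y, hy⟩ := IsIntegrallyClosed.isIntegral_iff.1 h1
  rw [← hy]
  exact y.2

lemma isAlgebraic_of_isIntegral_adjoin_inv {s f : F} (h1 : IsIntegral (Algebra.adjoin k {s}) f)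
    (h2 : IsIntegral (Algebra.adjoin k {s⁻¹}) f) : IsAlgebraic k f := by
  have h3 : f ∈ (integralClosure (Subring.closure (Set.range (algebraMap k F))) F).toSubring := by
    rw [← iInf_valuationSubring_superset, Subring.mem_iInf]
    rintro ⟨V, hV⟩
    have hk : ∀ c : k, algebraMap k F c ∈ V := fun c => hV ⟨c, rfl⟩
    rcases V.mem_or_inv_mem s with h | h
    · exact mem_valuationSubring_of_isIntegral_adjoin hk h h1
    · exact mem_valuationSubring_of_isIntegral_adjoin hk h h2
  have h4 : IsIntegral (Subring.closure (Set.range (algebraMap k F))) f := h3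
  obtain ⟨p, hp, hpf⟩ := h4
  have hcl : Subring.closure (Set.range (algebraMap k F)) = (algebraMap k F).range := by
    rw [← RingHom.coe_range, Subring.closure_eq]
  have h5 : p.map (algebraMap _ F) ∈ Polynomial.lifts (algebraMap k F) := by
    rw [Polynomial.lifts_iff_coeff_lifts]
    intro n
    rw [Polynomial.coeff_map]
    exact hcl.le (p.coeff n).2
  obtain ⟨q, hq, -, hqm⟩ := Polynomial.lifts_and_natDegree_eq_and_monic h5 (hp.map _)
  refine IsIntegral.isAlgebraic ⟨q, hqm, ?_⟩
  rw [← Polynomial.eval_map, hq, Polynomial.eval_map]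
  exact hpf

/-- A family of tame places of a function field which is large enough for Liouville's theorem. -/
lemma exists_places [IsAlgClosed k] [CharZero k] {x : F} (hx : Transcendental k x)
    [FiniteDimensional k⟮x⟯ F] :
    ∃ P : Set (Valuation F ℤᵐ⁰), (∀ v ∈ P, ∃ θ, IsTame (k := k) v θ) ∧
      ∀ f, (∀ v ∈ P, v f ≤ 1) → (∀ v ∈ P, 1 < v x → v f < 1) → f = 0 := by
  have hx0 : x ≠ 0 := by
    rintro rfl
    exact hx isAlgebraic_zero
  have hx' : Transcendental k x⁻¹ := fun h => hx (by simpa using h.inv)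
  have hfd : FiniteDimensional k⟮x⁻¹⟯ F := by
    have e : k⟮x⁻¹⟯ = k⟮x⟯ := by
      apply le_antisymm <;> rw [adjoin_simple_le_iff]
      · exact inv_mem (mem_adjoin_simple_self k x)
      · have := inv_mem (mem_adjoin_simple_self k x⁻¹)
        rwa [inv_inv] at this
    rw [e]
    infer_instance
  obtain ⟨P1, h1, h2, -⟩ := exists_tame hx
  obtain ⟨P2, g1, g2, v0, hv0, hv0x⟩ := exists_tame hx'
  refine ⟨P1 ∪ P2, ?_, ?_⟩
  · rintro v (hv | hv)
    · exact (h1 v hv).2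
    · exact (g1 v hv).2
  · intro f hf hf'
    have ha : IsAlgebraic k f := isAlgebraic_of_isIntegral_adjoin_inv
      (h2 f fun v hv => hf v (Or.inl hv)) (g2 f fun v hv => hf v (Or.inr hv))
    obtain ⟨c, rfl⟩ := mem_range_algebraMap_of_isAlgebraic ha
    obtain ⟨-, θ, hθ⟩ := g1 v0 hv0
    by_contra hc
    have hc' : c ≠ 0 := by rintro rfl; simp at hc
    have h3 := hf' v0 (Or.inr hv0) (by
      rw [map_inv₀] at hv0x
      rwa [inv_lt_one₀ (by simpa [zero_lt_iff] using hx0)] at hv0x)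
    rw [hθ.const c hc'] at h3
    exact lt_irrefl _ h3

end GlobalPlaces

end

section

/-! ### Subalgebras of powers of `sl₂` -/

/-- The bracket of `sl₂` in coordinates, `(α, β, γ)` standing for `[[α, β], [γ, -α]]`. -/
def slBr {k : Type*} [CommRing k] (a b : Fin 3 → k) : Fin 3 → k :=
  ![a 1 * b 2 - a 2 * b 1, 2 * (a 0 * b 1 - a 1 * b 0), 2 * (a 2 * b 0 - a 0 * b 2)]

section SlTwo

variable {k : Type*} [Field k]

lemma slBr_zero_left (b : Fin 3 → k) : slBr 0 b = 0 := by
  ext i; fin_cases i <;> simp [slBr]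

lemma slBr_zero_right (b : Fin 3 → k) : slBr b 0 = 0 := by
  ext i; fin_cases i <;> simp [slBr]

lemma vec3_eq (a : Fin 3 → k) :
    a = a 0 • ![1, 0, 0] + a 1 • ![0, 1, 0] + a 2 • ![0, 0, 1] := by
  ext i; fin_cases i <;> simp

lemma submodule_vec3_eq_top {N : Submodule k (Fin 3 → k)} (h0 : ![1, 0, 0] ∈ N)
    (h1 : ![0, 1, 0] ∈ N) (h2 : ![0, 0, 1] ∈ N) : N = ⊤ := by
  rw [eq_top_iff]
  intro a _
  rw [vec3_eq a]
  exact N.add_mem (N.add_mem (N.smul_mem _ h0) (N.smul_mem _ h1)) (N.smul_mem _ h2)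

lemma sl_ideal_eq_top [CharZero k] {N : Submodule k (Fin 3 → k)}
    (hN : ∀ a, ∀ b ∈ N, slBr a b ∈ N) (h : N ≠ ⊥) : N = ⊤ := by
  have key : ∀ (c : k) (v w : Fin 3 → k), c ≠ 0 → w ∈ N → w = c • v → v ∈ N := by
    intro c v w hc hw e
    rw [show v = c⁻¹ • w by rw [e, smul_smul, inv_mul_cancel₀ hc, one_smul]]
    exact N.smul_mem _ hw
  obtain ⟨a, ha, ha0⟩ := N.ne_bot_iff.1 h
  have he : ![0, 1, 0] ∈ N := by
    by_cases h2 : a 2 = 0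
    · by_cases h0 : a 0 = 0
      · by_cases h1 : a 1 = 0
        · exact absurd (by ext i; fin_cases i <;> simp [h0, h1, h2]) ha0
        · refine key (a 1) _ a h1 ha ?_
          ext i; fin_cases i <;> simp [h0, h2]
      · refine key (-(2 * a 0)) _ _ (by simpa using h0) (hN ![0, 1, 0] a ha) ?_
        ext i; fin_cases i <;> simp [slBr, h2]
    · refine key (-(2 * a 2)) _ _ (by simpa using h2)
        (hN ![0, 1, 0] _ (hN ![0, 1, 0] a ha)) ?_
      ext i; fin_cases i <;> simp [slBr]
  have hh : ![1, 0, 0] ∈ N := by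
    refine key (-1) _ _ (by simp) (hN ![0, 0, 1] _ he) ?_
    ext i; fin_cases i <;> simp [slBr]
  refine submodule_vec3_eq_top hh he ?_
  refine key 2 _ _ (by simp) (hN ![0, 0, 1] _ hh) ?_
  ext i; fin_cases i <;> simp [slBr]

lemma sl_perfect [CharZero k] {N : Submodule k (Fin 3 → k)} (hN : ∀ a b, slBr a b ∈ N) :
    N = ⊤ := by
  refine sl_ideal_eq_top (fun a b _ => hN a b) fun h => ?_
  have := hN ![0, 1, 0] ![0, 0, 1]
  rw [h, Submodule.mem_bot] at this
  simpa [slBr] using congrFun this 0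

/-- A proper subalgebra of `sl₂` stabilises a line. -/
lemma sl_proper_subalgebra [IsAlgClosed k] {N : Submodule k (Fin 3 → k)}
    (hN : ∀ a ∈ N, ∀ b ∈ N, slBr a b ∈ N) (h : N ≠ ⊤) :
    ∃ v : k × k, v ≠ 0 ∧ ∀ a ∈ N, a 2 * v.1 ^ 2 - 2 * a 0 * v.1 * v.2 - a 1 * v.2 ^ 2 = 0 := by
  obtain ⟨f, hf0, hf⟩ := Submodule.exists_le_ker_of_lt_top N (lt_top_iff_ne_top.2 h)
  set p := f ![1, 0, 0] with hp
  set q := f ![0, 1, 0] with hq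
  set r := f ![0, 0, 1] with hr
  have hfe : ∀ a, f a = a 0 * p + a 1 * q + a 2 * r := by
    intro a
    conv_lhs => rw [vec3_eq a]
    simp only [map_add, map_smul, smul_eq_mul, hp, hq, hr]
  by_cases hiso : p ^ 2 + 4 * q * r = 0
  · obtain ⟨s, hs⟩ := IsAlgClosed.exists_pow_nat_eq r (n := 2) (by norm_num)
    obtain ⟨t, ht⟩ := IsAlgClosed.exists_pow_nat_eq (-q) (n := 2) (by norm_num)
    have hst : (p - 2 * s * t) * (p + 2 * s * t) = 0 := by
      linear_combination hiso - 4 * s ^ 2 * ht + 4 * q * hs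
    have hne : ¬ (s = 0 ∧ t = 0) := by
      rintro ⟨rfl, rfl⟩
      have hr0 : r = 0 := by simpa using hs.symm
      have hq0 : q = 0 := by simpa using ht.symm
      have hp0 : p = 0 := by simpa using hst
      exact hf0 (LinearMap.ext fun a => by simp [hfe, hp0, hq0, hr0])
    rcases mul_eq_zero.1 hst with e | e
    · refine ⟨(s, -t), fun h => hne (by simpa using h), fun a ha => ?_⟩
      have := hf ha
      rw [LinearMap.mem_ker, hfe] at this
      simp only
      linear_combination this + a 2 * hs - a 1 * ht - a 0 * e
    · refine ⟨(s, t), fun h => hne (by simpa using h), fun a ha => ?_⟩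
      have := hf ha
      rw [LinearMap.mem_ker, hfe] at this
      simp only
      linear_combination this + a 2 * hs - a 1 * ht - a 0 * e
  · have hlt : N < LinearMap.ker f := by
      refine lt_of_le_of_ne hf fun e => ?_
      have m1 : ![q, -p, 0] ∈ N := by
        rw [e, LinearMap.mem_ker, hfe]; simp; ring
      have m2 : ![r, 0, -p] ∈ N := by
        rw [e, LinearMap.mem_ker, hfe]; simp; ring
      have m3 : ![0, r, -q] ∈ N := by
        rw [e, LinearMap.mem_ker, hfe]; simp; ring
      have b1 := hf (hN _ m1 _ m2)
      have b2 := hf (hN _ m1 _ m3)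
      have b3 := hf (hN _ m2 _ m3)
      rw [LinearMap.mem_ker, hfe] at b1 b2 b3
      simp [slBr] at b1 b2 b3
      have c1 : p * (p ^ 2 + 4 * q * r) = 0 := by linear_combination b1
      have c2 : q * (p ^ 2 + 4 * q * r) = 0 := by linear_combination b2
      have c3 : r * (p ^ 2 + 4 * q * r) = 0 := by linear_combination b3
      have hp0 := (mul_eq_zero.1 c1).resolve_right hiso
      have hq0 := (mul_eq_zero.1 c2).resolve_right hiso
      simp [hp0, hq0] at hiso
    have hfin : Module.finrank k N ≤ 1 := by
      have h1 := Submodule.finrank_lt_finrank_of_lt hlt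
      have h2 : Module.finrank k (LinearMap.ker f) < Module.finrank k (Fin 3 → k) := by
        refine Submodule.finrank_lt fun e => hf0 (LinearMap.ker_eq_top.1 e)
      simp at h2
      omega
    obtain ⟨a, ha⟩ := finrank_le_one_iff.1 hfin
    have hv : ∃ v : k × k, v ≠ 0 ∧
        a.1 2 * v.1 ^ 2 - 2 * a.1 0 * v.1 * v.2 - a.1 1 * v.2 ^ 2 = 0 := by
      by_cases h2 : a.1 2 = 0
      · exact ⟨(1, 0), by simp, by simp [h2]⟩
      · obtain ⟨d, hd⟩ := IsAlgClosed.exists_pow_nat_eq (a.1 0 ^ 2 + a.1 1 * a.1 2) (n := 2)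
          (by norm_num)
        refine ⟨(a.1 0 + d, a.1 2), by simp [h2], ?_⟩
        simp only
        linear_combination a.1 2 * hd
    obtain ⟨v, hv0, hv⟩ := hv
    refine ⟨v, hv0, fun b hb => ?_⟩
    obtain ⟨c, hc⟩ := ha ⟨b, hb⟩
    have : b = c • a.1 := by simpa using (congrArg Subtype.val hc).symm
    rw [this]
    simp only [Pi.smul_apply, smul_eq_mul]
    linear_combination c * hv

/-- A nonzero nilpotent of `sl₂` is `v (-v₂, v₁)`. -/
lemma sl_nilpotent [IsAlgClosed k] {a : Fin 3 → k} (h : a 0 ^ 2 + a 1 * a 2 = 0) :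
    ∃ s t : k, a 0 = - (s * t) ∧ a 1 = s ^ 2 ∧ a 2 = - t ^ 2 := by
  obtain ⟨s, hs⟩ := IsAlgClosed.exists_pow_nat_eq (a 1) (n := 2) (by norm_num)
  obtain ⟨t, ht⟩ := IsAlgClosed.exists_pow_nat_eq (-a 2) (n := 2) (by norm_num)
  have : (a 0 + s * t) * (a 0 - s * t) = 0 := by
    linear_combination h + a 2 * hs - s ^ 2 * ht
  rcases mul_eq_zero.1 this with e | e
  · exact ⟨s, t, by linear_combination e, hs.symm, by rw [ht]; ring⟩
  · exact ⟨s, -t, by linear_combination e, hs.symm, by linear_combination ht⟩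

/-- Automorphisms of `sl₂` are inner. -/
lemma sl_inner [IsAlgClosed k] [CharZero k] (φ : (Fin 3 → k) →ₗ[k] (Fin 3 → k))
    (hφ : ∀ a b, φ (slBr a b) = slBr (φ a) (φ b)) (hne : φ ≠ 0) :
    ∃ v1 v2 w1 w2 : k, v1 * w2 - v2 * w1 = 1 ∧ ∀ a,
      φ a 0 * v1 + φ a 1 * v2 = v1 * a 0 + w1 * a 2 ∧
      φ a 2 * v1 - φ a 0 * v2 = v2 * a 0 + w2 * a 2 ∧
      φ a 0 * w1 + φ a 1 * w2 = v1 * a 1 - w1 * a 0 ∧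
      φ a 2 * w1 - φ a 0 * w2 = v2 * a 1 - w2 * a 0 := by
  have two : (2 : k) ≠ 0 := two_ne_zero
  have hX : φ ![1, 0, 0] = slBr (φ ![0, 1, 0]) (φ ![0, 0, 1]) := by
    rw [← hφ]; congr 1; ext i; fin_cases i <;> simp [slBr]
  have hXE : slBr (φ ![1, 0, 0]) (φ ![0, 1, 0]) = (2 : k) • φ ![0, 1, 0] := by
    rw [← hφ, ← map_smul]; congr 1; ext i; fin_cases i <;> simp [slBr]
  have hXF : slBr (φ ![1, 0, 0]) (φ ![0, 0, 1]) = (-2 : k) • φ ![0, 0, 1] := by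
    rw [← hφ, ← map_smul]; congr 1; ext i; fin_cases i <;> simp [slBr]
  have hdec : ∀ a, φ a = a 0 • φ ![1, 0, 0] + a 1 • φ ![0, 1, 0] + a 2 • φ ![0, 0, 1] := by
    intro a
    conv_lhs => rw [vec3_eq a]
    simp only [map_add, map_smul]
  generalize φ ![1, 0, 0] = X at *
  generalize hE : φ ![0, 1, 0] = E at *
  generalize φ ![0, 0, 1] = F at *
  have e0 := congrFun hXE 0
  have e1 := congrFun hXE 1
  have e2 := congrFun hXE 2
  have f0 := congrFun hXF 0
  have f1 := congrFun hXF 1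
  have f2 := congrFun hXF 2
  simp [slBr] at e0 e1 e2 f0 f1 f2
  have nE : E 0 ^ 2 + E 1 * E 2 = 0 := by
    refine (mul_eq_zero.1 (?_ : 2 * (E 0 ^ 2 + E 1 * E 2) = 0)).resolve_left two
    linear_combination -E 0 * e0 - E 2 * e1 - E 1 * e2
  have nF : F 0 ^ 2 + F 1 * F 2 = 0 := by
    refine (mul_eq_zero.1 (?_ : 2 * (F 0 ^ 2 + F 1 * F 2) = 0)).resolve_left two
    linear_combination F 0 * f0 + F 2 * f1 / 2 + F 1 * f2 / 2
  have hE0 : E ≠ 0 := by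
    rintro rfl
    have hX0 : X = 0 := by rw [hX, slBr_zero_left]
    have hF0 : F = 0 := by
      rw [hX0, slBr_zero_left] at hXF
      simpa using hXF.symm
    exact hne (LinearMap.ext fun a => by simp [hdec a, hX0, hF0])
  obtain ⟨s, t, hs0, hs1, hs2⟩ := sl_nilpotent nE
  obtain ⟨w1, w2, hw0, hw1, hw2⟩ := sl_nilpotent (a := -F)
    (by simp only [Pi.neg_apply]; linear_combination nF)
  simp only [Pi.neg_apply] at hw0 hw1 hw2
  have hX0 := congrFun hX 0
  have hX1 := congrFun hX 1
  have hX2 := congrFun hX 2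
  simp [slBr] at hX0 hX1 hX2
  have hF0 : F 0 = w1 * w2 := by linear_combination -hw0
  have hF1 : F 1 = - w1 ^ 2 := by linear_combination -hw1
  have hF2 : F 2 = w2 ^ 2 := by linear_combination -hw2
  simp only [hs0, hs1, hs2, hF0, hF1, hF2] at hX0 hX1 hX2
  simp only [hX0, hX1, hX2, hs0, hs1, hs2] at e0 e1 e2
  have g0 : s * t * ((s * w2 - t * w1) ^ 2 - 1) = 0 := by
    refine (mul_eq_zero.1 (?_ : 2 * (s * t * ((s * w2 - t * w1) ^ 2 - 1)) = 0)).resolve_left two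
    linear_combination -e0
  have g1 : s ^ 2 * ((s * w2 - t * w1) ^ 2 - 1) = 0 := by
    refine (mul_eq_zero.1 (?_ : 2 * (s ^ 2 * ((s * w2 - t * w1) ^ 2 - 1)) = 0)).resolve_left two
    linear_combination 2 * e1
  have g2 : t ^ 2 * ((s * w2 - t * w1) ^ 2 - 1) = 0 := by
    refine (mul_eq_zero.1 (?_ : 2 * (t ^ 2 * ((s * w2 - t * w1) ^ 2 - 1)) = 0)).resolve_left two
    linear_combination -2 * e2
  have hd : (s * w2 - t * w1) ^ 2 - 1 = 0 := by
    by_contra hc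
    have z1 : s = 0 := by simpa [hc] using g1
    have z2 : t = 0 := by simpa [hc] using g2
    exact hE0 (by ext i; fin_cases i <;> simp [hs0, hs1, hs2, z1, z2])
  have hd' : (s * w2 - t * w1 - 1) * (s * w2 - t * w1 + 1) = 0 := by linear_combination hd
  rcases mul_eq_zero.1 hd' with e | e
  · have e' : s * w2 - t * w1 = 1 := by linear_combination e
    refine ⟨s, t, w1, w2, e', fun a => ?_⟩
    have a0 := congrFun (hdec a) 0
    have a1 := congrFun (hdec a) 1
    have a2 := congrFun (hdec a) 2
    simp only [Pi.add_apply, Pi.smul_apply, smul_eq_mul] at a0 a1 a2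
    rw [a0, a1, a2, hX0, hX1, hX2, hs0, hs1, hs2, hF0, hF1, hF2]
    refine ⟨?_, ?_, ?_, ?_⟩
    · linear_combination (a 0 * s * (s * w2 - t * w1 + 1) + a 2 * w1) * e'
    · linear_combination (a 0 * t * (s * w2 - t * w1 + 1) + a 2 * w2) * e'
    · linear_combination (-a 0 * w1 * (s * w2 - t * w1 + 1) + a 1 * s) * e'
    · linear_combination (-a 0 * w2 * (s * w2 - t * w1 + 1) + a 1 * t) * e'
  · have e' : s * (-w2) - t * (-w1) = 1 := by linear_combination -e
    refine ⟨s, t, -w1, -w2, e', fun a => ?_⟩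
    have a0 := congrFun (hdec a) 0
    have a1 := congrFun (hdec a) 1
    have a2 := congrFun (hdec a) 2
    simp only [Pi.add_apply, Pi.smul_apply, smul_eq_mul] at a0 a1 a2
    rw [a0, a1, a2, hX0, hX1, hX2, hs0, hs1, hs2, hF0, hF1, hF2]
    refine ⟨?_, ?_, ?_, ?_⟩
    · linear_combination (a 0 * s * (s * (-w2) - t * (-w1) + 1) + a 2 * (-w1)) * e'
    · linear_combination (a 0 * t * (s * (-w2) - t * (-w1) + 1) + a 2 * (-w2)) * e'
    · linear_combination (-a 0 * (-w1) * (s * (-w2) - t * (-w1) + 1) + a 1 * s) * e'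
    · linear_combination (-a 0 * (-w2) * (s * (-w2) - t * (-w1) + 1) + a 1 * t) * e'

end SlTwo

end

section

section Goursat

variable {k ι : Type*} [Field k] 

/-- The componentwise bracket on a power of `sl₂`. -/
def slBrPi (a b : ι → Fin 3 → k) : ι → Fin 3 → k := fun i => slBr (a i) (b i)

/-- The elements of the `i`-th factor which occur in `W` with vanishing components on `s`. -/
def slFibre (W : Submodule k (ι → Fin 3 → k)) (s : Finset ι) (i : ι) :
    Submodule k (Fin 3 → k) :=
  (W ⊓ ⨅ l ∈ s, LinearMap.ker (LinearMap.proj (R := k) (φ := fun _ : ι => Fin 3 → k) l)).map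
    (LinearMap.proj i)

lemma mem_slFibre {W : Submodule k (ι → Fin 3 → k)} {s : Finset ι} {i : ι} {a : Fin 3 → k} :
    a ∈ slFibre W s i ↔ ∃ w ∈ W, (∀ l ∈ s, w l = 0) ∧ w i = a := by
  simp [slFibre, and_assoc]

variable [CharZero k] [IsAlgClosed k] [Fintype ι]

/-- Proper subalgebras of a power of `sl₂` either stabilise a line in some factor, or relate two
distinct factors by an inner automorphism. -/
lemma sl_goursat {W : Submodule k (ι → Fin 3 → k)} (hW : ∀ a ∈ W, ∀ b ∈ W, slBrPi a b ∈ W)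
    (hne : W ≠ ⊤) :
    (∃ (i : ι) (v : k × k), v ≠ 0 ∧
      ∀ a ∈ W, a i 2 * v.1 ^ 2 - 2 * a i 0 * v.1 * v.2 - a i 1 * v.2 ^ 2 = 0) ∨
    ∃ i l : ι, i ≠ l ∧ ∃ v1 v2 w1 w2 : k, v1 * w2 - v2 * w1 = 1 ∧ ∀ a ∈ W,
      a l 0 * v1 + a l 1 * v2 = v1 * a i 0 + w1 * a i 2 ∧
      a l 2 * v1 - a l 0 * v2 = v2 * a i 0 + w2 * a i 2 ∧
      a l 0 * w1 + a l 1 * w2 = v1 * a i 1 - w1 * a i 0 ∧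
      a l 2 * w1 - a l 0 * w2 = v2 * a i 1 - w2 * a i 0 := by
  classical
  by_cases hpr : ∀ i, slFibre W ∅ i = ⊤
  swap
  · push Not at hpr
    obtain ⟨i, hi⟩ := hpr
    obtain ⟨v, hv, h⟩ := sl_proper_subalgebra (N := slFibre W ∅ i) (fun a ha b hb => by
      obtain ⟨x, hx, -, rfl⟩ := mem_slFibre.1 ha
      obtain ⟨y, hy, -, rfl⟩ := mem_slFibre.1 hb
      exact mem_slFibre.2 ⟨_, hW x hx y hy, by simp, rfl⟩) hi
    exact Or.inl ⟨i, v, hv, fun a ha => h _ (mem_slFibre.2 ⟨a, ha, by simp, rfl⟩)⟩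
  have hsurj : ∀ i a, ∃ w ∈ W, w i = a := fun i a => by
    obtain ⟨w, hw, -, h⟩ := mem_slFibre.1 (show a ∈ slFibre W ∅ i by rw [hpr]; trivial)
    exact ⟨w, hw, h⟩
  by_cases hpair : ∀ i l, i ≠ l → slFibre W {i} l = ⊤
  · exfalso
    have hall : ∀ (l : ι) (s : Finset ι), l ∉ s → slFibre W s l = ⊤ := by
      intro l s
      induction s using Finset.induction_on with
      | empty => exact fun _ => hpr l
      | insert i s his ih =>
        intro hl
        have hl' : i ≠ l := fun e => hl (by simp [e])
        have ih' := ih fun e => hl (by simp [e])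
        refine sl_perfect fun a b => ?_
        obtain ⟨x, hx, hx0, rfl⟩ := mem_slFibre.1 (show a ∈ slFibre W s l by rw [ih']; trivial)
        obtain ⟨y, hy, hy0, rfl⟩ := mem_slFibre.1
          (show b ∈ slFibre W {i} l by rw [hpair i l hl']; trivial)
        refine mem_slFibre.2 ⟨slBrPi x y, hW x hx y hy, fun m hm => ?_, rfl⟩
        rcases Finset.mem_insert.1 hm with rfl | hm
        · simp only [slBrPi, hy0 m (by simp), slBr_zero_right]
        · simp only [slBrPi, hx0 m hm, slBr_zero_left]
    refine hne (eq_top_iff.2 fun a _ => ?_)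
    have : a = ∑ i, Pi.single i (a i) := (Finset.univ_sum_single a).symm
    rw [this]
    refine Submodule.sum_mem _ fun i _ => ?_
    obtain ⟨w, hw, hw0, hwi⟩ := mem_slFibre.1
      (show a i ∈ slFibre W (Finset.univ.erase i) i by
        rw [hall i _ (Finset.notMem_erase i _)]; trivial)
    convert hw
    ext l : 1
    by_cases h : l = i
    · subst h; simp [hwi]
    · rw [hw0 l (by simp [h])]; simp [h]
  · push Not at hpair
    obtain ⟨i, l, hil, hfib⟩ := hpair
    right
    have hbot : slFibre W {i} l = ⊥ := by
      by_contra hc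
      refine hfib (sl_ideal_eq_top (fun a b hb => ?_) hc)
      obtain ⟨x, hx, rfl⟩ := hsurj l a
      obtain ⟨y, hy, hy0, rfl⟩ := mem_slFibre.1 hb
      refine mem_slFibre.2 ⟨slBrPi x y, hW x hx y hy, fun m hm => ?_, rfl⟩
      simp only [slBrPi, hy0 m hm, slBr_zero_right]
    have hinj : ∀ a ∈ W, a i = 0 → a l = 0 := fun a ha h => by
      have : a l ∈ slFibre W {i} l := mem_slFibre.2 ⟨a, ha, by simpa using h, rfl⟩
      rwa [hbot, Submodule.mem_bot] at this
    have huniq : ∀ a ∈ W, ∀ b ∈ W, a i = b i → a l = b l := fun a ha b hb h =>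
      sub_eq_zero.1 (hinj (a - b) (W.sub_mem ha hb) (by simp [h]))
    choose sec hsec hseci using hsurj i
    let φ : (Fin 3 → k) →ₗ[k] (Fin 3 → k) :=
      { toFun := fun a => sec a l
        map_add' := fun a b => huniq _ (hsec _) _ (W.add_mem (hsec a) (hsec b)) (by simp [hseci])
        map_smul' := fun c a => huniq _ (hsec _) _ (W.smul_mem c (hsec a)) (by simp [hseci]) }
    have hφ : ∀ a ∈ W, φ (a i) = a l := fun a ha => huniq _ (hsec _) _ ha (by simp [hseci])
    obtain ⟨v1, v2, w1, w2, h1, h2⟩ := sl_inner φ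
      (fun a b => by
        have := hφ _ (hW _ (hsec a) _ (hsec b))
        simp only [slBrPi, hseci] at this
        exact this)
      (fun h => by
        obtain ⟨x, hx, hxl⟩ := hsurj l ![1, 0, 0]
        have := hφ x hx
        rw [h, hxl] at this
        simpa using congrFun this 0)
    refine ⟨i, l, hil, v1, v2, w1, w2, h1, fun a ha => ?_⟩
    have := h2 (a i)
    rwa [hφ a ha] at this

end Goursat

section StableSubspace

variable {R K κ τ : Type*} [CommRing R] [Field K] [Algebra R K] [Fintype κ]

/-- A subspace of `K^κ` stable under derivations acting componentwise is spanned by its vectors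
with constant components. -/
lemma stable_subspace_eq_span (D : τ → Derivation R K K) (W : Submodule K (κ → K))
    (hW : ∀ i, ∀ w ∈ W, (fun l => D i (w l)) ∈ W) :
    W = Submodule.span K {w | w ∈ W ∧ ∀ i l, D i (w l) = 0} := by
  classical
  refine le_antisymm ?_ (Submodule.span_le.2 fun w hw => hw.1)
  suffices H : ∀ (n : ℕ) (v : κ → K), v ∈ W → (Finset.univ.filter fun l => v l ≠ 0).card = n →
      v ∈ Submodule.span K {w | w ∈ W ∧ ∀ i l, D i (w l) = 0} from
    fun v hv => H _ v hv rfl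
  intro n
  induction n using Nat.strong_induction_on with
  | _ n ih =>
    intro v hv hn
    by_cases hv0 : v = 0
    · rw [hv0]; exact Submodule.zero_mem _
    have hex : ∃ m, ∃ w ∈ W, w ≠ 0 ∧ (∀ l, v l = 0 → w l = 0) ∧
        (Finset.univ.filter fun l => w l ≠ 0).card = m := ⟨_, v, hv, hv0, fun _ h => h, rfl⟩
    obtain ⟨w, hw, hw0, hwv, hwm⟩ := Nat.find_spec hex
    have hmin := fun m => @Nat.find_min _ _ hex m
    obtain ⟨l₀, hl₀⟩ := Function.ne_iff.1 hw0
    simp only [Pi.zero_apply] at hl₀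
    set u : κ → K := (w l₀)⁻¹ • w with hu
    have huW : u ∈ W := W.smul_mem _ hw
    have hu1 : u l₀ = 1 := by simp [hu, hl₀]
    have huw : ∀ l, w l = 0 → u l = 0 := fun l h => by simp [hu, h]
    have huc : ∀ i l, D i (u l) = 0 := by
      intro i
      by_contra hc
      push Not at hc
      obtain ⟨l₁, hl₁⟩ := hc
      refine hmin _ ?_ ⟨_, hW i u huW, fun h => hl₁ (congrFun h l₁), fun l hl => by
        simp [huw l (hwv l hl)], rfl⟩
      rw [← hwm]
      refine Finset.card_lt_card ⟨fun l hl => ?_, fun hs => ?_⟩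
      · simp only [Finset.mem_filter, Finset.mem_univ, true_and] at hl ⊢
        exact fun h => hl (by simp [huw l h])
      · have := hs (show l₀ ∈ _ by simpa using hl₀)
        simp [hu1] at this
    have hsub : v - v l₀ • u ∈ Submodule.span K {w | w ∈ W ∧ ∀ i l, D i (w l) = 0} := by
      refine ih _ ?_ _ (W.sub_mem hv (W.smul_mem _ huW)) rfl
      rw [← hn]
      refine Finset.card_lt_card ⟨fun l hl => ?_, fun hs => ?_⟩
      · simp only [Finset.mem_filter, Finset.mem_univ, true_and] at hl ⊢
        exact fun h => hl (by simp [h, huw l (hwv l h)])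
      · have := hs (show l₀ ∈ _ by simpa using fun h => hl₀ (hwv l₀ h))
        simp [hu1] at this
    have := Submodule.add_mem _ hsub (Submodule.smul_mem _ (v l₀)
      (Submodule.subset_span (s := {w | w ∈ W ∧ ∀ i l, D i (w l) = 0}) ⟨huW, huc⟩))
    simpa using this

end StableSubspace

end

section

section Gauge

variable {R K : Type*} [CommRing R] [Field K] [Algebra R K]

/-- The coefficient of the normal form `u'' + q u = 0` of the uniformising equation of `J`. -/
def schQ (x : K) : K := (36 * x ^ 2 - 41 * x + 32) / (144 * x ^ 2 * (x - 1) ^ 2)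

lemma exists_deriv_schQ [CharZero K] {x : K} (h0 : x ≠ 0) (h1 : x ≠ 1) :
    ∃ c : K, ∀ E : Derivation R K K, E (schQ x) = c * E x := by
  have h1' : x - 1 ≠ 0 := sub_ne_zero.2 h1
  refine ⟨(72 * x - 41 - schQ x * (288 * x * (x - 1) ^ 2 + 288 * x ^ 2 * (x - 1))) /
    (144 * x ^ 2 * (x - 1) ^ 2), fun E => ?_⟩
  have h : schQ x * (144 * x ^ 2 * (x - 1) ^ 2) = 36 * x ^ 2 - 41 * x + 32 := by
    unfold schQ; field_simp
  have hn : ∀ n : ℕ, E (n : K) = 0 := fun n => E.map_natCast n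
  have h2 := congrArg E h
  have a1 : E (36 : K) = 0 := hn 36
  have a2 : E (41 : K) = 0 := hn 41
  have a3 : E (32 : K) = 0 := hn 32
  have a4 : E (144 : K) = 0 := hn 144
  simp only [Derivation.leibniz, map_add, map_sub, Derivation.leibniz_pow, smul_eq_mul, a1, a2, a3,
    a4, nsmul_eq_mul, Derivation.map_one_eq_zero] at h2
  rw [div_mul_eq_mul_div, eq_div_iff (by simp [h0, h1'])]
  push_cast at h2
  linear_combination h2

/-- The pull-back by `[[y, zy], [w, zw + 1/y]]` of the connection `d - [[0, 1], [-q, 0]] dx`. -/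
def gaugeForm (x y w z : K) (E : Derivation R K K) : Fin 3 → K :=
  ![(E y - E x * w) / y - z * (y * (E w + schQ x * E x * y) - w * (E y - E x * w)),
    -E x / y ^ 2 + 2 * z * ((E y - E x * w) / y)
      - z ^ 2 * (y * (E w + schQ x * E x * y) - w * (E y - E x * w)) + E z,
    y * (E w + schQ x * E x * y) - w * (E y - E x * w)]

lemma gaugeForm_spec {x y w z : K} (hy : y ≠ 0) (E : Derivation R K K) :
    E y = gaugeForm x y w z E 0 * y + gaugeForm x y w z E 2 * (z * y) + E x * w ∧
    E w = gaugeForm x y w z E 0 * w + gaugeForm x y w z E 2 * (z * w + y⁻¹) - schQ x * E x * y ∧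
    E (z * y) = gaugeForm x y w z E 1 * y - gaugeForm x y w z E 0 * (z * y)
      + E x * (z * w + y⁻¹) ∧
    E (z * w + y⁻¹) = gaugeForm x y w z E 1 * w - gaugeForm x y w z E 0 * (z * w + y⁻¹)
      - schQ x * E x * (z * y) := by
  refine ⟨?_, ?_, ?_, ?_⟩
  · simp [gaugeForm]; field_simp; ring
  · simp [gaugeForm]; field_simp; ring
  · simp [gaugeForm]; field_simp; ring
  · simp [gaugeForm, Derivation.leibniz_inv]; field_simp; ring

lemma gaugeForm_commutator [CharZero K] {x y w z : K} (h0 : x ≠ 0) (h1 : x ≠ 1) (hy : y ≠ 0)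
    (E E' : Derivation R K K) (i : Fin 3) :
    gaugeForm x y w z ⁅E, E'⁆ i = E (gaugeForm x y w z E' i) - E' (gaugeForm x y w z E i)
      + slBr (gaugeForm x y w z E) (gaugeForm x y w z E') i := by
  obtain ⟨c, hc⟩ := exists_deriv_schQ (R := R) h0 h1
  have hn : ∀ (D : Derivation R K K), D (2 : K) = 0 := fun D => D.map_natCast 2
  fin_cases i
  · simp [gaugeForm, slBr, Derivation.commutator_apply, hc, div_eq_mul_inv,
      Derivation.leibniz_inv, Derivation.leibniz_pow, hn]
    field_simp
    ring
  · simp [gaugeForm, slBr, Derivation.commutator_apply, hc, div_eq_mul_inv,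
      Derivation.leibniz_inv, Derivation.leibniz_pow, hn]
    field_simp
    ring
  · simp [gaugeForm, slBr, Derivation.commutator_apply, hc, div_eq_mul_inv,
      Derivation.leibniz_inv, Derivation.leibniz_pow, hn]
    field_simp
    ring

end Gauge

end

section

section Dichotomy

variable {K ι τ : Type*} [Field K] [CharZero K]

lemma isAlgClosed_constants [IsAlgClosed K] {C : Subfield K} (D : τ → Derivation C K K)
    (hC : ∀ a, (∀ i, D i a = 0) → a ∈ C) : IsAlgClosed C := by
  refine IsAlgClosed.of_exists_root _ fun p hp hirr => ?_
  obtain ⟨a, ha⟩ := IsAlgClosed.exists_aeval_eq_zero K p hirr.degree_pos.ne'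
  have ha' : a ∈ C := hC a fun i => derivation_eq_zero_of_isAlgebraic (D i) ⟨p, hirr.ne_zero, ha⟩
  refine ⟨⟨a, ha'⟩, (algebraMap C K).injective ?_⟩
  rw [map_zero, ← ha]
  exact (Polynomial.aeval_algebraMap_apply_eq_algebraMap_eval (⟨a, ha'⟩ : C) p).symm

/-- The family of the forms `gaugeForm`, as a linear map on derivations. -/
def gaugeMap {R : Type*} [CommRing R] [Algebra R K] (x y w z : ι → K) :
    Derivation R K K →ₗ[K] (ι → Fin 3 → K) where
  toFun E := fun i => gaugeForm (x i) (y i) (w i) (z i) E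
  map_add' E E' := by
    ext i a
    fin_cases a <;> simp [gaugeForm] <;> ring
  map_smul' c E := by
    ext i a
    fin_cases a <;> simp [gaugeForm] <;> ring

variable [IsAlgClosed K] [Fintype ι]

lemma gauge_dichotomy {C : Subfield K} (D : τ → Derivation C K K)
    (hC : ∀ a, (∀ i, D i a = 0) → a ∈ C) (x y w z : ι → K) (h0 : ∀ i, x i ≠ 0)
    (h1 : ∀ i, x i ≠ 1) (hy : ∀ i, y i ≠ 0) (hD : ∀ t, gaugeMap x y w z (D t) = 0)
    (hne : LinearMap.range (gaugeMap (R := C) x y w z) ≠ ⊤) :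
    (∃ (i : ι) (v1 v2 : C), (v1 ≠ 0 ∨ v2 ≠ 0) ∧ ∀ a ∈ LinearMap.range (gaugeMap (R := C) x y w z),
        a i 2 * v1 ^ 2 - 2 * a i 0 * v1 * v2 - a i 1 * v2 ^ 2 = 0) ∨
    ∃ i l : ι, i ≠ l ∧ ∃ v1 v2 w1 w2 : C, v1 * w2 - v2 * w1 = 1 ∧
      ∀ a ∈ LinearMap.range (gaugeMap (R := C) x y w z),
      a l 0 * v1 + a l 1 * v2 = v1 * a i 0 + w1 * a i 2 ∧
      a l 2 * v1 - a l 0 * v2 = v2 * a i 0 + w2 * a i 2 ∧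
      a l 0 * w1 + a l 1 * w2 = v1 * a i 1 - w1 * a i 0 ∧
      a l 2 * w1 - a l 0 * w2 = v2 * a i 1 - w2 * a i 0 := by
  classical
  have := isAlgClosed_constants D hC
  have two : ((2 : C) : K) = 2 := map_ofNat (algebraMap C K) 2
  set W := LinearMap.range (gaugeMap (R := C) x y w z) with hWdef
  let e := LinearEquiv.curry K K ι (Fin 3)
  have hstab : ∀ t, ∀ u ∈ W.comap e.toLinearMap, (fun l => D t (u l)) ∈ W.comap e.toLinearMap := by
    rintro t u ⟨E, hE⟩
    refine ⟨⁅D t, E⁆, ?_⟩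
    ext i a
    have hDi : gaugeForm (x i) (y i) (w i) (z i) (D t) = 0 := congrFun (hD t) i
    have hEi : gaugeForm (x i) (y i) (w i) (z i) E a = u (i, a) := congrFun (congrFun hE i) a
    change gaugeForm (x i) (y i) (w i) (z i) ⁅D t, E⁆ a = D t (u (i, a))
    rw [gaugeForm_commutator (h0 i) (h1 i) (hy i), hDi, slBr_zero_left, hEi]
    simp
  have hspan := stable_subspace_eq_span D _ hstab
  let emb : (ι → Fin 3 → C) → (ι → Fin 3 → K) := fun u i a => (u i a : K)
  let W₀ : Submodule C (ι → Fin 3 → C) :=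
    { carrier := {u | emb u ∈ W}
      add_mem' := fun {u v} hu hv => by
        have : emb (u + v) = emb u + emb v := by ext; simp [emb]
        rw [Set.mem_setOf_eq, this]; exact W.add_mem hu hv
      zero_mem' := by
        have : emb 0 = 0 := by ext; simp [emb]
        rw [Set.mem_setOf_eq, this]; exact W.zero_mem
      smul_mem' := fun c u hu => by
        have : emb (c • u) = (c : K) • emb u := by ext; simp [emb]
        rw [Set.mem_setOf_eq, this]; exact W.smul_mem _ hu }
  have hlift : ∀ P : Submodule K (ι → Fin 3 → K), (∀ u ∈ W₀, emb u ∈ P) → W ≤ P := by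
    intro P hP
    have h2 : W.comap e.toLinearMap ≤ P.comap e.toLinearMap := by
      rw [hspan]
      refine Submodule.span_le.2 fun u hu => ?_
      have hc : ∀ l, u l ∈ C := fun l => hC _ fun t => hu.2 t l
      exact hP (fun i a => ⟨u (i, a), hc _⟩) hu.1
    intro a ha
    have := h2 (show e.symm a ∈ W.comap e.toLinearMap by simpa using ha)
    simpa using this
  have hW₀ : W₀ ≠ ⊤ := by
    intro h
    refine hne (eq_top_iff.2 fun a _ => ?_)
    have hb : ∀ (i : ι) (b : Fin 3), (Pi.single i (Pi.single b (1 : K)) : ι → Fin 3 → K) ∈ W := by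
      intro i b
      have : (Pi.single i (Pi.single b (1 : C)) : ι → Fin 3 → C) ∈ W₀ := by rw [h]; trivial
      convert (show emb _ ∈ W from this) using 1
      ext i' b'
      by_cases hi : i' = i
      · subst hi
        by_cases hb : b' = b
        · subst hb; simp [emb]
        · simp [emb, hb]
      · simp [emb, hi]
    have ha : a = ∑ i, ∑ b, a i b • (Pi.single i (Pi.single b (1 : K)) : ι → Fin 3 → K) := by
      ext i b
      simp [Finset.sum_apply, Pi.single_apply, apply_ite, ite_apply]
    rw [ha]
    exact W.sum_mem fun i _ => W.sum_mem fun b _ => W.smul_mem _ (hb i b)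
  have hbr : ∀ a ∈ W₀, ∀ b ∈ W₀, slBrPi a b ∈ W₀ := by
    rintro a ⟨E, hE⟩ b ⟨E', hE'⟩
    refine ⟨⁅E, E'⁆, ?_⟩
    ext i c
    have h1' : gaugeForm (x i) (y i) (w i) (z i) E = fun c => (a i c : K) := congrFun hE i
    have h2' : gaugeForm (x i) (y i) (w i) (z i) E' = fun c => (b i c : K) := congrFun hE' i
    change gaugeForm (x i) (y i) (w i) (z i) ⁅E, E'⁆ c = (slBr (a i) (b i) c : C)
    rw [gaugeForm_commutator (h0 i) (h1 i) (hy i), h1', h2']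
    have z1 : ∀ u : C, E (u : K) = 0 := fun u => E.map_algebraMap u
    have z2 : ∀ u : C, E' (u : K) = 0 := fun u => E'.map_algebraMap u
    rw [z1, z2]
    fin_cases c <;> simp [slBr, two]
  rcases sl_goursat hbr hW₀ with ⟨i, v, hv, h⟩ | ⟨i, l, hil, v1, v2, w1, w2, hdet, h⟩
  · left
    refine ⟨i, v.1, v.2, ?_, ?_⟩
    · by_contra hc
      push Not at hc
      exact hv (Prod.ext hc.1 hc.2)
    · let P : (ι → Fin 3 → K) →ₗ[K] K :=
        { toFun := fun a => a i 2 * v.1 ^ 2 - 2 * a i 0 * v.1 * v.2 - a i 1 * v.2 ^ 2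
          map_add' := fun a b => by simp; ring
          map_smul' := fun c a => by simp; ring }
      exact fun a ha => hlift (LinearMap.ker P) (fun u hu => by
        have := congrArg (fun c : C => (c : K)) (h u hu)
        simpa [P, emb, two] using this) ha
  · right
    refine ⟨i, l, hil, v1, v2, w1, w2, hdet, ?_⟩
    let P : (ι → Fin 3 → K) →ₗ[K] (Fin 4 → K) :=
      { toFun := fun a => ![a l 0 * v1 + a l 1 * v2 - (v1 * a i 0 + w1 * a i 2),
          a l 2 * v1 - a l 0 * v2 - (v2 * a i 0 + w2 * a i 2),
          a l 0 * w1 + a l 1 * w2 - (v1 * a i 1 - w1 * a i 0),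
          a l 2 * w1 - a l 0 * w2 - (v2 * a i 1 - w2 * a i 0)]
        map_add' := fun a b => by ext j; fin_cases j <;> simp <;> ring
        map_smul' := fun c a => by ext j; fin_cases j <;> simp <;> ring }
    intro a ha
    have hP : P a = 0 := hlift (LinearMap.ker P) (fun u hu => by
      obtain ⟨e1, e2, e3, e4⟩ := h u hu
      replace e1 := congrArg (fun c : C => (c : K)) e1
      replace e2 := congrArg (fun c : C => (c : K)) e2
      replace e3 := congrArg (fun c : C => (c : K)) e3
      replace e4 := congrArg (fun c : C => (c : K)) e4
      push_cast at e1 e2 e3 e4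
      rw [LinearMap.mem_ker]
      ext j
      fin_cases j <;> simp [P, emb, e1, e2, e3, e4]) ha
    exact ⟨sub_eq_zero.1 (congrFun hP 0), sub_eq_zero.1 (congrFun hP 1),
      sub_eq_zero.1 (congrFun hP 2), sub_eq_zero.1 (congrFun hP 3)⟩

end Dichotomy

end

section

section Transfer

variable {R K : Type*} [CommRing R] [Field K] [Algebra R K]

/-- `(m₁, m₂)` spans a line stable under the connection, along the derivation `E`. -/
def LineHorizontal (x m1 m2 : K) (E : Derivation R K K) : Prop :=
  m1 * (E m2 + schQ x * E x * m1) = m2 * (E m1 - E x * m2)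

/-- `[[a, b], [c, d]]` is a horizontal map from the connection at `x` to the one at `X`, along
the derivation `E`. -/
structure MapHorizontal (x X a b c d : K) (E : Derivation R K K) : Prop where
  ha : E a = E X * c + schQ x * E x * b
  hb : E b = E X * d - E x * a
  hc : E c = - (schQ X * E X * a) + schQ x * E x * d
  hd : E d = - (schQ X * E X * b) - E x * c

lemma lineHorizontal_of_gauge {x y w z v1 v2 : K} (hy : y ≠ 0) (E : Derivation R K K)
    (hv1 : E v1 = 0) (hv2 : E v2 = 0)
    (h : gaugeForm x y w z E 2 * v1 ^ 2 - 2 * gaugeForm x y w z E 0 * v1 * v2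
      - gaugeForm x y w z E 1 * v2 ^ 2 = 0) :
    LineHorizontal x (y * v1 + z * y * v2) (w * v1 + (z * w + y⁻¹) * v2) E := by
  obtain ⟨h1, h2, h3, h4⟩ := gaugeForm_spec (x := x) (w := w) (z := z) hy E
  have hdet : y * (z * w + y⁻¹) - z * y * w = 1 := by field_simp; ring
  generalize gaugeForm x y w z E = f at *
  generalize hb : z * y = b at *
  generalize hd : z * w + y⁻¹ = d at *
  unfold LineHorizontal
  simp only [map_add, Derivation.leibniz, smul_eq_mul, hv1, hv2, h1, h2, h3, h4]
  linear_combination (y * d - b * w) * h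

lemma line_ne_zero {y w z v1 v2 : K} (hy : y ≠ 0) (h : v1 ≠ 0 ∨ v2 ≠ 0) :
    y * v1 + z * y * v2 ≠ 0 ∨ w * v1 + (z * w + y⁻¹) * v2 ≠ 0 := by
  by_contra hc
  push Not at hc
  obtain ⟨e1, e2⟩ := hc
  have e3 : v1 + z * v2 = 0 := by
    refine (mul_eq_zero.1 (?_ : y * (v1 + z * v2) = 0)).resolve_left hy
    linear_combination e1
  have e4 : v2 = 0 := by
    refine (mul_eq_zero.1 (?_ : y⁻¹ * v2 = 0)).resolve_left (inv_ne_zero hy)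
    linear_combination e2 - w * e3
  have e5 : v1 = 0 := by simpa [e4] using e3
  rcases h with h | h <;> contradiction

lemma mapHorizontal_of_gauge {x y w z x' y' w' z' v1 v2 w1 w2 : K} (hy : y ≠ 0) (hy' : y' ≠ 0)
    (hdet : v1 * w2 - v2 * w1 = 1) :
    ∃ a b c d : K, a * d - b * c = 1 ∧ ∀ E : Derivation R K K,
      E v1 = 0 → E v2 = 0 → E w1 = 0 → E w2 = 0 →
      (gaugeForm x' y' w' z' E 0 * v1 + gaugeForm x' y' w' z' E 1 * v2 =
        v1 * gaugeForm x y w z E 0 + w1 * gaugeForm x y w z E 2 ∧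
      gaugeForm x' y' w' z' E 2 * v1 - gaugeForm x' y' w' z' E 0 * v2 =
        v2 * gaugeForm x y w z E 0 + w2 * gaugeForm x y w z E 2 ∧
      gaugeForm x' y' w' z' E 0 * w1 + gaugeForm x' y' w' z' E 1 * w2 =
        v1 * gaugeForm x y w z E 1 - w1 * gaugeForm x y w z E 0 ∧
      gaugeForm x' y' w' z' E 2 * w1 - gaugeForm x' y' w' z' E 0 * w2 =
        v2 * gaugeForm x y w z E 1 - w2 * gaugeForm x y w z E 0) →
      MapHorizontal x x' a b c d E := by
  have hd1 : y * (z * w + y⁻¹) - z * y * w = 1 := by field_simp; ring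
  have hd2 : y' * (z' * w' + y'⁻¹) - z' * y' * w' = 1 := by field_simp; ring
  refine ⟨(y' * v1 + z' * y' * v2) * (z * w + y⁻¹) - (y' * w1 + z' * y' * w2) * w,
    -(y' * v1 + z' * y' * v2) * (z * y) + (y' * w1 + z' * y' * w2) * y,
    (w' * v1 + (z' * w' + y'⁻¹) * v2) * (z * w + y⁻¹)
      - (w' * w1 + (z' * w' + y'⁻¹) * w2) * w,
    -(w' * v1 + (z' * w' + y'⁻¹) * v2) * (z * y)
      + (w' * w1 + (z' * w' + y'⁻¹) * w2) * y, ?_, ?_⟩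
  · generalize hb : z * y = b at *
    generalize hd : z * w + y⁻¹ = d at *
    generalize hb' : z' * y' = b' at *
    generalize hd' : z' * w' + y'⁻¹ = d' at *
    linear_combination (y' * d' - b' * w') * (y * d - b * w) * hdet
      + (y * d - b * w) * hd2 + hd1
  · rintro E k1 k2 k3 k4 ⟨e1, e2, e3, e4⟩
    obtain ⟨h1, h2, h3, h4⟩ := gaugeForm_spec (x := x) (w := w) (z := z) hy E
    obtain ⟨g1, g2, g3, g4⟩ := gaugeForm_spec (x := x') (w := w') (z := z') hy' E
    generalize gaugeForm x y w z E = f at *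
    generalize gaugeForm x' y' w' z' E = f' at *
    generalize hb : z * y = b at *
    generalize hd : z * w + y⁻¹ = d at *
    generalize hb' : z' * y' = b' at *
    generalize hd' : z' * w' + y'⁻¹ = d' at *
    constructor
    · simp only [map_add, map_sub, map_neg, Derivation.leibniz, smul_eq_mul, k1, k2, k3, k4, h1,
        h2, h3, h4, g1, g2, g3, g4]
      linear_combination (y' * e1 + b' * e2) * d - (y' * e3 + b' * e4) * w
    · simp only [map_add, map_sub, map_neg, Derivation.leibniz, smul_eq_mul, k1, k2, k3, k4, h1,
        h2, h3, h4, g1, g2, g3, g4]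
      linear_combination -(y' * e1 + b' * e2) * b + (y' * e3 + b' * e4) * y
    · simp only [map_add, map_sub, map_neg, Derivation.leibniz, smul_eq_mul, k1, k2, k3, k4, h1,
        h2, h3, h4, g1, g2, g3, g4]
      linear_combination (w' * e1 + d' * e2) * d - (w' * e3 + d' * e4) * w
    · simp only [map_add, map_sub, map_neg, Derivation.leibniz, smul_eq_mul, k1, k2, k3, k4, h1,
        h2, h3, h4, g1, g2, g3, g4]
      linear_combination -(w' * e1 + d' * e2) * b + (w' * e3 + d' * e4) * y

end Transfer

end

section

open WithZero

section Residues

variable {k F : Type*} [Field k] [Field F] [Algebra k F]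

/-- The function `f` has residue `c` at the place `v`. -/
def HasRes (v : Valuation F ℤᵐ⁰) (f : F) (c : k) : Prop := v (f - algebraMap k F c) < 1

variable {v : Valuation F ℤᵐ⁰} {θ : Derivation k F F} {f g : F} {c d : k}

lemma hasRes_zero_iff : HasRes v f (0 : k) ↔ v f < 1 := by simp [HasRes]

lemma hasRes_algebraMap (c : k) : HasRes v (algebraMap k F c) c := by simp [HasRes]

lemma hasRes_one : HasRes v 1 (1 : k) := by simpa using hasRes_algebraMap (v := v) (1 : k)

lemma hasRes_ofNat (n : ℕ) [n.AtLeastTwo] : HasRes v (OfNat.ofNat n) (OfNat.ofNat n : k) := by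
  have := hasRes_algebraMap (v := v) (OfNat.ofNat n : k)
  rwa [map_ofNat (algebraMap k F) n] at this

lemma hasRes_intCast (n : ℤ) : HasRes v (n : F) (n : k) := by
  simpa using hasRes_algebraMap (v := v) (n : k)

lemma HasRes.add (hf : HasRes v f c) (hg : HasRes v g d) : HasRes v (f + g) (c + d) := by
  unfold HasRes at *
  rw [map_add, add_sub_add_comm]
  exact v.map_add_lt hf hg

lemma HasRes.neg (hf : HasRes v f c) : HasRes v (-f) (-c) := by
  unfold HasRes at *
  rw [map_neg, neg_sub_neg, v.map_sub_swap]
  exact hf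

lemma HasRes.sub (hf : HasRes v f c) (hg : HasRes v g d) : HasRes v (f - g) (c - d) := by
  rw [sub_eq_add_neg, sub_eq_add_neg]
  exact hf.add hg.neg

namespace IsTame

variable (h : IsTame v θ)
include h

lemma map_algebraMap_le (c : k) : v (algebraMap k F c) ≤ 1 := by
  by_cases hc : c = 0
  · simp [hc]
  · exact (h.const c hc).le

lemma le_one (hf : HasRes v f c) : v f ≤ 1 := by
  have : f = (f - algebraMap k F c) + algebraMap k F c := by ring
  rw [this]
  exact v.map_add_le hf.le (h.map_algebraMap_le c)

lemma hasRes_mul (hf : HasRes v f c) (hg : HasRes v g d) : HasRes v (f * g) (c * d) := by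
  have h1 := h.le_one hg
  have e : f * g - algebraMap k F (c * d) =
      (f - algebraMap k F c) * g + algebraMap k F c * (g - algebraMap k F d) := by
    rw [map_mul]; ring
  unfold HasRes at *
  rw [e]
  refine v.map_add_lt ?_ ?_
  · rw [map_mul]
    exact (mul_le_of_le_one_right' h1).trans_lt hf
  · rw [map_mul]
    exact (mul_le_of_le_one_left' (h.map_algebraMap_le c)).trans_lt hg

lemma hasRes_pow (hf : HasRes v f c) (n : ℕ) : HasRes v (f ^ n) (c ^ n) := by
  induction n with
  | zero => simpa using hasRes_one
  | succ n ih => rw [pow_succ, pow_succ]; exact h.hasRes_mul ih hf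

lemma eq_one (hf : HasRes v f c) (hc : c ≠ 0) : v f = 1 := by
  have : f = algebraMap k F c + (f - algebraMap k F c) := by ring
  rw [this, v.map_add_eq_of_lt_left, h.const c hc]
  rw [h.const c hc]
  exact hf

lemma hasRes_unique (hf : HasRes v f c) (hg : HasRes v f d) : c = d := by
  by_contra hne
  have h1 := hf.sub hg
  have h2 := h.eq_one h1 (sub_ne_zero.2 hne)
  simp at h2

lemma hasRes_inv (hf : HasRes v f c) (hc : c ≠ 0) : HasRes v f⁻¹ c⁻¹ := by
  have h1 := h.eq_one hf hc
  have hf0 : f ≠ 0 := by rintro rfl; simp at h1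
  have hc0 : algebraMap k F c ≠ 0 := by simpa using hc
  have e : f⁻¹ - algebraMap k F c⁻¹ = (-(f - algebraMap k F c)) / (f * algebraMap k F c) := by
    rw [map_inv₀]; field_simp; ring
  unfold HasRes at *
  rw [e, map_div₀, map_mul, h1, h.const c hc, Valuation.map_neg]
  simpa using hf

lemma hasRes_div (hf : HasRes v f c) (hg : HasRes v g d) (hd : d ≠ 0) :
    HasRes v (f / g) (c / d) := by
  rw [div_eq_mul_inv, div_eq_mul_inv]
  exact h.hasRes_mul hf (h.hasRes_inv hg hd)

lemma hasRes_deriv (hf : v f ≤ 1) : HasRes v (θ f) (0 : k) := hasRes_zero_iff.2 (h.small f hf)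

lemma hasRes_logDeriv (hf : f ≠ 0) : HasRes v (θ f / f) (-(log (v f)) : k) := by
  have := h.ord f hf
  unfold HasRes
  simpa using this

end IsTame

end Residues

section LocalParameter

variable {k F : Type*} [Field k] [Field F] [Algebra k F]

/-- Local data at the place `v` of the connection attached to `x`: a parameter `s`, the order `n`
of `s`, twelve times the exponents `a₁, a₂`, and the normalised order `ω` of `x⁴(x-1)³`. -/
structure LocalData (k : Type*) [Field k] [Algebra k F] (v : Valuation F ℤᵐ⁰)
    (x s : F) (n a₁ a₂ ω : ℤ) : Prop where
  ne_zero : s ≠ 0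
  der : ∀ E : Derivation k F F, E s = E x
  n_ne : n ≠ 0
  log_s : log (v s) = -n
  res : ∃ c : k, 144 * c = a₁ * a₂ ∧ HasRes v (s ^ 2 * schQ x) c
  log_w : log (v (x ^ 4 * (x - 1) ^ 3)) = -(ω * n)
  pole : 1 < v x ↔ n < 0
  sum : a₁ + a₂ = 12
  pos₁ : 0 ≤ n * (a₁ - ω)
  pos₂ : 0 ≤ n * (a₂ - ω)
  neg₁ : n < 0 → 0 < n * (a₁ - ω)
  neg₂ : n < 0 → 0 < n * (a₂ - ω)

lemma IsTame.exists_localData [CharZero k] {v : Valuation F ℤᵐ⁰} {θ : Derivation k F F}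
    (h : IsTame v θ) {x : F} (hx : Transcendental k x) :
    ∃ (s : F) (n a₁ a₂ ω : ℤ), LocalData k v x s n a₁ a₂ ω := by
  have hF : CharZero F := charZero_of_injective_algebraMap (algebraMap k F).injective
  have hne : ∀ c : k, x - algebraMap k F c ≠ 0 := by
    intro c h0
    exact hx ((sub_eq_zero.1 h0) ▸ isAlgebraic_algebraMap c)
  have hx0 : x ≠ 0 := by simpa using hne 0
  have hx1 : x - 1 ≠ 0 := by simpa using hne 1
  rcases le_or_gt (v x) 1 with hv | hv
  · obtain ⟨a, ha⟩ := h.res x hv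
    have hra : HasRes v x a := ha
    set s := x - algebraMap k F a with hs
    have hs0 : s ≠ 0 := hne a
    have hlog : log (v s) < 0 := by
      rw [← log_one, log_lt_log ((v.ne_zero_iff).2 hs0) one_ne_zero]
      exact ha
    have hder : ∀ E : Derivation k F F, E s = E x := by
      intro E
      rw [hs, map_sub, Derivation.map_algebraMap, sub_zero]
    have hnum : HasRes v (36 * x ^ 2 - 41 * x + 32) (36 * a ^ 2 - 41 * a + 32) :=
      ((h.hasRes_mul (hasRes_ofNat 36) (h.hasRes_pow hra 2)).sub
        (h.hasRes_mul (hasRes_ofNat 41) hra)).add (hasRes_ofNat 32)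
    have hra1 : HasRes v (x - 1) (a - 1) := hra.sub hasRes_one
    have hpole : 1 < v x ↔ -log (v s) < 0 := by
      constructor
      · intro h1; exact absurd hv (not_le.2 h1)
      · intro h1; omega
    by_cases ha0 : a = 0
    · have hsx : s = x := by rw [hs, ha0]; simp
      refine ⟨s, -log (v s), 4, 8, 4, hs0, hder, by omega, by ring, ⟨32 / 144, by push_cast; norm_num, ?_⟩,
        ?_, hpole, by norm_num, by norm_num, ?_, by omega, by omega⟩
      · have e : s ^ 2 * schQ x = (36 * x ^ 2 - 41 * x + 32) / (144 * (x - 1) ^ 2) := by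
          rw [hsx, schQ]; field_simp
        rw [e]
        have := h.hasRes_div hnum (h.hasRes_mul (hasRes_ofNat 144) (h.hasRes_pow hra1 2))
          (by rw [ha0]; norm_num)
        rw [ha0] at this
        convert this using 1
        norm_num
      · have h1 : v (x - 1) = 1 := h.eq_one hra1 (by rw [ha0]; norm_num)
        rw [map_mul, map_pow, map_pow, h1, hsx]
        simp [log_pow]
      · nlinarith
    by_cases ha1 : a = 1
    · have hsx : s = x - 1 := by rw [hs, ha1]; simp
      refine ⟨s, -log (v s), 3, 9, 3, hs0, hder, by omega, by ring, ⟨27 / 144, by push_cast; norm_num, ?_⟩,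
        ?_, hpole, by norm_num, by norm_num, ?_, by omega, by omega⟩
      · have e : s ^ 2 * schQ x = (36 * x ^ 2 - 41 * x + 32) / (144 * x ^ 2) := by
          rw [hsx, schQ]; field_simp
        rw [e]
        have := h.hasRes_div hnum (h.hasRes_mul (hasRes_ofNat 144) (h.hasRes_pow hra 2))
          (by rw [ha1]; norm_num)
        rw [ha1] at this
        convert this using 1
        norm_num
      · have h1 : v x = 1 := h.eq_one hra ha0
        rw [map_mul, map_pow, map_pow, h1, ← hsx]
        simp [log_pow]
      · nlinarith
    · have ha1' : a - 1 ≠ 0 := sub_ne_zero.2 ha1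
      refine ⟨s, -log (v s), 0, 12, 0, hs0, hder, by omega, by ring, ⟨0, by simp, ?_⟩,
        ?_, hpole, by norm_num, by norm_num, ?_, by omega, by omega⟩
      · have h1 : HasRes v (schQ x) _ := h.hasRes_div hnum (h.hasRes_mul (h.hasRes_mul (hasRes_ofNat 144)
          (h.hasRes_pow hra 2)) (h.hasRes_pow hra1 2))
          (mul_ne_zero (mul_ne_zero (by norm_num) (pow_ne_zero 2 ha0)) (pow_ne_zero 2 ha1'))
        have h2 := h.hasRes_mul (h.hasRes_pow (hasRes_zero_iff (k := k).2 ha) 2) h1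
        simpa using h2
      · rw [map_mul, map_pow, map_pow, h.eq_one hra ha0, h.eq_one hra1 ha1']
        simp
      · nlinarith
  · have hlog : 0 < log (v x) := by
      rw [← log_one, log_lt_log one_ne_zero ((v.ne_zero_iff).2 hx0)]
      exact hv
    have hy : HasRes v x⁻¹ (0 : k) := by
      rw [hasRes_zero_iff, map_inv₀]
      exact inv_lt_one_of_one_lt₀ hv
    refine ⟨x, -log (v x), 6, 6, 7, hx0, fun _ => rfl, by omega, by ring, ⟨36 / 144, by push_cast; norm_num, ?_⟩,
        ?_, ?_, by norm_num, ?_, ?_, ?_, ?_⟩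
    · have e : x ^ 2 * schQ x = (36 - 41 * x⁻¹ + 32 * x⁻¹ ^ 2) / (144 * (1 - x⁻¹) ^ 2) := by
        have : (1 - x⁻¹) ≠ 0 := by
          rw [sub_ne_zero]
          intro h1
          have : x = 1 := by rw [← inv_inv x, ← h1, inv_one]
          exact hx1 (by rw [this, sub_self])
        have e2 : 1 - x⁻¹ = (x - 1) / x := by field_simp
        rw [schQ, e2]; field_simp
      rw [e]
      have := h.hasRes_div (((hasRes_ofNat (v := v) (k := k) 36).sub
        (h.hasRes_mul (hasRes_ofNat 41) hy)).add (h.hasRes_mul (hasRes_ofNat 32) (h.hasRes_pow hy 2)))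
        (h.hasRes_mul (hasRes_ofNat 144) (h.hasRes_pow (hasRes_one.sub hy) 2)) (by norm_num)
      convert this using 1
      norm_num
    · have h1 : v (x - 1) = v x := v.map_sub_eq_of_lt_left (by simpa using hv)
      rw [map_mul, map_pow, map_pow, h1, ← pow_add, log_pow]
      simp
    · constructor
      · intro _; omega
      · intro _; exact hv
    all_goals norm_num <;> omega

end LocalParameter

end

section

open WithZero IntermediateField

section Liouville

variable {k F : Type*} [Field k] [Field F] [Algebra k F]

/-- The Riccati equation of the uniformising equation of `J`, along the derivation `E`. -/
def RiccatiSol {R : Type*} [CommRing R] [Algebra R F] (x u : F) (E : Derivation R F F) : Prop :=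
  E u = -(E x * (schQ x + u ^ 2))

variable {v : Valuation F ℤᵐ⁰} {θ : Derivation k F F}

lemma le_one_of_log_nonpos {f : F} (h : f ≠ 0 → log (v f) ≤ 0) : v f ≤ 1 := by
  by_cases hf : f = 0
  · simp [hf]
  · rw [← log_le_log ((v.ne_zero_iff).2 hf) one_ne_zero, log_one]
    exact h hf

lemma lt_one_of_log_neg {f : F} (h : f ≠ 0 → log (v f) < 0) : v f < 1 := by
  by_cases hf : f = 0
  · simp [hf]
  · rw [← log_lt_log ((v.ne_zero_iff).2 hf) one_ne_zero, log_one]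
    exact h hf

lemma LocalData.hasRes_logDeriv {x s : F} {n a₁ a₂ ω : ℤ} (D : LocalData k v x s n a₁ a₂ ω)
    (h : IsTame v θ) : HasRes v (θ s / s) (n : k) := by
  simpa [D.log_s] using h.hasRes_logDeriv D.ne_zero

lemma LocalData.hasRes_riccati [CharZero k] {x s : F} {n a₁ a₂ ω : ℤ}
    (D : LocalData k v x s n a₁ a₂ ω) (h : IsTame v θ) {u : F} (hu : RiccatiSol x u θ) :
    ∃ (b : ℤ) (c : k), (b = a₁ ∨ b = a₂) ∧ 12 * c = b ∧ HasRes v (s * u) c := by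
  obtain ⟨q0, hq0, hq⟩ := D.res
  have hκ := D.hasRes_logDeriv h
  have hs := D.ne_zero
  have hn : (n : k) ≠ 0 := by exact_mod_cast D.n_ne
  set κ := θ s / s with hκd
  have hx : θ x = κ * s := by rw [hκd, ← D.der]; field_simp
  have hU : θ (s * u) = κ * (s * u - s ^ 2 * schQ x - (s * u) ^ 2) := by
    rw [Derivation.leibniz, smul_eq_mul, smul_eq_mul, hu, D.der, hx]; ring
  set U := s * u
  have hle : v U ≤ 1 := by
    by_contra hgt
    rw [not_le] at hgt
    have hU0 : U ≠ 0 := by rintro h0; simp [h0] at hgt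
    have hy : HasRes v U⁻¹ (0 : k) := by
      rw [hasRes_zero_iff, map_inv₀]
      exact inv_lt_one_of_one_lt₀ hgt
    have h1 : θ U⁻¹ = -κ * (U⁻¹ - s ^ 2 * schQ x * U⁻¹ ^ 2 - 1) := by
      rw [Derivation.leibniz_inv, hU, smul_eq_mul]; field_simp
    have h2 := h.hasRes_deriv (h.le_one hy)
    rw [h1] at h2
    have h3 := h.hasRes_mul hκ.neg ((hy.sub (h.hasRes_mul hq (h.hasRes_pow hy 2))).sub hasRes_one)
    have h4 := h.hasRes_unique h2 h3
    exact hn (by linear_combination -h4)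
  obtain ⟨c, hc⟩ := h.res U hle
  have hc : HasRes v U c := hc
  have h2 := h.hasRes_deriv hle
  rw [hU] at h2
  have h3 := h.hasRes_unique h2 (h.hasRes_mul hκ ((hc.sub hq).sub (h.hasRes_pow hc 2)))
  have h4 : c - q0 - c ^ 2 = 0 := (mul_eq_zero.1 h3.symm).resolve_left hn
  have hsum : (a₁ + a₂ : k) = 12 := by exact_mod_cast D.sum
  have h5 : (12 * c - a₁) * (12 * c - a₂) = 0 := by
    linear_combination -144 * h4 - hq0 - 12 * c * hsum
  rcases mul_eq_zero.1 h5 with h5 | h5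
  · exact ⟨a₁, c, Or.inl rfl, by linear_combination h5, hc⟩
  · exact ⟨a₂, c, Or.inr rfl, by linear_combination h5, hc⟩

lemma LocalData.pos {x s : F} {n a₁ a₂ ω : ℤ} (D : LocalData k v x s n a₁ a₂ ω) {b : ℤ}
    (hb : b = a₁ ∨ b = a₂) : 0 ≤ n * (b - ω) ∧ (1 < v x → 0 < n * (b - ω)) := by
  rcases hb with rfl | rfl
  · exact ⟨D.pos₁, fun hx => D.neg₁ (D.pole.1 hx)⟩
  · exact ⟨D.pos₂, fun hx => D.neg₂ (D.pole.1 hx)⟩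

lemma weight_ne_zero {x : F} (hx : Transcendental k x) : x ^ 4 * (x - 1) ^ 3 ≠ 0 := by
  refine mul_ne_zero (pow_ne_zero 4 ?_) (pow_ne_zero 3 ?_)
  · rintro rfl; exact hx isAlgebraic_zero
  · intro h
    exact hx ((sub_eq_zero.1 h) ▸ isAlgebraic_one)

/-- Over a finite extension of `k(x)` the Riccati equation has at most one solution. -/
lemma riccati_unique [IsAlgClosed k] [CharZero k] {x : F} (hx : Transcendental k x)
    [FiniteDimensional k⟮x⟯ F] {u₁ u₂ : F} (h₁ : ∀ E : Derivation k F F, RiccatiSol x u₁ E)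
    (h₂ : ∀ E : Derivation k F F, RiccatiSol x u₂ E) : u₁ = u₂ := by
  obtain ⟨P, hP, hL⟩ := exists_places hx
  by_contra hne
  have hsub : u₁ - u₂ ≠ 0 := sub_ne_zero.2 hne
  have hw := weight_ne_zero hx
  set f := (u₁ - u₂)⁻¹ with hf
  have hf0 : f ≠ 0 := inv_ne_zero hsub
  set g := f ^ 12 / (x ^ 4 * (x - 1) ^ 3) ^ 2 with hg
  have hg0 : g ≠ 0 := div_ne_zero (pow_ne_zero _ hf0) (pow_ne_zero _ hw)
  have key : ∀ v ∈ P, ∃ e : ℤ, log (v g) = -e ∧ 0 ≤ e ∧ (1 < v x → 0 < e) := by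
    intro v hv
    obtain ⟨θ, hθ⟩ := hP v hv
    obtain ⟨s, n, a₁, a₂, ω, D⟩ := hθ.exists_localData hx
    obtain ⟨b₁, c₁, hb₁, hc₁, hr₁⟩ := D.hasRes_riccati hθ (h₁ θ)
    obtain ⟨b₂, c₂, hb₂, hc₂, hr₂⟩ := D.hasRes_riccati hθ (h₂ θ)
    have hs := D.ne_zero
    have e1 : θ f / f = θ s / s * (s * u₁ + s * u₂) := by
      have e2 : θ u₁ = -(θ x * (schQ x + u₁ ^ 2)) := h₁ θ
      have e3 : θ u₂ = -(θ x * (schQ x + u₂ ^ 2)) := h₂ θ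
      rw [hf, Derivation.leibniz_inv, smul_eq_mul, map_sub, e2, e3, D.der]
      field_simp
      ring
    have e2 := hθ.hasRes_logDeriv hf0
    rw [e1] at e2
    have e3 := hθ.hasRes_unique e2 (hθ.hasRes_mul (D.hasRes_logDeriv hθ) (hr₁.add hr₂))
    have e4 : 12 * log (v f) = -(n * (b₁ + b₂)) := by
      have : (12 * log (v f) : k) = -(n * (b₁ + b₂)) := by
        rw [← hc₁, ← hc₂]; linear_combination -12 * e3
      exact_mod_cast this
    refine ⟨n * (b₁ - ω) + n * (b₂ - ω), ?_, ?_, fun h => ?_⟩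
    · rw [hg, map_div₀, map_pow, map_pow, log_div (by simpa using hf0) (by simpa using hw), log_pow,
        log_pow, D.log_w]
      simp only [nsmul_eq_mul]
      push_cast
      linear_combination e4
    · exact add_nonneg (D.pos hb₁).1 (D.pos hb₂).1
    · exact add_pos ((D.pos hb₁).2 h) ((D.pos hb₂).2 h)
  refine hg0 (hL g (fun v hv => ?_) fun v hv h => ?_)
  · obtain ⟨e, h1, h2, -⟩ := key v hv
    exact le_one_of_log_nonpos fun _ => by omega
  · obtain ⟨e, h1, -, h3⟩ := key v hv
    have := h3 h
    exact lt_one_of_log_neg fun _ => by omega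

/-- If `T ↦ n' M' T - n T M` has the eigenvalue `N`, where `M` and `M'` satisfy split quadratic
equations, then `N` is a difference of eigenvalues. -/
lemma sylvester_eigenvalue {A : Type*} [Ring A] [Algebra k A] {M M' T : A} {n n' N r₁ r₂ r₁' r₂' : k}
    (hM : (M - algebraMap k A r₁) * (M - algebraMap k A r₂) = 0)
    (hM' : (M' - algebraMap k A r₁') * (M' - algebraMap k A r₂') = 0) (hT : T ≠ 0)
    (h : N • T = n' • (M' * T) - n • (T * M)) :
    ∃ r r', (r = r₁ ∨ r = r₂) ∧ (r' = r₁' ∨ r' = r₂') ∧ N = n' * r' - n * r := by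
  have left : ∃ r', (r' = r₁' ∨ r' = r₂') ∧ ∃ Z : A, Z ≠ 0 ∧
      N • Z = n' • (M' * Z) - n • (Z * M) ∧ M' * Z = r' • Z := by
    by_cases hZ : (M' - algebraMap k A r₂') * T = 0
    · refine ⟨r₂', Or.inr rfl, T, hT, h, ?_⟩
      rw [sub_mul, sub_eq_zero] at hZ
      rw [hZ, Algebra.smul_def]
    · refine ⟨r₁', Or.inl rfl, _, hZ, ?_, ?_⟩
      · have := congrArg ((M' - algebraMap k A r₂') * ·) h
        simp only [mul_smul_comm, mul_sub] at this
        rw [this, ← mul_assoc, ← mul_assoc, ← mul_assoc]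
        congr 3
        rw [sub_mul, mul_sub, Algebra.commutes]
      · have : (M' - algebraMap k A r₁') * ((M' - algebraMap k A r₂') * T) = 0 := by
          rw [← mul_assoc, hM', zero_mul]
        rw [sub_mul, sub_eq_zero] at this
        rw [this, Algebra.smul_def]
  obtain ⟨r', hr', Z, hZ0, hZ, hZ'⟩ := left
  rw [hZ'] at hZ
  by_cases hW : Z * (M - algebraMap k A r₁) = 0
  · refine ⟨r₁, r', Or.inl rfl, hr', ?_⟩
    rw [mul_sub, sub_eq_zero, ← Algebra.commutes, ← Algebra.smul_def] at hW
    rw [hW, smul_smul, smul_smul, ← sub_smul] at hZ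
    exact smul_left_injective k hZ0 hZ
  · refine ⟨r₂, r', Or.inr rfl, hr', ?_⟩
    set W := Z * (M - algebraMap k A r₁) with hWd
    have h1 : W * M = r₂ • W := by
      have : W * (M - algebraMap k A r₂) = 0 := by rw [hWd, mul_assoc, hM, mul_zero]
      rwa [mul_sub, sub_eq_zero, ← Algebra.commutes, ← Algebra.smul_def] at this
    have h2 : N • W = n' • r' • W - n • (W * M) := by
      have := congrArg (· * (M - algebraMap k A r₁)) hZ
      simp only [smul_mul_assoc, sub_mul] at this
      rw [hWd, this, mul_assoc, mul_assoc]
      congr 3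
      rw [sub_mul, mul_sub, Algebra.commutes]
    rw [h1, smul_smul, smul_smul, ← sub_smul] at h2
    exact smul_left_injective k hW h2

end Liouville

end

section

open WithZero IntermediateField

section HorizontalMaps

variable {k F : Type*} [Field k] [Field F] [Algebra k F]

lemma companion_mul [CharZero k] {a₁ a₂ : ℤ} {q : k} (hs : a₁ + a₂ = 12) (hq : 144 * q = a₁ * a₂) :
    (!![0, 1; -q, 1] - algebraMap k (Matrix (Fin 2) (Fin 2) k) (a₁ / 12)) *
      (!![0, 1; -q, 1] - algebraMap k (Matrix (Fin 2) (Fin 2) k) (a₂ / 12)) = 0 := by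
  have h2 : (a₁ : k) + a₂ = 12 := by exact_mod_cast hs
  ext i j
  fin_cases i <;> fin_cases j <;>
    simp [Matrix.mul_apply, Fin.sum_univ_two, Matrix.algebraMap_matrix_apply, Matrix.sub_apply]
  · linear_combination (-1 / 144 : k) * hq
  · linear_combination (-1 / 12 : k) * h2
  · linear_combination (q / 12 : k) * h2
  · linear_combination (-1 / 144 : k) * hq - (1 / 12 : k) * h2

variable {v : Valuation F ℤᵐ⁰} {θ : Derivation k F F}

/-- Lower bound for the order of the upper right entry of a horizontal map at a place. -/
lemma MapHorizontal.log_le [CharZero k] (h : IsTame v θ) {x s X S : F} {n a₁ a₂ ω n' a₁' a₂' ω' : ℤ}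
    (D : LocalData k v x s n a₁ a₂ ω) (D' : LocalData k v X S n' a₁' a₂' ω') {a b c d : F}
    (hT : MapHorizontal x X a b c d θ) (hb : b ≠ 0) :
    ∃ e e' : ℤ, (e = a₁ ∨ e = a₂) ∧ (e' = a₁' ∨ e' = a₂') ∧
      12 * log (v b) ≤ -(n' * e' + n * e) := by
  obtain ⟨q0, hq0, hq⟩ := D.res
  obtain ⟨q0', hq0', hq'⟩ := D'.res
  have hκ := D.hasRes_logDeriv h
  have hκ' := D'.hasRes_logDeriv h
  have hs := D.ne_zero
  have hS := D'.ne_zero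
  set κ := θ s / s with hκd
  set κ' := θ S / S with hκd'
  have hx : θ x = κ * s := by rw [hκd, ← D.der]; field_simp
  have hX : θ X = κ' * S := by rw [hκd', ← D'.der]; field_simp
  have hsd : θ s = κ * s := by rw [D.der, hx]
  have hSd : θ S = κ' * S := by rw [D'.der, hX]
  obtain ⟨ha', hb', hc', hd'⟩ := hT
  rw [hx, hX] at ha' hc'
  rw [hx, hX] at hb' hd'
  obtain ⟨A, hA⟩ : ∃ A, A = a := ⟨_, rfl⟩
  obtain ⟨B, hB⟩ : ∃ B, B = b / s := ⟨_, rfl⟩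
  obtain ⟨C, hC⟩ : ∃ C, C = S * c := ⟨_, rfl⟩
  obtain ⟨E, hE⟩ : ∃ E, E = S * d / s := ⟨_, rfl⟩
  have dA : θ A = κ' * C + κ * (s ^ 2 * schQ x) * B := by
    rw [hA, hB, hC, ha']; field_simp
  have dB : θ B = κ' * E - κ * A - κ * B := by
    rw [hA, hB, hE, Derivation.leibniz_div, hb', hsd, smul_eq_mul, smul_eq_mul, smul_eq_mul]
    field_simp
  have dC : θ C = -(κ' * (S ^ 2 * schQ X) * A) + κ * (s ^ 2 * schQ x) * E + κ' * C := by
    rw [hA, hC, hE, Derivation.leibniz, hc', hSd, smul_eq_mul, smul_eq_mul]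
    field_simp
  have dE : θ E = -(κ' * (S ^ 2 * schQ X) * B) - κ * C + (κ' - κ) * E := by
    rw [hB, hC, hE, Derivation.leibniz_div, Derivation.leibniz, hd', hSd, hsd, smul_eq_mul,
      smul_eq_mul, smul_eq_mul, smul_eq_mul, smul_eq_mul]
    field_simp
    ring
  have hB0 : B ≠ 0 := by rw [hB]; exact div_ne_zero hb hs
  obtain ⟨i0, hi0⟩ := Finite.exists_max fun i : Fin 4 => v (![A, B, C, E] i)
  set e0 := ![A, B, C, E] i0 with he0
  have mA : v A ≤ v e0 := hi0 0
  have mB : v B ≤ v e0 := hi0 1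
  have mC : v C ≤ v e0 := hi0 2
  have mE : v E ≤ v e0 := hi0 3
  have he0' : e0 ≠ 0 := by
    intro h0
    rw [h0, map_zero, le_zero_iff, v.zero_iff] at mB
    exact hB0 mB
  have hve : 0 < v e0 := zero_lt_iff.2 ((v.ne_zero_iff).2 he0')
  have nrm : ∀ {f : F}, v f ≤ v e0 → v (f / e0) ≤ 1 := by
    intro f hf
    rw [map_div₀]
    exact div_le_one_of_le₀ hf hve.le
  have hN := h.hasRes_logDeriv he0'
  have der : ∀ {f g : F} {r p : k}, v f ≤ v e0 → HasRes v (f / e0) r → θ f / e0 = g →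
      HasRes v g p → -(log (v e0)) * r = p := by
    intro f g r p hf hr hg hp
    have h1 : θ (f / e0) = g - f / e0 * (θ e0 / e0) := by
      rw [Derivation.leibniz_div, ← hg, smul_eq_mul, smul_eq_mul, smul_eq_mul]
      field_simp
    have h2 := h.hasRes_deriv (nrm hf)
    rw [h1] at h2
    have h3 := h.hasRes_unique h2 (hp.sub (h.hasRes_mul hr hN))
    linear_combination h3
  obtain ⟨α, hα⟩ := h.res _ (nrm mA)
  obtain ⟨β, hβ⟩ := h.res _ (nrm mB)
  obtain ⟨γ, hγ⟩ := h.res _ (nrm mC)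
  obtain ⟨δ, hδ⟩ := h.res _ (nrm mE)
  change HasRes v _ _ at hα hβ hγ hδ
  have eA := der (g := κ' * (C / e0) + κ * (s ^ 2 * schQ x) * (B / e0)) mA hα
    (by rw [dA]; ring) ((h.hasRes_mul hκ' hγ).add (h.hasRes_mul (h.hasRes_mul hκ hq) hβ))
  have eB := der (g := κ' * (E / e0) - κ * (A / e0) - κ * (B / e0)) mB hβ
    (by rw [dB]; ring) (((h.hasRes_mul hκ' hδ).sub (h.hasRes_mul hκ hα)).sub (h.hasRes_mul hκ hβ))
  have eC := der (g := -(κ' * (S ^ 2 * schQ X) * (A / e0)) + κ * (s ^ 2 * schQ x) * (E / e0)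
    + κ' * (C / e0)) mC hγ (by rw [dC]; ring)
    ((((h.hasRes_mul (h.hasRes_mul hκ' hq') hα).neg).add
      (h.hasRes_mul (h.hasRes_mul hκ hq) hδ)).add (h.hasRes_mul hκ' hγ))
  have eE := der (g := -(κ' * (S ^ 2 * schQ X) * (B / e0)) - κ * (C / e0) + (κ' - κ) * (E / e0))
    mE hδ (by rw [dE]; ring)
    ((((h.hasRes_mul (h.hasRes_mul hκ' hq') hβ).neg).sub
      (h.hasRes_mul hκ hγ)).add (h.hasRes_mul (hκ'.sub hκ) hδ))
  have hne : (!![α, β; γ, δ] : Matrix (Fin 2) (Fin 2) k) ≠ 0 := by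
    intro h0
    have z1 : α = 0 := by simpa using congrFun₂ h0 0 0
    have z2 : β = 0 := by simpa using congrFun₂ h0 0 1
    have z3 : γ = 0 := by simpa using congrFun₂ h0 1 0
    have z4 : δ = 0 := by simpa using congrFun₂ h0 1 1
    rw [z1] at hα; rw [z2] at hβ; rw [z3] at hγ; rw [z4] at hδ
    have : HasRes v (e0 / e0) (0 : k) := by
      have aux : ∀ i : Fin 4, HasRes v (![A, B, C, E] i / e0) (0 : k) := by
        intro i; fin_cases i
        exacts [hα, hβ, hγ, hδ]
      exact aux i0
    rw [div_self he0', hasRes_zero_iff, map_one] at this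
    exact lt_irrefl _ this
  obtain ⟨r, r', hr, hr', hNr⟩ := sylvester_eigenvalue (N := -((log (v e0) : ℤ) : k)) (n := (n : k))
    (n' := (n' : k)) (companion_mul D.sum hq0) (companion_mul D'.sum hq0') hne (by
      ext i j
      fin_cases i <;> fin_cases j <;>
        simp [Matrix.mul_apply, Fin.sum_univ_two]
      · linear_combination eA
      · linear_combination eB
      · linear_combination eC
      · linear_combination eE)
  have hr2 : ∃ e : ℤ, (e = a₁ ∨ e = a₂) ∧ r = (12 - e) / 12 := by
    have := D.sum
    rcases hr with rfl | rfl
    · refine ⟨a₂, Or.inr rfl, ?_⟩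
      rw [show a₁ = 12 - a₂ by omega]; push_cast; ring
    · refine ⟨a₁, Or.inl rfl, ?_⟩
      rw [show a₂ = 12 - a₁ by omega]; push_cast; ring
  have hr2' : ∃ e : ℤ, (e = a₁' ∨ e = a₂') ∧ r' = e / 12 := by
    rcases hr' with rfl | rfl
    exacts [⟨_, Or.inl rfl, rfl⟩, ⟨_, Or.inr rfl, rfl⟩]
  obtain ⟨e, he, rfl⟩ := hr2
  obtain ⟨e', he', rfl⟩ := hr2'
  refine ⟨e, e', he, he', ?_⟩
  have h1 : 12 * log (v e0) = -(n' * e') + n * (12 - e) := by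
    have : (12 * log (v e0) : k) = -(n' * e') + n * (12 - e) := by
      linear_combination -12 * hNr
    exact_mod_cast this
  have h2 : log (v b) ≤ log (v e0) - n := by
    have : b = B * s := by rw [hB]; field_simp
    rw [this, map_mul, log_mul (by simpa using hB0) (by simpa using hs), D.log_s]
    have := (log_le_log ((v.ne_zero_iff).2 hB0) hve.ne').2 mB
    omega
  linarith

/-- Over a common finite extension of `k(x)` and `k(X)`, a horizontal map is lower triangular. -/
lemma MapHorizontal.eq_zero [IsAlgClosed k] [CharZero k] {x X : F} (hx : Transcendental k x)
    (hX : Transcendental k X) [FiniteDimensional k⟮x⟯ F] {a b c d : F}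
    (hT : ∀ E : Derivation k F F, MapHorizontal x X a b c d E) : b = 0 := by
  obtain ⟨P, hP, hL⟩ := exists_places hx
  by_contra hb
  have hw := weight_ne_zero hx
  have hW := weight_ne_zero hX
  set g := b ^ 12 / ((x ^ 4 * (x - 1) ^ 3) * (X ^ 4 * (X - 1) ^ 3)) with hg
  have hg0 : g ≠ 0 := div_ne_zero (pow_ne_zero _ hb) (mul_ne_zero hw hW)
  have key : ∀ v ∈ P, ∃ e : ℤ, log (v g) ≤ -e ∧ 0 ≤ e ∧ (1 < v x → 0 < e) := by
    intro v hv
    obtain ⟨θ, hθ⟩ := hP v hv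
    obtain ⟨s, n, a₁, a₂, ω, D⟩ := hθ.exists_localData hx
    obtain ⟨S, n', a₁', a₂', ω', D'⟩ := hθ.exists_localData hX
    obtain ⟨e, e', he, he', hle⟩ := (hT θ).log_le hθ D D' hb
    refine ⟨n' * (e' - ω') + n * (e - ω), ?_, ?_, fun h => ?_⟩
    · rw [hg, map_div₀, map_pow, map_mul, log_div (by simpa using hb)
        (mul_ne_zero (by simpa using hw) (by simpa using hW)), log_mul (by simpa using hw)
        (by simpa using hW), log_pow, D.log_w, D'.log_w]
      simp only [nsmul_eq_mul]
      push_cast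
      linarith
    · exact add_nonneg (D'.pos he').1 (D.pos he).1
    · exact add_pos_of_nonneg_of_pos (D'.pos he').1 ((D.pos he).2 h)
  refine hg0 (hL g (fun v hv => ?_) fun v hv h => ?_)
  · obtain ⟨e, h1, h2, -⟩ := key v hv
    exact le_one_of_log_nonpos fun _ => by omega
  · obtain ⟨e, h1, -, h3⟩ := key v hv
    have := h3 h
    exact lt_one_of_log_neg fun _ => by omega

end HorizontalMaps

end

section

open IntermediateField Polynomial

section Descent

variable {k K : Type*} [Field k] [Field K] [Algebra k K]

lemma exists_derivation_tower [CharZero K] {L : Type*} [Field L] [Algebra k L] [Algebra L K]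
    [IsScalarTower k L K] (E : Derivation k L L) :
    ∃ E' : Derivation k K K, ∀ a, E' (algebraMap L K a) = algebraMap L K (E a) := by
  obtain ⟨s, hs⟩ := exists_isTranscendenceBasis L K
  obtain ⟨D, hD, -⟩ := exists_derivation_extension hs
    (((Algebra.linearMap L K).compDer (E.restrictScalars ℤ) : Derivation ℤ L K)) 0
  have hD : ∀ a, D (algebraMap L K a) = algebraMap L K (E a) := fun a => hD a
  refine ⟨Derivation.ofConst D fun c => ?_, hD⟩
  rw [IsScalarTower.algebraMap_apply k L K, hD, Derivation.map_algebraMap, map_zero]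

lemma algebraMap_schQ {L : Type*} [Field L] [Algebra L K] (x : L) :
    algebraMap L K (schQ x) = schQ (algebraMap L K x) := by
  have hn : ∀ (n : ℕ) [n.AtLeastTwo], algebraMap L K (OfNat.ofNat n) = OfNat.ofNat n :=
    fun n _ => map_ofNat (algebraMap L K) n
  simp [schQ, hn]

lemma RiccatiSol.descend [CharZero K] {L : Type*} [Field L] [Algebra k L] [Algebra L K]
    [IsScalarTower k L K] {x u : L}
    (h : ∀ E : Derivation k K K, RiccatiSol (algebraMap L K x) (algebraMap L K u) E)
    (E : Derivation k L L) : RiccatiSol x u E := by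
  obtain ⟨E', hE'⟩ := exists_derivation_tower (K := K) E
  have := h E'
  unfold RiccatiSol at *
  refine (algebraMap L K).injective ?_
  simpa [hE', algebraMap_schQ] using this

lemma MapHorizontal.descend [CharZero K] {L : Type*} [Field L] [Algebra k L] [Algebra L K]
    [IsScalarTower k L K] {x X a b c d : L}
    (h : ∀ E : Derivation k K K, MapHorizontal (algebraMap L K x) (algebraMap L K X)
      (algebraMap L K a) (algebraMap L K b) (algebraMap L K c) (algebraMap L K d) E)
    (E : Derivation k L L) : MapHorizontal x X a b c d E := by
  obtain ⟨E', hE'⟩ := exists_derivation_tower (K := K) E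
  obtain ⟨h1, h2, h3, h4⟩ := h E'
  constructor <;> refine (algebraMap L K).injective ?_
  · simpa [hE', algebraMap_schQ] using h1
  · simpa [hE', algebraMap_schQ] using h2
  · simpa [hE', algebraMap_schQ] using h3
  · simpa [hE', algebraMap_schQ] using h4

lemma isAlgebraic_adjoin_of_derivation [CharZero K] {x a : K}
    (h : ∀ E : Derivation k K K, E x = 0 → E a = 0) : IsAlgebraic k⟮x⟯ a := by
  refine isAlgebraic_of_forall_derivation fun D => ?_
  refine h (D.restrictScalars k) ?_
  exact D.map_algebraMap (⟨x, mem_adjoin_simple_self k x⟩ : k⟮x⟯)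

lemma adjoin_preimage_eq_top (S : Set K) :
    adjoin k ((↑) ⁻¹' S : Set (adjoin k S)) = ⊤ := by
  refine IntermediateField.map_injective (adjoin k S).val ?_
  rw [adjoin_map, ← AlgHom.fieldRange_eq_map, fieldRange_val]
  congr 1
  ext a
  constructor
  · rintro ⟨b, hb, rfl⟩; exact hb
  · intro ha; exact ⟨⟨a, subset_adjoin k S ha⟩, ha, rfl⟩

lemma finiteDimensional_of_adjoin_eq_top {x : K} {S : Set K} (hS : S.Finite) (htop : adjoin k S = ⊤)
    (h : ∀ a ∈ S, IsAlgebraic k⟮x⟯ a) : FiniteDimensional k⟮x⟯ K := by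
  have : Finite S := hS
  have h1 : FiniteDimensional k⟮x⟯ (adjoin k⟮x⟯ S) :=
    finiteDimensional_adjoin fun a ha => (h a ha).isIntegral
  have h2 : adjoin k⟮x⟯ S = ⊤ := by
    refine restrictScalars_injective k ?_
    rw [restrictScalars_top, eq_top_iff, ← htop, adjoin_le_iff]
    exact subset_adjoin k⟮x⟯ S
  rw [h2] at h1
  exact Module.Finite.equiv (topEquiv (F := k⟮x⟯) (E := K)).toLinearEquiv

/-- The field generated by finitely many elements, all algebraic over `k(x)` in the sense that
they are killed by all derivations killing `x`, is finite over `k(x)`. -/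
lemma finiteDimensional_adjoin_of_derivation [CharZero K] {S : Set K} (hS : S.Finite)
    (x : adjoin k S)
    (h : ∀ E : Derivation k (adjoin k S) (adjoin k S), E x = 0 → ∀ a : adjoin k S, (a : K) ∈ S → E a = 0) :
    FiniteDimensional k⟮x⟯ (adjoin k S) := by
  have : CharZero (adjoin k S) := (algebraMap (adjoin k S) K).charZero
  exact finiteDimensional_of_adjoin_eq_top (hS.preimage Subtype.val_injective.injOn)
    (adjoin_preimage_eq_top S)
    fun a ha => isAlgebraic_adjoin_of_derivation fun E hE => h E hE a ha

lemma transcendental_of_algebraMap {L : Type*} [Field L] [Algebra k L] [Algebra L K]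
    [IsScalarTower k L K] {x : L} (hx : Transcendental k (algebraMap L K x)) : Transcendental k x :=
  fun h => hx (h.algebraMap)

/-- Two solutions of the Riccati equation agree. -/
lemma riccati_unique' [IsAlgClosed k] [CharZero k] [CharZero K] {x : K} (hx : Transcendental k x)
    {u₁ u₂ : K} (h₁ : ∀ E : Derivation k K K, RiccatiSol x u₁ E)
    (h₂ : ∀ E : Derivation k K K, RiccatiSol x u₂ E) : u₁ = u₂ := by
  set S : Set K := {x, u₁, u₂}
  let x' : adjoin k S := ⟨x, subset_adjoin k S (by simp [S])⟩
  let v₁ : adjoin k S := ⟨u₁, subset_adjoin k S (by simp [S])⟩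
  let v₂ : adjoin k S := ⟨u₂, subset_adjoin k S (by simp [S])⟩
  have e₁ : ∀ E, RiccatiSol x' v₁ E := RiccatiSol.descend (K := K) h₁
  have e₂ : ∀ E, RiccatiSol x' v₂ E := RiccatiSol.descend (K := K) h₂
  have : FiniteDimensional k⟮x'⟯ (adjoin k S) := by
    refine finiteDimensional_adjoin_of_derivation (by simp [S]) x' fun E hE a ha => ?_
    have h1 := e₁ E
    have h2 := e₂ E
    unfold RiccatiSol at h1 h2
    rw [hE, zero_mul, neg_zero] at h1 h2
    rcases ha with ha | ha | ha
    · rwa [show a = x' from Subtype.ext ha]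
    · rwa [show a = v₁ from Subtype.ext ha]
    · rwa [show a = v₂ from Subtype.ext (Set.mem_singleton_iff.1 ha)]
  have hx' : Transcendental k x' := transcendental_of_algebraMap (K := K) hx
  exact congrArg Subtype.val (riccati_unique hx' e₁ e₂)

lemma exists_reduced_monic (r : k[X]) {s : k[X]} (hs : s ≠ 0) :
    ∃ p q : k[X], IsCoprime p q ∧ q.Monic ∧ r * q = p * s := by
  classical
  obtain ⟨a, ha⟩ := EuclideanDomain.gcd_dvd_left r s
  obtain ⟨b, hb⟩ := EuclideanDomain.gcd_dvd_right r s
  set g := EuclideanDomain.gcd r s with hg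
  have hg0 : g ≠ 0 := by
    intro h0
    rw [h0, zero_mul] at hb
    exact hs hb
  have hb0 : b ≠ 0 := by
    rintro rfl
    rw [mul_zero] at hb
    exact hs hb
  have hcop : IsCoprime a b := by
    have h2 := EuclideanDomain.gcd_eq_gcd_ab r s
    rw [← hg] at h2
    refine ⟨EuclideanDomain.gcdA r s, EuclideanDomain.gcdB r s, mul_left_cancel₀ hg0 ?_⟩
    linear_combination -h2 - EuclideanDomain.gcdA r s * ha - EuclideanDomain.gcdB r s * hb
  have hl : b.leadingCoeff ≠ 0 := leadingCoeff_ne_zero.2 hb0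
  have hu : IsUnit (C b.leadingCoeff⁻¹ : k[X]) := isUnit_C.2 (isUnit_iff_ne_zero.2 (inv_ne_zero hl))
  refine ⟨a * C b.leadingCoeff⁻¹, b * C b.leadingCoeff⁻¹, ?_,
    monic_mul_leadingCoeff_inv hb0, ?_⟩
  · exact (isCoprime_mul_unit_right_left hu _ _).2 ((isCoprime_mul_unit_right_right hu _ _).2 hcop)
  · linear_combination (C b.leadingCoeff⁻¹ * b) * ha - (C b.leadingCoeff⁻¹ * a) * hb

lemma not_riccati_adjoin [CharZero k] [CharZero K] {x u : K} (hx : Transcendental k x) (hu : u ∈ k⟮x⟯) :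
    ¬ ∀ E : Derivation k K K, RiccatiSol x u E := by
  intro h
  obtain ⟨r, s, hrs⟩ := mem_adjoin_simple_iff k u |>.1 hu
  have hinj : ∀ f : k[X], f ≠ 0 → aeval x f ≠ 0 := fun f hf h0 => hx ⟨f, hf, h0⟩
  obtain ⟨p, q, hpq, hq, hu'⟩ : ∃ p q : k[X], IsCoprime p q ∧ q.Monic ∧ u * aeval x q = aeval x p := by
    by_cases hs : s = 0
    · exact ⟨0, 1, isCoprime_one_right, monic_one, by simp [hrs, hs]⟩
    obtain ⟨p, q, hpq, hq, he⟩ := exists_reduced_monic r hs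
    refine ⟨p, q, hpq, hq, ?_⟩
    have := congrArg (aeval x) he
    rw [map_mul, map_mul] at this
    rw [hrs, div_mul_eq_mul_div, this, mul_div_cancel_right₀ _ (hinj s hs)]
  obtain ⟨E, hE⟩ := exists_derivation_ne_zero hx
  have hr := h E
  unfold RiccatiSol at hr
  rw [hE, one_mul] at hr
  have hd := congrArg E hu'
  rw [Derivation.leibniz, Derivation.map_aeval, Derivation.map_aeval, hE, hr, smul_eq_mul,
    smul_eq_mul, smul_eq_mul, smul_eq_mul, mul_one, mul_one] at hd
  have hQ := hinj q hq.ne_zero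
  have hX0 : x ≠ 0 := by simpa using hinj X X_ne_zero
  have hX1 : x - 1 ≠ 0 := by simpa using hinj (X - C 1) (X_sub_C_ne_zero 1)
  have hn : ∀ (n : ℕ) [n.AtLeastTwo], aeval x (OfNat.ofNat n : k[X]) = OfNat.ofNat n :=
    fun n _ => map_ofNat (aeval x) n
  refine hinj _ (not_rational_riccati hpq hq) ?_
  simp only [map_add, map_mul, map_sub, map_pow, hn, aeval_X, map_one]
  have hq' : schQ x * (144 * x ^ 2 * (x - 1) ^ 2) = 36 * x ^ 2 - 41 * x + 32 := by
    have : CharZero K := inferInstance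
    unfold schQ; field_simp
  generalize aeval x p = P at *
  generalize aeval x q = Q at *
  generalize aeval x (derivative p) = P' at *
  generalize aeval x (derivative q) = Q' at *
  rw [← hq', ← hu']
  linear_combination (-144 * x ^ 2 * (x - 1) ^ 2 * Q) * hd

lemma isGalois_algebraicClosure (L K : Type*) [Field L] [Field K] [Algebra L K] [CharZero L]
    [IsAlgClosed K] : IsGalois L (algebraicClosure L K) := by
  have : Normal L (algebraicClosure L K) := (algebraicClosure.isAlgClosure L K).normal
  have : Algebra.IsSeparable L (algebraicClosure L K) :=
    Algebra.IsAlgebraic.isSeparable_of_perfectField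
  exact IsGalois.mk

/-- The Riccati equation has no solution in any extension of `k(x)`. -/
lemma not_riccati [IsAlgClosed k] [CharZero k] [CharZero K] [IsAlgClosed K] {x u : K}
    (hx : Transcendental k x) : ¬ ∀ E : Derivation k K K, RiccatiSol x u E := by
  intro h
  let M := algebraicClosure k⟮x⟯ K
  have hu : IsAlgebraic k⟮x⟯ u := isAlgebraic_adjoin_of_derivation fun E hE => by
    have := h E
    unfold RiccatiSol at this
    rwa [hE, zero_mul, neg_zero] at this
  let x' : M := algebraMap k⟮x⟯ M ⟨x, mem_adjoin_simple_self k x⟩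
  let u' : M := ⟨u, mem_algebraicClosure_iff.2 hu⟩
  have : CharZero M := (algebraMap M K).charZero
  have : IsScalarTower k M K := IsScalarTower.of_algebraMap_eq fun _ => rfl
  have hM : ∀ E : Derivation k M M, RiccatiSol x' u' E := RiccatiSol.descend (K := K) h
  have hx' : Transcendental k x' := transcendental_of_algebraMap (K := K) hx
  have hfix : ∀ σ : M ≃ₐ[k⟮x⟯] M, σ u' = u' := by
    intro σ
    have hσx : σ x' = x' := σ.commutes _
    refine riccati_unique' hx' (fun E => ?_) hM
    let E' : Derivation k M M := Derivation.mk'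
      ((σ.symm.toLinearMap.restrictScalars k) ∘ₗ (E : M →ₗ[k] M) ∘ₗ (σ.toLinearMap.restrictScalars k))
      (fun a b => by simp)
    have hE' : ∀ a, E' a = σ.symm (E (σ a)) := fun a => rfl
    have h1 := hM E'
    unfold RiccatiSol at h1 ⊢
    rw [hE', hE', hσx] at h1
    have h2 := congrArg σ h1
    have h3 : σ (schQ x') = schQ x' := by
      have := algebraMap_schQ (K := M) (⟨x, mem_adjoin_simple_self k x⟩ : k⟮x⟯)
      change _ = schQ x' at this
      rw [← this]
      exact σ.commutes _
    simpa [h3] using h2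
  have : CharZero k⟮x⟯ := (algebraMap k⟮x⟯ K).charZero
  have : IsGalois k⟮x⟯ M := isGalois_algebraicClosure k⟮x⟯ K
  have hbot : u' ∈ (⊥ : IntermediateField k⟮x⟯ M) := (InfiniteGalois.mem_bot_iff_fixed u').2 hfix
  obtain ⟨y, hy⟩ := mem_bot.1 hbot
  have : (y : K) = u := congrArg Subtype.val hy
  exact not_riccati_adjoin hx (this ▸ y.2) h

/-- The connection attached to a nonconstant function has no stable line. -/
lemma no_line [IsAlgClosed k] [CharZero k] [CharZero K] [IsAlgClosed K] {x m₁ m₂ : K}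
    (hx : Transcendental k x) (h : ∀ E : Derivation k K K, LineHorizontal x m₁ m₂ E) :
    m₁ = 0 ∧ m₂ = 0 := by
  by_cases h1 : m₁ = 0
  · obtain ⟨E, hE⟩ := exists_derivation_ne_zero hx
    have := h E
    unfold LineHorizontal at this
    rw [h1, hE] at this
    exact ⟨h1, by simpa using this⟩
  · refine absurd (fun E => ?_) (not_riccati (u := m₂ / m₁) hx)
    have := h E
    unfold LineHorizontal at this
    unfold RiccatiSol
    rw [Derivation.leibniz_div, smul_eq_mul, smul_eq_mul, smul_eq_mul]
    field_simp
    linear_combination this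

end Descent

end

section

open IntermediateField

section AxCore

variable {K : Type*} [Field K] [CharZero K]

/-- The functions `x` and `X` are related by a triangular horizontal map, along all derivations of
the family `D`. -/
def SchRel {F τ : Type*} [Field F] (D : τ → Derivation ℤ F F) (x X : F) : Prop :=
  ∃ s p : F, s ≠ 0 ∧ ∀ i, D i X = s ^ 2 * D i x ∧ D i s = p * D i X ∧
    D i p = schQ x * D i x / s - s * schQ X * D i X

lemma SchRel.refl {F τ : Type*} [Field F] (D : τ → Derivation ℤ F F) (x : F) : SchRel D x x :=
  ⟨1, 0, one_ne_zero, fun i => ⟨by simp, by simp, by simp⟩⟩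

lemma SchRel.symm {F τ : Type*} [Field F] {D : τ → Derivation ℤ F F} {x X : F}
    (h : SchRel D x X) : SchRel D X x := by
  obtain ⟨s, p, hs, h⟩ := h
  refine ⟨s⁻¹, -p, inv_ne_zero hs, fun i => ?_⟩
  obtain ⟨h1, h2, h3⟩ := h i
  refine ⟨?_, ?_, ?_⟩
  · rw [h1]; field_simp
  · rw [Derivation.leibniz_inv, h2, h1, smul_eq_mul]; field_simp
  · rw [map_neg, h3, h1]; field_simp; ring

lemma SchRel.trans {F τ : Type*} [Field F] {D : τ → Derivation ℤ F F} {x y z : F}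
    (h : SchRel D x y) (h' : SchRel D y z) : SchRel D x z := by
  obtain ⟨s, p, hs, h⟩ := h
  obtain ⟨s', p', hs', h'⟩ := h'
  refine ⟨s' * s, p' * s + p / s', mul_ne_zero hs' hs, fun i => ?_⟩
  obtain ⟨h1, h2, h3⟩ := h i
  obtain ⟨h1', h2', h3'⟩ := h' i
  refine ⟨?_, ?_, ?_⟩
  · rw [h1', h1]; ring
  · rw [Derivation.leibniz, h2, h2', h1', h1, smul_eq_mul, smul_eq_mul]; field_simp; ring
  · rw [map_add, Derivation.leibniz, Derivation.leibniz_div, h3, h3', h2, h2', h1', h1]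
    simp only [smul_eq_mul]
    field_simp
    ring

/-- Given constants `c` of a differential extension `K` of `L`, not all zero, a relation
`∑ c_i v_i = 0` with `v_i ∈ L` forces a relation with constant coefficients in `L`. -/
lemma exists_constant_relation {L τ ι : Type*} [Field L] [Algebra L K] [Fintype ι]
    {C : Type*} [Field C] [Algebra C L] (D : τ → Derivation C L L)
    (hC : ∀ a, (∀ i, D i a = 0) → a ∈ Set.range (algebraMap C L))
    (D' : τ → Derivation ℤ K K) (hD : ∀ i a, D' i (algebraMap L K a) = algebraMap L K (D i a))
    {c : ι → K} (hc : ∀ i k, D' i (c k) = 0) (hc0 : c ≠ 0) {v : ι → L}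
    (hv : ∑ k, c k * algebraMap L K (v k) = 0) :
    ∃ γ : ι → C, γ ≠ 0 ∧ ∑ k, algebraMap C L (γ k) * v k = 0 := by
  classical
  let N : Submodule L (ι → L) :=
    { carrier := {a | ∑ k, c k * algebraMap L K (a k) = 0}
      add_mem' := fun {a b} ha hb => by
        simp only [Set.mem_setOf_eq, Pi.add_apply, map_add, mul_add, Finset.sum_add_distrib] at *
        rw [ha, hb, add_zero]
      zero_mem' := by simp
      smul_mem' := fun r a ha => by
        simp only [Set.mem_setOf_eq, Pi.smul_apply, smul_eq_mul, map_mul] at *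
        rw [← mul_zero (algebraMap L K r), ← ha, Finset.mul_sum]
        exact Finset.sum_congr rfl fun k _ => by ring }
  have hst : ∀ t, ∀ u ∈ N, (fun l => D t (u l)) ∈ N := by
    intro t u hu
    have h1 := congrArg (D' t) hu
    change ∑ k, c k * algebraMap L K (D t (u k)) = 0
    simpa [map_sum, Derivation.leibniz, hc, hD] using h1
  have hspan := stable_subspace_eq_span D N hst
  let N₀ : Submodule C (ι → C) :=
    { carrier := {a | (fun k => algebraMap C L (a k)) ∈ N}
      add_mem' := fun {a b} ha hb => by
        have := N.add_mem ha hb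
        simp only [Set.mem_setOf_eq, Pi.add_apply, map_add]
        exact this
      zero_mem' := by
        simp only [Set.mem_setOf_eq, Pi.zero_apply, map_zero]
        exact N.zero_mem
      smul_mem' := fun r a ha => by
        have := N.smul_mem (algebraMap C L r) ha
        simp only [Set.mem_setOf_eq, Pi.smul_apply, smul_eq_mul, map_mul]
        exact this }
  have hN₀ : N₀ < ⊤ := by
    refine lt_top_iff_ne_top.2 fun h => hc0 (funext fun k => ?_)
    have h1 : Pi.single k 1 ∈ N₀ := by rw [h]; trivial
    have h2 : ∑ l, c l * algebraMap L K (algebraMap C L ((Pi.single k 1 : ι → C) l)) = 0 := h1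
    rw [Finset.sum_eq_single k] at h2
    · simpa using h2
    · intro l _ hl; simp [hl]
    · simp
  obtain ⟨f, hf, hle⟩ := Submodule.exists_le_ker_of_lt_top N₀ hN₀
  have hfe : ∀ a : ι → C, f a = ∑ k, a k * f (Pi.single k 1) := by
    intro a
    conv_lhs => rw [LinearMap.pi_apply_eq_sum_univ f a]
    refine Finset.sum_congr rfl fun k _ => ?_
    rw [smul_eq_mul]
    congr 2
    ext l
    simp [Pi.single_apply, eq_comm]
  refine ⟨fun k => f (Pi.single k 1), fun h => hf ?_, ?_⟩
  · refine LinearMap.ext fun a => ?_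
    rw [hfe a]
    exact Finset.sum_eq_zero fun k _ => by rw [congrFun h k, Pi.zero_apply, mul_zero]
  · let P : Submodule L (ι → L) :=
      LinearMap.ker (∑ k, algebraMap C L (f (Pi.single k 1)) • LinearMap.proj (R := L) (φ := fun _ : ι => L) k)
    have hNP : N ≤ P := by
      rw [hspan]
      refine Submodule.span_le.2 fun u hu => ?_
      choose u' hu' using fun l => hC _ fun t => hu.2 t l
      have h1 := hle (show u' ∈ N₀ by
        change (fun k => algebraMap C L (u' k)) ∈ N
        rw [funext hu']
        exact hu.1)
      rw [LinearMap.mem_ker, hfe] at h1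
      have h2 := congrArg (algebraMap C L) h1
      simp only [map_sum, map_mul, hu', map_zero] at h2
      simp only [P, SetLike.mem_coe, LinearMap.mem_ker, LinearMap.sum_apply, LinearMap.smul_apply,
        LinearMap.proj_apply, smul_eq_mul]
      rw [← h2]
      exact Finset.sum_congr rfl fun k _ => mul_comm _ _
    have := hNP (show v ∈ N from hv)
    simpa only [P, LinearMap.mem_ker, LinearMap.sum_apply, LinearMap.smul_apply,
      LinearMap.proj_apply, smul_eq_mul] using this

end AxCore

end

section

open IntermediateField

section AxCore

variable {K : Type*} [Field K] [CharZero K]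

lemma gaugeForm_eq_zero_of {R : Type*} [CommRing R] [Algebra R K] {x y w z : K}
    {E : Derivation R K K} (hx : E x = 0) (hy : E y = 0) (hw : E w = 0) (hz : E z = 0) :
    gaugeForm x y w z E = 0 := by
  ext a; fin_cases a <;> simp [gaugeForm, hx, hy, hw, hz]

/-- If the functions `x` depend on few parameters, there are too few derivations for the gauge map
to be onto. -/
lemma gaugeMap_range_ne_top {R : Type*} [CommRing R] [Algebra R K] {r d t : ℕ} (x y w z : Fin d → K)
    (cl : Fin d → Fin t) (ζ : Fin t → K) (hz : ∀ k, z k = ζ (cl k)) (s : Finset (Fin d))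
    (hs : ∀ E : Derivation R K K, (∀ k ∈ s, E (x k) = 0) → ∀ k, E (x k) = 0)
    (D : Fin r → Derivation R K K) (hrow : LinearIndependent K fun i => fun k => D i (x k))
    (hD : ∀ i, gaugeMap x y w z (D i) = 0) (hn : s.card + t < d + r) :
    LinearMap.range (gaugeMap (R := R) x y w z) ≠ ⊤ := by
  intro htop
  let Φ : Derivation R K K →ₗ[K] ((s ⊕ Fin t) ⊕ (Fin d ⊕ Fin d) → K) :=
    { toFun := fun E => Sum.elim (Sum.elim (fun k => E (x k)) fun c => E (ζ c))
        (Sum.elim (fun k => E (y k)) fun k => E (w k))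
      map_add' := fun E E' => by ext ((_ | _) | (_ | _)) <;> simp
      map_smul' := fun c E => by ext ((_ | _) | (_ | _)) <;> simp }
  have hΦ : ∀ E, Φ E = 0 → (∀ k, E (x k) = 0) ∧ (∀ c, E (ζ c) = 0) ∧ (∀ k, E (y k) = 0) ∧
      ∀ k, E (w k) = 0 := by
    intro E hE
    exact ⟨hs E fun k hk => congrFun hE (Sum.inl (Sum.inl ⟨k, hk⟩)),
      fun c => congrFun hE (Sum.inl (Sum.inr c)), fun k => congrFun hE (Sum.inr (Sum.inl k)),
      fun k => congrFun hE (Sum.inr (Sum.inr k))⟩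
  have hker : LinearMap.ker Φ ≤ LinearMap.ker (gaugeMap (R := R) x y w z) := by
    intro E hE
    obtain ⟨h1, h2, h3, h4⟩ := hΦ E hE
    exact funext fun k => gaugeForm_eq_zero_of (h1 k) (h3 k) (h4 k) (by rw [hz]; exact h2 _)
  let V := Derivation R K K ⧸ LinearMap.ker Φ
  have : FiniteDimensional K V := Module.Finite.equiv Φ.quotKerEquivRange.symm
  have hV : Module.finrank K V ≤ s.card + t + (d + d) := by
    rw [Φ.quotKerEquivRange.finrank_eq]
    refine (Submodule.finrank_le _).trans ?_
    simp
  let g : V →ₗ[K] (Fin d → Fin 3 → K) := (LinearMap.ker Φ).liftQ _ hker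
  have hg : LinearMap.range g = ⊤ := by rw [Submodule.range_liftQ, htop]
  have hrank := LinearMap.finrank_range_add_finrank_ker g
  have hli : LinearIndependent K fun i : Fin r =>
      (⟨(LinearMap.ker Φ).mkQ (D i), by
        rw [LinearMap.mem_ker]; exact hD i⟩ : LinearMap.ker g) := by
    rw [Fintype.linearIndependent_iff] at hrow ⊢
    intro c hc
    refine hrow c ?_
    have h1 : (LinearMap.ker Φ).mkQ (∑ i, c i • D i) = 0 := by
      have := congrArg Subtype.val hc
      simpa using this
    rw [← LinearMap.mem_ker, Submodule.ker_mkQ, LinearMap.mem_ker] at h1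
    ext k
    have h2 := (hΦ _ h1).1 k
    have h3 : (∑ i, c i • D i) (x k) = ∑ i, c i * D i (x k) := by
      change Derivation.coeFnAddMonoidHom (∑ i, c i • D i) (x k) = _
      simp [map_sum]
    simpa [h3] using h2
  have hkr := hli.fintype_card_le_finrank
  rw [hg, finrank_top] at hrank
  simp only [Module.finrank_pi_fintype, Module.finrank_self, Fintype.card_fin, Finset.sum_const,
    Finset.card_univ, smul_eq_mul] at hrank hkr
  omega

lemma transcendental_of_ne_zero {C : Subfield K} (D : Derivation C K K) {x : K} (h : D x ≠ 0) :
    Transcendental C x :=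
  fun hx => h (derivation_eq_zero_of_isAlgebraic D hx)

variable [IsAlgClosed K]

/-- A horizontal map between two nonconstant functions forces them to be algebraically dependent
over the constants. -/
lemma MapHorizontal.dependent {C : Subfield K} {x X a b c d : K}
    (hdet : a * d - b * c = 1) (h : ∀ E : Derivation C K K, MapHorizontal x X a b c d E)
    (E : Derivation C K K) (hE : E x = 0) : E X = 0 := by
  by_contra hX
  let k₁ := algebraicClosure C⟮x⟯ K
  have h1 : ∀ y : C⟮x⟯, E (y : K) = 0 := by
    rintro ⟨y, hy⟩
    refine adjoin_induction C (p := fun y _ => E y = 0) ?_ ?_ ?_ ?_ ?_ hy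
    · rintro _ rfl; exact hE
    · intro y; exact E.map_algebraMap y
    · intro y z _ _ hy hz; rw [map_add, hy, hz, add_zero]
    · intro y _ hy; rw [Derivation.leibniz_inv, hy, smul_zero]
    · intro y z _ _ hy hz; simp [Derivation.leibniz, hy, hz]
  have : CharZero C⟮x⟯ := (algebraMap C⟮x⟯ K).charZero
  let E₁ : Derivation C⟮x⟯ K K := Derivation.ofConst (E.restrictScalars ℤ) h1
  have h2 : ∀ y : k₁, E (y : K) = 0 := fun y =>
    derivation_eq_zero_of_isAlgebraic E₁ (mem_algebraicClosure_iff.1 y.2)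
  have hk₁ : IsAlgClosed k₁ := (algebraicClosure.isAlgClosure C⟮x⟯ K).isAlgClosed
  have : CharZero k₁ := (algebraMap k₁ K).charZero
  let E₂ : Derivation k₁ K K := Derivation.ofConst (E.restrictScalars ℤ) h2
  have hXt : Transcendental k₁ X := fun hX' => hX (derivation_eq_zero_of_isAlgebraic E₂ hX')
  have hl : ∀ E' : Derivation k₁ K K, LineHorizontal X a c E' := by
    intro E'
    have hx : E' x = 0 := E'.map_algebraMap
      (⟨x, mem_algebraicClosure_iff.2 (isAlgebraic_algebraMap (⟨x, mem_adjoin_simple_self C x⟩ : C⟮x⟯))⟩ : k₁)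
    let E'' : Derivation C K K := Derivation.ofConst (E'.restrictScalars ℤ) fun y =>
      E'.map_algebraMap (⟨y, mem_algebraicClosure_iff.2 (isAlgebraic_algebraMap (algebraMap C C⟮x⟯ y))⟩ : k₁)
    obtain ⟨ha, hb, hc, hd⟩ := h E''
    change E' a = E' X * c + schQ x * E' x * b at ha
    change E' c = -(schQ X * E' X * a) + schQ x * E' x * d at hc
    rw [hx, mul_zero, zero_mul, add_zero] at ha hc
    unfold LineHorizontal
    linear_combination a * hc - c * ha
  obtain ⟨ha, hc⟩ := no_line hXt hl
  simp [ha, hc] at hdet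

lemma MapHorizontal.triangular {C : Subfield K} [IsAlgClosed C] {x X a b c d : K}
    (hx : Transcendental C x) (hX : Transcendental C X)
    (hdet : a * d - b * c = 1) (h : ∀ E : Derivation C K K, MapHorizontal x X a b c d E) : b = 0 := by
  set S : Set K := {x, X, a, b, c, d}
  have hm : ∀ y ∈ S, y ∈ adjoin C S := fun y hy => subset_adjoin C S hy
  let x' : adjoin C S := ⟨x, hm x (by simp [S])⟩
  let X' : adjoin C S := ⟨X, hm X (by simp [S])⟩
  let a' : adjoin C S := ⟨a, hm a (by simp [S])⟩
  let b' : adjoin C S := ⟨b, hm b (by simp [S])⟩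
  let c' : adjoin C S := ⟨c, hm c (by simp [S])⟩
  let d' : adjoin C S := ⟨d, hm d (by simp [S])⟩
  have h' : ∀ E : Derivation C (adjoin C S) (adjoin C S), MapHorizontal x' X' a' b' c' d' E :=
    MapHorizontal.descend (K := K) h
  have : FiniteDimensional C⟮x'⟯ (adjoin C S) := by
    refine finiteDimensional_adjoin_of_derivation (by simp [S]) x' fun E hE y hy => ?_
    have hEX : E X' = 0 := by
      obtain ⟨E', hE'⟩ := exists_derivation_tower (K := K) E
      have := MapHorizontal.dependent hdet h E' (by
        have := hE' x'
        rw [hE, map_zero] at this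
        exact this)
      have h3 := hE' X'
      exact Subtype.ext (h3.symm.trans this)
    obtain ⟨ha, hb, hc, hd⟩ := h' E
    simp only [hE, hEX, mul_zero, zero_mul, add_zero, sub_zero, neg_zero] at ha hb hc hd
    rcases hy with hy | hy | hy | hy | hy | hy
    · rwa [show y = x' from Subtype.ext hy]
    · rwa [show y = X' from Subtype.ext hy]
    · rwa [show y = a' from Subtype.ext hy]
    · rwa [show y = b' from Subtype.ext hy]
    · rwa [show y = c' from Subtype.ext hy]
    · rwa [show y = d' from Subtype.ext (Set.mem_singleton_iff.1 hy)]
  have : CharZero (adjoin C S) := (algebraMap (adjoin C S) K).charZero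
  exact congrArg Subtype.val (MapHorizontal.eq_zero (transcendental_of_algebraMap (K := K) hx : Transcendental C x')
    (transcendental_of_algebraMap (K := K) hX : Transcendental C X') h')

/-- Ax's theorem for the uniformising equation of `J`, over an algebraically closed field carrying
fundamental solutions. -/
lemma ax_closed {C : Subfield K} {r d t : ℕ} (D : Fin r → Derivation C K K)
    (hC : ∀ a, (∀ i, D i a = 0) → a ∈ C) (x y w z : Fin d → K)
    (cl : Fin d → Fin t) (ζ : Fin t → K) (hz : ∀ k, z k = ζ (cl k)) (s : Finset (Fin d))
    (hs : ∀ E : Derivation C K K, (∀ k ∈ s, E (x k) = 0) → ∀ k, E (x k) = 0)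
    (hrow : LinearIndependent K fun i => fun k => D i (x k))
    (hx : ∀ k, ∃ i, D i (x k) ≠ 0) (hy : ∀ k, y k ≠ 0)
    (hD : ∀ i, gaugeMap x y w z (D i) = 0) (hn : s.card + t < d + r) :
    ∃ i l : Fin d, i ≠ l ∧ (∃ a c, a ≠ 0 ∧
      ∀ E : Derivation C K K, MapHorizontal (x i) (x l) a 0 c a⁻¹ E) ∧
      ∀ E : Derivation C K K, E (x i) = 0 → E (x l) = 0 := by
  have hCa := isAlgClosed_constants D hC
  have htr : ∀ k, Transcendental C (x k) := fun k =>
    let ⟨i, hi⟩ := hx k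
    transcendental_of_ne_zero (D i) hi
  have h0 : ∀ k, x k ≠ 0 := fun k h => htr k (h ▸ isAlgebraic_zero)
  have h1 : ∀ k, x k ≠ 1 := fun k h => htr k (h ▸ isAlgebraic_one)
  rcases gauge_dichotomy D hC x y w z h0 h1 hy hD
    (gaugeMap_range_ne_top x y w z cl ζ hz s hs D hrow hD hn) with
    ⟨i, v1, v2, hv, h⟩ | ⟨i, l, hil, v1, v2, w1, w2, hdet, h⟩
  · have hv' : (v1 : K) ≠ 0 ∨ (v2 : K) ≠ 0 := by simpa using hv
    obtain ⟨e1, e2⟩ := no_line (htr i) fun E => lineHorizontal_of_gauge (hy i) E (z := z i) (w := w i)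
      (E.map_algebraMap v1) (E.map_algebraMap v2) (h _ ⟨E, rfl⟩)
    rcases line_ne_zero (w := w i) (z := z i) (hy i) hv' with h | h
    · exact absurd e1 h
    · exact absurd e2 h
  · have hdet' : (v1 : K) * w2 - v2 * w1 = 1 := by exact_mod_cast congrArg (Subtype.val : C → K) hdet
    obtain ⟨a, b, c, e, hde, hT⟩ := mapHorizontal_of_gauge (R := C) (x := x i) (x' := x l) (w := w i) (z := z i)
      (w' := w l) (z' := z l) (hy i) (hy l) hdet'
    have hT' : ∀ E : Derivation C K K, MapHorizontal (x i) (x l) a b c e E := fun E =>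
      hT E (E.map_algebraMap v1) (E.map_algebraMap v2) (E.map_algebraMap w1) (E.map_algebraMap w2)
        (h _ ⟨E, rfl⟩)
    obtain rfl := MapHorizontal.triangular (htr i) (htr l) hde hT'
    have ha : a ≠ 0 := by rintro rfl; simp at hde
    have he : e = a⁻¹ := eq_inv_of_mul_eq_one_right (by linear_combination hde)
    exact ⟨i, l, hil, ⟨a, c, ha, he ▸ hT'⟩, MapHorizontal.dependent hde hT'⟩

end AxCore

end

section

open IntermediateField

section AxSchanuel

variable {C L : Type*} [Field C] [Field L] [Algebra C L] [CharZero L]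

open scoped algebraAdjoinAdjoin in
lemma isAlgebraic_adjoin_of_not_transcendental {S : Set L} {a : L}
    (h : ¬ Transcendental (Algebra.adjoin C S) a) : IsAlgebraic (adjoin C S) a := by
  have h1 : IsAlgebraic (Algebra.adjoin C S) a := not_not.1 h
  exact h1.extendScalars (FaithfulSMul.algebraMap_injective (Algebra.adjoin C S) (adjoin C S))

lemma exists_max_algebraicIndepOn {ι : Type*} [Fintype ι] (x : ι → L) :
    ∃ s : Finset ι, AlgebraicIndepOn C x s ∧ ∀ k, IsAlgebraic (adjoin C (x '' s)) (x k) := by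
  classical
  have hne : (Finset.univ.filter fun s : Finset ι => AlgebraicIndepOn C x (s : Set ι)).Nonempty :=
    ⟨∅, by simp [AlgebraicIndepOn, algebraicIndependent_empty_type_iff, (algebraMap C L).injective]⟩
  obtain ⟨s, hs, hmax⟩ := Finset.exists_max_image _ Finset.card hne
  have hs' := (Finset.mem_filter.1 hs).2
  refine ⟨s, hs', fun k => ?_⟩
  by_cases hk : k ∈ s
  · exact isAlgebraic_algebraMap (⟨x k, subset_adjoin C _ ⟨k, hk, rfl⟩⟩ : adjoin C (x '' s))
  · refine isAlgebraic_adjoin_of_not_transcendental fun ht => ?_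
    have h1 := (AlgebraicIndepOn.insert_iff (x := x) (show k ∉ (s : Set ι) from hk)).2 ⟨hs', ht⟩
    have h2 := hmax (insert k s) (by simpa using h1)
    rw [Finset.card_insert_of_notMem hk] at h2
    omega

/-- A derivation of an extension vanishes on elements algebraic over a set where it vanishes. -/
lemma derivation_eq_zero_of_adjoin {K : Type*} [Field K] [CharZero K] [Algebra L K]
    (E : Derivation ℤ K K) (hC : ∀ c : C, E (algebraMap L K (algebraMap C L c)) = 0) {S : Set L}
    (hS : ∀ a ∈ S, E (algebraMap L K a) = 0) {a : L} (ha : IsAlgebraic (adjoin C S) a) :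
    E (algebraMap L K a) = 0 := by
  have h1 : ∀ y : adjoin C S, E (algebraMap L K (y : L)) = 0 := by
    rintro ⟨y, hy⟩
    refine adjoin_induction C (p := fun y _ => E (algebraMap L K y) = 0) ?_ ?_ ?_ ?_ ?_ hy
    · exact hS
    · exact hC
    · intro y z _ _ hy hz; rw [map_add, map_add, hy, hz, add_zero]
    · intro y _ hy; rw [map_inv₀, Derivation.leibniz_inv, hy, smul_zero]
    · intro y z _ _ hy hz; simp [Derivation.leibniz, hy, hz]
  let E₁ : Derivation (adjoin C S) K K := Derivation.ofConst E h1
  have : CharZero (adjoin C S) := (algebraMap (adjoin C S) L).charZero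
  exact derivation_eq_zero_of_isAlgebraic E₁ (ha.algebraMap (A := K))

end AxSchanuel

lemma exists_isAlgClosed_isTranscendenceBasis (σ : Type) (L : Type) [Field L] [CharZero L] :
    ∃ (K : Type) (_ : Field K) (_ : CharZero K) (_ : IsAlgClosed K) (_ : Algebra L K) (g : σ → K),
      IsTranscendenceBasis L g := by
  let A := FractionRing (MvPolynomial σ L)
  let K := AlgebraicClosure A
  have : CharZero K := charZero_of_injective_algebraMap (algebraMap L K).injective
  have h1 := IsTranscendenceBasis.mvPolynomial σ L
  have : Algebra.IsAlgebraic (MvPolynomial σ L) A :=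
    IsLocalization.isAlgebraic _ (nonZeroDivisors (MvPolynomial σ L))
  have h2 := h1.algebraMap_comp (A := A)
  have h3 := h2.algebraMap_comp (A := K)
  exact ⟨K, inferInstance, inferInstance, inferInstance, inferInstance, _, h3⟩

end

section

open IntermediateField

lemma gaugeForm_eq_zero_of_schRel {K : Type*} [Field K] {R : Type*} [CommRing R] [Algebra R K]
    {x x₀ y₀ w₀ z s p : K} (hs : s ≠ 0) (hy₀ : y₀ ≠ 0)
    (E : Derivation R K K) (hx : E x = s ^ 2 * E x₀) (hEs : E s = p * E x)
    (hp : E p = schQ x₀ * E x₀ / s - s * schQ x * E x) (hy : E y₀ = E x₀ * w₀)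
    (hw : E w₀ = -(schQ x₀ * E x₀ * y₀)) (hz : E z = E x₀ / y₀ ^ 2) :
    gaugeForm x (s * y₀) (p * y₀ + w₀ / s) z E = 0 := by
  have h1 : E (s * y₀) - E x * (p * y₀ + w₀ / s) = 0 := by
    rw [Derivation.leibniz, hy, hEs, hx]; simp only [smul_eq_mul]; field_simp; ring
  have h2 : E (p * y₀ + w₀ / s) + schQ x * E x * (s * y₀) = 0 := by
    rw [map_add, Derivation.leibniz, Derivation.leibniz_div, hy, hw, hp, hEs, hx]
    simp only [smul_eq_mul]; field_simp; ring
  have h3 : -E x / (s * y₀) ^ 2 + E z = 0 := by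
    rw [hz, hx]; field_simp; ring
  rw [gaugeForm, h1, h2]
  ext a; fin_cases a
  · simp
  · simpa using h3
  · simp

section AxSchanuel

variable {C L : Type} [Field C] [Field L] [Algebra C L] [CharZero L]

/-- An algebraic relation over the constants of a differential extension descends. -/
lemma exists_mvPolynomial_descent {K ι τ : Type*} [Field K] [CharZero K] [Algebra L K]
    (D : τ → Derivation C L L) (hC : ∀ a, (∀ i, D i a = 0) → a ∈ Set.range (algebraMap C L))
    (D' : τ → Derivation ℤ K K) (hD : ∀ i a, D' i (algebraMap L K a) = algebraMap L K (D i a))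
    {C' : Subfield K} (hC' : ∀ c ∈ C', ∀ i, D' i c = 0) {x : ι → L}
    (h : ¬ AlgebraicIndependent C' fun i => algebraMap L K (x i)) :
    ∃ P : MvPolynomial ι C, P ≠ 0 ∧ MvPolynomial.aeval x P = 0 := by
  classical
  rw [algebraicIndependent_iff] at h
  push Not at h
  obtain ⟨p, hp, hp0⟩ := h
  obtain ⟨γ, hγ, hγv⟩ := exists_constant_relation (ι := p.support) D hC D' hD
    (c := fun m => ((MvPolynomial.coeff m.1 p : C') : K)) (v := fun m => m.1.prod fun i k => x i ^ k)
    (fun i k => hC' _ (p.coeff k.1).2 i)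
    (by
      intro h0
      refine hp0 (MvPolynomial.ext _ _ fun m => ?_)
      by_cases hm : m ∈ p.support
      · have := congrFun h0 ⟨m, hm⟩
        simpa using this
      · simpa using hm)
    (by
      rw [MvPolynomial.aeval_def, MvPolynomial.eval₂_eq] at hp
      rw [← hp, ← Finset.sum_coe_sort p.support]
      refine Finset.sum_congr rfl fun m _ => ?_
      rw [Finsupp.prod, map_prod]
      simp only [map_pow]
      rfl)
  obtain ⟨k, hk⟩ := Function.ne_iff.1 hγ
  refine ⟨∑ m, MvPolynomial.monomial m.1 (γ m), fun h0 => hk ?_, ?_⟩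
  · have := congrArg (MvPolynomial.coeff k.1) h0
    simpa [MvPolynomial.coeff_sum, MvPolynomial.coeff_monomial, Subtype.coe_inj] using this
  · rw [map_sum, ← hγv]
    exact Finset.sum_congr rfl fun m _ => by rw [MvPolynomial.aeval_monomial]

/-- The Ax–Schanuel theorem for the uniformising equation of `J`, over a differential field closed
under square roots. -/
theorem ax_schanuel (hsq : ∀ a : L, ∃ b, b ^ 2 = a) {r d t u : ℕ} (D : Fin r → Derivation C L L)
    (hC : ∀ a, (∀ i, D i a = 0) → a ∈ Set.range (algebraMap C L)) (x : Fin d → L)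
    (cl : Fin d → Fin t) (x₀ : Fin t → L)
    (hrel : ∀ k, SchRel (fun i => (D i).restrictScalars ℤ) (x₀ (cl k)) (x k))
    (hx : ∀ k, ∃ i, D i (x k) ≠ 0)
    (hu : ∀ s : Finset (Fin d), AlgebraicIndepOn C x (s : Set (Fin d)) → s.card ≤ u)
    (hrow : LinearIndependent L fun i => fun k => D i (x k)) (hn : u + t < d + r) :
    ∃ i l : Fin d, i ≠ l ∧ SchRel (fun i => (D i).restrictScalars ℤ) (x i) (x l) ∧
      ∃ P : MvPolynomial (Fin 2) C, P ≠ 0 ∧ MvPolynomial.aeval ![x i, x l] P = 0 := by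
  classical
  obtain ⟨K, _, _, _, _, g, hg⟩ := exists_isAlgClosed_isTranscendenceBasis (Fin t × Fin 3) L
  have hgne : ∀ a, g a ≠ 0 := fun a => hg.1.ne_zero a
  let A := algebraMap L K
  have hDL : ∀ i, ∃ D' : Derivation ℤ K K, (∀ a, D' (A a) = A (D i a)) ∧
      ∀ c, D' (g (c, 0)) = A (D i (x₀ c)) * g (c, 1) ∧
        D' (g (c, 1)) = -(schQ (A (x₀ c)) * A (D i (x₀ c)) * g (c, 0)) ∧
        D' (g (c, 2)) = A (D i (x₀ c)) / g (c, 0) ^ 2 := by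
    intro i
    obtain ⟨D', h1, h2⟩ := exists_derivation_extension hg
      ((Algebra.linearMap L K).compDer ((D i).restrictScalars ℤ))
      (fun a => ![A (D i (x₀ a.1)) * g (a.1, 1), -(schQ (A (x₀ a.1)) * A (D i (x₀ a.1)) * g (a.1, 0)),
        A (D i (x₀ a.1)) / g (a.1, 0) ^ 2] a.2)
    exact ⟨D', h1, fun c => ⟨h2 (c, 0), h2 (c, 1), h2 (c, 2)⟩⟩
  choose D' hD' hg' using hDL
  let C' : Subfield K :=
    { carrier := {a | ∀ i, D' i a = 0}
      mul_mem' := fun {a b} ha hb i => by rw [Derivation.leibniz, ha i, hb i]; simp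
      one_mem' := fun i => by simp
      add_mem' := fun {a b} ha hb i => by rw [map_add, ha i, hb i, add_zero]
      zero_mem' := fun i => map_zero _
      neg_mem' := fun {a} ha i => by rw [map_neg, ha i, neg_zero]
      inv_mem' := fun a ha i => by rw [Derivation.leibniz_inv, ha i, smul_zero] }
  let E : Fin r → Derivation C' K K := fun i => Derivation.ofConst (D' i) fun a => a.2 i
  have hE : ∀ i a, E i a = D' i a := fun i a => rfl
  choose σ p hσ hrel' using hrel
  obtain ⟨s, hs, hsx⟩ := exists_max_algebraicIndepOn (C := C) x
  have hCE : ∀ (F : Derivation C' K K) (c : C), F (A (algebraMap C L c)) = 0 := by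
    intro F c
    have : A (algebraMap C L c) ∈ C' := fun i => by rw [hD', Derivation.map_algebraMap, map_zero]
    exact F.map_algebraMap (⟨_, this⟩ : C')
  have hAne : ∀ a, A a = 0 → a = 0 := fun a h => (map_eq_zero A).1 h
  obtain ⟨i, l, hil, ⟨a, c, ha, hmap⟩, hdep⟩ := ax_closed (C := C') E (fun a ha => ha)
    (fun k => A (x k)) (fun k => A (σ k) * g (cl k, 0))
    (fun k => A (p k) * g (cl k, 0) + g (cl k, 1) / A (σ k)) (fun k => g (cl k, 2)) cl
    (fun c => g (c, 2)) (fun k => rfl) s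
    (fun F hF k => derivation_eq_zero_of_adjoin (C := C) (F.restrictScalars ℤ) (hCE F)
      (by rintro _ ⟨k, hk, rfl⟩; exact hF k hk) (hsx k))
    (by
      have h1 : (fun i => fun k => E i (A (x k))) =
          fun i => algebraMap L K ∘ fun k => D i (x k) := by
        funext i k
        exact hD' i (x k)
      rw [h1]
      exact linearIndependent_algebraMap_comp_iff.2 hrow)
    (fun k => by
      obtain ⟨i, hi⟩ := hx k
      exact ⟨i, fun h => hi (hAne _ (by rw [← hD']; exact h))⟩)
    (fun k => mul_ne_zero (fun h => hσ k (hAne _ h)) (hgne _))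
    (fun i => by
      funext k
      have h1 := hrel' k i
      obtain ⟨e1, e2, e3⟩ := hg' i (cl k)
      refine gaugeForm_eq_zero_of_schRel (x₀ := A (x₀ (cl k))) (fun h => hσ k (hAne _ h)) (hgne _)
        (E i) ?_ ?_ ?_ ?_ ?_ ?_
      · simp only [hE, hD']; rw [← map_pow, ← map_mul]; exact congrArg A h1.1
      · simp only [hE, hD']; rw [← map_mul]; exact congrArg A h1.2.1
      · simp only [hE, hD']
        have := congrArg A h1.2.2
        simpa [A, algebraMap_schQ] using this
      · simp only [hE, hD']; exact e1
      · simp only [hE, hD']; exact e2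
      · simp only [hE, hD']; exact e3)
    (by have := hu s hs; omega)
  obtain ⟨i₀, hi₀⟩ := hx i
  have hai : ∀ m, A (D m (x l)) = a ^ 2 * A (D m (x i)) := by
    intro m
    have h1 := (hmap (E m)).hb
    simp only [hE, hD'] at h1
    rw [map_zero] at h1
    field_simp at h1
    linear_combination -h1
  have hca : ∀ m, D' m a = A (D m (x l)) * c ∧
      D' m c = -(schQ (A (x l)) * A (D m (x l)) * a) + schQ (A (x i)) * A (D m (x i)) * a⁻¹ := by
    intro m
    have h1 := (hmap (E m)).ha
    have h2 := (hmap (E m)).hc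
    simp only [hE, hD'] at h1 h2
    exact ⟨by linear_combination h1, h2⟩
  have hAi : A (D i₀ (x i)) ≠ 0 := fun h => hi₀ (hAne _ h)
  obtain ⟨b, rfl⟩ : ∃ b, A b = a := by
    obtain ⟨b, hb⟩ := hsq (D i₀ (x l) / D i₀ (x i))
    have h1 : (A b) ^ 2 = a ^ 2 := by
      rw [← map_pow, hb, map_div₀, hai]; field_simp
    rcases sq_eq_sq_iff_eq_or_eq_neg.1 h1 with h | h
    · exact ⟨b, h⟩
    · exact ⟨-b, by rw [map_neg, h, neg_neg]⟩
  have hAl : A (D i₀ (x l)) ≠ 0 := by rw [hai]; exact mul_ne_zero (pow_ne_zero _ ha) hAi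
  obtain ⟨c, rfl⟩ : ∃ c', A c' = c := by
    refine ⟨D i₀ b / D i₀ (x l), ?_⟩
    rw [map_div₀, ← hD', (hca i₀).1]; field_simp
  have hb0 : b ≠ 0 := fun h => ha (by rw [h, map_zero])
  refine ⟨i, l, hil, ⟨b, c, hb0, fun m => ⟨A.injective ?_, A.injective ?_, A.injective ?_⟩⟩, ?_⟩
  · simpa using hai m
  · have := (hca m).1
    rw [hD'] at this
    simp only [Derivation.restrictScalars_apply, map_mul]
    linear_combination this
  · have := (hca m).2
    rw [hD'] at this
    simp only [Derivation.restrictScalars_apply, map_mul, map_sub, map_div₀, algebraMap_schQ, A]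
    simp only [A] at this
    rw [this]
    field_simp
    ring
  · refine exists_mvPolynomial_descent (K := K) D hC D' hD' (C' := C') (fun c hc i => hc i) fun h => ?_
    obtain ⟨F, hF⟩ := exists_derivation_of_algebraicIndependent h ![0, 1]
    have h0 := hF 0
    have h1 := hF 1
    simp only [Matrix.cons_val_zero, Matrix.cons_val_one] at h0 h1
    exact one_ne_zero (h1.symm.trans (hdep F h0))

end AxSchanuel

end

section

open MvPolynomial

section Zariski

variable {ι : Type*}

lemma mem_vanishingIdeal {X : Set (ι → ℂ)} {p : MvPolynomial ι ℂ} :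
    p ∈ vanishingIdeal ℂ X ↔ ∀ x ∈ X, eval x p = 0 := by
  simp [mem_vanishingIdeal_iff, aeval_eq_eval]

lemma mem_zeroLocus {I : Ideal (MvPolynomial ι ℂ)} {x : ι → ℂ} :
    x ∈ zeroLocus ℂ I ↔ ∀ p ∈ I, eval x p = 0 := by
  simp [mem_zeroLocus_iff, aeval_eq_eval]

lemma isAlgSet_zeroLocus (I : Ideal (MvPolynomial ι ℂ)) : IsAlgSet (zeroLocus ℂ I) :=
  ⟨I, by ext x; exact mem_zeroLocus⟩

lemma isAlgSet_setOf_eval (p : MvPolynomial ι ℂ) : IsAlgSet {x : ι → ℂ | eval x p = 0} :=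
  ⟨{p}, by simp⟩

lemma zcl_eq_zeroLocus (S : Set (ι → ℂ)) : zcl S = zeroLocus ℂ (vanishingIdeal ℂ S) := by
  apply Set.Subset.antisymm
  · exact Set.sInter_subset_of_mem ⟨isAlgSet_zeroLocus _, zeroLocus_vanishingIdeal_le S⟩
  · rintro x hx T ⟨⟨P, rfl⟩, hT⟩ p hp
    exact mem_zeroLocus.1 hx p (mem_vanishingIdeal.2 fun y hy => hT hy p hp)

lemma isAlgSet_zcl (S : Set (ι → ℂ)) : IsAlgSet (zcl S) :=
  zcl_eq_zeroLocus S ▸ isAlgSet_zeroLocus _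

lemma subset_zcl (S : Set (ι → ℂ)) : S ⊆ zcl S := fun _ hx _ hT => hT.2 hx

lemma zcl_subset {S T : Set (ι → ℂ)} (hT : IsAlgSet T) (h : S ⊆ T) : zcl S ⊆ T :=
  Set.sInter_subset_of_mem ⟨hT, h⟩

lemma IsAlgSet.zcl_eq {S : Set (ι → ℂ)} (hS : IsAlgSet S) : zcl S = S :=
  (zcl_subset hS Set.Subset.rfl).antisymm (subset_zcl S)

lemma zcl_mono {S T : Set (ι → ℂ)} (h : S ⊆ T) : zcl S ⊆ zcl T :=
  zcl_subset (isAlgSet_zcl T) (h.trans (subset_zcl T))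

lemma vanishingIdeal_zcl (S : Set (ι → ℂ)) : vanishingIdeal ℂ (zcl S) = vanishingIdeal ℂ S := by
  refine le_antisymm (vanishingIdeal_anti_mono (subset_zcl S)) fun p hp => ?_
  rw [mem_vanishingIdeal]
  intro x hx
  rw [zcl_eq_zeroLocus] at hx
  exact mem_zeroLocus.1 hx p hp

lemma IsAlgSet.zeroLocus_vanishingIdeal {S : Set (ι → ℂ)} (hS : IsAlgSet S) :
    zeroLocus ℂ (vanishingIdeal ℂ S) = S := by rw [← zcl_eq_zeroLocus, hS.zcl_eq]

lemma IsAlgSet.sInter {𝒞 : Set (Set (ι → ℂ))} (h : ∀ V ∈ 𝒞, IsAlgSet V) : IsAlgSet (⋂₀ 𝒞) := by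
  have : zcl (⋂₀ 𝒞) = ⋂₀ 𝒞 := by
    refine (Set.subset_sInter fun V hV => ?_).antisymm (subset_zcl _)
    exact zcl_subset (h V hV) (Set.sInter_subset_of_mem hV)
  rw [← this]; exact isAlgSet_zcl _

lemma IsAlgSet.iInter {τ : Sort*} {V : τ → Set (ι → ℂ)} (h : ∀ i, IsAlgSet (V i)) :
    IsAlgSet (⋂ i, V i) := IsAlgSet.sInter (by rintro _ ⟨i, rfl⟩; exact h i)

lemma IsAlgSet.inter {V W : Set (ι → ℂ)} (hV : IsAlgSet V) (hW : IsAlgSet W) :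
    IsAlgSet (V ∩ W) := by
  rw [← Set.sInter_pair]
  exact IsAlgSet.sInter (by rintro U (rfl | rfl); exacts [hV, hW])

lemma IsAlgSet.univ : IsAlgSet (Set.univ : Set (ι → ℂ)) := ⟨∅, by simp⟩

lemma IsAlgSet.empty : IsAlgSet (∅ : Set (ι → ℂ)) := ⟨{1}, by ext; simp⟩

lemma IsAlgSet.union {V W : Set (ι → ℂ)} (hV : IsAlgSet V) (hW : IsAlgSet W) :
    IsAlgSet (V ∪ W) := by
  obtain ⟨P, rfl⟩ := hV
  obtain ⟨Q, rfl⟩ := hW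
  refine ⟨{r | ∃ p ∈ P, ∃ q ∈ Q, r = p * q}, Set.ext fun x => ⟨?_, fun h => ?_⟩⟩
  · rintro (h | h) _ ⟨p, hp, q, hq, rfl⟩
    · rw [map_mul, h p hp, zero_mul]
    · rw [map_mul, h q hq, mul_zero]
  · by_contra hc
    simp only [Set.mem_union, Set.mem_setOf_eq, not_or, not_forall] at hc
    obtain ⟨⟨p, hp, hp0⟩, q, hq, hq0⟩ := hc
    exact mul_ne_zero hp0 hq0 (by rw [← map_mul]; exact h _ ⟨p, hp, q, hq, rfl⟩)

lemma IsAlgSet.iUnion {τ : Type*} [Finite τ] {V : τ → Set (ι → ℂ)} (h : ∀ i, IsAlgSet (V i)) :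
    IsAlgSet (⋃ i, V i) := by
  classical
  have := Fintype.ofFinite τ
  have key : ∀ s : Finset τ, IsAlgSet (⋃ i ∈ s, V i) := by
    intro s
    induction s using Finset.induction_on with
    | empty => simpa using IsAlgSet.empty
    | insert a s _ ih => rw [Finset.set_biUnion_insert]; exact (h a).union ih
  simpa using key Finset.univ

lemma eval_bind₁ {κ : Type*} (f : κ → MvPolynomial ι ℂ) (x : ι → ℂ) (p : MvPolynomial κ ℂ) :
    eval x (bind₁ f p) = eval (fun k => eval x (f k)) p := by
  induction p using MvPolynomial.induction_on <;> simp_all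

/-- Algebraic sets are stable under preimage by polynomial maps. -/
lemma IsAlgSet.preimage {κ : Type*} {V : Set (κ → ℂ)} (hV : IsAlgSet V)
    (f : κ → MvPolynomial ι ℂ) : IsAlgSet {x : ι → ℂ | (fun k => eval x (f k)) ∈ V} := by
  obtain ⟨P, rfl⟩ := hV
  refine ⟨(bind₁ f) '' P, ?_⟩
  ext x
  simp [eval_bind₁]

lemma isIrr_iff_isPrime {S : Set (ι → ℂ)} : IsIrr S ↔ (vanishingIdeal ℂ S).IsPrime := by
  constructor
  · rintro ⟨⟨x, hx⟩, h⟩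
    refine ⟨fun ht => ?_, fun {p q} hpq => ?_⟩
    · have h1 : (1 : MvPolynomial ι ℂ) ∈ vanishingIdeal ℂ S := by rw [ht]; trivial
      simpa using mem_vanishingIdeal.1 h1 x hx
    · have h1 : S ⊆ {x | eval x p = 0} ∪ {x | eval x q = 0} := fun x hx => by
        have := mem_vanishingIdeal.1 hpq x hx
        simpa using this
      rcases h _ _ (isAlgSet_setOf_eval p) (isAlgSet_setOf_eval q) h1 with h2 | h2
      · exact Or.inl (mem_vanishingIdeal.2 fun x hx => h2 hx)
      · exact Or.inr (mem_vanishingIdeal.2 fun x hx => h2 hx)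
  · intro h
    refine ⟨?_, ?_⟩
    · by_contra hc
      rw [Set.not_nonempty_iff_eq_empty] at hc
      exact h.ne_top (by rw [hc, vanishingIdeal_empty])
    · rintro _ _ ⟨P, rfl⟩ ⟨Q, rfl⟩ hS
      by_contra hc
      simp only [not_or, Set.not_subset, Set.mem_setOf_eq, not_forall] at hc
      obtain ⟨⟨x, hx, p, hp, hpx⟩, y, hy, q, hq, hqy⟩ := hc
      have h1 : p * q ∈ vanishingIdeal ℂ S := mem_vanishingIdeal.2 fun z hz => by
        rcases hS hz with h2 | h2
        · rw [map_mul, h2 p hp, zero_mul]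
        · rw [map_mul, h2 q hq, mul_zero]
      rcases h.mem_or_mem h1 with h2 | h2
      · exact hpx (mem_vanishingIdeal.1 h2 x hx)
      · exact hqy (mem_vanishingIdeal.1 h2 y hy)

lemma IsIrr.zcl {S : Set (ι → ℂ)} (h : IsIrr S) : IsIrr (zcl S) := by
  rw [isIrr_iff_isPrime, vanishingIdeal_zcl]; exact isIrr_iff_isPrime.1 h

lemma IsIrr.subset_of_iUnion {τ : Type*} [Finite τ] {S : Set (ι → ℂ)} (h : IsIrr S)
    {V : τ → Set (ι → ℂ)} (hV : ∀ i, IsAlgSet (V i)) (hS : S ⊆ ⋃ i, V i) : ∃ i, S ⊆ V i := by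
  classical
  have := Fintype.ofFinite τ
  have key : ∀ s : Finset τ, S ⊆ ⋃ i ∈ s, V i → ∃ i, S ⊆ V i := by
    intro s
    induction s using Finset.induction_on with
    | empty =>
      intro h1
      obtain ⟨x, hx⟩ := h.1
      simpa using h1 hx
    | insert a s _ ih =>
      intro h1
      rw [Finset.set_biUnion_insert] at h1
      have h2 : IsAlgSet (⋃ i ∈ s, V i) := by
        have : (⋃ i ∈ s, V i) = ⋃ i : s, V i.1 := by ext; simp
        rw [this]; exact IsAlgSet.iUnion fun i => hV i
      rcases h.2 _ _ (hV a) h2 h1 with h3 | h3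
      · exact ⟨a, h3⟩
      · exact ih h3
  exact key Finset.univ (by simpa using hS)

variable [Finite ι]

lemma isIrr_zeroLocus {P : Ideal (MvPolynomial ι ℂ)} (hP : P.IsPrime) : IsIrr (zeroLocus ℂ P) := by
  rw [isIrr_iff_isPrime, MvPolynomial.IsPrime.vanishingIdeal_zeroLocus P]; exact hP

/-- Every irreducible algebraic subset lies in an irreducible component. -/
lemma exists_isIrrCompOf {A X : Set (ι → ℂ)} (hX : IsIrr X) (h : X ⊆ zcl A) :
    ∃ Y, IsIrrCompOf Y A ∧ X ⊆ Y := by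
  have hX' := isIrr_iff_isPrime.1 hX
  obtain ⟨p, hp, hpX⟩ := Ideal.exists_minimalPrimes_le (I := vanishingIdeal ℂ A)
    (J := vanishingIdeal ℂ X) (by rw [← vanishingIdeal_zcl A]; exact vanishingIdeal_anti_mono h)
  have hpp : p.IsPrime := hp.1.1
  refine ⟨zeroLocus ℂ p, ⟨isAlgSet_zeroLocus p, isIrr_zeroLocus hpp, ?_, ?_⟩, ?_⟩
  · rw [zcl_eq_zeroLocus]; exact zeroLocus_anti_mono hp.1.2
  · intro Y hY hYi hYA hpY
    have h1 : vanishingIdeal ℂ Y ≤ p := by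
      rw [← MvPolynomial.IsPrime.vanishingIdeal_zeroLocus (K := ℂ) p]
      exact vanishingIdeal_anti_mono hpY
    have h2 := hp.2 ⟨isIrr_iff_isPrime.1 hYi, by
      rw [← vanishingIdeal_zcl A]; exact vanishingIdeal_anti_mono hYA⟩ h1
    rw [le_antisymm h2 h1, hY.zeroLocus_vanishingIdeal]
  · exact (zeroLocus_vanishingIdeal_le X).trans (zeroLocus_anti_mono hpX)

lemma finite_irrComps (A : Set (ι → ℂ)) : {Y | IsIrrCompOf Y A}.Finite := by
  have hfin := (vanishingIdeal ℂ A).finite_minimalPrimes_of_isNoetherianRing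
  refine Set.Finite.of_finite_image (f := vanishingIdeal ℂ) (hfin.subset ?_) ?_
  · rintro _ ⟨Y, hY, rfl⟩
    obtain ⟨hYa, hYi, hYA, hmax⟩ := hY
    refine ⟨⟨isIrr_iff_isPrime.1 hYi, by
      rw [← vanishingIdeal_zcl A]; exact vanishingIdeal_anti_mono hYA⟩, ?_⟩
    rintro p ⟨hp, hpA⟩ hpY
    have h1 := hmax (zeroLocus ℂ p) (isAlgSet_zeroLocus p) (isIrr_zeroLocus hp)
      (by rw [zcl_eq_zeroLocus]; exact zeroLocus_anti_mono hpA)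
      ((zeroLocus_vanishingIdeal_le Y).trans (zeroLocus_anti_mono hpY))
    rw [h1, MvPolynomial.IsPrime.vanishingIdeal_zeroLocus]
  · intro Y hY Z hZ h
    rw [← hY.1.zeroLocus_vanishingIdeal, ← hZ.1.zeroLocus_vanishingIdeal]
    exact congrArg _ h

lemma subset_iUnion_irrComps (A : Set (ι → ℂ)) {x : ι → ℂ} (hx : x ∈ zcl A) :
    ∃ Y, IsIrrCompOf Y A ∧ x ∈ Y := by
  have h1 : IsIrr ({x} : Set (ι → ℂ)) :=
    ⟨⟨x, rfl⟩, fun V W _ _ h => by simpa using h⟩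
  obtain ⟨Y, hY, h2⟩ := exists_isIrrCompOf h1 (by simpa using hx : ({x} : Set (ι → ℂ)) ⊆ zcl A)
  exact ⟨Y, hY, h2 rfl⟩

end Zariski

end

section

open MvPolynomial

/-- The image of `Spec` of an injective ring homomorphism of finite presentation into a domain
contains a nonempty basic open set. -/
lemma exists_basicOpen_subset_range_comap {R B : Type*} [CommRing R] [IsDomain R] [CommRing B]
    [IsDomain B] {f : R →+* B} (hf : f.FinitePresentation) (hinj : Function.Injective f) :
    ∃ h : R, h ≠ 0 ∧ ∀ P : Ideal R, P.IsPrime → h ∉ P → ∃ Q : Ideal B, Q.IsPrime ∧ Q.comap f = P := by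
  obtain ⟨S, hS⟩ := PrimeSpectrum.exists_constructibleSetData_iff.2
    (PrimeSpectrum.isConstructible_range_comap hf)
  have h0 : (⟨⊥, Ideal.isPrime_bot⟩ : PrimeSpectrum R) ∈ Set.range (PrimeSpectrum.comap f) :=
    ⟨⟨⊥, Ideal.isPrime_bot⟩, by
      ext1
      exact (RingHom.injective_iff_ker_eq_bot f).1 hinj⟩
  rw [← hS, PrimeSpectrum.ConstructibleSetData.toSet, Set.mem_iUnion₂] at h0
  obtain ⟨c, hc, h1, h2⟩ := h0
  refine ⟨c.f, fun h => h2 ?_, fun P hP hPc => ?_⟩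
  · rw [h]; simp
  · have h3 : (⟨P, hP⟩ : PrimeSpectrum R) ∈ S.toSet := by
      rw [PrimeSpectrum.ConstructibleSetData.toSet, Set.mem_iUnion₂]
      refine ⟨c, hc, ?_, fun h => hPc (by simpa using h)⟩
      rw [PrimeSpectrum.mem_zeroLocus] at h1 ⊢
      intro a ha
      have : a = 0 := by simpa using h1 ha
      rw [this]; exact P.zero_mem
    rw [hS] at h3
    obtain ⟨Q, hQ⟩ := h3
    exact ⟨Q.asIdeal, Q.isPrime, congrArg PrimeSpectrum.asIdeal hQ⟩

/-- Generic values of algebraically independent coordinates lift to specialisations of a point. -/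
lemma exists_generic_lift {C L : Type*} [Field C] [IsAlgClosed C] [Field L] [Algebra C L]
    {ι : Type*} [Finite ι] (x : ι → L) {s : Set ι} (hs : AlgebraicIndepOn C x s)
    {b : MvPolynomial ι C} (hb : aeval x b ≠ 0) :
    ∃ h : MvPolynomial s C, h ≠ 0 ∧ ∀ a : s → C, eval a h ≠ 0 →
      ∃ y : ι → C, (∀ i : s, y i = a i) ∧ (∀ p : MvPolynomial ι C, aeval x p = 0 → eval y p = 0) ∧
        eval y b ≠ 0 := by
  classical
  set B : Subalgebra C L := Algebra.adjoin C (insert (aeval x b)⁻¹ (Set.range x)) with hB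
  have hxB : ∀ i, x i ∈ B := fun i => Algebra.subset_adjoin (Or.inr ⟨i, rfl⟩)
  have hbB : (aeval x b)⁻¹ ∈ B := Algebra.subset_adjoin (Or.inl rfl)
  let xB : ι → B := fun i => ⟨x i, hxB i⟩
  have hval : ∀ p : MvPolynomial ι C, ((aeval xB p : B) : L) = aeval x p := fun p => by
    have := MvPolynomial.aeval_algebraMap_apply L xB p
    exact this.symm
  let f : MvPolynomial s C →ₐ[C] B := aeval fun i : s => xB i
  have hfinj : Function.Injective f := by
    intro p q hpq
    have h1 : ∀ p, ((f p : B) : L) = aeval (fun i : s => x i) p := fun p => by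
      have := MvPolynomial.aeval_algebraMap_apply L (fun i : s => xB i) p
      exact this.symm
    exact hs (by
      change aeval (fun i : s => x i) p = aeval (fun i : s => x i) q
      rw [← h1, ← h1, hpq])
  have hBft : Algebra.FiniteType C B := by
    refine (Subalgebra.fg_iff_finiteType _).1 ?_
    have hfs := (Set.finite_range x).insert (aeval x b)⁻¹
    exact ⟨hfs.toFinset, by rw [Set.Finite.coe_toFinset]⟩
  have hff : f.toRingHom.FiniteType := by
    have h1 : (f.toRingHom.comp (algebraMap C (MvPolynomial s C))).FiniteType := by
      have : f.toRingHom.comp (algebraMap C (MvPolynomial s C)) = algebraMap C B := f.comp_algebraMap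
      rw [this]
      exact RingHom.finiteType_algebraMap.2 hBft
    exact RingHom.FiniteType.of_comp_finiteType h1
  have hfp : f.toRingHom.FinitePresentation := RingHom.FinitePresentation.of_finiteType.1 hff
  obtain ⟨h, hh0, hh⟩ := exists_basicOpen_subset_range_comap hfp hfinj
  refine ⟨h, hh0, fun a ha => ?_⟩
  set P : Ideal (MvPolynomial s C) := RingHom.ker (eval a) with hP
  have hPp : P.IsPrime := RingHom.ker_isPrime _
  have hPm : P.IsMaximal := RingHom.ker_isMaximal_of_surjective _ fun c => ⟨MvPolynomial.C c, by simp⟩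
  obtain ⟨Q, hQ, hQP⟩ := hh P hPp (fun hc => ha (by simpa [hP, RingHom.mem_ker] using hc))
  obtain ⟨M, hM, hQM⟩ := Q.exists_le_maximal hQ.ne_top
  have hMP : M.comap f.toRingHom = P := by
    refine (hPm.eq_of_le (Ideal.comap_ne_top _ hM.ne_top) ?_).symm
    rw [← hQP]
    exact Ideal.comap_mono hQM
  let _ : Field (B ⧸ M) := Ideal.Quotient.field M
  have hft : Algebra.FiniteType C (B ⧸ M) :=
    Algebra.FiniteType.of_surjective (Ideal.Quotient.mkₐ C M) (Ideal.Quotient.mkₐ_surjective C M)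
  have hfin := finite_of_finite_type_of_isJacobsonRing C (B ⧸ M)
  have hbij : Function.Bijective (algebraMap C (B ⧸ M)) := IsAlgClosed.algebraMap_bijective_of_isIntegral
  choose y hy using fun i => hbij.2 (Ideal.Quotient.mk M (xB i))
  have hev : ∀ p : MvPolynomial ι C,
      algebraMap C (B ⧸ M) (eval y p) = Ideal.Quotient.mk M (aeval xB p) := by
    intro p
    have h2 : (fun i => algebraMap C (B ⧸ M) (y i)) = fun i => Ideal.Quotient.mkₐ C M (xB i) :=
      funext hy
    have h3 := MvPolynomial.aeval_algebraMap_apply (B ⧸ M) y p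
    have h4 := comp_aeval_apply (f := xB) (Ideal.Quotient.mkₐ C M) p
    rw [← h2] at h4
    rw [aeval_eq_eval] at h3
    exact h3.symm.trans h4.symm
  refine ⟨y, fun i => ?_, fun p hp => ?_, fun hc => ?_⟩
  · have h1 : X i - MvPolynomial.C (a i) ∈ M.comap f.toRingHom := by
      rw [hMP, hP, RingHom.mem_ker]; simp
    have h2 : xB i - algebraMap C B (a i) ∈ M := by
      have : f.toRingHom (X i - MvPolynomial.C (a i)) = xB i - algebraMap C B (a i) := by
        change f (X i - MvPolynomial.C (a i)) = _
        rw [map_sub]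
        simp [f]
      rw [← this]; exact h1
    apply hbij.1
    rw [hy]
    exact Ideal.Quotient.eq.2 h2
  · apply hbij.1
    have : aeval xB p = 0 := Subtype.ext (by rw [hval, hp]; rfl)
    rw [hev, this, map_zero, map_zero]
  · have h1 : aeval xB b ∈ M := by
      rw [← Ideal.Quotient.eq_zero_iff_mem, ← hev, hc, map_zero]
    apply hM.ne_top
    rw [Ideal.eq_top_iff_one]
    have h2 : (⟨_, hbB⟩ : B) * aeval xB b = 1 := Subtype.ext (by
      rw [MulMemClass.coe_mul, hval]; exact inv_mul_cancel₀ hb)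
    rw [← h2]
    exact M.mul_mem_left _ h1

end

section

open MvPolynomial

/-- A value of a polynomial at a tuple algebraic over some of its independent coordinates divides a
nonzero polynomial in these coordinates. -/
lemma exists_mvPolynomial_eq_mul {C K ι : Type*} [Field C] [Field K] [Algebra C K] {ξ : ι → K}
    {s : Set ι} (hs : AlgebraicIndepOn C ξ s)
    (halg : ∀ k, IsAlgebraic (Algebra.adjoin C (ξ '' s)) (ξ k)) {p : MvPolynomial ι C}
    (hp : aeval ξ p ≠ 0) :
    ∃ (r : MvPolynomial s C) (g : MvPolynomial ι C), r ≠ 0 ∧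
      aeval ξ (rename (↑) r) = aeval ξ (p * g) := by
  let S : Subalgebra C K := (aeval ξ : MvPolynomial ι C →ₐ[C] K).range
  let f : MvPolynomial s C →ₐ[C] S := (aeval ξ).rangeRestrict.comp (rename (↑))
  have hf : ∀ r, ((f r : S) : K) = aeval (fun i : s => ξ i) r := fun r => by
    change aeval ξ (rename _ r) = _
    rw [aeval_rename]; rfl
  let _ : Algebra (MvPolynomial s C) S := f.toRingHom.toAlgebra
  let _ : Algebra (MvPolynomial s C) K := (aeval (fun i : s => ξ i)).toRingHom.toAlgebra
  have ht : IsScalarTower (MvPolynomial s C) S K := IsScalarTower.of_algebraMap_eq fun r => (hf r).symm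
  have hinj : Function.Injective (algebraMap (MvPolynomial s C) K) := hs
  have hfs : FaithfulSMul (MvPolynomial s C) K := (faithfulSMul_iff_algebraMap_injective _ _).2 hinj
  have hk : ∀ k, IsAlgebraic (MvPolynomial s C) (ξ k) := by
    intro k
    have hmem : ∀ r : MvPolynomial s C, aeval (fun i : s => ξ i) r ∈ Algebra.adjoin C (ξ '' s) := by
      intro r
      have h0 := AlgHom.mem_range_self (aeval (fun i : s => ξ i)) r
      rw [← Algebra.adjoin_range_eq_range_aeval] at h0
      rwa [Set.image_eq_range]
    let e : MvPolynomial s C →+* Algebra.adjoin C (ξ '' s) :=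
      ((aeval (fun i : s => ξ i)).codRestrict (Algebra.adjoin C (ξ '' s)) hmem).toRingHom
    have he : Function.Surjective e := by
      rintro ⟨y, hy⟩
      have h1 : y ∈ (aeval (fun i : s => ξ i) : MvPolynomial s C →ₐ[C] K).range := by
        rw [← Algebra.adjoin_range_eq_range_aeval]
        rwa [Set.image_eq_range] at hy
      obtain ⟨r, hr⟩ := h1
      exact ⟨r, Subtype.ext hr⟩
    obtain ⟨P, hP0, hP⟩ := halg k
    obtain ⟨P', hP'⟩ := Polynomial.map_surjective e he P
    refine ⟨P', fun h => hP0 (by rw [← hP', h, Polynomial.map_zero]), ?_⟩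
    rw [← hP', Polynomial.aeval_def, Polynomial.eval₂_map] at hP
    rw [Polynomial.aeval_def]
    exact hP
  have hpa : ∀ q : MvPolynomial ι C,
      aeval ξ q ∈ Subalgebra.algebraicClosure (MvPolynomial s C) K := by
    intro q
    induction q using MvPolynomial.induction_on with
    | C a =>
      have : aeval ξ (MvPolynomial.C a : MvPolynomial ι C)
          = algebraMap (MvPolynomial s C) K (MvPolynomial.C a) := by
        change _ = aeval (fun i : s => ξ i) (MvPolynomial.C a)
        rw [aeval_C, aeval_C]
      rw [this]
      exact Subalgebra.algebraMap_mem _ _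
    | add p q hp hq => rw [map_add]; exact add_mem hp hq
    | mul_X p n hp => rw [map_mul, aeval_X]; exact mul_mem hp (hk n)
  let fS : S := ⟨aeval ξ p, p, rfl⟩
  have hfS : IsAlgebraic (MvPolynomial s C) fS :=
    (isAlgebraic_algebraMap_iff (FaithfulSMul.algebraMap_injective S K)).1 (hpa p)
  obtain ⟨r, hr0, ⟨_, g, rfl⟩, hg⟩ := hfS.exists_nonzero_dvd
    (mem_nonZeroDivisors_of_ne_zero fun h => hp (congrArg Subtype.val h))
  refine ⟨r, g, hr0, ?_⟩
  have := congrArg Subtype.val hg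
  rw [map_mul]
  exact this

end

section

open MvPolynomial

/-- `ξ` is a generic point of (the Zariski closure of) `Z`. -/
def IsGenericPt {ι K : Type*} [Field K] [Algebra ℂ K] (ξ : ι → K) (Z : Set (ι → ℂ)) : Prop :=
  ∀ p : MvPolynomial ι ℂ, aeval ξ p = 0 ↔ p ∈ vanishingIdeal ℂ Z

lemma exists_isGenericPt {ι : Type} {Z : Set (ι → ℂ)} (hZ : IsIrr Z) :
    ∃ (K : Type) (_ : Field K) (_ : Algebra ℂ K) (ξ : ι → K), IsGenericPt ξ Z := by
  have := isIrr_iff_isPrime.1 hZ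
  let A := MvPolynomial ι ℂ ⧸ vanishingIdeal ℂ Z
  refine ⟨FractionRing A, inferInstance, inferInstance,
    fun i => algebraMap A (FractionRing A) (Ideal.Quotient.mk _ (X i)), fun p => ?_⟩
  have h0 := MvPolynomial.aeval_algebraMap_apply (FractionRing A)
    (fun i => (Ideal.Quotient.mk (vanishingIdeal ℂ Z) (X i) : A)) p
  change aeval (algebraMap A (FractionRing A) ∘ fun i =>
    (Ideal.Quotient.mk (vanishingIdeal ℂ Z) (X i) : A)) p = 0 ↔ _
  rw [h0, FaithfulSMul.algebraMap_eq_zero_iff, ← Ideal.Quotient.eq_zero_iff_mem]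
  have h := comp_aeval_apply (f := (X : ι → MvPolynomial ι ℂ))
    (Ideal.Quotient.mkₐ ℂ (vanishingIdeal ℂ Z)) p
  rw [aeval_X_left_apply] at h
  have h' : Ideal.Quotient.mk (vanishingIdeal ℂ Z) p
    = aeval (fun i => Ideal.Quotient.mk (vanishingIdeal ℂ Z) (X i)) p := h
  rw [h']

/-- The coordinates in `s` are algebraically independent as functions on `Z`. -/
def IndepOn {ι : Type*} (Z : Set (ι → ℂ)) (s : Set ι) : Prop :=
  ∀ p : MvPolynomial s ℂ, (∀ z ∈ Z, eval (fun i : s => z i) p = 0) → p = 0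

section

variable {ι : Type*}

lemma IndepOn.mono {Z Z' : Set (ι → ℂ)} {s : Set ι} (h : IndepOn Z s) (hZ : Z ⊆ Z') :
    IndepOn Z' s := fun p hp => h p fun z hz => hp z (hZ hz)

lemma IndepOn.subset {Z : Set (ι → ℂ)} {s t : Set ι} (h : IndepOn Z s) (hts : t ⊆ s) :
    IndepOn Z t := fun p hp => by
  have h1 := h (rename (Set.inclusion hts) p) fun z hz => by
    rw [eval_rename]; exact hp z hz
  exact rename_injective _ (Set.inclusion_injective hts) (by rw [h1, map_zero])

lemma indepOn_zcl {Z : Set (ι → ℂ)} {s : Set ι} (h : IndepOn (zcl Z) s) : IndepOn Z s :=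
  fun p hp => h p fun z hz => by
    have h1 : rename (↑) p ∈ vanishingIdeal ℂ Z := mem_vanishingIdeal.2 fun x hx => by
      rw [eval_rename]; exact hp x hx
    rw [← vanishingIdeal_zcl] at h1
    have := mem_vanishingIdeal.1 h1 z hz
    rwa [eval_rename] at this

lemma IsGenericPt.algebraicIndepOn_iff {K : Type*} [Field K] [Algebra ℂ K] {ξ : ι → K}
    {Z : Set (ι → ℂ)} (hξ : IsGenericPt ξ Z) {s : Set ι} :
    AlgebraicIndepOn ℂ ξ s ↔ IndepOn Z s := by
  have h1 : ∀ p : MvPolynomial s ℂ, aeval (fun i : s => ξ i) p = 0 ↔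
      ∀ z ∈ Z, eval (fun i : s => z i) p = 0 := fun p => by
    have := hξ (rename (↑) p)
    rw [aeval_rename, mem_vanishingIdeal] at this
    simp only [eval_rename] at this
    exact this
  rw [AlgebraicIndepOn, algebraicIndependent_iff]
  exact forall_congr' fun p => imp_congr (h1 p) Iff.rfl

lemma IndepOn.nonempty {Z : Set (ι → ℂ)} {s : Set ι} (h : IndepOn Z s) : Z.Nonempty := by
  by_contra hc
  rw [Set.not_nonempty_iff_eq_empty] at hc
  exact one_ne_zero (h 1 (by simp [hc]))

lemma IndepOn.exists_irrComp [Finite ι] {A : Set (ι → ℂ)} {s : Set ι} (h : IndepOn A s) :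
    ∃ Y, IsIrrCompOf Y A ∧ IndepOn Y s := by
  by_contra! hc
  have hc' : ∀ Y : {Y | IsIrrCompOf Y A}, ∃ p : MvPolynomial s ℂ,
      (∀ z ∈ Y.1, eval (fun i : s => z i) p = 0) ∧ p ≠ 0 := fun Y => by
    have := hc Y.1 Y.2
    rw [IndepOn] at this
    push Not at this
    exact this
  choose p hp hp0 using hc'
  have := (finite_irrComps A).fintype
  refine Finset.prod_ne_zero_iff.2 (fun Y _ => hp0 Y) (h (∏ Y, p Y) fun z hz => ?_)
  obtain ⟨Y, hY, hzY⟩ := subset_iUnion_irrComps A (subset_zcl A hz)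
  rw [map_prod]
  exact Finset.prod_eq_zero (Finset.mem_univ ⟨Y, hY⟩) (hp ⟨Y, hY⟩ z hzY)

end

section

variable {ι : Type} [Fintype ι]

/-- A strictly larger irreducible algebraic set has more independent coordinates. -/
lemma exists_indepOn_card_lt {Z Z' : Set (ι → ℂ)} (hZ : IsAlgSet Z)
    (hZ' : IsIrr Z') (hlt : Z ⊂ Z') {s : Finset ι} (hs : IndepOn Z (s : Set ι)) :
    ∃ s' : Finset ι, IndepOn Z' (s' : Set ι) ∧ s.card < s'.card := by
  classical
  by_contra! hc
  obtain ⟨K, _, _, ξ, hξ⟩ := exists_isGenericPt hZ'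
  have hs' := hξ.algebraicIndepOn_iff.2 (hs.mono hlt.1)
  have halg : ∀ k, IsAlgebraic (Algebra.adjoin ℂ (ξ '' (s : Set ι))) (ξ k) := by
    intro k
    by_contra hk
    by_cases hks : k ∈ s
    · exact hk (isAlgebraic_algebraMap
        (⟨ξ k, Algebra.subset_adjoin ⟨k, hks, rfl⟩⟩ : Algebra.adjoin ℂ (ξ '' (s : Set ι))))
    · have h1 : AlgebraicIndepOn ℂ ξ (insert k (s : Set ι)) :=
        (AlgebraicIndepOn.insert_iff (by simpa using hks)).2 ⟨hs', hk⟩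
      have h2 := hc (insert k s) (by
        rw [Finset.coe_insert]; exact hξ.algebraicIndepOn_iff.1 h1)
      rw [Finset.card_insert_of_notMem hks] at h2
      omega
  obtain ⟨p, hp, hp'⟩ : ∃ p ∈ vanishingIdeal ℂ Z, p ∉ vanishingIdeal ℂ Z' := by
    by_contra! h
    apply hlt.2
    rw [← hZ.zeroLocus_vanishingIdeal]
    exact (zeroLocus_vanishingIdeal_le Z').trans (zeroLocus_anti_mono h)
  obtain ⟨r, g, hr0, hrg⟩ := exists_mvPolynomial_eq_mul hs' halg (fun h => hp' ((hξ p).1 h))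
  apply hr0
  refine hs r fun z hz => ?_
  have h1 : rename (↑) r - p * g ∈ vanishingIdeal ℂ Z' := (hξ _).1 (by rw [map_sub, hrg, sub_self])
  have h2 := mem_vanishingIdeal.1 h1 z (hlt.1 hz)
  rw [map_sub, map_mul, mem_vanishingIdeal.1 hp z hz, zero_mul, sub_zero, eval_rename] at h2
  exact h2

lemma exists_indepOn_erase {Z : Set (ι → ℂ)} (hZ : IsAlgSet Z) (hZi : IsIrr Z) {s : Finset ι}
    (hs : IndepOn Z (s : Set ι)) {i : ι} (hi : i ∈ s) :
    ∃ Q, IsAlgSet Q ∧ IsIrr Q ∧ Q ⊂ Z ∧ ∃ t : Finset ι, IndepOn Q (t : Set ι) ∧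
      t.card + 1 = s.card := by
  classical
  obtain ⟨K, _, _, ξ, hξ⟩ := exists_isGenericPt hZi
  have hs' := hξ.algebraicIndepOn_iff.2 hs
  obtain ⟨h, hh0, hh⟩ := exists_generic_lift ξ hs' (b := 1) (by simp)
  obtain ⟨a₀, ha₀⟩ : ∃ a₀, eval a₀ h ≠ 0 := by
    by_contra! hc
    exact hh0 (MvPolynomial.funext fun a => by rw [hc a, map_zero])
  let i' : (s : Set ι) := ⟨i, hi⟩
  set c := a₀ i' with hc
  set A : Set (ι → ℂ) := Z ∩ {x | eval x (X i - MvPolynomial.C c) = 0} with hA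
  have hAalg : IsAlgSet A := hZ.inter (isAlgSet_setOf_eval _)
  have hAi : IndepOn A ((s.erase i : Finset ι) : Set ι) := by
    intro p hp
    let φ : ↥(s : Set ι) → MvPolynomial ((s.erase i : Finset ι) : Set ι) ℂ := fun k =>
      if hk : (k : ι) = i then MvPolynomial.C c else
        X ⟨k, Finset.mem_coe.2 (Finset.mem_erase.2 ⟨hk, k.2⟩)⟩
    let ext : (((s.erase i : Finset ι) : Set ι) → ℂ) → ↥(s : Set ι) → ℂ := fun a k =>
      if hk : (k : ι) = i then c else a ⟨k, Finset.mem_coe.2 (Finset.mem_erase.2 ⟨hk, k.2⟩)⟩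
    have hφ : ∀ a, eval a (bind₁ φ h) = eval (ext a) h := fun a => by
      rw [eval_bind₁]
      congr 2
      funext k
      by_cases hk : (k : ι) = i <;> simp [φ, ext, hk]
    have h1 : p * bind₁ φ h = 0 := by
      refine MvPolynomial.funext fun a => ?_
      rw [map_zero, map_mul, hφ, mul_eq_zero]
      by_contra! hne
      obtain ⟨y, hy1, hy2, -⟩ := hh (ext a) hne.2
      have hyZ : y ∈ Z := by
        rw [← hZ.zeroLocus_vanishingIdeal, mem_zeroLocus]
        exact fun p hp => hy2 p ((hξ p).2 hp)
      have hyc : y i = c := by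
        rw [hy1 i']; simp [ext, i']
      apply hne.1
      rw [← hp y ⟨hyZ, by simp [hyc]⟩]
      congr 2
      funext k
      have hk := Finset.mem_erase.1 (Finset.mem_coe.1 k.2)
      rw [hy1 ⟨k, hk.2⟩]
      simp [ext, hk.1]
    refine (mul_eq_zero.1 h1).resolve_right fun h2 => ha₀ ?_
    have h3 := hφ (fun k => a₀ ⟨k, Finset.mem_of_mem_erase k.2⟩)
    rw [h2, map_zero] at h3
    rw [h3]
    congr 2
    funext k
    by_cases hk : (k : ι) = i
    · have : k = i' := Subtype.ext hk
      subst this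
      simp [ext, i', hc]
    · simp [ext, hk]
  obtain ⟨Q, hQ, hQi⟩ := hAi.exists_irrComp
  have hQA : Q ⊆ A := hAalg.zcl_eq ▸ hQ.2.2.1
  refine ⟨Q, hQ.1, hQ.2.1, ⟨hQA.trans Set.inter_subset_left, fun hZQ => ?_⟩, s.erase i, hQi,
    Finset.card_erase_add_one hi⟩
  have h1 := hs (X i' - MvPolynomial.C c) fun z hz => by
    have := (hQA (hZQ hz)).2
    simpa using this
  have h2 := congrArg (eval fun _ => c + 1) h1
  simp at h2

end

end

section

open MvPolynomial

variable {ι : Type} [Fintype ι]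

lemma exists_chain_of_indepOn (k : ℕ) : ∀ {Z : Set (ι → ℂ)}, IsAlgSet Z → IsIrr Z →
    ∀ {s : Finset ι}, IndepOn Z (s : Set ι) → s.card = k →
    ∃ c : Fin (k + 1) → Set (ι → ℂ), StrictMono c ∧ (∀ i, IsAlgSet (c i) ∧ IsIrr (c i)) ∧
      c (Fin.last k) = Z := by
  induction k with
  | zero =>
    intro Z hZ hZi s _ _
    exact ⟨fun _ => Z, fun a b hab => absurd hab (by omega), fun _ => ⟨hZ, hZi⟩, rfl⟩
  | succ k ih =>
    intro Z hZ hZi s hs hsk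
    obtain ⟨i, hi⟩ : s.Nonempty := Finset.card_pos.1 (by omega)
    obtain ⟨Q, hQ, hQi, hQZ, t, ht, htk⟩ := exists_indepOn_erase hZ hZi hs hi
    obtain ⟨c, hc, hci, hcQ⟩ := ih hQ hQi ht (by omega)
    refine ⟨Fin.snoc c Z, ?_, ?_, Fin.snoc_last _ _⟩
    · rw [Fin.strictMono_iff_lt_succ]
      intro l
      induction l using Fin.lastCases with
      | last => rw [Fin.succ_last, Fin.snoc_last, Fin.snoc_castSucc, hcQ]; exact hQZ
      | cast l =>
        rw [Fin.succ_castSucc, Fin.snoc_castSucc, Fin.snoc_castSucc]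
        exact hc (Fin.castSucc_lt_succ)
    · intro l
      induction l using Fin.lastCases with
      | last => rw [Fin.snoc_last]; exact ⟨hZ, hZi⟩
      | cast l => rw [Fin.snoc_castSucc]; exact hci l

lemma exists_indepOn_of_chain {k : ℕ} {c : Fin (k + 1) → Set (ι → ℂ)} (hc : StrictMono c)
    (hci : ∀ i, IsAlgSet (c i) ∧ IsIrr (c i)) (i : Fin (k + 1)) :
    ∃ s : Finset ι, IndepOn (c i) (s : Set ι) ∧ (i : ℕ) ≤ s.card := by
  induction i using Fin.induction with
  | zero =>
    refine ⟨∅, fun p hp => ?_, by simp⟩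
    obtain ⟨z, hz⟩ := (hci 0).2.1
    refine MvPolynomial.funext fun a => ?_
    rw [map_zero, ← hp z hz]
    congr 2
    funext l
    simpa using l.2
  | succ i ih =>
    obtain ⟨s, hs, hsi⟩ := ih
    obtain ⟨s', hs', hlt⟩ := exists_indepOn_card_lt (hci _).1 (hci _).2
      (hc (Fin.castSucc_lt_succ (i := i))) hs
    exact ⟨s', hs', by simp only [Fin.val_succ, Fin.val_castSucc] at *; omega⟩

lemma adim_bddAbove (A : Set (ι → ℂ)) :
    BddAbove {k : ℕ | ∃ c : Fin (k + 1) → Set (ι → ℂ), StrictMono c ∧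
      ∀ i, IsAlgSet (c i) ∧ IsIrr (c i) ∧ c i ⊆ zcl A} := by
  refine ⟨Fintype.card ι, ?_⟩
  rintro k ⟨c, hc, hci⟩
  obtain ⟨s, -, hs⟩ := exists_indepOn_of_chain hc (fun i => ⟨(hci i).1, (hci i).2.1⟩) (Fin.last k)
  exact hs.trans s.card_le_univ

lemma IndepOn.card_le_adim {A : Set (ι → ℂ)} {s : Finset ι} (h : IndepOn A (s : Set ι)) :
    s.card ≤ adim A := by
  obtain ⟨Y, hY, hYs⟩ := h.exists_irrComp
  obtain ⟨c, hc, hci, hcY⟩ := exists_chain_of_indepOn s.card hY.1 hY.2.1 hYs rfl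
  refine le_csSup (adim_bddAbove A) ⟨c, hc, fun i => ⟨(hci i).1, (hci i).2, ?_⟩⟩
  refine Set.Subset.trans ?_ hY.2.2.1
  rw [← hcY]
  exact hc.monotone (Fin.le_last i)

lemma exists_indepOn_card_eq_adim {A : Set (ι → ℂ)} (hA : A.Nonempty) :
    ∃ s : Finset ι, IndepOn A (s : Set ι) ∧ s.card = adim A := by
  have hne : {k : ℕ | ∃ c : Fin (k + 1) → Set (ι → ℂ), StrictMono c ∧
      ∀ i, IsAlgSet (c i) ∧ IsIrr (c i) ∧ c i ⊆ zcl A}.Nonempty := by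
    obtain ⟨x, hx⟩ := hA
    obtain ⟨Y, hY, -⟩ := subset_iUnion_irrComps A (subset_zcl A hx)
    exact ⟨0, fun _ => Y, fun a b hab => absurd hab (by omega), fun _ => ⟨hY.1, hY.2.1, hY.2.2.1⟩⟩
  obtain ⟨c, hc, hci⟩ := Nat.sSup_mem hne (adim_bddAbove A)
  obtain ⟨s, hs, hsk⟩ := exists_indepOn_of_chain hc (fun i => ⟨(hci i).1, (hci i).2.1⟩) (Fin.last _)
  have hs' : IndepOn A (s : Set ι) := indepOn_zcl (hs.mono (hci _).2.2)
  exact ⟨s, hs', le_antisymm hs'.card_le_adim hsk⟩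

lemma adim_mono_zcl {A B : Set (ι → ℂ)} (h : A ⊆ zcl B) : adim A ≤ adim B := by
  rcases A.eq_empty_or_nonempty with rfl | hA
  · have : adim (∅ : Set (ι → ℂ)) = 0 := by
      rw [adim, IsAlgSet.empty.zcl_eq]
      have h0 : {k : ℕ | ∃ c : Fin (k + 1) → Set (ι → ℂ), StrictMono c ∧
          ∀ i, IsAlgSet (c i) ∧ IsIrr (c i) ∧ c i ⊆ ∅} = ∅ := by
        refine Set.eq_empty_iff_forall_notMem.2 ?_
        rintro k ⟨c, -, hc⟩
        obtain ⟨x, hx⟩ := (hc 0).2.1.1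
        exact (hc 0).2.2 hx
      rw [h0]
      simp
    omega
  · obtain ⟨s, hs, hsk⟩ := exists_indepOn_card_eq_adim hA
    rw [← hsk]
    exact (indepOn_zcl (hs.mono h)).card_le_adim

lemma adim_mono {A B : Set (ι → ℂ)} (h : A ⊆ B) : adim A ≤ adim B :=
  adim_mono_zcl (h.trans (subset_zcl B))

lemma adim_lt_of_ssubset {Z Z' : Set (ι → ℂ)} (hZ : IsAlgSet Z) (hne : Z.Nonempty)
    (hZ' : IsIrr Z') (h : Z ⊂ Z') : adim Z < adim Z' := by
  obtain ⟨s, hs, hsk⟩ := exists_indepOn_card_eq_adim hne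
  obtain ⟨s', hs', hlt⟩ := exists_indepOn_card_lt hZ hZ' h hs
  exact hsk ▸ hlt.trans_le hs'.card_le_adim

lemma adim_zcl (A : Set (ι → ℂ)) : adim (zcl A) = adim A :=
  le_antisymm (adim_mono_zcl Set.Subset.rfl) (adim_mono (subset_zcl A))

end

section

open MvPolynomial

/-- The points which, on each class of `r`, agree with some point of `X`. -/
def mix {ι : Type*} (r : Setoid ι) (X : Set (ι → ℂ)) : Set (ι → ℂ) :=
  {y | ∀ c : Quotient r, ∃ x ∈ X, ∀ i, (⟦i⟧ : Quotient r) = c → y i = x i}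

lemma subset_mix {ι : Type*} (r : Setoid ι) (X : Set (ι → ℂ)) : X ⊆ mix r X :=
  fun x hx _ => ⟨x, hx, fun _ _ => rfl⟩

lemma mix_mono {ι : Type*} (r : Setoid ι) {X Y : Set (ι → ℂ)} (h : X ⊆ Y) : mix r X ⊆ mix r Y :=
  fun _ hy c => let ⟨x, hx, hxy⟩ := hy c; ⟨x, h hx, hxy⟩

lemma mix_anti {ι : Type*} {r r' : Setoid ι} (h : r ≤ r') (X : Set (ι → ℂ)) :
    mix r' X ⊆ mix r X := by
  intro y hy c
  induction c using Quotient.inductionOn with | _ k => ?_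
  obtain ⟨x, hx, hxy⟩ := hy ⟦k⟧
  exact ⟨x, hx, fun i hi => hxy i (Quotient.sound (h (Quotient.exact hi)))⟩

/-- A power of an irreducible set is irreducible for separately algebraic conditions. -/
lemma IsIrr.pi {ι Q : Type*} [Finite Q] [DecidableEq Q] {X : Set (ι → ℂ)} (hX : IsIrr X)
    {V W : Set (Q → ι → ℂ)} (hV : ∀ f c, IsAlgSet {w | Function.update f c w ∈ V})
    (hW : ∀ f c, IsAlgSet {w | Function.update f c w ∈ W})
    (h : ∀ f, (∀ c, f c ∈ X) → f ∈ V ∪ W) :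
    (∀ f, (∀ c, f c ∈ X) → f ∈ V) ∨ ∀ f, (∀ c, f c ∈ X) → f ∈ W := by
  have := Fintype.ofFinite Q
  have key : ∀ A : Finset Q, ∀ f : Q → ι → ℂ, (∀ c, f c ∈ X) →
      (∀ g, (∀ c, g c ∈ X) → (∀ c ∉ A, g c = f c) → g ∈ V) ∨
      (∀ g, (∀ c, g c ∈ X) → (∀ c ∉ A, g c = f c) → g ∈ W) := by
    intro A
    induction A using Finset.induction_on with
    | empty =>
      intro f hf
      have h1 : ∀ g : Q → ι → ℂ, (∀ c ∉ (∅ : Finset Q), g c = f c) → g = f :=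
        fun g hg => funext fun c => hg c (Finset.notMem_empty c)
      rcases h f hf with h2 | h2
      · exact Or.inl fun g _ hg => h1 g hg ▸ h2
      · exact Or.inr fun g _ hg => h1 g hg ▸ h2
    | insert c A hc ih =>
      intro f hf
      let N : Set (Q → ι → ℂ) := {g | (∀ c, g c ∈ X) ∧ ∀ d ∉ insert c A, g d = f d}
      have hup : ∀ g : Q → ι → ℂ, g ∈ N → ∀ w ∈ X, (∀ d, Function.update g c w d ∈ X) ∧
          ∀ d ∉ A, Function.update g c w d = Function.update f c w d := by
        intro g hg w hw
        constructor <;> intro d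
        · by_cases hd : d = c
          · subst hd; simpa using hw
          · simpa [hd] using hg.1 d
        · intro hdA
          by_cases hd : d = c
          · subst hd; simp
          · simpa [hd] using hg.2 d (by simp [hd, hdA])
      have hcov : X ⊆ (⋂ g : N, {w | Function.update g.1 c w ∈ V}) ∪
          ⋂ g : N, {w | Function.update g.1 c w ∈ W} := by
        intro w hw
        have hfw : ∀ d, Function.update f c w d ∈ X := (hup f ⟨hf, fun _ _ => rfl⟩ w hw).1
        rcases ih _ hfw with h2 | h2
        · exact Or.inl (Set.mem_iInter.2 fun g => h2 _ (hup g.1 g.2 w hw).1 (hup g.1 g.2 w hw).2)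
        · exact Or.inr (Set.mem_iInter.2 fun g => h2 _ (hup g.1 g.2 w hw).1 (hup g.1 g.2 w hw).2)
      rcases hX.2 _ _ (IsAlgSet.iInter fun g : N => hV g.1 c)
          (IsAlgSet.iInter fun g : N => hW g.1 c) hcov
        with h2 | h2
      · refine Or.inl fun g hg hgf => ?_
        have := Set.mem_iInter.1 (h2 (hg c)) ⟨g, hg, hgf⟩
        simpa using this
      · refine Or.inr fun g hg hgf => ?_
        have := Set.mem_iInter.1 (h2 (hg c)) ⟨g, hg, hgf⟩
        simpa using this
  obtain ⟨x, hx⟩ := hX.1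
  rcases key Finset.univ (fun _ => x) (fun _ => hx) with h2 | h2
  · exact Or.inl fun f hf => h2 f hf fun c hc => absurd (Finset.mem_univ c) hc
  · exact Or.inr fun f hf => h2 f hf fun c hc => absurd (Finset.mem_univ c) hc

lemma IsIrr.mix {ι : Type*} [Finite ι] (r : Setoid ι) {X : Set (ι → ℂ)} (hX : IsIrr X) :
    IsIrr (mix r X) := by
  classical
  refine ⟨hX.1.mono (subset_mix r X), fun V W hV hW h => ?_⟩
  let μ : (Quotient r → ι → ℂ) → ι → ℂ := fun f i => f ⟦i⟧ i
  have hsep : ∀ V : Set (ι → ℂ), IsAlgSet V → ∀ (f : Quotient r → ι → ℂ) c,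
      IsAlgSet {w | Function.update f c w ∈ μ ⁻¹' V} := by
    intro V hV f c
    convert hV.preimage (fun i => if (⟦i⟧ : Quotient r) = c then MvPolynomial.X i else C (f ⟦i⟧ i)) using 1
    ext w
    simp only [Set.mem_preimage, Set.mem_setOf_eq]
    have : μ (Function.update f c w) = fun k =>
        eval w (if (⟦k⟧ : Quotient r) = c then MvPolynomial.X k else C (f ⟦k⟧ k)) := by
      funext k
      by_cases hk : (⟦k⟧ : Quotient r) = c
      · simp [μ, hk]
      · simp [μ, hk]
    rw [this]
  have hmix : ∀ y ∈ ModularJPaper.mix r X, ∃ f : Quotient r → ι → ℂ, (∀ c, f c ∈ X) ∧ μ f = y := by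
    intro y hy
    choose f hf hfy using hy
    exact ⟨f, hf, funext fun i => (hfy _ i rfl).symm⟩
  have hmix' : ∀ f : Quotient r → ι → ℂ, (∀ c, f c ∈ X) → μ f ∈ ModularJPaper.mix r X :=
    fun f hf c => ⟨f c, hf c, fun i hi => by simp [μ, hi]⟩
  rcases hX.pi (hsep V hV) (hsep W hW) (fun f hf => h (hmix' f hf)) with h1 | h1
  · left
    intro y hy
    obtain ⟨f, hf, rfl⟩ := hmix y hy
    exact h1 f hf
  · right
    intro y hy
    obtain ⟨f, hf, rfl⟩ := hmix y hy
    exact h1 f hf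

lemma NoConstCoord.infinite_image {ι : Type*} {X : Set (ι → ℂ)} (hX : IsIrr X)
    (h : NoConstCoord X) (i : ι) : ((fun x : ι → ℂ => x i) '' X).Infinite := by
  intro hfin
  have := hfin.fintype
  obtain ⟨c, hc⟩ := hX.subset_of_iUnion
    (V := fun c : (fun x : ι → ℂ => x i) '' X => {x | eval x (MvPolynomial.X i - C c.1) = 0})
    (fun c => isAlgSet_setOf_eval _) (fun x hx => Set.mem_iUnion.2 ⟨⟨x i, x, hx, rfl⟩, by simp⟩)
  obtain ⟨v, hv, hvc⟩ := h i c.1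
  have := hc hv
  simp only [map_sub, eval_X, eval_C, Set.mem_setOf_eq, sub_eq_zero] at this
  exact hvc this

lemma NoConstCoord.mono {ι : Type*} {X Y : Set (ι → ℂ)} (h : NoConstCoord X) (hXY : X ⊆ Y) :
    NoConstCoord Y := fun i c => let ⟨v, hv, hvc⟩ := h i c; ⟨v, hXY hv, hvc⟩

lemma indepOn_mix {ι : Type*} (r : Setoid ι) {X : Set (ι → ℂ)} (hX : IsIrr X)
    (h : NoConstCoord X) : IndepOn (mix r X) (Set.range (Quotient.out : Quotient r → ι)) := by
  intro p hp
  refine MvPolynomial.funext_set (fun i => (fun x : ι → ℂ => x i) '' X)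
    (fun i => h.infinite_image hX i) fun a ha => ?_
  rw [map_zero]
  have ha' : ∀ i : Set.range (Quotient.out : Quotient r → ι), ∃ x ∈ X, x (i : ι) = a i :=
    fun i => ha i (Set.mem_univ i)
  choose f hf hfa using ha'
  let y : ι → ℂ := fun i => f ⟨_, ⟨(⟦i⟧ : Quotient r), rfl⟩⟩ i
  have hy : y ∈ mix r X := fun c => ⟨_, hf ⟨_, ⟨c, rfl⟩⟩, fun i hi => by subst hi; rfl⟩
  rw [← hp y hy]
  congr 2
  funext i
  obtain ⟨_, c, rfl⟩ := i
  simp only [y]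
  rw [← hfa]
  congr 2
  simp

lemma card_le_adim_mix {ι : Type} [Fintype ι] (r : Setoid ι) {X : Set (ι → ℂ)} (hX : IsIrr X)
    (h : NoConstCoord X) : Nat.card (Quotient r) ≤ adim (mix r X) := by
  classical
  have := Fintype.ofFinite (Quotient r)
  have h1 := indepOn_mix r hX h
  have h2 : (Set.range (Quotient.out : Quotient r → ι)) =
      ((Finset.univ.image (Quotient.out : Quotient r → ι) : Finset ι) : Set ι) := by simp
  rw [h2] at h1
  have h3 := h1.card_le_adim
  rwa [Finset.card_image_of_injective _ Quotient.out_injective, Finset.card_univ,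
    ← Nat.card_eq_fintype_card] at h3

end

section

open MvPolynomial

/-- The relations `PhiRel j M` are symmetric algebraic correspondences with finite fibres. -/
structure PhiAlg (j : ℂ → ℂ) : Prop where
  alg : ∀ M, 1 ≤ M → ∃ Φ : MvPolynomial (Fin 2) ℂ, ∀ x y, PhiRel j M x y ↔ eval ![x, y] Φ = 0
  fin : ∀ M, 1 ≤ M → ∀ x, {y | PhiRel j M x y}.Finite
  symm : ∀ M, 1 ≤ M → ∀ x y, PhiRel j M x y → PhiRel j M y x

/-- The set cut out by the modular relations in `R`. -/
def phiSet {ι : Type*} (j : ℂ → ℂ) (R : Set (ι × ι × ℕ)) : Set (ι → ℂ) :=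
  {y | ∀ r ∈ R, PhiRel j r.2.2 (y r.1) (y r.2.1)}

/-- The partition of the coordinates generated by `R`. -/
def setoidOf {ι : Type*} (R : Set (ι × ι × ℕ)) : Setoid ι :=
  Relation.EqvGen.setoid fun i k => ∃ M, (i, k, M) ∈ R

/-- The modular relations which hold on `X`. -/
def relsOn {ι : Type*} (j : ℂ → ℂ) (X : Set (ι → ℂ)) : Set (ι × ι × ℕ) :=
  {r | 1 ≤ r.2.2 ∧ ∀ x ∈ X, PhiRel j r.2.2 (x r.1) (x r.2.1)}

/-- The number of classes of coordinates modulo the modular relations which hold on `X`. -/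
def numClasses {ι : Type*} (j : ℂ → ℂ) (X : Set (ι → ℂ)) : ℕ :=
  Nat.card (Quotient (setoidOf (relsOn j X)))

lemma setoidOf_mono {ι : Type*} {R R' : Set (ι × ι × ℕ)} (h : R ⊆ R') :
    setoidOf R ≤ setoidOf R' := by
  intro i k hik
  induction hik with
  | rel i k hik => exact Relation.EqvGen.rel _ _ (hik.imp fun _ hM => h hM)
  | refl i => exact Relation.EqvGen.refl i
  | symm _ _ _ ih => exact Relation.EqvGen.symm _ _ ih
  | trans _ _ _ _ _ h1 h2 => exact Relation.EqvGen.trans _ _ _ h1 h2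

lemma mix_subset_phiSet {ι : Type*} {j : ℂ → ℂ} {R : Set (ι × ι × ℕ)} {X : Set (ι → ℂ)}
    (h : X ⊆ phiSet j R) : mix (setoidOf R) X ⊆ phiSet j R := by
  intro y hy r hr
  obtain ⟨x, hx, hxy⟩ := hy ⟦r.1⟧
  rw [hxy r.1 rfl, hxy r.2.1 (Quotient.sound (Relation.EqvGen.symm _ _
    (Relation.EqvGen.rel _ _ ⟨r.2.2, hr⟩)))]
  exact h hx r hr

lemma PhiAlg.isAlgSet_phiSet {ι : Type*} {j : ℂ → ℂ} (hj : PhiAlg j) {R : Set (ι × ι × ℕ)}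
    (hR : ∀ r ∈ R, 1 ≤ r.2.2) : IsAlgSet (phiSet j R) := by
  have : phiSet j R = ⋂ r : R, {y | PhiRel j r.1.2.2 (y r.1.1) (y r.1.2.1)} := by
    ext y; simp [phiSet]
  rw [this]
  refine IsAlgSet.iInter fun r => ?_
  obtain ⟨Φ, hΦ⟩ := hj.alg r.1.2.2 (hR r.1 r.2)
  refine ⟨{rename ![r.1.1, r.1.2.1] Φ}, ?_⟩
  ext y
  simp only [Set.mem_setOf_eq, Set.mem_singleton_iff, forall_eq, eval_rename, hΦ]
  have : y ∘ ![r.1.1, r.1.2.1] = ![y r.1.1, y r.1.2.1] := by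
    funext i; fin_cases i <;> rfl
  rw [this]

/-- Two coordinates, each a finite-valued function of the other, are dependent. -/
lemma not_indepOn_of_finite {ι : Type} [Finite ι] {Z : Set (ι → ℂ)} (hZ : IsAlgSet Z)
    (hZi : IsIrr Z) {i k : ι} (hik : i ≠ k) (hfin : ∀ a, ((fun x : ι → ℂ => x k) ''
      {x | x ∈ Z ∧ x i = a}).Finite) {s : Set ι} (hi : i ∈ s) (hk : k ∈ s) : ¬ IndepOn Z s := by
  classical
  intro hs
  obtain ⟨K, hK, hA, ξ, hξ⟩ := exists_isGenericPt hZi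
  have hs' := hξ.algebraicIndepOn_iff.2 hs
  obtain ⟨h, hh, hlift⟩ := exists_generic_lift (C := ℂ) ξ hs' (b := 1) (by simp)
  obtain ⟨a, ha⟩ : ∃ a, eval a h ≠ 0 := by
    by_contra hc
    push Not at hc
    exact hh (MvPolynomial.funext fun a => by rw [hc a, map_zero])
  let p : Polynomial ℂ := aeval (fun z : s => if (z : ι) = k then Polynomial.X else Polynomial.C (a z)) h
  have hp : ∀ d, p.eval d = eval (fun z : s => if (z : ι) = k then d else a z) h := by
    intro d
    have := comp_aeval_apply (f := fun z : s => if (z : ι) = k then (Polynomial.X : Polynomial ℂ) else Polynomial.C (a z))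
      (Polynomial.aeval d) h
    rw [← Polynomial.coe_aeval_eq_eval]
    simp only [p]
    refine this.trans ?_
    rw [← coe_aeval_eq_eval]
    simp only [AlgHom.coe_toRingHom]
    congr 2
    funext z
    by_cases hz : (z : ι) = k <;> simp [hz]
  have hp0 : p ≠ 0 := by
    intro h0
    have := hp (a ⟨k, hk⟩)
    rw [h0, Polynomial.eval_zero] at this
    apply ha
    rw [this]
    congr 2
    funext z
    by_cases hz : (z : ι) = k
    · subst hz; simp
    · simp [hz]
  have hsub : (Set.univ : Set ℂ) ⊆ {d | p.IsRoot d} ∪ (fun x : ι → ℂ => x k) ''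
      {x | x ∈ Z ∧ x i = a ⟨i, hi⟩} := by
    intro d _
    by_cases hd : p.eval d = 0
    · exact Or.inl hd
    · rw [hp] at hd
      obtain ⟨y, hy, hyZ, -⟩ := hlift _ hd
      refine Or.inr ⟨y, ⟨?_, ?_⟩, ?_⟩
      · rw [← hZ.zeroLocus_vanishingIdeal, mem_zeroLocus]
        exact fun q hq => hyZ q ((hξ q).2 hq)
      · simpa [hik] using hy ⟨i, hi⟩
      · simpa using hy ⟨k, hk⟩
  exact Set.infinite_univ (((Polynomial.finite_setOf_isRoot hp0).union (hfin _)).subset hsub)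

lemma PhiAlg.finite_image {ι : Type*} {j : ℂ → ℂ} (hj : PhiAlg j) {R : Set (ι × ι × ℕ)}
    (hR : ∀ r ∈ R, 1 ≤ r.2.2) {Z : Set (ι → ℂ)} (hZ : Z ⊆ phiSet j R) {i k : ι}
    (h : setoidOf R i k) :
    (∀ a, ((fun x : ι → ℂ => x k) '' {x | x ∈ Z ∧ x i = a}).Finite) ∧
      ∀ a, ((fun x : ι → ℂ => x i) '' {x | x ∈ Z ∧ x k = a}).Finite := by
  have trans : ∀ i k l : ι, (∀ a, ((fun x : ι → ℂ => x k) '' {x | x ∈ Z ∧ x i = a}).Finite) →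
      (∀ a, ((fun x : ι → ℂ => x l) '' {x | x ∈ Z ∧ x k = a}).Finite) →
      ∀ a, ((fun x : ι → ℂ => x l) '' {x | x ∈ Z ∧ x i = a}).Finite := by
    intro i k l h1 h2 a
    refine ((h1 a).biUnion fun b _ => h2 b).subset ?_
    rintro _ ⟨x, hx, rfl⟩
    exact Set.mem_biUnion ⟨x, hx, rfl⟩ ⟨x, ⟨hx.1, rfl⟩, rfl⟩
  induction h with
  | rel i k h =>
    obtain ⟨M, hM⟩ := h
    have h1 := hR _ hM
    constructor <;> intro a
    · refine (hj.fin M h1 a).subset ?_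
      rintro _ ⟨x, ⟨hx, rfl⟩, rfl⟩
      exact hZ hx _ hM
    · refine (hj.fin M h1 a).subset ?_
      rintro _ ⟨x, ⟨hx, rfl⟩, rfl⟩
      exact hj.symm M h1 _ _ (hZ hx _ hM)
  | refl i =>
    have : ∀ a, ((fun x : ι → ℂ => x i) '' {x | x ∈ Z ∧ x i = a}).Finite := by
      intro a
      refine (Set.finite_singleton a).subset ?_
      rintro _ ⟨x, ⟨-, rfl⟩, rfl⟩
      rfl
    exact ⟨this, this⟩
  | symm _ _ _ ih => exact ih.symm
  | trans i k l _ _ h1 h2 => exact ⟨trans _ _ _ h1.1 h2.1, trans _ _ _ h2.2 h1.2⟩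

section

variable {ι : Type} [Fintype ι] {j : ℂ → ℂ}

lemma PhiAlg.adim_le (hj : PhiAlg j) {R : Set (ι × ι × ℕ)}
    (hR : ∀ r ∈ R, 1 ≤ r.2.2) {Z : Set (ι → ℂ)} (hZa : IsAlgSet Z) (hZi : IsIrr Z)
    (hZ : Z ⊆ phiSet j R) : adim Z ≤ Nat.card (Quotient (setoidOf R)) := by
  classical
  obtain ⟨s, hs, hsk⟩ := exists_indepOn_card_eq_adim hZi.1
  have := Fintype.ofFinite (Quotient (setoidOf R))
  rw [← hsk, Nat.card_eq_fintype_card, ← Finset.card_univ]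
  refine Finset.card_le_card_of_injOn (fun i => (⟦i⟧ : Quotient (setoidOf R)))
    (fun _ _ => Finset.mem_coe.2 (Finset.mem_univ _)) ?_
  intro i hi k hk hik
  by_contra hne
  exact not_indepOn_of_finite hZa hZi hne
    (hj.finite_image hR hZ (Quotient.exact hik)).1 hi hk hs

/-- A component of `phiSet j R` is recovered by mixing from any of its subvarieties. -/
lemma PhiAlg.comp_eq (hj : PhiAlg j) {R : Set (ι × ι × ℕ)} (hR : ∀ r ∈ R, 1 ≤ r.2.2)
    {T X : Set (ι → ℂ)} (hT : IsIrrCompOf T (phiSet j R)) (hX : IsIrr X) (hXc : NoConstCoord X)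
    (hXT : X ⊆ T) : T = zcl (mix (setoidOf R) X) ∧
      adim T = Nat.card (Quotient (setoidOf R)) := by
  obtain ⟨hTa, hTi, hTs, hTm⟩ := hT
  have halg := hj.isAlgSet_phiSet hR
  rw [halg.zcl_eq] at hTs
  have h1 : T = zcl (mix (setoidOf R) T) :=
    hTm _ (isAlgSet_zcl _) (hTi.mix _).zcl (zcl_mono (mix_subset_phiSet hTs))
      ((subset_mix _ _).trans (subset_zcl _))
  have h2 : zcl (mix (setoidOf R) X) ⊆ T := by
    rw [h1]; exact zcl_mono (mix_mono _ hXT)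
  have h3 := card_le_adim_mix (setoidOf R) hX hXc
  have h4 := hj.adim_le hR hTa hTi hTs
  have h5 : adim (mix (setoidOf R) X) ≤ adim T := adim_mono ((subset_zcl _).trans h2)
  refine ⟨?_, by omega⟩
  by_contra hne
  have := adim_lt_of_ssubset (isAlgSet_zcl _) (hX.mix _).zcl.1 hTi (h2.ssubset_of_ne (Ne.symm hne))
  rw [adim_zcl] at this
  omega

lemma PhiAlg.isSpecial_comp {R : Set (ι × ι × ℕ)} (hR : ∀ r ∈ R, 1 ≤ r.2.2)
    {T : Set (ι → ℂ)} (hT : IsIrrCompOf T (phiSet j R)) : IsSpecial j T :=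
  ⟨phiSet j R, ⟨R, ∅, hR, by simp, by simp [phiSet]⟩, hT⟩

lemma IsSpecial.isAlgSet {T : Set (ι → ℂ)} (hT : IsSpecial j T) : IsAlgSet T := by
  obtain ⟨B, -, h⟩ := hT; exact h.1

lemma IsSpecial.isIrr {T : Set (ι → ℂ)} (hT : IsSpecial j T) : IsIrr T := by
  obtain ⟨B, -, h⟩ := hT; exact h.2.1

lemma PhiAlg.exists_rels (hj : PhiAlg j) {T : Set (ι → ℂ)} (hT : IsSpecial j T)
    (hTc : NoConstCoord T) : ∃ R : Set (ι × ι × ℕ), (∀ r ∈ R, 1 ≤ r.2.2) ∧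
      IsIrrCompOf T (phiSet j R) := by
  obtain ⟨B, ⟨R, E, hR, -, rfl⟩, hT⟩ := hT
  refine ⟨R, hR, ?_⟩
  have halg : IsAlgSet {y : ι → ℂ | (∀ r ∈ R, PhiRel j r.2.2 (y r.1) (y r.2.1)) ∧
      ∀ e ∈ E, y e.1 = e.2} := by
    have h1 : {y : ι → ℂ | (∀ r ∈ R, PhiRel j r.2.2 (y r.1) (y r.2.1)) ∧ ∀ e ∈ E, y e.1 = e.2} =
        phiSet j R ∩ ⋂ e : E, {y | eval y (X e.1.1 - C e.1.2) = 0} := by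
      ext y; simp [phiSet, sub_eq_zero]
    rw [h1]
    exact (hj.isAlgSet_phiSet hR).inter (IsAlgSet.iInter fun e => isAlgSet_setOf_eval _)
  have hE : E = ∅ := by
    by_contra hne
    obtain ⟨e, he⟩ := Set.nonempty_iff_ne_empty.2 hne
    obtain ⟨v, hv, hve⟩ := hTc e.1 e.2
    have := hT.2.2.1 hv
    rw [halg.zcl_eq] at this
    exact hve (this.2 e he)
  subst hE
  simpa [phiSet] using hT

lemma PhiAlg.numClasses_le (hj : PhiAlg j) {T X : Set (ι → ℂ)} (hT : IsSpecial j T)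
    (hX : IsIrr X) (hXc : NoConstCoord X) (hXT : X ⊆ T) :
    mix (setoidOf (relsOn j X)) X ⊆ T ∧ numClasses j X ≤ adim T := by
  obtain ⟨R, hR, hTR⟩ := hj.exists_rels hT (hXc.mono hXT)
  have hTs := hTR.2.2.1
  rw [(hj.isAlgSet_phiSet hR).zcl_eq] at hTs
  have hle : setoidOf R ≤ setoidOf (relsOn j X) :=
    setoidOf_mono fun r hr => ⟨hR r hr, fun x hx => hTs (hXT hx) r hr⟩
  obtain ⟨h1, -⟩ := hj.comp_eq hR hTR hX hXc hXT
  have h2 : mix (setoidOf (relsOn j X)) X ⊆ T := by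
    rw [h1]; exact (mix_anti hle X).trans (subset_zcl _)
  exact ⟨h2, (card_le_adim_mix _ hX hXc).trans (adim_mono h2)⟩

lemma PhiAlg.numClasses_le_spcl (hj : PhiAlg j) {X : Set (ι → ℂ)}
    (hX : IsIrr X) (hXc : NoConstCoord X) : numClasses j X ≤ adim (spcl j X) := by
  refine (card_le_adim_mix _ hX hXc).trans (adim_mono ?_)
  exact fun y hy T hT => (hj.numClasses_le hT.1 hX hXc hT.2).1 hy

lemma PhiAlg.adim_eq_numClasses (hj : PhiAlg j) {S : Set (ι → ℂ)} (hS : IsSpecial j S)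
    (hSc : NoConstCoord S) : adim S = numClasses j S := by
  refine le_antisymm ?_ (hj.numClasses_le hS hS.isIrr hSc subset_rfl).2
  exact hj.adim_le (R := relsOn j S) (fun r hr => hr.1) hS.isAlgSet hS.isIrr
    fun x hx r hr => hr.2 x hx

/-- Imposing one more modular relation on `S`. -/
lemma PhiAlg.exists_special_lt (hj : PhiAlg j) {S : Set (ι → ℂ)} (hS : IsSpecial j S)
    (hSc : NoConstCoord S) (N : ℕ) : ∃ 𝒮 : Set (Set (ι → ℂ)), 𝒮.Finite ∧
      (∀ T ∈ 𝒮, IsSpecial j T ∧ NoConstCoord T ∧ T ⊆ S ∧ T ≠ S) ∧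
      ∀ X, IsIrr X → NoConstCoord X → X ⊆ S → ∀ i k M, 1 ≤ M → M ≤ N →
        ¬ setoidOf (relsOn j S) i k → (∀ x ∈ X, PhiRel j M (x i) (x k)) → ∃ T ∈ 𝒮, X ⊆ T := by
  obtain ⟨R, hR, hSR⟩ := hj.exists_rels hS hSc
  have hSs := hSR.2.2.1
  rw [(hj.isAlgSet_phiSet hR).zcl_eq] at hSs
  refine ⟨(⋃ r : ι × ι × Fin (N + 1), {Y | IsIrrCompOf Y (phiSet j (insert (r.1, r.2.1, r.2.2.1) R))})
    ∩ {T | IsSpecial j T ∧ NoConstCoord T ∧ T ⊆ S ∧ T ≠ S}, ?_, fun T hT => hT.2, ?_⟩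
  · exact (Set.finite_iUnion fun r => finite_irrComps _).inter_of_left _
  · intro X hX hXc hXS i k M hM hMN hik hXM
    have hR1 : ∀ r ∈ insert (i, k, M) R, 1 ≤ r.2.2 := by
      rintro r (rfl | hr)
      · exact hM
      · exact hR r hr
    have hXR1 : X ⊆ phiSet j (insert (i, k, M) R) := by
      rintro x hx r (rfl | hr)
      · exact hXM x hx
      · exact hSs (hXS hx) r hr
    obtain ⟨T, hT, hXT⟩ := exists_isIrrCompOf hX (hXR1.trans (subset_zcl _))
    refine ⟨T, ⟨Set.mem_iUnion.2 ⟨(i, k, ⟨M, by omega⟩), hT⟩, PhiAlg.isSpecial_comp hR1 hT,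
      hXc.mono hXT, ?_, ?_⟩, hXT⟩
    · rw [(hj.comp_eq hR1 hT hX hXc hXT).1, (hj.comp_eq hR hSR hX hXc hXS).1]
      exact zcl_mono (mix_anti (setoidOf_mono (Set.subset_insert _ _)) X)
    · rintro rfl
      apply hik
      refine Relation.EqvGen.rel _ _ ⟨M, hM, fun x hx => ?_⟩
      have := hT.2.2.1 hx
      rw [(hj.isAlgSet_phiSet hR1).zcl_eq] at this
      exact this _ (Set.mem_insert _ _)

end

lemma IsConstr.inter_isAlgSet {ι : Type*} {F V : Set (ι → ℂ)} (hF : IsConstr F) (hV : IsAlgSet V) :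
    IsConstr (F ∩ V) := by
  obtain ⟨k, A, B, hAB, rfl⟩ := hF
  refine ⟨k, fun i => A i ∩ V, B, fun i => ⟨(hAB i).1.inter hV, (hAB i).2⟩, ?_⟩
  ext x
  simp only [Set.mem_inter_iff, Set.mem_iUnion, Set.mem_diff]
  constructor
  · rintro ⟨⟨i, h1, h2⟩, h3⟩; exact ⟨i, ⟨h1, h3⟩, h2⟩
  · rintro ⟨i, ⟨h1, h3⟩, h2⟩; exact ⟨⟨i, h1, h2⟩, h3⟩

lemma IsIrrCompOf.subset_zcl_inter {ι : Type*} [Finite ι] {X U T : Set (ι → ℂ)}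
    (hX : IsIrrCompOf X (U ∩ T)) : X ⊆ zcl (X ∩ U) := by
  have := (finite_irrComps (U ∩ T)).to_subtype
  have hcov : U ∩ T ⊆ ⋃ Y : {Y | IsIrrCompOf Y (U ∩ T)}, zcl (Y.1 ∩ U) := by
    intro x hx
    obtain ⟨Y, hY, hxY⟩ := subset_iUnion_irrComps _ (subset_zcl _ hx)
    exact Set.mem_iUnion.2 ⟨⟨Y, hY⟩, subset_zcl _ ⟨hxY, hx.1⟩⟩
  have halg : IsAlgSet (⋃ Y : {Y | IsIrrCompOf Y (U ∩ T)}, zcl (Y.1 ∩ U)) :=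
    IsAlgSet.iUnion fun Y => isAlgSet_zcl _
  obtain ⟨Y, hY⟩ := hX.2.1.subset_of_iUnion (V := fun Y : {Y | IsIrrCompOf Y (U ∩ T)} => zcl (Y.1 ∩ U))
    (fun Y => isAlgSet_zcl _) (hX.2.2.1.trans (zcl_subset halg hcov))
  have h1 : X ⊆ Y.1 := hY.trans (zcl_subset Y.2.1 Set.inter_subset_left)
  rwa [← hX.2.2.2 Y.1 Y.2.1 Y.2.2.1 Y.2.2.2.1 h1] at hY

/-- The functional-transcendence input: on strongly atypical subvarieties, a modular relation
of bounded level holds between coordinates which are unrelated on `S`. -/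
def BoundedRelation (j : ℂ → ℂ) : Prop :=
  ∀ (n m : ℕ) (S : Set (Fin n → ℂ)), IsSpecial j S → NoConstCoord S →
    ∀ F : Set ((Fin n ⊕ Fin m) → ℂ), IsConstr F → (∀ q, fib F q ⊆ S) →
    ∃ N : ℕ, ∀ q X, IsAlgSet X → IsIrr X → NoConstCoord X → X ⊆ S → X ⊆ zcl (X ∩ fib F q) →
      adim (fib F q) + numClasses j X < adim X + adim S →
      ∃ i k M, 1 ≤ M ∧ M ≤ N ∧ ¬ setoidOf (relsOn j S) i k ∧ ∀ x ∈ X, PhiRel j M (x i) (x k)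

lemma exists_finite_of_boundedRelation {j : ℂ → ℂ} (hj : PhiAlg j) (hB : BoundedRelation j)
    {n m : ℕ} (d : ℕ) : ∀ S : Set (Fin n → ℂ), adim S = d → IsSpecial j S → NoConstCoord S →
    ∀ F : Set ((Fin n ⊕ Fin m) → ℂ), IsConstr F → (∀ q, fib F q ⊆ S) →
    ∃ 𝒮 : Set (Set (Fin n → ℂ)), 𝒮.Finite ∧ (∀ T ∈ 𝒮, IsSpecial j T ∧ T ⊆ S ∧ T ≠ S) ∧
      ∀ q X, IsAlgSet X → IsIrr X → NoConstCoord X → X ⊆ S → X ⊆ zcl (X ∩ fib F q) →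
        adim (fib F q) + numClasses j X < adim X + adim S →
        ∃ T ∈ 𝒮, X ⊆ T ∧ adim X + adim T ≤ adim (fib F q ∩ T) + numClasses j X := by
  induction d using Nat.strong_induction_on with
  | _ d ih =>
  rintro S rfl hS hSc F hF hFS
  obtain ⟨N, hN⟩ := hB n m S hS hSc F hF hFS
  obtain ⟨𝒮₀, hfin, hprop, hex⟩ := hj.exists_special_lt hS hSc N
  have hfib : ∀ (T : Set (Fin n → ℂ)) q,
      fib (F ∩ {v | (fun i => v (Sum.inl i)) ∈ T}) q = fib F q ∩ T := fun T q => by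
    ext x; simp [fib]
  have hrec : ∀ T : 𝒮₀, ∃ 𝒮 : Set (Set (Fin n → ℂ)), 𝒮.Finite ∧
      (∀ T' ∈ 𝒮, IsSpecial j T' ∧ T' ⊆ T.1 ∧ T' ≠ T.1) ∧
      ∀ q X, IsAlgSet X → IsIrr X → NoConstCoord X → X ⊆ T.1 → X ⊆ zcl (X ∩ (fib F q ∩ T.1)) →
        adim (fib F q ∩ T.1) + numClasses j X < adim X + adim T.1 →
        ∃ T' ∈ 𝒮, X ⊆ T' ∧ adim X + adim T' ≤ adim (fib F q ∩ T.1 ∩ T') + numClasses j X := by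
    rintro ⟨T, hT⟩
    obtain ⟨h1, h2, h3, h4⟩ := hprop T hT
    have hlt := adim_lt_of_ssubset h1.isAlgSet h1.isIrr.1 hS.isIrr (h3.ssubset_of_ne h4)
    have := ih _ hlt T rfl h1 h2 (F ∩ {v | (fun i => v (Sum.inl i)) ∈ T})
      (hF.inter_isAlgSet (by
        have := h1.isAlgSet.preimage (fun i => (X (Sum.inl i) : MvPolynomial (Fin n ⊕ Fin m) ℂ))
        simpa using this))
      (fun q => by rw [hfib]; exact Set.inter_subset_right)
    simpa only [hfib] using this
  choose 𝒯 h𝒯fin h𝒯prop h𝒯 using hrec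
  have := hfin.to_subtype
  refine ⟨𝒮₀ ∪ ⋃ T, 𝒯 T, hfin.union (Set.finite_iUnion h𝒯fin), ?_, ?_⟩
  · rintro T (hT | hT)
    · exact ⟨(hprop T hT).1, (hprop T hT).2.2⟩
    · obtain ⟨T', hT'⟩ := Set.mem_iUnion.1 hT
      obtain ⟨h1, h2, h3⟩ := h𝒯prop T' T hT'
      obtain ⟨-, -, h4, h5⟩ := hprop T'.1 T'.2
      exact ⟨h1, h2.trans h4, fun h => h5 (h4.antisymm (h ▸ h2))⟩
  · intro q X hXa hXi hXc hXS hXU hlt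
    obtain ⟨i, k, M, hM, hMN, hik, hX⟩ := hN q X hXa hXi hXc hXS hXU hlt
    obtain ⟨T, hT, hXT⟩ := hex X hXi hXc hXS i k M hM hMN hik hX
    by_cases hb : adim X + adim T ≤ adim (fib F q ∩ T) + numClasses j X
    · exact ⟨T, Or.inl hT, hXT, hb⟩
    · obtain ⟨T', hT', hXT', hb'⟩ := h𝒯 ⟨T, hT⟩ q X hXa hXi hXc hXT
        (hXU.trans (zcl_mono fun x hx => ⟨hx.1, hx.2, hXT hx.1⟩)) (not_le.1 hb)
      refine ⟨T', Or.inr (Set.mem_iUnion.2 ⟨_, hT'⟩), hXT', ?_⟩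
      rwa [Set.inter_assoc, Set.inter_eq_right.2 (h𝒯prop _ _ hT').2.1] at hb'

theorem refined_weak_MZP_of_boundedRelation {j : ℂ → ℂ} (hj : PhiAlg j) (hB : BoundedRelation j)
    (n m : ℕ) (S : Set (Fin n → ℂ)) (hS : IsSpecial j S)
    (Q : Set (Fin m → ℂ)) (F : Set ((Fin n ⊕ Fin m) → ℂ)) (hF : IsConstr F)
    (hsub : ∀ q, fib F q ⊆ S) :
    ∃ 𝒮 : Set (Set (Fin n → ℂ)), 𝒮.Finite ∧
      (∀ T₀ ∈ 𝒮, IsSpecial j T₀ ∧ T₀ ⊆ S ∧ T₀ ≠ S) ∧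
      ∀ q ∈ Q, ∀ T : Set (Fin n → ℂ), IsSpecial j T → T ⊆ S →
        ∀ X : Set (Fin n → ℂ), IsIrrCompOf X (fib F q ∩ T) →
          (adim (fib F q) : ℤ) + (adim T : ℤ) - (adim S : ℤ) < (adim X : ℤ) →
          NoConstCoord X →
          ∃ T₀ ∈ 𝒮, X ⊆ T₀ ∧
            (adim X : ℤ) ≤ (adim (fib F q ∩ T₀) : ℤ) + (adim (spcl j X) : ℤ)
              - (adim T₀ : ℤ) ∧
            (adim (fib F q) : ℤ) + (adim T₀ : ℤ) - (adim S : ℤ)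
              < (adim (fib F q ∩ T₀) : ℤ) := by
  by_cases hSc : NoConstCoord S
  · obtain ⟨𝒮, hfin, hprop, h𝒮⟩ :=
      exists_finite_of_boundedRelation hj hB _ S rfl hS hSc F hF hsub
    refine ⟨𝒮, hfin, hprop, fun q _ T hT hTS X hX hlt hXc => ?_⟩
    have hXT : X ⊆ T := hX.2.2.1.trans (zcl_subset hT.isAlgSet Set.inter_subset_right)
    have ht := (hj.numClasses_le hT hX.2.1 hXc hXT).2
    have ht' := hj.numClasses_le_spcl hX.2.1 hXc
    obtain ⟨T₀, hT₀, hXT₀, hb⟩ := h𝒮 q X hX.1 hX.2.1 hXc (hXT.trans hTS) hX.subset_zcl_inter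
      (by omega)
    exact ⟨T₀, hT₀, hXT₀, by omega, by omega⟩
  · refine ⟨∅, Set.finite_empty, by simp, fun q _ T hT hTS X hX _ hXc => ?_⟩
    have hXT : X ⊆ T := hX.2.2.1.trans (zcl_subset hT.isAlgSet Set.inter_subset_right)
    exact absurd (hXc.mono (hXT.trans hTS)) hSc

end

section

open MvPolynomial Filter

/-- The ultrapower of a `ℂ`-algebra as an algebra over the ultrapower of `ℂ`. -/
@[reducible] def germAlgebra (φ : Ultrafilter ℕ) (K : Type) [Field K] [Algebra ℂ K] :
    Algebra (Germ (φ : Filter ℕ) ℂ) (Germ (φ : Filter ℕ) K) where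
  smul := (· • ·)
  algebraMap :=
    { toFun := Germ.map (algebraMap ℂ K)
      map_one' := congrArg ((↑) : K → Germ (φ : Filter ℕ) K) (map_one (algebraMap ℂ K))
      map_zero' := congrArg ((↑) : K → Germ (φ : Filter ℕ) K) (map_zero (algebraMap ℂ K))
      map_mul' := fun a b => Germ.inductionOn₂ a b fun f g =>
        congrArg (Germ.ofFun (l := (φ : Filter ℕ))) (funext fun N => map_mul (algebraMap ℂ K) (f N) (g N))
      map_add' := fun a b => Germ.inductionOn₂ a b fun f g =>
        congrArg (Germ.ofFun (l := (φ : Filter ℕ))) (funext fun N => map_add (algebraMap ℂ K) (f N) (g N)) }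
  commutes' := fun _ _ => mul_comm _ _
  smul_def' := fun a b => Germ.inductionOn₂ a b fun f g =>
        congrArg (Germ.ofFun (l := (φ : Filter ℕ))) (funext fun N => Algebra.smul_def (f N) (g N))

attribute [local instance] germAlgebra

variable {φ : Ultrafilter ℕ}

lemma germ_algebraMap_coe {K : Type} [Field K] [Algebra ℂ K] (f : ℕ → ℂ) :
    algebraMap (Germ (φ : Filter ℕ) ℂ) (Germ (φ : Filter ℕ) K) (f : Germ (φ : Filter ℕ) ℂ) =
      ((fun N => algebraMap ℂ K (f N) : ℕ → K) : Germ (φ : Filter ℕ) K) := rfl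

/-- A polynomial over the ultrapower is a sequence of polynomials of bounded degree. -/
lemma exists_germ_mvPolynomial {σ : Type} (p : MvPolynomial σ (Germ (φ : Filter ℕ) ℂ)) :
    ∃ (p' : ℕ → MvPolynomial σ ℂ) (d : ℕ), (∀ N, (p' N).totalDegree ≤ d) ∧
      (∀ a : ℕ → σ → ℂ, eval (fun i => ((fun N => a N i : ℕ → ℂ) : Germ (φ : Filter ℕ) ℂ)) p =
        ((fun N => eval (a N) (p' N) : ℕ → ℂ) : Germ (φ : Filter ℕ) ℂ)) ∧
      ∀ (K : Type) [Field K] [Algebra ℂ K] (a : ℕ → σ → K),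
        aeval (fun i => ((fun N => a N i : ℕ → K) : Germ (φ : Filter ℕ) K)) p =
          ((fun N => aeval (a N) (p' N) : ℕ → K) : Germ (φ : Filter ℕ) K) := by
  induction p using MvPolynomial.induction_on with
  | C c =>
    induction c using Germ.inductionOn with | _ c => ?_
    refine ⟨fun N => C (c N), 0, by simp, fun a => by simp, fun K _ _ a => ?_⟩
    simp [germ_algebraMap_coe]
  | add p q hp hq =>
    obtain ⟨p', d, h1, h2, h3⟩ := hp
    obtain ⟨q', e, h4, h5, h6⟩ := hq
    refine ⟨fun N => p' N + q' N, max d e, fun N => (totalDegree_add _ _).trans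
      (max_le_max (h1 N) (h4 N)), fun a => ?_, fun K _ _ a => ?_⟩
    · rw [map_add, h2, h5]; simp only [map_add]; rfl
    · rw [map_add, h3, h6]; simp only [map_add]; rfl
  | mul_X p i hp =>
    obtain ⟨p', d, h1, h2, h3⟩ := hp
    refine ⟨fun N => p' N * X i, d + 1, fun N => (totalDegree_mul _ _).trans
      (add_le_add (h1 N) (by simp)), fun a => ?_, fun K _ _ a => ?_⟩
    · rw [map_mul, h2, eval_X]; simp only [map_mul, eval_X]; rfl
    · rw [map_mul, h3, aeval_X]; simp only [map_mul, aeval_X]; rfl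

lemma germ_ne_zero_iff {β : Type} [Zero β] {f : ℕ → β} :
    (f : Germ (φ : Filter ℕ) β) ≠ 0 ↔ ∀ᶠ N in (φ : Filter ℕ), f N ≠ 0 := by
  rw [Ultrafilter.eventually_not]
  exact not_congr Germ.coe_eq

lemma germ_eq_zero_iff {β : Type} [Zero β] {f : ℕ → β} :
    (f : Germ (φ : Filter ℕ) β) = 0 ↔ ∀ᶠ N in (φ : Filter ℕ), f N = 0 := Germ.coe_eq

lemma eventually_ne_zero_of_germ {σ : Type} {p : MvPolynomial σ (Germ (φ : Filter ℕ) ℂ)} (hp : p ≠ 0)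
    {p' : ℕ → MvPolynomial σ ℂ}
    (h : ∀ a : ℕ → σ → ℂ, eval (fun i => ((fun N => a N i : ℕ → ℂ) : Germ (φ : Filter ℕ) ℂ)) p =
        ((fun N => eval (a N) (p' N) : ℕ → ℂ) : Germ (φ : Filter ℕ) ℂ)) :
    ∀ᶠ N in (φ : Filter ℕ), p' N ≠ 0 := by
  have : Infinite (Germ (φ : Filter ℕ) ℂ) :=
    Infinite.of_injective (fun c : ℂ => (c : Germ (φ : Filter ℕ) ℂ)) fun a b hab => Germ.const_inj.1 hab
  obtain ⟨a, ha⟩ : ∃ a, eval a p ≠ 0 := by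
    by_contra hc
    push Not at hc
    exact hp (MvPolynomial.funext fun a => by rw [hc a, map_zero])
  choose a' ha' using fun i => Quotient.exists_rep (a i)
  have h1 := h fun N i => a' i N
  have h2 : (fun i => ((fun N => a' i N : ℕ → ℂ) : Germ (φ : Filter ℕ) ℂ)) = a := funext ha'
  rw [h2] at h1
  rw [h1, germ_ne_zero_iff] at ha
  exact ha.mono fun N hN h0 => hN (by rw [h0, map_zero])

instance isAlgClosed_germ : IsAlgClosed (Germ (φ : Filter ℕ) ℂ) := by
  refine IsAlgClosed.of_exists_root _ fun p hp hirr => ?_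
  have hdeg : 0 < p.natDegree := hirr.natDegree_pos
  choose c hc using fun i => Quotient.exists_rep (p.coeff i)
  let q : ℕ → Polynomial ℂ := fun N => Polynomial.X ^ p.natDegree +
    ∑ i ∈ Finset.range p.natDegree, Polynomial.C (c i N) * Polynomial.X ^ i
  have hq : ∀ N, ∃ z, (q N).IsRoot z := fun N => by
    refine IsAlgClosed.exists_root _ ?_
    have hlt : (∑ i ∈ Finset.range p.natDegree, Polynomial.C (c i N) * Polynomial.X ^ i).degree <
        (p.natDegree : WithBot ℕ) := by
      refine (Polynomial.degree_sum_le _ _).trans_lt ?_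
      rw [Finset.sup_lt_iff (by exact WithBot.bot_lt_coe _)]
      intro i hi
      exact (Polynomial.degree_C_mul_X_pow_le _ _).trans_lt (by exact_mod_cast Finset.mem_range.1 hi)
    simp only [q]
    rw [Polynomial.degree_add_eq_left_of_degree_lt (by rwa [Polynomial.degree_X_pow]),
      Polynomial.degree_X_pow]
    exact_mod_cast hdeg.ne'
  choose z hz using hq
  refine ⟨(z : Germ (φ : Filter ℕ) ℂ), ?_⟩
  have hsum := hp.as_sum
  rw [hsum]
  simp only [Polynomial.eval_add, Polynomial.eval_pow, Polynomial.eval_X, Polynomial.eval_finset_sum,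
    Polynomial.eval_mul, Polynomial.eval_C]
  have h1 : ∀ i, p.coeff i = Germ.coeRingHom (φ : Filter ℕ) (c i) := fun i => (hc i).symm
  have h2 : (z : Germ (φ : Filter ℕ) ℂ) = Germ.coeRingHom (φ : Filter ℕ) z := rfl
  simp only [h1, h2, ← map_pow, ← map_mul, ← map_sum, ← map_add]
  have h3 : z ^ p.natDegree + ∑ i ∈ Finset.range p.natDegree, c i * z ^ i = 0 := by
    funext N
    have := hz N
    simp only [Polynomial.IsRoot.def, q, Polynomial.eval_add, Polynomial.eval_pow, Polynomial.eval_X,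
      Polynomial.eval_finset_sum, Polynomial.eval_mul, Polynomial.eval_C] at this
    simpa using this
  rw [h3, map_zero]

/-- The componentwise extension of a derivation to the ultrapower. -/
def germDerivation (φ : Ultrafilter ℕ) {K : Type} [Field K] [Algebra ℂ K] (D : Derivation ℂ K K) :
    Derivation (Germ (φ : Filter ℕ) ℂ) (Germ (φ : Filter ℕ) K) (Germ (φ : Filter ℕ) K) where
  toFun := Germ.map D
  map_add' := fun a b => Germ.inductionOn₂ a b fun f g =>
    congrArg (Germ.ofFun (l := (φ : Filter ℕ))) (funext fun N => map_add D (f N) (g N))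
  map_smul' := fun a b => Germ.inductionOn₂ a b fun f g =>
    congrArg (Germ.ofFun (l := (φ : Filter ℕ))) (funext fun N => D.map_smul (f N) (g N))
  map_one_eq_zero' := congrArg ((↑) : K → Germ (φ : Filter ℕ) K) D.map_one_eq_zero
  leibniz' := fun a b => Germ.inductionOn₂ a b fun f g =>
    congrArg (Germ.ofFun (l := (φ : Filter ℕ))) (funext fun N => D.leibniz (f N) (g N))

lemma germDerivation_coe {K : Type} [Field K] [Algebra ℂ K] (D : Derivation ℂ K K) (f : ℕ → K) :
    germDerivation φ D (f : Germ (φ : Filter ℕ) K) = ((fun N => D (f N) : ℕ → K) : Germ (φ : Filter ℕ) K) :=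
  rfl

end

section

open MvPolynomial

lemma IsGenericPt.transcendental {ι K : Type*} [Field K] [Algebra ℂ K] {ξ : ι → K}
    {Z : Set (ι → ℂ)} (hξ : IsGenericPt ξ Z) (hc : NoConstCoord Z) (i : ι) :
    Transcendental ℂ (ξ i) := by
  intro h
  obtain ⟨p, hp, h0⟩ := h
  obtain ⟨c, hc0, hcξ⟩ : ∃ c : ℂ, c ∈ p.roots ∧ ξ i = algebraMap ℂ K c := by
    have h1 := (IsAlgClosed.splits p).eq_prod_roots
    rw [h1, map_mul, Polynomial.aeval_C, mul_eq_zero] at h0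
    rcases h0 with h0 | h0
    · exact absurd ((map_eq_zero _).1 h0) (by simpa using hp)
    · rw [map_multiset_prod, Multiset.prod_eq_zero_iff] at h0
      simp only [Multiset.map_map, Multiset.mem_map, Function.comp_apply] at h0
      obtain ⟨c, hc, h2⟩ := h0
      refine ⟨c, hc, sub_eq_zero.1 ?_⟩
      simpa using h2
  obtain ⟨v, hv, hvc⟩ := hc i c
  have := (hξ (X i - C c)).1 (by simp [hcξ])
  have := mem_vanishingIdeal.1 this v hv
  simp at this
  exact hvc (sub_eq_zero.1 this)

lemma isAlgebraic_adjoin_trans {L K : Type*} [Field L] [Field K] [Algebra L K] {S T : Set K}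
    (hST : ∀ a ∈ S, IsAlgebraic (IntermediateField.adjoin L T) a) {b : K}
    (hb : IsAlgebraic (IntermediateField.adjoin L S) b) :
    IsAlgebraic (IntermediateField.adjoin L T) b := by
  let T' := IntermediateField.adjoin L T
  let A := (algebraicClosure T' K)
  have hle : IntermediateField.adjoin L S ≤ A.restrictScalars L :=
    IntermediateField.adjoin_le_iff.2 fun a ha => (mem_algebraicClosure_iff (F := T')).2 (hST a ha)
  obtain ⟨p, hp, h0⟩ := hb
  have h1 : IsAlgebraic A b := by
    let ρ : IntermediateField.adjoin L S →+* A := (IntermediateField.inclusion hle).toRingHom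
    refine ⟨p.map ρ, (Polynomial.map_ne_zero_iff ρ.injective).2 hp, ?_⟩
    rw [Polynomial.aeval_def, Polynomial.eval₂_map]
    exact h0
  exact IsAlgebraic.restrictScalars T' h1

/-- Transport of an algebraic tuple to an algebraically closed field. -/
lemma exists_tuple_of_isAlgebraic {ι B K' K : Type*} [Field B] [Field K'] [Algebra B K'] [Field K]
    [Algebra B K] [IsAlgClosed K] {ξ' : ι → K'} (halg : ∀ k, IsAlgebraic B (ξ' k)) :
    ∃ ξ : ι → K, ∀ p : MvPolynomial ι B, aeval ξ p = 0 ↔ aeval ξ' p = 0 := by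
  obtain ⟨φ⟩ : Nonempty (algebraicClosure B K' →ₐ[B] K) := ⟨IsAlgClosed.lift⟩
  let η : ι → algebraicClosure B K' := fun k => ⟨ξ' k, (mem_algebraicClosure_iff (F := B)).2 (halg k)⟩
  refine ⟨fun k => φ (η k), fun p => ?_⟩
  have h1 : aeval (fun k => φ (η k)) p = φ (aeval η p) := (comp_aeval_apply (f := η) φ p).symm
  have h2 : aeval ξ' p = ((aeval η p : algebraicClosure B K') : K') :=
    MvPolynomial.aeval_algebraMap_apply K' η p
  rw [h1, h2, map_eq_zero, ZeroMemClass.coe_eq_zero]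

/-- Transport of a tuple algebraic over a transcendence basis to another field. -/
lemma exists_tuple_of_algebraicIndependent {ι κ K' K : Type} [Field K'] [Algebra ℂ K'] [Field K]
    [Algebra ℂ K] [IsAlgClosed K] {ξ' : ι → K'} {y : κ → K'} (hy : AlgebraicIndependent ℂ y)
    (halg : ∀ k, IsAlgebraic (IntermediateField.adjoin ℂ (Set.range y)) (ξ' k))
    {g : κ → K} (hg : AlgebraicIndependent ℂ g) :
    ∃ ξ : ι → K, (∀ p : MvPolynomial ι ℂ, aeval ξ p = 0 ↔ aeval ξ' p = 0) ∧
      ∀ i k, ξ' k = y i → ξ k = g i := by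
  obtain ⟨f, hf⟩ : ∃ f : IntermediateField.adjoin ℂ (Set.range y) →ₐ[ℂ] K,
      ∀ i (h : y i ∈ IntermediateField.adjoin ℂ (Set.range y)), f ⟨y i, h⟩ = g i := by
    refine ⟨(IntermediateField.val _).comp
      (hg.aevalEquivField.toAlgHom.comp hy.aevalEquivField.symm.toAlgHom), fun i h => ?_⟩
    have h1 : hy.aevalEquivField (algebraMap _ _ (X i)) = ⟨y i, h⟩ :=
      Subtype.ext (by rw [AlgebraicIndependent.aevalEquivField_algebraMap_apply_coe, aeval_X])
    change ((hg.aevalEquivField (hy.aevalEquivField.symm _) : _) : K) = _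
    rw [← h1, AlgEquiv.symm_apply_apply, AlgebraicIndependent.aevalEquivField_algebraMap_apply_coe,
      aeval_X]
  generalize hB : IntermediateField.adjoin ℂ (Set.range y) = B at f hf halg
  let _ : Algebra B K := f.toRingHom.toAlgebra
  have : IsScalarTower ℂ B K := IsScalarTower.of_algHom f
  obtain ⟨ξ, hξ⟩ := exists_tuple_of_isAlgebraic (K := K) halg
  refine ⟨ξ, fun p => ?_, fun i k hk => ?_⟩
  · have := hξ (map (algebraMap ℂ B) p)
    rwa [aeval_map_algebraMap, aeval_map_algebraMap] at this
  · have h0 : y i ∈ B := hB ▸ IntermediateField.subset_adjoin _ _ ⟨i, rfl⟩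
    have h3 := (hξ (X k - C ⟨y i, h0⟩)).2 (by
      rw [map_sub, aeval_X, aeval_C, hk, sub_eq_zero]; rfl)
    rw [map_sub, aeval_X, aeval_C, sub_eq_zero] at h3
    rw [h3, ← hf i h0]
    rfl

/-- A generic point of `X` inside a prescribed algebraically closed field, with transcendence basis
among the chosen coordinates. -/
lemma exists_isGenericPt_of_isTranscendenceBasis {n d : ℕ} {X : Set (Fin n → ℂ)}
    (hXi : IsIrr X) (hc : NoConstCoord X) (rep : Fin d → Fin n)
    (hrep : ∀ k, ∃ l, k = rep l ∨ ¬ IndepOn X {k, rep l}) :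
    ∃ (r : ℕ) (s : Fin r → Fin d), r ≤ d ∧ adim X ≤ r ∧ ∀ (K : Type) [Field K] [CharZero K]
      [IsAlgClosed K] [Algebra ℂ K] (g : Fin r → K), IsTranscendenceBasis ℂ g →
      ∃ ξ : Fin n → K, IsGenericPt ξ X ∧ ∀ i, ξ (rep (s i)) = g i := by
  obtain ⟨K', _, _, ξ', hξ'⟩ := exists_isGenericPt hXi
  have : CharZero K' := charZero_of_injective_algebraMap (algebraMap ℂ K').injective
  obtain ⟨s₀, hs₀, hmax⟩ := exists_max_algebraicIndepOn (C := ℂ) (ξ' ∘ rep)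
  obtain ⟨r, s, hr, hind, hrange⟩ : ∃ (r : ℕ) (s : Fin r → Fin d), r ≤ d ∧
      AlgebraicIndependent ℂ (fun i => ξ' (rep (s i))) ∧
      Set.range (fun i => ξ' (rep (s i))) = (ξ' ∘ rep) '' s₀ := by
    refine ⟨s₀.card, fun i => (s₀.equivFin.symm i).1, by simpa using s₀.card_le_univ,
      AlgebraicIndependent.comp hs₀ (fun i => ⟨(s₀.equivFin.symm i).1, (s₀.equivFin.symm i).2⟩)
        fun i k h => s₀.equivFin.symm.injective (Subtype.ext (congrArg Subtype.val h)), ?_⟩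
    ext a
    constructor
    · rintro ⟨i, rfl⟩
      exact ⟨_, (s₀.equivFin.symm i).2, rfl⟩
    · rintro ⟨i, hi, rfl⟩
      exact ⟨s₀.equivFin ⟨i, hi⟩, by simp⟩
  have halg : ∀ k, IsAlgebraic (IntermediateField.adjoin ℂ (Set.range fun i => ξ' (rep (s i))))
      (ξ' k) := fun k => by
    rw [hrange]
    obtain ⟨l, rfl | hl⟩ := hrep k
    · exact hmax l
    by_cases hk : k = rep l
    · rw [hk]; exact hmax l
    have h1 : AlgebraicIndepOn ℂ ξ' {rep l} :=
      (algebraicIndependent_unique_type_iff).2 (hξ'.transcendental hc _)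
    have h2 := mt hξ'.algebraicIndepOn_iff.1 hl
    rw [AlgebraicIndepOn.insert_iff (by simpa using hk)] at h2
    have h3 := isAlgebraic_adjoin_of_not_transcendental (not_and.1 h2 h1)
    refine isAlgebraic_adjoin_trans ?_ h3
    rintro _ ⟨_, rfl, rfl⟩
    exact hmax l
  have hgen : ∀ (K : Type) [Field K] [CharZero K]
      [IsAlgClosed K] [Algebra ℂ K] (g : Fin r → K), IsTranscendenceBasis ℂ g →
      ∃ ξ : Fin n → K, IsGenericPt ξ X ∧ ∀ i, ξ (rep (s i)) = g i := by
    intro K _ _ _ _ g hg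
    obtain ⟨ξ, h1, h2⟩ := exists_tuple_of_algebraicIndependent hind halg hg.1
    exact ⟨ξ, fun p => (h1 p).trans (hξ' p), fun i => h2 i _ rfl⟩
  refine ⟨r, s, hr, ?_, hgen⟩
  obtain ⟨K, _, _, _, _, g, hg⟩ := exists_isAlgClosed_isTranscendenceBasis (Fin r) ℂ
  obtain ⟨ξ, hξ, -⟩ := hgen K g hg
  obtain ⟨s₁, hs₁, h2⟩ := exists_indepOn_card_eq_adim hXi.1
  have h3 := (hξ.algebraicIndepOn_iff.2 hs₁).lift_cardinalMk_le_trdeg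
  rw [← h2]
  rw [← hg.lift_cardinalMk_eq_trdeg] at h3
  simpa using h3

end

section

open MvPolynomial Filter

/-- A constructible set is a finite union of principal pieces. -/
lemma IsConstr.exists_pieces {σ : Type} [Finite σ] {F : Set (σ → ℂ)} (hF : IsConstr F) :
    ∃ (κ : Type) (_ : Finite κ) (A : κ → Finset (MvPolynomial σ ℂ)) (b : κ → MvPolynomial σ ℂ),
      F = ⋃ i, {v | (∀ p ∈ A i, eval v p = 0) ∧ eval v (b i) ≠ 0} := by
  have key : ∀ V : Set (σ → ℂ), IsAlgSet V → ∃ P : Finset (MvPolynomial σ ℂ),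
      V = {v | ∀ p ∈ P, eval v p = 0} := by
    rintro V hV
    obtain ⟨P, hP⟩ := (isNoetherianRing_iff_ideal_fg _).1 inferInstance (vanishingIdeal ℂ V)
    refine ⟨P, Set.ext fun v => ?_⟩
    constructor
    · intro hv p hp
      exact mem_vanishingIdeal.1 (hP ▸ Ideal.subset_span hp) v hv
    · intro hv
      rw [← hV.zeroLocus_vanishingIdeal, ← hP, mem_zeroLocus]
      intro p hp
      have hle : Ideal.span (P : Set (MvPolynomial σ ℂ)) ≤ RingHom.ker (eval v) :=
        Ideal.span_le.2 fun p hp => hv p hp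
      exact hle hp
  obtain ⟨k, A, B, hAB, rfl⟩ := hF
  choose P hP using fun i => key (A i) (hAB i).1
  choose R hR using fun i => key (B i) (hAB i).2
  refine ⟨Σ i : Fin k, R i, inferInstance, fun i => P i.1, fun i => i.2.1, ?_⟩
  ext v
  simp only [Set.mem_iUnion, Set.mem_diff, Set.mem_setOf_eq]
  constructor
  · rintro ⟨i, h1, h2⟩
    rw [hP i] at h1
    rw [hR i] at h2
    simp only [Set.mem_setOf_eq, not_forall] at h2
    obtain ⟨p, hp, h2⟩ := h2
    exact ⟨⟨i, p, hp⟩, h1, h2⟩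
  · rintro ⟨⟨i, p, hp⟩, h1, h2⟩
    refine ⟨i, ?_, ?_⟩
    · rw [hP i]; exact h1
    · rw [hR i]; exact fun h => h2 (h p hp)

attribute [local instance] germAlgebra

variable {φ : Ultrafilter ℕ}

/-- Substituting a sequence of parameters gives a polynomial over the ultrapower. -/
lemma exists_germ_specialization {σ κ : Type} (b : MvPolynomial (σ ⊕ κ) ℂ) (q : ℕ → κ → ℂ) :
    ∃ b' : MvPolynomial σ (Germ (φ : Filter ℕ) ℂ),
      (∀ a : ℕ → σ → ℂ, eval (fun i => ((fun N => a N i : ℕ → ℂ) : Germ (φ : Filter ℕ) ℂ)) b' =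
        ((fun N => eval (Sum.elim (a N) (q N)) b : ℕ → ℂ) : Germ (φ : Filter ℕ) ℂ)) ∧
      ∀ (K : Type) [Field K] [Algebra ℂ K] (a : ℕ → σ → K),
        aeval (fun i => ((fun N => a N i : ℕ → K) : Germ (φ : Filter ℕ) K)) b' =
          ((fun N => aeval (Sum.elim (a N) fun i => algebraMap ℂ K (q N i)) b : ℕ → K) :
            Germ (φ : Filter ℕ) K) := by
  induction b using MvPolynomial.induction_on with
  | C c =>
    refine ⟨C ((fun _ => c : ℕ → ℂ) : Germ (φ : Filter ℕ) ℂ), fun a => by simp, fun K _ _ a => ?_⟩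
    simp only [aeval_C]
    rw [germ_algebraMap_coe]
  | add p q hp hq =>
    obtain ⟨p', h2, h3⟩ := hp
    obtain ⟨q', h5, h6⟩ := hq
    refine ⟨p' + q', fun a => ?_, fun K _ _ a => ?_⟩
    · rw [map_add, h2, h5]; simp only [map_add]; rfl
    · rw [map_add, h3, h6]; simp only [map_add]; rfl
  | mul_X p i hp =>
    obtain ⟨p', h2, h3⟩ := hp
    rcases i with i | i
    · refine ⟨p' * X i, fun a => ?_, fun K _ _ a => ?_⟩
      · rw [map_mul, h2, eval_X]; simp only [map_mul, eval_X]; rfl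
      · rw [map_mul, h3, aeval_X]; simp only [map_mul, aeval_X]; rfl
    · refine ⟨p' * C ((fun N => q N i : ℕ → ℂ) : Germ (φ : Filter ℕ) ℂ), fun a => ?_,
        fun K _ _ a => ?_⟩
      · rw [map_mul, h2, eval_C]; simp only [map_mul, eval_X]; rfl
      · rw [map_mul, h3, aeval_C, germ_algebraMap_coe]; simp only [map_mul, aeval_X]; rfl

/-- Coordinates which are independent at an ultraproduct of generic points are independent on some
member of the family. -/
lemma exists_indepOn_of_germ {σ κ : Type} [Finite σ] {K : Type} [Field K] [Algebra ℂ K]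
    (A : Finset (MvPolynomial (σ ⊕ κ) ℂ)) (b : MvPolynomial (σ ⊕ κ) ℂ) (q : ℕ → κ → ℂ)
    (Z : ℕ → Set (σ → ℂ)) (ξ : ℕ → σ → K) (hZ : ∀ N, IsIrr (Z N))
    (hξ : ∀ N, IsGenericPt (ξ N) (Z N))
    (hZq : ∀ N, Z N ⊆ zcl (Z N ∩ {v | (∀ p ∈ A, eval (Sum.elim v (q N)) p = 0) ∧
      eval (Sum.elim v (q N)) b ≠ 0})) {s : Set σ}
    (hs : AlgebraicIndepOn (Germ (φ : Filter ℕ) ℂ)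
      (fun i => ((fun N => ξ N i : ℕ → K) : Germ (φ : Filter ℕ) K)) s) :
    ∃ N, IndepOn {v | (∀ p ∈ A, eval (Sum.elim v (q N)) p = 0) ∧
      eval (Sum.elim v (q N)) b ≠ 0} s := by
  by_contra hcon
  push Not at hcon
  have hw : ∀ N, ∃ w : MvPolynomial s ℂ, (∀ v, (∀ p ∈ A, eval (Sum.elim v (q N)) p = 0) →
      eval (Sum.elim v (q N)) b ≠ 0 → eval (fun i : s => v i) w = 0) ∧ w ≠ 0 := fun N => by
    have := hcon N
    unfold IndepOn at this
    push Not at this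
    obtain ⟨w, h1, h2⟩ := this
    exact ⟨w, fun v hv hb => h1 v ⟨hv, hb⟩, h2⟩
  choose w hw hw0 using hw
  have hspec : ∀ (N : ℕ) (p : MvPolynomial (σ ⊕ κ) ℂ), ∃ p' : MvPolynomial σ ℂ,
      (∀ v, eval v p' = eval (Sum.elim v (q N)) p) ∧
      aeval (ξ N) p' = aeval (Sum.elim (ξ N) fun i => algebraMap ℂ K (q N i)) p := fun N p => by
    refine ⟨bind₁ (Sum.elim X fun i => C (q N i)) p, fun v => ?_, ?_⟩
    · rw [eval_bind₁]
      congr 2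
      funext i
      rcases i with i | i <;> simp
    · rw [aeval_bind₁]
      congr 2
      funext i
      rcases i with i | i <;> simp
  have hne : ∀ N, (Z N ∩ {v | (∀ p ∈ A, eval (Sum.elim v (q N)) p = 0) ∧
      eval (Sum.elim v (q N)) b ≠ 0}).Nonempty := fun N => by
    by_contra h
    rw [Set.not_nonempty_iff_eq_empty] at h
    have h1 := hZq N
    rw [h] at h1
    obtain ⟨z, hz⟩ := (hZ N).1
    have h2 := zcl_subset (IsAlgSet.empty) (Set.Subset.refl (∅ : Set (σ → ℂ))) (h1 hz)
    exact h2
  have hA : ∀ N, ∀ p ∈ A, aeval (Sum.elim (ξ N) fun i => algebraMap ℂ K (q N i)) p = 0 := by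
    intro N p hp
    obtain ⟨p', h1, h2⟩ := hspec N p
    rw [← h2, hξ N, mem_vanishingIdeal]
    intro z hz
    have := zcl_subset (isAlgSet_setOf_eval p') (fun v hv => ?_) (hZq N hz)
    · exact this
    · change eval v p' = 0
      rw [h1]; exact hv.2.1 p hp
  have hb : ∀ N, aeval (Sum.elim (ξ N) fun i => algebraMap ℂ K (q N i)) b ≠ 0 := by
    intro N h0
    obtain ⟨p', h1, h2⟩ := hspec N b
    rw [← h2, hξ N, mem_vanishingIdeal] at h0
    obtain ⟨v, hv, -, hvb⟩ := hne N
    exact hvb ((h1 v).symm.trans (h0 v hv))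
  obtain ⟨b', hb1, hb2⟩ := exists_germ_specialization (φ := φ) b q
  obtain ⟨h, hh, hlift⟩ := exists_generic_lift _ hs (b := b') (by
    rw [hb2 K ξ, germ_ne_zero_iff]
    exact Eventually.of_forall hb)
  obtain ⟨h', -, -, hh', -⟩ := exists_germ_mvPolynomial h
  have ha : ∀ N, ∃ a : s → ℂ, h' N ≠ 0 → eval a (h' N) ≠ 0 ∧ eval a (w N) ≠ 0 := fun N => by
    by_cases h0 : h' N = 0
    · exact ⟨0, fun h => absurd h0 h⟩
    by_contra hc
    push Not at hc
    refine mul_ne_zero h0 (hw0 N) (MvPolynomial.funext fun a => ?_)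
    rw [map_mul, map_zero]
    by_cases h1 : eval a (h' N) = 0
    · rw [h1, zero_mul]
    · rw [(hc a).2 h1, mul_zero]
  choose a ha using ha
  have hev := eventually_ne_zero_of_germ hh hh'
  obtain ⟨y, hy1, hy2, hy3⟩ := hlift (fun i => ((fun N => a N i : ℕ → ℂ) : Germ (φ : Filter ℕ) ℂ)) (by
    rw [hh', germ_ne_zero_iff]
    exact hev.mono fun N hN => (ha N hN).1)
  choose y' hy' using fun i => Quotient.exists_rep (y i)
  have hyy : y = fun i => ((fun N => y' i N : ℕ → ℂ) : Germ (φ : Filter ℕ) ℂ) :=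
    (funext hy').symm
  have e1 : ∀ᶠ N in (φ : Filter ℕ), ∀ i : s, y' i N = a N i := by
    rw [eventually_all]
    intro i
    have := hy1 i
    rw [hyy] at this
    exact Germ.coe_eq.1 this
  have e2 : ∀ᶠ N in (φ : Filter ℕ), ∀ p ∈ A, eval (Sum.elim (fun i => y' i N) (q N)) p = 0 := by
    rw [eventually_all_finset]
    intro p hp
    obtain ⟨p', hp1, hp2⟩ := exists_germ_specialization (φ := φ) p q
    have := hy2 p' (by
      rw [hp2 K ξ, germ_eq_zero_iff]
      exact Eventually.of_forall fun N => hA N p hp)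
    rw [hyy, hp1 fun N i => y' i N, germ_eq_zero_iff] at this
    exact this
  have e3 : ∀ᶠ N in (φ : Filter ℕ), eval (Sum.elim (fun i => y' i N) (q N)) b ≠ 0 := by
    rw [hyy, hb1 fun N i => y' i N, germ_ne_zero_iff] at hy3
    exact hy3
  obtain ⟨N, h1, h2, h3, h4⟩ := (e1.and (e2.and (e3.and hev))).exists
  have h5 := hw N _ h2 h3
  rw [show (fun i : s => y' i N) = a N from funext h1] at h5
  exact (ha N h4).2 h5

end

section

open MvPolynomial Filter

/-- The constants of the partial derivations along a transcendence basis. -/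
lemma mem_range_of_derivation_eq_zero {K : Type} [Field K] [CharZero K] [Algebra ℂ K] {r : ℕ}
    {g : Fin r → K} (hg : IsTranscendenceBasis ℂ g) {D : Fin r → Derivation ℂ K K}
    (hD : ∀ i l, D i (g l) = if i = l then 1 else 0) {a : K} (ha : ∀ i, D i a = 0) :
    a ∈ Set.range (algebraMap ℂ K) := by
  refine mem_range_algebraMap_of_isAlgebraic (isAlgebraic_of_forall_derivation fun E => ?_)
  let E' : Derivation ℂ K K := E - ∑ i, E (g i) • D i
  have hE' : ∀ b, E' b = E b - ∑ i, E (g i) * D i b := fun b => by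
    have := congrFun (map_sum Derivation.coeFnAddMonoidHom (fun i => E (g i) • D i) Finset.univ) b
    change (∑ i, E (g i) • D i) b = _ at this
    change E b - (∑ i, E (g i) • D i) b = _
    rw [this, Finset.sum_apply]
    rfl
  have h1 : (E'.restrictScalars ℤ) (algebraMap K K a) = 0 := by
    refine derivation_eq_zero_of_adjoin (C := ℂ) (S := Set.range g) (E'.restrictScalars ℤ)
      (fun c => ?_) ?_ (isAlgebraic_adjoin_of_not_transcendental
        fun h => h (hg.isAlgebraic.isAlgebraic a))
    · exact E'.map_algebraMap c
    · rintro _ ⟨l, rfl⟩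
      change E' (g l) = 0
      rw [hE']
      simp [hD]
  have h2 : E' a = 0 := h1
  rw [hE'] at h2
  simpa [ha] using h2

attribute [local instance] germAlgebra

variable {φ : Ultrafilter ℕ} {K : Type} [Field K]

lemma germ_schQ (f : ℕ → K) : schQ (f : Germ (φ : Filter ℕ) K) =
    ((fun N => schQ (f N) : ℕ → K) : Germ (φ : Filter ℕ) K) := by
  unfold schQ
  rfl

lemma charZero_germ [CharZero K] : CharZero (Germ (φ : Filter ℕ) K) :=
  ⟨fun m n h => by
    have h1 : ((m : K) : Germ (φ : Filter ℕ) K) = ((n : K) : Germ (φ : Filter ℕ) K) := h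
    exact Nat.cast_injective (Germ.const_inj.1 h1)⟩

lemma schRel_germ [Algebra ℂ K] {r : ℕ} {D : Fin r → Derivation ℂ K K} {x X : ℕ → K} :
    SchRel (fun i => (germDerivation φ (D i)).restrictScalars ℤ) (x : Germ (φ : Filter ℕ) K)
        (X : Germ (φ : Filter ℕ) K) ↔
      ∀ᶠ N in (φ : Filter ℕ), SchRel (fun i => (D i).restrictScalars ℤ) (x N) (X N) := by
  have key : ∀ s p : ℕ → K, ∀ i, (((germDerivation φ (D i)).restrictScalars ℤ)
        (X : Germ (φ : Filter ℕ) K) = (s : Germ (φ : Filter ℕ) K) ^ 2 *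
          ((germDerivation φ (D i)).restrictScalars ℤ) (x : Germ (φ : Filter ℕ) K) ∧
      ((germDerivation φ (D i)).restrictScalars ℤ) (s : Germ (φ : Filter ℕ) K) =
        (p : Germ (φ : Filter ℕ) K) * ((germDerivation φ (D i)).restrictScalars ℤ)
          (X : Germ (φ : Filter ℕ) K) ∧
      ((germDerivation φ (D i)).restrictScalars ℤ) (p : Germ (φ : Filter ℕ) K) =
        schQ (x : Germ (φ : Filter ℕ) K) *
          ((germDerivation φ (D i)).restrictScalars ℤ) (x : Germ (φ : Filter ℕ) K) /
            (s : Germ (φ : Filter ℕ) K) - (s : Germ (φ : Filter ℕ) K) *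
          schQ (X : Germ (φ : Filter ℕ) K) *
          ((germDerivation φ (D i)).restrictScalars ℤ) (X : Germ (φ : Filter ℕ) K)) ↔
      ∀ᶠ N in (φ : Filter ℕ), D i (X N) = s N ^ 2 * D i (x N) ∧ D i (s N) = p N * D i (X N) ∧
        D i (p N) = schQ (x N) * D i (x N) / s N - s N * schQ (X N) * D i (X N) := by
    intro s p i
    rw [eventually_and, eventually_and]
    refine and_congr Germ.coe_eq (and_congr Germ.coe_eq ?_)
    rw [germ_schQ, germ_schQ]
    exact Germ.coe_eq
  constructor
  · rintro ⟨s, p, hs, h⟩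
    obtain ⟨s, rfl⟩ := Quotient.exists_rep s
    obtain ⟨p, rfl⟩ := Quotient.exists_rep p
    have h1 := (eventually_all (l := (φ : Filter ℕ))).2 fun i => (key s p i).1 (h i)
    have h2 := germ_ne_zero_iff.1 hs
    filter_upwards [h1, h2] with N hN hN2
    exact ⟨s N, p N, hN2, hN⟩
  · intro h
    have h1 : ∀ N, ∃ s p, SchRel (fun i => (D i).restrictScalars ℤ) (x N) (X N) →
        s ≠ 0 ∧ ∀ i, D i (X N) = s ^ 2 * D i (x N) ∧ D i s = p * D i (X N) ∧
        D i p = schQ (x N) * D i (x N) / s - s * schQ (X N) * D i (X N) := fun N => by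
      by_cases hN : SchRel (fun i => (D i).restrictScalars ℤ) (x N) (X N)
      · obtain ⟨s, p, hs, h⟩ := hN
        exact ⟨s, p, fun _ => ⟨hs, h⟩⟩
      · exact ⟨0, 0, fun h => absurd h hN⟩
    choose s p h1 using h1
    refine ⟨(s : Germ (φ : Filter ℕ) K), (p : Germ (φ : Filter ℕ) K), ?_, fun i => ?_⟩
    · exact germ_ne_zero_iff.2 (h.mono fun N hN => (h1 N hN).1)
    · exact (key s p i).2 (h.mono fun N hN => (h1 N hN).2 i)

end

section

open MvPolynomial Filter

attribute [local instance] germAlgebra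

lemma algebraicIndependent_of_smul {ι F L : Type*} [Field F] [Field L] [Algebra F L] {x : ι → L}
    {c : F} (hc : c ≠ 0) (h : AlgebraicIndependent F fun i => c • x i) :
    AlgebraicIndependent F x := by
  rw [algebraicIndependent_iff] at h ⊢
  intro p hp
  have h1 : aeval (fun i => c • x i) (bind₁ (fun i => C c⁻¹ * X i) p) = 0 := by
    rw [aeval_bind₁, ← hp]
    congr 2
    funext i
    simp [Algebra.smul_def, hc]
  have h2 := congrArg (bind₁ fun i => C c * X i) (h _ h1)
  rw [bind₁_bind₁, map_zero] at h2
  rw [← h2]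
  have h3 : (fun i => bind₁ (fun i => C c * X i) (C c⁻¹ * X i : MvPolynomial ι F)) = X := by
    funext i
    rw [map_mul, bind₁_C_right, bind₁_X_right, ← mul_assoc, ← C_mul, inv_mul_cancel₀ hc, C_1, one_mul]
  rw [h3, bind₁_X_left, AlgHom.id_apply]

lemma exists_schRel_of_unlikely {φ : Ultrafilter ℕ} {K : Type} [Field K] [CharZero K] [Algebra ℂ K]
    [IsAlgClosed K] {r d t u : ℕ} {g : Fin r → K} (hg : IsTranscendenceBasis ℂ g)
    {D : Fin r → Derivation ℂ K K} (hD : ∀ i l, D i (g l) = if i = l then 1 else 0)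
    (x : ℕ → Fin d → K) (cl : Fin d → Fin t) (x₀ : ℕ → Fin t → K)
    (hrel : ∀ N k, SchRel (fun i => (D i).restrictScalars ℤ) (x₀ N (cl k)) (x N k))
    (hx : ∀ N k, Transcendental ℂ (x N k)) {s : Fin r → Fin d} {c : ℂ} (hc : c ≠ 0)
    (hxs : ∀ N i, x N (s i) = c • g i)
    (hu : ∀ s' : Finset (Fin d), AlgebraicIndepOn (Germ (φ : Filter ℕ) ℂ)
      (fun k => ((fun N => x N k : ℕ → K) : Germ (φ : Filter ℕ) K)) (s' : Set (Fin d)) → s'.card ≤ u)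
    (hn : u + t < d + r) :
    ∃ (i l : Fin d) (B : ℕ), i ≠ l ∧ ∀ᶠ N in (φ : Filter ℕ),
      SchRel (fun i => (D i).restrictScalars ℤ) (x N i) (x N l) ∧
      ∃ P : MvPolynomial (Fin 2) ℂ, P ≠ 0 ∧ P.totalDegree ≤ B ∧ aeval ![x N i, x N l] P = 0 := by
  have : CharZero (Germ (φ : Filter ℕ) K) := charZero_germ
  have hconst : ∀ a : ℕ → K, (∀ i, ∀ᶠ N in (φ : Filter ℕ), D i (a N) = 0) →
      ∀ᶠ N in (φ : Filter ℕ), a N ∈ Set.range (algebraMap ℂ K) := fun a ha =>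
    (eventually_all.2 ha).mono fun N hN => mem_range_of_derivation_eq_zero hg hD hN
  obtain ⟨i, l, hil, hS, P, hP, hP0⟩ := ax_schanuel (C := Germ (φ : Filter ℕ) ℂ)
    (L := Germ (φ : Filter ℕ) K) (u := u) (fun a => by
      obtain ⟨a, rfl⟩ := Quotient.exists_rep a
      choose b hb using fun N => IsAlgClosed.exists_pow_nat_eq (a N) (n := 2) (by norm_num)
      exact ⟨((b : ℕ → K) : Germ (φ : Filter ℕ) K), congrArg (Germ.ofFun (l := (φ : Filter ℕ)))
        (funext hb)⟩)
    (fun i => germDerivation φ (D i)) (fun a ha => by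
      obtain ⟨a, rfl⟩ := Quotient.exists_rep a
      have h1 := hconst a fun i => germ_eq_zero_iff.1 (ha i)
      have h2 : ∀ N, ∃ c : ℂ, a N ∈ Set.range (algebraMap ℂ K) → algebraMap ℂ K c = a N :=
        fun N => by
          by_cases h : a N ∈ Set.range (algebraMap ℂ K)
          · exact ⟨h.choose, fun _ => h.choose_spec⟩
          · exact ⟨0, fun h' => absurd h' h⟩
      choose c hc using h2
      refine ⟨((c : ℕ → ℂ) : Germ (φ : Filter ℕ) ℂ), ?_⟩
      rw [germ_algebraMap_coe]
      exact Germ.coe_eq.2 (h1.mono hc))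
    (fun k => ((fun N => x N k : ℕ → K) : Germ (φ : Filter ℕ) K)) cl
    (fun k => ((fun N => x₀ N k : ℕ → K) : Germ (φ : Filter ℕ) K))
    (fun k => schRel_germ.2 (Eventually.of_forall fun N => hrel N k))
    (fun k => by
      by_contra hcon
      push Not at hcon
      obtain ⟨N, c, hN⟩ := (hconst (fun N => x N k) fun i => germ_eq_zero_iff.1 (hcon i)).exists
      exact hx N k (hN ▸ isAlgebraic_algebraMap c)) hu
    (by
      rw [Fintype.linearIndependent_iff]
      intro a ha l
      have h1 := congrFun ha (s l)
      simp only [Finset.sum_apply, Pi.smul_apply, smul_eq_mul, Pi.zero_apply] at h1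
      have h2 : ∀ i, germDerivation φ (D i) ((fun N => x N (s l) : ℕ → K) : Germ (φ : Filter ℕ) K) =
          if i = l then ((fun _ => algebraMap ℂ K c : ℕ → K) : Germ (φ : Filter ℕ) K) else 0 := by
        intro i
        rw [germDerivation_coe]
        simp only [hxs, Derivation.map_smul, hD]
        split_ifs
        · congr 1
          funext N
          rw [Algebra.smul_def, mul_one]
        · simp only [smul_zero]
          rfl
      rw [Finset.sum_eq_single l (fun i _ hi => by rw [h2, if_neg hi, mul_zero]) (by simp), h2,
        if_pos rfl] at h1
      refine (mul_eq_zero.1 h1).resolve_right ?_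
      exact germ_ne_zero_iff.2 (Eventually.of_forall fun _ => by simpa using hc)) hn
  obtain ⟨P', B, hB, hP1, hP2⟩ := exists_germ_mvPolynomial P
  refine ⟨i, l, B, hil, ?_⟩
  have h1 := schRel_germ.1 hS
  have h2 := eventually_ne_zero_of_germ hP hP1
  have h3 := hP2 K fun N => ![x N i, x N l]
  have h4 : (fun k => ((fun N => ![x N i, x N l] k : ℕ → K) : Germ (φ : Filter ℕ) K)) =
      ![((fun N => x N i : ℕ → K) : Germ (φ : Filter ℕ) K),
        ((fun N => x N l : ℕ → K) : Germ (φ : Filter ℕ) K)] := by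
    funext k
    fin_cases k <;> rfl
  rw [h4, hP0] at h3
  have h5 := germ_eq_zero_iff.1 h3.symm
  filter_upwards [h1, h2, h5] with N n1 n2 n3
  exact ⟨n1, P' N, n2, hB N, n3⟩

/-- `(a, b)` satisfies every polynomial relation which holds on the modular correspondence of
level `M`. -/
def PhiGen (J : ℂ → ℂ) (M : ℕ) {K : Type} [Field K] [Algebra ℂ K] (a b : K) : Prop :=
  ∀ p : MvPolynomial (Fin 2) ℂ, (∀ x y, PhiRel J M x y → eval ![x, y] p = 0) → aeval ![a, b] p = 0

/-- The Schwarzian equation characterises modular relations among algebraic relations. -/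
structure SchPhi (J : ℂ → ℂ) : Prop where
  schRel : ∀ (K : Type) [Field K] [CharZero K] [IsAlgClosed K] [Algebra ℂ K] (r : ℕ)
    (D : Fin r → Derivation ℂ K K) (a b : K) (M : ℕ), 1 ≤ M → Transcendental ℂ a →
    PhiGen J M a b → SchRel (fun i => (D i).restrictScalars ℤ) a b
  exists_phiGen : ∀ B : ℕ, ∃ N₀ : ℕ, ∀ (K : Type) [Field K] [CharZero K] [IsAlgClosed K]
    [Algebra ℂ K] (r : ℕ) (D : Fin r → Derivation ℂ K K) (a b : K), (∃ i, D i a ≠ 0) →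
    SchRel (fun i => (D i).restrictScalars ℤ) a b → ∀ P : MvPolynomial (Fin 2) ℂ, P ≠ 0 →
    P.totalDegree ≤ B → aeval ![a, b] P = 0 → ∃ M, 1 ≤ M ∧ M ≤ N₀ ∧ PhiGen J M a b

lemma phiRel_smul_iff {j : ℂ → ℂ} {M : ℕ} {c : ℂ} (hc : c ≠ 0) {x y : ℂ} :
    PhiRel (fun z => c * j z) M (c * x) (c * y) ↔ PhiRel j M x y := by
  unfold PhiRel
  simp only [mul_right_inj' hc]

lemma IsGenericPt.phiGen_iff {j : ℂ → ℂ} (hj : PhiAlg j) {ι K : Type} [Field K] [Algebra ℂ K]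
    {ξ : ι → K} {Z : Set (ι → ℂ)} (hξ : IsGenericPt ξ Z) {c : ℂ} (hc : c ≠ 0) {M : ℕ} (hM : 1 ≤ M)
    {i k : ι} :
    PhiGen (fun z => c * j z) M (c • ξ i) (c • ξ k) ↔ ∀ x ∈ Z, PhiRel j M (x i) (x k) := by
  have hev : ∀ p : MvPolynomial (Fin 2) ℂ, aeval ![c • ξ i, c • ξ k] p = 0 ↔
      ∀ x ∈ Z, eval ![c * x i, c * x k] p = 0 := fun p => by
    have h1 : aeval ![c • ξ i, c • ξ k] p = aeval ξ (bind₁ ![C c * X i, C c * X k] p) := by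
      rw [aeval_bind₁]
      congr 2
      funext l
      fin_cases l <;> simp [Algebra.smul_def]
    rw [h1, hξ, mem_vanishingIdeal]
    refine forall₂_congr fun x hx => ?_
    rw [show ![c * x i, c * x k] = fun l => eval x (![C c * X i, C c * X k] l) by
      funext l; fin_cases l <;> simp, eval_bind₁]
  constructor
  · intro h x hx
    obtain ⟨Φ, hΦ⟩ := hj.alg M hM
    have h1 := (hev (bind₁ (fun l => C c⁻¹ * X l) Φ)).1 (h _ fun x y hxy => ?_) x hx
    · rw [hΦ, ← h1, eval_bind₁]
      congr 2
      funext l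
      fin_cases l <;> simp [hc]
    · rw [eval_bind₁]
      have h2 := (hΦ (c⁻¹ * x) (c⁻¹ * y)).1 ((phiRel_smul_iff hc).1 (by
        rwa [mul_inv_cancel_left₀ hc, mul_inv_cancel_left₀ hc]))
      rw [← h2]
      congr 2
      funext l
      fin_cases l <;> simp
  · intro h p hp
    rw [hev]
    intro x hx
    exact hp _ _ ((phiRel_smul_iff hc).2 (h x hx))

end

section

open MvPolynomial Filter

attribute [local instance] germAlgebra

lemma IsGenericPt.schRel_of_setoidOf {j : ℂ → ℂ} (hj : PhiAlg j) {c : ℂ} (hc : c ≠ 0)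
    (hJ : SchPhi fun z => c * j z) {n : ℕ} {X : Set (Fin n → ℂ)} (hXc : NoConstCoord X)
    {K : Type} [Field K] [CharZero K] [IsAlgClosed K] [Algebra ℂ K] {ξ : Fin n → K}
    (hξ : IsGenericPt ξ X) {r : ℕ} (D : Fin r → Derivation ℂ K K) {i k : Fin n}
    (h : setoidOf (relsOn j X) i k) :
    SchRel (fun i => (D i).restrictScalars ℤ) (c • ξ i) (c • ξ k) := by
  induction h with
  | rel i k h =>
    obtain ⟨M, hM, hX⟩ := h
    refine hJ.schRel K r D _ _ M hM ?_ ((hξ.phiGen_iff hj hc hM).2 hX)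
    rw [Algebra.smul_def]
    exact fun h => hξ.transcendental hXc i (by
      have := (isAlgebraic_algebraMap (A := K) c⁻¹).mul h
      rwa [← mul_assoc, ← map_mul, inv_mul_cancel₀ hc, map_one, one_mul] at this)
  | refl i => exact SchRel.refl _ _
  | symm _ _ _ ih => exact ih.symm
  | trans _ _ _ _ _ h1 h2 => exact h1.trans h2

/-- Generic points of `X` prescribed along `s`, with the Schwarzian relations along the fibres
of `cl`. -/
def GenericData {n d r t : ℕ} (c : ℂ) (rep : Fin d → Fin n) (s : Fin r → Fin d)
    (cl : Fin d → Fin t) (X : Set (Fin n → ℂ)) : Prop :=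
  ∀ (K : Type) [Field K] [CharZero K] [IsAlgClosed K] [Algebra ℂ K] (g : Fin r → K),
    IsTranscendenceBasis ℂ g → ∀ D : Fin r → Derivation ℂ K K, ∃ ξ : Fin n → K,
      IsGenericPt ξ X ∧ (∀ i, ξ (rep (s i)) = g i) ∧ ∃ x₀ : Fin t → K, ∀ k,
        SchRel (fun i => (D i).restrictScalars ℤ) (x₀ (cl k)) (c • ξ (rep k))

lemma exists_genericData {j : ℂ → ℂ} (hj : PhiAlg j) {c : ℂ} (hc : c ≠ 0)
    (hJ : SchPhi fun z => c * j z) {n d : ℕ} {X : Set (Fin n → ℂ)} (hXi : IsIrr X)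
    (hXc : NoConstCoord X) (rep : Fin d → Fin n)
    (hrep : ∀ k, ∃ l, k = rep l ∨ ¬ IndepOn X {k, rep l}) :
    ∃ (r : Fin (d + 1)) (s : Fin r → Fin d) (t : Fin (n + 1)) (cl : Fin d → Fin t),
      adim X ≤ r ∧ (t : ℕ) = numClasses j X ∧ GenericData c rep s cl X := by
  obtain ⟨r, s, hr, hXr, hg⟩ := exists_isGenericPt_of_isTranscendenceBasis hXi hXc rep hrep
  have e := Finite.equivFin (Quotient (setoidOf (relsOn j X)))
  have ht : numClasses j X ≤ n := by
    have := Nat.card_le_card_of_surjective (Quotient.mk (setoidOf (relsOn j X)))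
      Quotient.mk_surjective
    rwa [Nat.card_fin] at this
  refine ⟨⟨r, by omega⟩, s, ⟨numClasses j X, by omega⟩, fun k => e ⟦rep k⟧, hXr, rfl, ?_⟩
  intro K _ _ _ _ g hgb D
  obtain ⟨ξ, hξ, hs⟩ := hg K g hgb
  refine ⟨ξ, hξ, hs, fun l => c • ξ (e.symm l).out, fun k => ?_⟩
  refine hξ.schRel_of_setoidOf hj hc hJ hXc D ?_
  rw [e.symm_apply_apply]
  exact Quotient.mk_out (rep k)

lemma exists_rep {j : ℂ → ℂ} (hj : PhiAlg j) {n : ℕ} {S : Set (Fin n → ℂ)} (hS : IsSpecial j S)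
    (hSc : NoConstCoord S) : ∃ rep : Fin (adim S) → Fin n,
      (∀ i l, setoidOf (relsOn j S) (rep i) (rep l) → i = l) ∧
      ∀ X, IsAlgSet X → IsIrr X → X ⊆ S → ∀ k, ∃ l, k = rep l ∨ ¬ IndepOn X {k, rep l} := by
  rw [hj.adim_eq_numClasses hS hSc]
  have e := Finite.equivFin (Quotient (setoidOf (relsOn j S)))
  refine ⟨fun l => (e.symm l).out, fun i l h => ?_, fun X hXa hXi hXS k => ⟨e ⟦k⟧, ?_⟩⟩
  · have := Quotient.sound h
    rw [Quotient.out_eq, Quotient.out_eq] at this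
    exact e.symm.injective this
  · rw [or_iff_not_imp_left]
    intro hne
    refine not_indepOn_of_finite hXa hXi hne (hj.finite_image (R := relsOn j S)
      (fun r hr => hr.1) (fun x hx r hr => hr.2 x (hXS hx)) ?_).1 (by simp) (by simp)
    have := Quotient.mk_out (s := setoidOf (relsOn j S)) k
    rw [← e.symm_apply_apply ⟦k⟧] at this
    exact Setoid.symm' _ this

lemma exists_forall_of_antitone {Δ : Type} [Finite Δ] {P : ℕ → Δ → Prop}
    (hP : ∀ M N δ, M ≤ N → P N δ → P M δ) (h : ∀ N, ∃ δ, P N δ) : ∃ δ, ∀ N, P N δ := by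
  choose f hf using h
  obtain ⟨δ, hδ⟩ := Finite.exists_infinite_fiber f
  refine ⟨δ, fun N => ?_⟩
  obtain ⟨M, hM, hNM⟩ := (Set.infinite_coe_iff.1 hδ).exists_gt N
  exact hP N M δ hNM.le (hM ▸ hf M)

lemma false_of_genericData {j : ℂ → ℂ} (hj : PhiAlg j) {c : ℂ} (hc : c ≠ 0)
    (hJ : SchPhi fun z => c * j z) {n d r t : ℕ} {κ : Type} {rep : Fin d → Fin n}
    (hinj : Function.Injective rep) (s : Fin r → Fin d) (cl : Fin d → Fin t)
    (A : Finset (MvPolynomial (Fin n ⊕ κ) ℂ)) (b : MvPolynomial (Fin n ⊕ κ) ℂ)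
    (q : ℕ → κ → ℂ) (X : ℕ → Set (Fin n → ℂ)) (hXi : ∀ N, IsIrr (X N))
    (hXc : ∀ N, NoConstCoord (X N)) (hXd : ∀ N, GenericData c rep s cl (X N))
    (hXq : ∀ N, X N ⊆ zcl (X N ∩ {v | (∀ p ∈ A, eval (Sum.elim v (q N)) p = 0) ∧
      eval (Sum.elim v (q N)) b ≠ 0}))
    (hdim : ∀ N, adim {v | (∀ p ∈ A, eval (Sum.elim v (q N)) p = 0) ∧
      eval (Sum.elim v (q N)) b ≠ 0} + t < r + d)
    (hbad : ∀ N i l M, i ≠ l → 1 ≤ M → M ≤ N → ¬ ∀ x ∈ X N, PhiRel j M (x (rep i)) (x (rep l))) :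
    False := by
  classical
  obtain ⟨K, _, _, _, _, g, hg⟩ := exists_isAlgClosed_isTranscendenceBasis (Fin r) ℂ
  choose D hD using fun i : Fin r =>
    exists_derivation_of_algebraicIndependent hg.1 (fun l => if i = l then (1 : K) else 0)
  choose ξ hξ hs x₀ hx₀ using fun N => hXd N K g hg D
  let φ : Ultrafilter ℕ := hyperfilter ℕ
  have htr : ∀ N k, Transcendental ℂ (c • ξ N (rep k)) := fun N k h => by
    rw [Algebra.smul_def] at h
    have := (isAlgebraic_algebraMap (A := K) c⁻¹).mul h
    rw [← mul_assoc, ← map_mul, inv_mul_cancel₀ hc, map_one, one_mul] at this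
    exact (hξ N).transcendental (hXc N) _ this
  obtain ⟨i, l, B, hil, hev⟩ := exists_schRel_of_unlikely (φ := φ) (u := r + d - t - 1) hg
    hD (fun N k => c • ξ N (rep k)) cl x₀ hx₀ htr hc (fun N i => by rw [hs])
    (fun s' hs' => by
      have h1 : AlgebraicIndepOn (Germ (φ : Filter ℕ) ℂ)
          (fun k => ((fun N => ξ N k : ℕ → K) : Germ (φ : Filter ℕ) K))
          (s'.map ⟨rep, hinj⟩ : Set (Fin n)) := by
        have h2 := algebraicIndependent_of_smul (F := Germ (φ : Filter ℕ) ℂ)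
          (L := Germ (φ : Filter ℕ) K) (c := ((fun _ => c : ℕ → ℂ) : Germ (φ : Filter ℕ) ℂ))
          (x := fun k : (s' : Set (Fin d)) => ((fun N => ξ N (rep k) : ℕ → K) : Germ (φ : Filter ℕ) K))
          (germ_ne_zero_iff.2 (Eventually.of_forall fun _ => hc)) (by
            have h3 : ∀ k : Fin d, ((fun N => c • ξ N (rep k) : ℕ → K) : Germ (φ : Filter ℕ) K) =
                ((fun _ => c : ℕ → ℂ) : Germ (φ : Filter ℕ) ℂ) •
                  ((fun N => ξ N (rep k) : ℕ → K) : Germ (φ : Filter ℕ) K) := fun k => by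
              rw [Algebra.smul_def, germ_algebraMap_coe]
              simp only [Algebra.smul_def]
              rfl
            simpa only [AlgebraicIndepOn, h3] using hs')
        have h4 : ∀ i : ((s'.map ⟨rep, hinj⟩ : Finset (Fin n)) : Set (Fin n)),
            ∃ k : (s' : Set (Fin d)), rep k = i := fun i => by
          obtain ⟨k, hk, hki⟩ := Finset.mem_map.1 i.2
          exact ⟨⟨k, hk⟩, hki⟩
        choose f hf using h4
        have h5 := h2.comp f fun a b hab => Subtype.ext (by rw [← hf a, ← hf b, hab])
        have h6 : ((fun k : (s' : Set (Fin d)) =>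
            ((fun N => ξ N (rep k) : ℕ → K) : Germ (φ : Filter ℕ) K)) ∘ f) =
            fun i => ((fun N => ξ N i.1 : ℕ → K) : Germ (φ : Filter ℕ) K) := by
          funext i
          simp only [Function.comp_apply, hf]
        rwa [h6] at h5
      obtain ⟨N, hN⟩ := exists_indepOn_of_germ A b q X ξ hXi hξ hXq h1
      have h2 := hN.card_le_adim
      rw [Finset.card_map] at h2
      have h3 := hdim N
      omega)
    (by have := hdim 0; omega)
  obtain ⟨N₀, hN₀⟩ := hJ.exists_phiGen B
  have hlarge : ∀ᶠ N in (φ : Filter ℕ), N₀ ≤ N :=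
    Nat.hyperfilter_le_atTop (eventually_ge_atTop N₀)
  obtain ⟨N, ⟨h1, P, hP, hPB, hP0⟩, hN⟩ := (hev.and hlarge).exists
  obtain ⟨M, hM1, hM, hgen⟩ := hN₀ K r D _ _ (by
    by_contra hcon
    push Not at hcon
    obtain ⟨a, ha⟩ := mem_range_of_derivation_eq_zero hg hD hcon
    exact htr N i (ha ▸ isAlgebraic_algebraMap a)) h1 P hP hPB hP0
  exact hbad N i l M hil hM1 (hM.trans hN) (((hξ N).phiGen_iff hj hc hM1).1 hgen)

lemma boundedRelation_of_schPhi {j : ℂ → ℂ} (hj : PhiAlg j) {c : ℂ} (hc : c ≠ 0)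
    (hJ : SchPhi fun z => c * j z) : BoundedRelation j := by
  intro n m S hS hSc F hF hFS
  obtain ⟨rep, hrep, hdep⟩ := exists_rep hj hS hSc
  obtain ⟨κ, _, A, b, rfl⟩ := hF.exists_pieces
  by_contra hcon
  push Not at hcon
  have hpiece : ∀ q z, {v : Fin n → ℂ | (∀ p ∈ A z, eval (Sum.elim v q) p = 0) ∧
      eval (Sum.elim v q) (b z) ≠ 0} ⊆ fib (⋃ i, {v | (∀ p ∈ A i, eval v p = 0) ∧ eval v (b i) ≠ 0}) q :=
    fun q z v hv => Set.mem_iUnion.2 ⟨z, hv⟩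
  obtain ⟨⟨⟨r, s⟩, ⟨t, cl⟩, z⟩, hδ⟩ := exists_forall_of_antitone
    (Δ := (Σ r : Fin (adim S + 1), (Fin r → Fin (adim S))) ×
      (Σ t : Fin (n + 1), (Fin (adim S) → Fin t)) × κ)
    (P := fun N δ => ∃ (q : Fin m → ℂ) (X : Set (Fin n → ℂ)), IsIrr X ∧ NoConstCoord X ∧
      GenericData c rep δ.1.2 δ.2.1.2 X ∧
      X ⊆ zcl (X ∩ {v | (∀ p ∈ A δ.2.2, eval (Sum.elim v q) p = 0) ∧
        eval (Sum.elim v q) (b δ.2.2) ≠ 0}) ∧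
      adim {v | (∀ p ∈ A δ.2.2, eval (Sum.elim v q) p = 0) ∧
        eval (Sum.elim v q) (b δ.2.2) ≠ 0} + δ.2.1.1 < δ.1.1 + adim S ∧
      ∀ i l M, i ≠ l → 1 ≤ M → M ≤ N → ¬ ∀ x ∈ X, PhiRel j M (x (rep i)) (x (rep l)))
    (by
      rintro M N δ hMN ⟨q, X, h1, h2, h3, h4, h5, h6⟩
      exact ⟨q, X, h1, h2, h3, h4, h5, fun i l M' h7 h8 h9 => h6 i l M' h7 h8 (h9.trans hMN)⟩)
    (fun N => by
      obtain ⟨q, X, hXa, hXi, hXc, hXS, hXF, hlt, hno⟩ := hcon N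
      obtain ⟨r, s, t, cl, hr, ht, hgd⟩ := exists_genericData hj hc hJ hXi hXc rep
        (hdep X hXa hXi hXS)
      obtain ⟨z, hz⟩ := hXi.subset_of_iUnion (V := fun z => zcl (X ∩ {v : Fin n → ℂ |
        (∀ p ∈ A z, eval (Sum.elim v q) p = 0) ∧ eval (Sum.elim v q) (b z) ≠ 0}))
        (fun z => isAlgSet_zcl _) (hXF.trans (zcl_subset (IsAlgSet.iUnion fun z => isAlgSet_zcl _) (by
          rintro v ⟨hv, hvF⟩
          obtain ⟨z, hz⟩ := Set.mem_iUnion.1 hvF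
          exact Set.mem_iUnion.2 ⟨z, subset_zcl _ ⟨hv, hz⟩⟩)))
      refine ⟨⟨⟨r, s⟩, ⟨t, cl⟩, z⟩, q, X, hXi, hXc, hgd, hz, ?_, fun i l M hil hM hMN hX => ?_⟩
      · have := adim_mono (hpiece q z)
        change adim {v : Fin n → ℂ | (∀ p ∈ A z, eval (Sum.elim v q) p = 0) ∧
          eval (Sum.elim v q) (b z) ≠ 0} + (t : ℕ) < (r : ℕ) + adim S
        omega
      · obtain ⟨x, hx, hxM⟩ := hno (rep i) (rep l) M hM hMN fun h => hil (hrep i l h)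
        exact hxM (hX x hx))
  choose q X h1 h2 h3 h4 h5 h6 using hδ
  exact false_of_genericData hj hc hJ (fun i l h => hrep i l (by rw [h])) s cl (A z) (b z)
    q X h1 h2 h3 h4 h5 h6

end

section

section ModularForms
open UpperHalfPlane ModularForm ModularFormClass MatrixGroups EisensteinSeries Filter Topology Derivative
open scoped Manifold

def levelOneForm {k : ℤ} (F : ℍ → ℂ) (hF : MDiff F) (hinv : ∀ γ : SL(2, ℤ), F ∣[k] γ = F)
    (hb : IsBoundedAtImInfty F) : ModularForm 𝒮ℒ k where
  toFun := F
  slash_action_eq' := fun _ ⟨γ, hγ⟩ => hγ ▸ hinv γ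
  holo' := hF
  bdd_at_cusps' {c} hc := by
    rw [Subgroup.IsArithmetic.isCusp_iff_isCusp_SL2Z] at hc
    rw [OnePoint.isBoundedAt_iff_forall_SL2Z hc]
    intro γ _
    rwa [hinv γ]

def levelOneCuspForm {k : ℤ} (F : ℍ → ℂ) (hF : MDiff F) (hinv : ∀ γ : SL(2, ℤ), F ∣[k] γ = F)
    (hb : IsZeroAtImInfty F) : CuspForm 𝒮ℒ k where
  toFun := F
  slash_action_eq' := fun _ ⟨γ, hγ⟩ => hγ ▸ hinv γ
  holo' := hF
  zero_at_cusps' {c} hc := by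
    rw [Subgroup.IsArithmetic.isCusp_iff_isCusp_SL2Z] at hc
    rw [OnePoint.isZeroAt_iff_forall_SL2Z hc]
    intro γ _
    rwa [hinv γ]

lemma levelOne_eq_zero_of_tendsto {k : ℤ} (hk : k < 12) {F : ℍ → ℂ} (hF : MDiff F)
    (hinv : ∀ γ : SL(2, ℤ), F ∣[k] γ = F) (h0 : Tendsto F atImInfty (𝓝 0)) (z : ℍ) : F z = 0 := by
  have := rank_zero_iff_forall_zero.mp (CuspForm.rank_eq_zero_of_weight_lt_twelve hk)
    (levelOneCuspForm F hF hinv h0)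
  exact congrArg (fun f : CuspForm 𝒮ℒ k => f z) this

lemma tendsto_normalizedDeriv {F : ℍ → ℂ} (hF : MDiff F) {c : ℂ}
    (h : Tendsto F atImInfty (𝓝 c)) : Tendsto (D F) atImInfty (𝓝 0) := by
  rw [Metric.tendsto_nhds]
  intro ε hε
  have h1 := (Metric.tendsto_nhds.1 h) ε hε
  rw [atImInfty, eventually_comap] at h1
  obtain ⟨A, hA⟩ := eventually_atTop.1 h1
  have h2 : ∀ᶠ z in atImInfty, A + 2 ≤ UpperHalfPlane.im z ∧ 2 ≤ UpperHalfPlane.im z :=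
    (tendsto_comap.eventually (eventually_ge_atTop (A + 2))).and
      (tendsto_comap.eventually (eventually_ge_atTop 2))
  filter_upwards [h2] with z ⟨hz, hz2⟩
  have him : ∀ w ∈ Metric.closedBall (z : ℂ) 1, z.im - 1 ≤ w.im := fun w hw => by
    have h3 : |(w - z).im| ≤ 1 := (Complex.abs_im_le_norm _).trans (by
      simpa [dist_eq_norm] using hw)
    have := (abs_le.1 h3).1
    simp only [Complex.sub_im, UpperHalfPlane.coe_im] at this
    linarith
  have hd : DiffContOnCl ℂ (fun w => (F ∘ ofComplex) w - c) (Metric.ball (z : ℂ) 1) := by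
    apply DifferentiableOn.diffContOnCl
    rw [closure_ball _ one_ne_zero]
    refine DifferentiableOn.sub_const ?_ _
    refine (UpperHalfPlane.mdifferentiable_iff.1 hF).mono fun w hw => ?_
    have := him w hw
    change 0 < w.im
    linarith
  have h4 := Complex.norm_deriv_le_of_forall_mem_sphere_norm_le (C := ε) one_pos hd (by
    intro w hw
    have h5 := him w (Metric.sphere_subset_closedBall hw)
    have h6 : 0 < w.im := by linarith
    have := hA w.im (by linarith) ⟨w, h6⟩ rfl
    rw [dist_eq_norm] at this
    simpa [ofComplex_apply_of_im_pos h6] using this.le)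
  rw [deriv_sub_const, div_one] at h4
  rw [dist_zero_right, normalizedDerivOfComplex, norm_mul]
  have h7 : ‖(2 * (Real.pi : ℂ) * Complex.I)⁻¹‖ < 1 := by
    rw [norm_inv, norm_mul, norm_mul, Complex.norm_I, Complex.norm_real, Real.norm_eq_abs,
      abs_of_pos Real.pi_pos]
    norm_num
    have := Real.pi_gt_three
    rw [inv_mul_lt_iff₀ Real.pi_pos]
    linarith
  calc _ ≤ ‖(2 * (Real.pi : ℂ) * Complex.I)⁻¹‖ * ε := by gcongr
    _ < 1 * ε := by gcongr
    _ = ε := one_mul _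

lemma hasSum_div_qParam {f : ℍ → ℂ} {c : ℕ → ℂ}
    (hf : ∀ τ : ℍ, HasSum (fun m => c m • Function.Periodic.qParam 1 τ ^ m) (f τ)) (τ : ℍ) :
    HasSum (fun m => c (m + 1) • Function.Periodic.qParam 1 τ ^ m)
      ((f τ - c 0) / Function.Periodic.qParam 1 τ) := by
  have h1 := ((hasSum_nat_add_iff' 1).2 (hf τ)).div_const (Function.Periodic.qParam 1 τ)
  have hq : Function.Periodic.qParam 1 (τ : ℂ) ≠ 0 := Function.Periodic.qParam_ne_zero _
  simpa [pow_succ, ← mul_assoc, hq] using h1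

lemma tendsto_of_hasSum_qParam {f : ℍ → ℂ} {c : ℕ → ℂ}
    (hf : ∀ τ : ℍ, HasSum (fun m => c m • Function.Periodic.qParam 1 τ ^ m) (f τ)) :
    Tendsto f atImInfty (𝓝 (c 0)) := by
  have h1 := isBoundedAtImInfty_of_hasSum_qExpansion one_pos (hasSum_div_qParam hf)
  have h2 : Tendsto (fun τ : ℍ => Function.Periodic.qParam 1 τ *
      ((f τ - c 0) / Function.Periodic.qParam 1 τ)) atImInfty (𝓝 0) :=
    (qParam_tendsto_atImInfty one_pos).zero_mul_isBoundedUnder_le h1.isBoundedUnder_le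
  have h3 := h2.const_add (c 0)
  rw [add_zero] at h3
  refine h3.congr fun τ => ?_
  rw [mul_div_cancel₀ _ (Function.Periodic.qParam_ne_zero _)]
  ring

lemma hasSum_modularForm {k : ℤ} (f : ModularForm 𝒮ℒ k) (τ : ℍ) :
    HasSum (fun m => (qExpansion 1 f).coeff m • Function.Periodic.qParam 1 τ ^ m) (f τ) :=
  UpperHalfPlane.hasSum_qExpansion one_pos
    (SlashInvariantFormClass.periodic_comp_ofComplex f one_mem_strictPeriods_SL) f.holo'
    (ModularFormClass.bdd_at_infty f) τ

lemma tendsto_E₄ : Tendsto E₄ atImInfty (𝓝 1) := by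
  simpa [-PowerSeries.coeff_zero_eq_constantCoeff, E_qExpansion_coeff_zero _ ⟨2, rfl⟩] using
    tendsto_of_hasSum_qParam (hasSum_modularForm E₄)

lemma tendsto_E₆ : Tendsto E₆ atImInfty (𝓝 1) := by
  simpa [-PowerSeries.coeff_zero_eq_constantCoeff, E_qExpansion_coeff_zero _ ⟨3, rfl⟩] using
    tendsto_of_hasSum_qParam (hasSum_modularForm E₆)

lemma tendsto_E2 : Tendsto E2 atImInfty (𝓝 1) :=
  tendsto_of_hasSum_qParam (c := fun m : ℕ =>
    (if m = 0 then 1 else -24 * ArithmeticFunction.sigma 1 m : ℂ)) fun τ => by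
    simpa only [Function.Periodic.qParam, Complex.ofReal_one, div_one] using
      hasSum_qExpansion_E2 (z := τ)

def HolInv (k : ℤ) (F : ℍ → ℂ) : Prop := MDiff F ∧ ∀ γ : SL(2, ℤ), F ∣[k] γ = F

lemma holInv_modularForm {k : ℤ} (f : ModularForm 𝒮ℒ k) : HolInv k f :=
  ⟨f.holo', fun γ => SlashInvariantForm.slash_action_eqn f _ ⟨γ, rfl⟩⟩

lemma HolInv.add {k : ℤ} {F G : ℍ → ℂ} (hF : HolInv k F) (hG : HolInv k G) : HolInv k (F + G) :=
  ⟨hF.1.add hG.1, fun γ => by rw [SlashAction.add_slash, hF.2, hG.2]⟩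

lemma HolInv.const_smul {k : ℤ} {F : ℍ → ℂ} (hF : HolInv k F) (c : ℂ) : HolInv k (c • F) :=
  ⟨hF.1.const_smul c, fun γ => by rw [ModularForm.SL_smul_slash, hF.2]⟩

lemma HolInv.mul {k l : ℤ} {F G : ℍ → ℂ} (hF : HolInv k F) (hG : HolInv l G) :
    HolInv (k + l) (F * G) :=
  ⟨hF.1.mul hG.1, fun γ => by rw [ModularForm.mul_slash_SL2, hF.2, hG.2]⟩

lemma HolInv.serre {k : ℤ} {F : ℍ → ℂ} (hF : HolInv k F) :
    HolInv (k + 2) (serreDerivative k F) :=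
  ⟨serreDerivative_mdifferentiable _ hF.1, fun γ => serreDerivative_slash_invariant hF.1 (hF.2 γ)⟩

lemma HolInv.eq_zero {k : ℤ} (hk : k < 12) {F : ℍ → ℂ} (hF : HolInv k F)
    (h0 : Tendsto F atImInfty (𝓝 0)) (z : ℍ) : F z = 0 :=
  levelOne_eq_zero_of_tendsto hk hF.1 hF.2 h0 z

lemma normalizedDeriv_E₄ (z : ℍ) : D E₄ z = 3⁻¹ * (E2 z * E₄ z - E₆ z) := by
  have h1 := ((tendsto_normalizedDeriv E₄.holo' tendsto_E₄).sub
      ((tendsto_E2.const_mul (4 * 12⁻¹ : ℂ)).mul tendsto_E₄)).add (tendsto_E₆.const_mul (3⁻¹ : ℂ))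
  rw [show (0 - 4 * 12⁻¹ * 1 * 1 + 3⁻¹ * 1 : ℂ) = 0 by norm_num] at h1
  have h2 := ((holInv_modularForm E₄).serre.add
    ((holInv_modularForm E₆).const_smul 3⁻¹)).eq_zero (by norm_num) h1 z
  simp only [Pi.add_apply, Pi.smul_apply, smul_eq_mul, serreDerivative_apply] at h2
  push_cast at h2
  linear_combination h2

lemma normalizedDeriv_E₆ (z : ℍ) : D E₆ z = 2⁻¹ * (E2 z * E₆ z - E₄ z ^ 2) := by
  have h1 := ((tendsto_normalizedDeriv E₆.holo' tendsto_E₆).sub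
      ((tendsto_E2.const_mul (6 * 12⁻¹ : ℂ)).mul tendsto_E₆)).add
      ((tendsto_E₄.mul tendsto_E₄).const_mul (2⁻¹ : ℂ))
  rw [show (0 - 6 * 12⁻¹ * 1 * 1 + 2⁻¹ * (1 * 1) : ℂ) = 0 by norm_num] at h1
  have h2 := ((holInv_modularForm E₆).serre.add
    (((holInv_modularForm E₄).mul (holInv_modularForm E₄)).const_smul 2⁻¹)).eq_zero
    (by norm_num) h1 z
  simp only [Pi.add_apply, Pi.smul_apply, smul_eq_mul, serreDerivative_apply, Pi.mul_apply] at h2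
  push_cast at h2
  linear_combination h2

lemma mdiff_D2 (γ : SL(2, ℤ)) :
    MDiff (D2 γ) ∧ ∀ z : ℍ, D (D2 γ) z = -((γ 1 0 : ℂ) / denom γ z) ^ 2 := by
  have h1 : ∀ w : ℂ, 0 < w.im → HasDerivAt (D2 γ ∘ ofComplex)
      (2 * Real.pi * Complex.I * -((γ 1 0 : ℂ) / (γ 1 0 * w + γ 1 1)) ^ 2) w := fun w hw => by
    have h2 : (γ 1 0 : ℂ) * w + γ 1 1 ≠ 0 := by
      have := denom_ne_zero γ ⟨w, hw⟩
      simpa [denom] using this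
    have h3 : HasDerivAt (fun w : ℂ => (γ 1 0 : ℂ) * w + γ 1 1) (γ 1 0) w := by
      simpa using ((hasDerivAt_id w).const_mul (γ 1 0 : ℂ)).add_const (γ 1 1 : ℂ)
    have h4 := (h3.inv h2).const_mul (2 * Real.pi * Complex.I * γ 1 0)
    refine (h4.congr_of_eventuallyEq ?_).congr_deriv (by field_simp)
    filter_upwards [(isOpen_lt continuous_const Complex.continuous_im).mem_nhds hw] with v hv
    simp [D2, ofComplex_apply_of_im_pos hv, denom, div_eq_mul_inv]
  refine ⟨UpperHalfPlane.mdifferentiable_iff.2 fun w hw => 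
    (h1 w hw).differentiableAt.differentiableWithinAt, fun z => ?_⟩
  rw [normalizedDerivOfComplex, (h1 z z.im_pos).deriv, inv_mul_cancel_left₀ Complex.two_pi_I_ne_zero]
  simp [denom]

lemma normalizedDeriv_E2 (z : ℍ) : D E2 z = 12⁻¹ * (E2 z ^ 2 - E₄ z) := by
  have h1 := ((tendsto_normalizedDeriv E2_mdifferentiable tendsto_E2).add
      ((tendsto_E2.mul tendsto_E2).const_mul (-12⁻¹ : ℂ))).add (tendsto_E₄.const_mul (12⁻¹ : ℂ))
  rw [show (0 + -12⁻¹ * (1 * 1) + 12⁻¹ * 1 : ℂ) = 0 by norm_num] at h1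
  have h3 : HolInv 4 (D E2 + (-12⁻¹ : ℂ) • (E2 * E2)) := by
    refine ⟨(normalizedDerivOfComplex_mdifferentiable E2_mdifferentiable).add
      ((E2_mdifferentiable.mul E2_mdifferentiable).const_smul _), fun γ => ?_⟩
    have h4 := normalizedDerivOfComplex_SL_slash (k := 2) E2_mdifferentiable (γ := γ)
    obtain ⟨hd, hd'⟩ := mdiff_D2 γ
    rw [E2_slash_action, normalizedDerivOfComplex_sub _ _ E2_mdifferentiable (hd.const_smul _),
      normalizedDerivOfComplex_smul _ _ hd] at h4
    rw [SlashAction.add_slash, ModularForm.SL_smul_slash, 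
      show (4 : ℤ) = 2 + 2 by norm_num, ModularForm.mul_slash_SL2, E2_slash_action]
    ext z
    have h5 := congrFun h4 z
    simp only [Pi.add_apply, Pi.smul_apply, smul_eq_mul, Pi.mul_apply, Pi.sub_apply, hd'] at h5 ⊢
    have h6 : 2 * (Real.pi : ℂ) * Complex.I ≠ 0 := Complex.two_pi_I_ne_zero
    have h7 : D2 γ z = 2 * (Real.pi : ℂ) * Complex.I * (γ 1 0 / denom γ z) := by
      rw [D2, mul_div_assoc]
    have h8 : (1 / (2 * riemannZeta 2) : ℂ) = -12 * ((2 * (Real.pi : ℂ) * Complex.I)⁻¹) ^ 2 := by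
      rw [riemannZeta_two, mul_inv, mul_inv, mul_pow, Complex.inv_I, mul_pow, neg_sq, Complex.I_sq]
      have := Complex.ofReal_ne_zero.2 Real.pi_ne_zero
      field_simp
      norm_num
    rw [h7, h8] at h5 ⊢
    rw [show (D E2 ∣[(2 + 2 : ℤ)] γ) z = (D E2 ∣[(4 : ℤ)] γ) z from rfl]
    generalize 2 * (Real.pi : ℂ) * Complex.I = t at *
    generalize (γ 1 0 / denom γ z : ℂ) = u at *
    have h9 : t * t⁻¹ = 1 := mul_inv_cancel₀ h6
    push_cast at h5
    linear_combination -h5 + (-12 * t⁻¹ ^ 2 * u ^ 2 * (t * t⁻¹ - 1) - 2 * t⁻¹ * u * E2 z) * h9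
  have h2 := (h3.add ((holInv_modularForm E₄).const_smul 12⁻¹)).eq_zero (by norm_num) h1 z
  simp only [Pi.add_apply, Pi.smul_apply, smul_eq_mul, Pi.mul_apply] at h2
  linear_combination h2

lemma normalizedDeriv_discriminant (z : ℍ) :
    D discriminant z = E2 z * discriminant z := by
  have h1 : discriminant = (1728⁻¹ : ℂ) • (⇑E₄ ^ 3 - ⇑E₆ ^ 2) := by
    ext z
    simp [discriminant_eq_E₄_cube_sub_E₆_sq]
    ring
  have h4 : MDiff (⇑E₄ ^ 3) := E₄.holo'.pow 3
  have h6 : MDiff (⇑E₆ ^ 2) := E₆.holo'.pow 2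
  rw [h1, normalizedDerivOfComplex_smul _ _ (h4.sub h6), normalizedDerivOfComplex_sub _ _ h4 h6,
    normalizedDerivOfComplex_pow (⇑E₄) _ E₄.holo', normalizedDerivOfComplex_pow (⇑E₆) _ E₆.holo']
  simp only [Pi.sub_apply, Pi.smul_apply, smul_eq_mul, Pi.mul_apply, Pi.pow_apply,
    normalizedDeriv_E₄, normalizedDeriv_E₆]
  simp
  ring

lemma coe_SL_smul (γ : SL(2, ℤ)) (z : ℍ) :
    ((γ • z : ℍ) : ℂ) = moeb (zmat (γ : Matrix (Fin 2) (Fin 2) ℤ)) z := by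
  rw [UpperHalfPlane.coe_specialLinearGroup_apply]
  simp [moeb, zmat]

lemma IsModularJ.holInv {j : ℂ → ℂ} (hj : IsModularJ j) : HolInv 0 (fun z : ℍ => j z) := by
  refine ⟨UpperHalfPlane.mdifferentiable_iff.2 (hj.holo.congr fun w hw => ?_), fun γ => ?_⟩
  · simp [ofComplex_apply_of_im_pos hw]
  · ext z
    rw [ModularForm.SL_slash_apply, coe_SL_smul, hj.invariant _ γ.2 z z.im_pos]
    simp

lemma E₄_second_order : Tendsto (fun z : ℍ => (E₄ z - 1) / Function.Periodic.qParam 1 z) atImInfty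
    (𝓝 240) ∧ Tendsto (fun z : ℍ => ((E₄ z - 1) / Function.Periodic.qParam 1 z - 240) /
      Function.Periodic.qParam 1 z) atImInfty (𝓝 2160) := by
  have h1 := hasSum_div_qParam (hasSum_modularForm E₄)
  have h2 := hasSum_div_qParam h1
  have e0 := E_qExpansion_coeff_zero (k := 4) (by norm_num) ⟨2, rfl⟩
  have e2 : (qExpansion 1 E₄).coeff 2 = 2160 := by
    rw [E_qExpansion_coeff _ ⟨2, rfl⟩, show bernoulli 4 = -1 / 30 by decide +kernel,
      show ArithmeticFunction.sigma (4 - 1) 2 = 9 by decide +kernel]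
    norm_num
  have h3 := tendsto_of_hasSum_qParam h1
  have h4 := tendsto_of_hasSum_qParam h2
  simp only [zero_add, e0, E₄_qExpansion_coeff_one, e2] at h3 h4
  exact ⟨h3, h4⟩

lemma E₆_second_order : Tendsto (fun z : ℍ => (E₆ z - 1) / Function.Periodic.qParam 1 z) atImInfty
    (𝓝 (-504)) ∧ Tendsto (fun z : ℍ => ((E₆ z - 1) / Function.Periodic.qParam 1 z - -504) /
      Function.Periodic.qParam 1 z) atImInfty (𝓝 (-16632)) := by
  have h1 := hasSum_div_qParam (hasSum_modularForm E₆)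
  have h2 := hasSum_div_qParam h1
  have e0 := E_qExpansion_coeff_zero (k := 6) (by norm_num) ⟨3, rfl⟩
  have e2 : (qExpansion 1 E₆).coeff 2 = -16632 := by
    rw [E_qExpansion_coeff _ ⟨3, rfl⟩, show bernoulli 6 = 1 / 42 by decide +kernel,
      show ArithmeticFunction.sigma (6 - 1) 2 = 33 by decide +kernel]
    norm_num
  have h3 := tendsto_of_hasSum_qParam h1
  have h4 := tendsto_of_hasSum_qParam h2
  simp only [zero_add, e0, E₆_qExpansion_coeff_one, e2] at h3 h4
  exact ⟨h3, h4⟩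

lemma discriminant_second_order :
    Tendsto (fun z : ℍ => discriminant z / Function.Periodic.qParam 1 z) atImInfty (𝓝 1) ∧
    Tendsto (fun z : ℍ => (discriminant z / Function.Periodic.qParam 1 z - 1) /
      Function.Periodic.qParam 1 z) atImInfty (𝓝 (-24)) := by
  have hq := qParam_tendsto_atImInfty one_pos
  obtain ⟨a1, a2⟩ := E₄_second_order
  obtain ⟨b1, b2⟩ := E₆_second_order
  have h2 : Tendsto (fun z : ℍ => (discriminant z / Function.Periodic.qParam 1 z - 1) /
      Function.Periodic.qParam 1 z) atImInfty (𝓝 (-24)) := by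
    have h := (((((a2.const_mul 3).sub (b2.const_mul 2)).add ((a1.pow 2).const_mul 3)).add
      (hq.mul (a1.pow 3))).sub (b1.pow 2)).div_const 1728
    rw [show ((3 * 2160 - 2 * -16632 + 3 * 240 ^ 2 + 0 * 240 ^ 3 - (-504) ^ 2) / 1728 : ℂ) = -24 by
      norm_num] at h
    refine h.congr fun z => ?_
    have : Function.Periodic.qParam 1 (z : ℂ) ≠ 0 := Function.Periodic.qParam_ne_zero _
    rw [discriminant_eq_E₄_cube_sub_E₆_sq]
    field_simp
    ring
  refine ⟨?_, h2⟩
  have h3 := (hq.mul h2).const_add 1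
  rw [zero_mul, add_zero] at h3
  refine h3.congr fun z => ?_
  rw [mul_div_cancel₀ _ (Function.Periodic.qParam_ne_zero _)]
  ring

theorem IsModularJ.eq_div {j : ℂ → ℂ} (hj : IsModularJ j) (z : ℍ) :
    j z = E₄ z ^ 3 / discriminant z := by
  have hq := qParam_tendsto_atImInfty one_pos
  have hq0 : ∀ z : ℍ, Function.Periodic.qParam 1 (z : ℂ) ≠ 0 := fun z =>
    Function.Periodic.qParam_ne_zero _
  have hG : Tendsto (fun z : ℍ => j z - (Function.Periodic.qParam 1 z)⁻¹ - 744) atImInfty (𝓝 0) := by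
    obtain ⟨a, ha⟩ := hj.fourier
    refine tendsto_of_hasSum_qParam (c := fun m => m.casesOn 0 a) fun τ => ?_
    rw [← hasSum_nat_add_iff' 1]
    have := ha τ τ.im_pos
    simpa [Function.Periodic.qParam] using this
  obtain ⟨d1, d2⟩ := discriminant_second_order
  have e1 := (E₄_second_order.1.mul ((tendsto_E₄.pow 2).add (tendsto_E₄.add_const 1)))
  have hF : HolInv 12 ((fun z : ℍ => j z) * discriminant + (-1 : ℂ) • ⇑(E₄.pow 3)) :=
    ((hj.holInv.mul (holInv_modularForm (CuspForm.toModularFormₗ CuspForm.discriminant))).add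
      ((holInv_modularForm (E₄.pow 3)).const_smul _))
  have hp : ∀ z, (E₄.pow 3) z = E₄ z ^ 3 := fun z => by rw [ModularForm.coe_pow]; rfl
  have key := ((d2.add (d1.const_mul 744)).add (hG.mul d1)).sub e1
  rw [show (-24 + 744 * 1 + 0 * 1 - 240 * (1 ^ 2 + (1 + 1)) : ℂ) = 0 by norm_num] at key
  have key' : ∀ z : ℍ, ((fun z : ℍ => j z) * discriminant + (-1 : ℂ) • ⇑(E₄.pow 3)) z =
      Function.Periodic.qParam 1 (z : ℂ) *
      ((discriminant z / Function.Periodic.qParam 1 z - 1) / Function.Periodic.qParam 1 z +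
      744 * (discriminant z / Function.Periodic.qParam 1 z) +
      (j z - (Function.Periodic.qParam 1 z)⁻¹ - 744) * (discriminant z / Function.Periodic.qParam 1 z)
      - (E₄ z - 1) / Function.Periodic.qParam 1 z * (E₄ z ^ 2 + (E₄ z + 1))) := fun z => by
    have := hq0 z
    simp only [Pi.add_apply, Pi.mul_apply, Pi.smul_apply, ModularForm.coe_pow, Pi.pow_apply,
      smul_eq_mul]
    field_simp
    ring
  have h0 := hq.mul key
  rw [zero_mul] at h0
  obtain ⟨c, hc⟩ := CuspForm.exists_smul_discriminant_of_weight_eq_twelve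
    (levelOneCuspForm _ hF.1 hF.2 (h0.congr fun z => (key' z).symm))
  have hc' : ∀ z, c * discriminant z = j z * discriminant z - E₄ z ^ 3 := fun z => by
    have := congrArg (fun f : CuspForm 𝒮ℒ 12 => f z) hc
    have h2 : c * discriminant z = ((fun z : ℍ => j z) * discriminant + (-1 : ℂ) • ⇑(E₄.pow 3)) z :=
      this
    simpa [sub_eq_add_neg, hp] using h2
  have hc0 : c = 0 := by
    refine tendsto_nhds_unique (f := fun z : ℍ => c * (discriminant z / Function.Periodic.qParam 1 z))
      (by simpa using d1.const_mul c) (key.congr fun z => ?_)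
    rw [← mul_right_inj' (hq0 z), ← key', ← mul_assoc, mul_comm _ c, mul_assoc,
      mul_div_cancel₀ _ (hq0 z), hc']
    simp [sub_eq_add_neg, hp]
  rw [eq_div_iff (discriminant_ne_zero z)]
  have := hc' z
  rw [hc0] at this
  linear_combination -this

end ModularForms

end

section

section JODE
open UpperHalfPlane ModularForm EisensteinSeries Filter Topology Derivative
open scoped Manifold

lemma hasDerivAt_comp_ofComplex {F : ℍ → ℂ} (hF : MDiff F) {z : ℂ} (hz : 0 < z.im) :
    HasDerivAt (F ∘ ofComplex) (2 * Real.pi * Complex.I * D F (ofComplex z)) z := by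
  rw [normalizedDerivOfComplex, mul_inv_cancel_left₀ Complex.two_pi_I_ne_zero,
    ofComplex_apply_of_im_pos hz]
  exact ((UpperHalfPlane.mdifferentiable_iff.1 hF).differentiableAt
    ((isOpen_lt continuous_const Complex.continuous_im).mem_nhds hz)).hasDerivAt

def schwPoly {A : Type*} [CommRing A] (x x1 x2 x3 : A) : A :=
  x ^ 2 * (x - 1) ^ 2 * (72 * x3 * x1 - 108 * x2 ^ 2) + (36 * x ^ 2 - 41 * x + 32) * x1 ^ 4

theorem IsModularJ.schwarz {j : ℂ → ℂ} (hj : IsModularJ j) :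
    ∃ J1 J2 J3 : ℂ → ℂ, ∀ z ∈ HH, HasDerivAt (fun z => (1728 : ℂ)⁻¹ * j z) (J1 z) z ∧
      HasDerivAt J1 (J2 z) z ∧ HasDerivAt J2 (J3 z) z ∧
      schwPoly ((1728 : ℂ)⁻¹ * j z) (J1 z) (J2 z) (J3 z) = 0 ∧
      ((1728 : ℂ)⁻¹ * j z ≠ 0 → (1728 : ℂ)⁻¹ * j z ≠ 1 → J1 z ≠ 0) := by
  obtain ⟨t, ht⟩ : ∃ t : ℂ, t = 2 * Real.pi * Complex.I := ⟨_, rfl⟩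
  have ht0 : t ≠ 0 := ht ▸ Complex.two_pi_I_ne_zero
  obtain ⟨a, ha⟩ : ∃ a : ℂ → ℂ, a = E2 ∘ ofComplex := ⟨_, rfl⟩
  obtain ⟨b, hb⟩ : ∃ b : ℂ → ℂ, b = E₄ ∘ ofComplex := ⟨_, rfl⟩
  obtain ⟨c, hc⟩ : ∃ c : ℂ → ℂ, c = E₆ ∘ ofComplex := ⟨_, rfl⟩
  obtain ⟨d, hd⟩ : ∃ d : ℂ → ℂ, d = discriminant ∘ ofComplex := ⟨_, rfl⟩
  have da : ∀ z ∈ HH, HasDerivAt a (t * (12⁻¹ * (a z ^ 2 - b z))) z := fun z hz => by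
    have := hasDerivAt_comp_ofComplex E2_mdifferentiable hz
    rw [ha, hb, ht]
    exact (normalizedDeriv_E2 (ofComplex z)) ▸ this
  have db : ∀ z ∈ HH, HasDerivAt b (t * (3⁻¹ * (a z * b z - c z))) z := fun z hz => by
    have := hasDerivAt_comp_ofComplex E₄.holo' hz
    rw [ha, hb, hc, ht]
    exact (normalizedDeriv_E₄ (ofComplex z)) ▸ this
  have dc : ∀ z ∈ HH, HasDerivAt c (t * (2⁻¹ * (a z * c z - b z ^ 2))) z := fun z hz => by
    have := hasDerivAt_comp_ofComplex E₆.holo' hz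
    rw [ha, hb, hc, ht]
    exact (normalizedDeriv_E₆ (ofComplex z)) ▸ this
  have dd : ∀ z ∈ HH, HasDerivAt d (t * (a z * d z)) z := fun z hz => by
    have := hasDerivAt_comp_ofComplex CuspForm.discriminant.holo' hz
    rw [ha, hd, ht]
    exact (normalizedDeriv_discriminant (ofComplex z)) ▸ this
  have d0 : ∀ z, d z ≠ 0 := fun z => by rw [hd]; exact discriminant_ne_zero _
  have hrel : ∀ z, 1728 * d z = b z ^ 3 - c z ^ 2 := fun z => by
    rw [hd, hb, hc, Function.comp_apply, discriminant_eq_E₄_cube_sub_E₆_sq]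
    simp only [Function.comp_apply]
    ring
  have hjz : ∀ z ∈ HH, j z = b z ^ 3 / d z := fun z hz => by
    have := hj.eq_div ⟨z, hz⟩
    rw [hb, hd]
    simpa [ofComplex_apply_of_im_pos (show 0 < z.im from hz)] using this
  have hHH : IsOpen HH := isOpen_lt continuous_const Complex.continuous_im
  refine ⟨fun z => -t / 1728 * (b z ^ 2 * c z / d z),
    fun z => -t ^ 2 / 1728 * ((a z * b z ^ 2 * c z / 6 - 2 * b z * c z ^ 2 / 3 - b z ^ 4 / 2) / d z),
    fun z => -t ^ 3 / 1728 * ((((12⁻¹ * (a z ^ 2 - b z)) * b z ^ 2 * c z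
      + a z * (2 * b z * (3⁻¹ * (a z * b z - c z))) * c z
      + a z * b z ^ 2 * (2⁻¹ * (a z * c z - b z ^ 2))) / 6
      - 2 * ((3⁻¹ * (a z * b z - c z)) * c z ^ 2 + b z * (2 * c z * (2⁻¹ * (a z * c z - b z ^ 2)))) / 3
      - 4 * b z ^ 3 * (3⁻¹ * (a z * b z - c z)) / 2
      - a z * (a z * b z ^ 2 * c z / 6 - 2 * b z * c z ^ 2 / 3 - b z ^ 4 / 2)) / d z),
    fun z hz => ⟨?_, ?_, ?_, ?_, ?_⟩⟩
  · have h := ((((db z hz).pow 3).div (dd z hz) (d0 z)).const_mul (1728 : ℂ)⁻¹)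
    refine (h.congr_of_eventuallyEq ?_).congr_deriv ?_
    · filter_upwards [hHH.mem_nhds hz] with w hw
      rw [hjz w hw]
      rfl
    · have := d0 z
      simp only [Pi.pow_apply]
      field_simp
      push_cast
      ring
  · have h := ((((db z hz).pow 2).mul (dc z hz)).div (dd z hz) (d0 z)).const_mul (-t / 1728)
    refine h.congr_deriv ?_
    have := d0 z
    simp only [Pi.pow_apply, Pi.mul_apply]
    field_simp
    push_cast
    ring
  · have h := (((((((da z hz).mul ((db z hz).pow 2)).mul (dc z hz)).div_const 6).sub
      ((((db z hz).const_mul 2).mul ((dc z hz).pow 2)).div_const 3)).sub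
      (((db z hz).pow 4).div_const 2)).div (dd z hz) (d0 z)).const_mul (-t ^ 2 / 1728)
    refine h.congr_deriv ?_
    have := d0 z
    simp only [Pi.pow_apply, Pi.mul_apply, Pi.sub_apply]
    field_simp
    push_cast
    ring
  · rw [hjz z hz]
    have h0 := d0 z
    have h1 := hrel z
    simp only [schwPoly]
    generalize a z = a, b z = b, c z = c, d z = d at *
    obtain rfl : d = (b ^ 3 - c ^ 2) / 1728 := by linear_combination h1 / 1728
    have h2 : b ^ 3 - c ^ 2 ≠ 0 := by
      rintro h
      simp [h] at h0
    field_simp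
    ring
  · intro h0 h1 h2
    rw [hjz z hz] at h0 h1
    have hd0 := d0 z
    have h3 := hrel z
    have hb0 : b z ≠ 0 := fun h => h0 (by simp [h])
    have hc0 : c z ≠ 0 := fun h => h1 (by
      rw [h] at h3
      field_simp
      linear_combination -h3)
    simp [ht0, hb0, hc0, hd0] at h2

end JODE

end

section

section Hecke
open UpperHalfPlane ModularForm EisensteinSeries Filter Topology MatrixGroups
open scoped Manifold

lemma moeb_mul (A B : Matrix (Fin 2) (Fin 2) ℂ) {z : ℂ} (h : B 1 0 * z + B 1 1 ≠ 0) :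
    moeb (A * B) z = moeb A (moeb B z) := by
  simp only [moeb, Matrix.mul_apply, Fin.sum_univ_two]
  rw [← mul_div_mul_right (A 0 0 * (_ / _) + _) _ h]
  congr 1 <;> field_simp <;> ring

lemma zmat_mul (A B : Matrix (Fin 2) (Fin 2) ℤ) : zmat (A * B) = zmat A * zmat B :=
  Matrix.map_mul (f := Int.castRingHom ℂ)

lemma zmat_denom_ne_zero {g : Matrix (Fin 2) (Fin 2) ℤ} (hg : g.det ≠ 0) {z : ℂ} (hz : z ∈ HH) :
    zmat g 1 0 * z + zmat g 1 1 ≠ 0 := by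
  intro h
  have hz' : z.im ≠ 0 := (show 0 < z.im from hz).ne'
  have h1 := congrArg Complex.im h
  have h2 := congrArg Complex.re h
  simp [zmat, hz'] at h1 h2
  simp [h1] at h2
  exact hg (by rw [Matrix.det_fin_two, h1, h2]; ring)

lemma moeb_zmat_mem {g : Matrix (Fin 2) (Fin 2) ℤ} (hg : 0 < g.det) {z : ℂ} (hz : z ∈ HH) :
    moeb (zmat g) z ∈ HH := by
  have h0 := zmat_denom_ne_zero hg.ne' hz
  change 0 < (_ / _ : ℂ).im
  rw [← mul_div_mul_right _ _ ((map_ne_zero (starRingEnd ℂ)).2 h0), Complex.mul_conj,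
    Complex.div_ofReal_im]
  refine div_pos ?_ (Complex.normSq_pos.2 h0)
  have : (g.det : ℝ) = g 0 0 * g 1 1 - g 0 1 * g 1 0 := by rw [Matrix.det_fin_two]; push_cast; ring
  have h2 : (0 : ℝ) < g.det * z.im := mul_pos (by exact_mod_cast hg) hz
  rw [this] at h2
  simp [zmat]
  linarith

lemma IsModularJ.tendsto_mul_qParam {j : ℂ → ℂ} (hj : IsModularJ j) :
    Tendsto (fun z : ℍ => j z * Function.Periodic.qParam 1 (z : ℂ)) atImInfty (𝓝 1) := by
  have h := (tendsto_E₄.pow 3).div discriminant_second_order.1 one_ne_zero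
  rw [one_pow, div_one] at h
  refine h.congr fun z => ?_
  rw [hj.eq_div]
  simp only [Pi.div_apply]
  have := discriminant_ne_zero z
  have : Function.Periodic.qParam 1 (z : ℂ) ≠ 0 := Function.Periodic.qParam_ne_zero _
  field_simp

lemma IsModularJ.tendsto_inv {j : ℂ → ℂ} (hj : IsModularJ j) (c : ℂ) :
    Tendsto (fun z : ℍ => (j z - c)⁻¹) atImInfty (𝓝 0) := by
  have hq := qParam_tendsto_atImInfty one_pos
  have h := hq.div (hj.tendsto_mul_qParam.sub (hq.const_mul c)) (by simp)
  rw [zero_div] at h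
  refine h.congr fun z => ?_
  have : Function.Periodic.qParam 1 (z : ℂ) ≠ 0 := Function.Periodic.qParam_ne_zero _
  simp only [Pi.div_apply]
  rw [← sub_mul, div_mul_cancel_right₀ this]

lemma holInv_zero_iff {f : ℍ → ℂ} :
    HolInv 0 f ↔ MDiff f ∧ ∀ (γ : SL(2, ℤ)) z, f (γ • z) = f z := by
  simp [HolInv, funext_iff, ModularForm.SL_slash_apply]

theorem IsModularJ.surj {j : ℂ → ℂ} (hj : IsModularJ j) (c : ℂ) : ∃ z : ℍ, j z = c := by
  by_contra! h
  have h1 := holInv_zero_iff.1 hj.holInv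
  have hF : HolInv 0 (fun z : ℍ => (j z - c)⁻¹) := by
    refine holInv_zero_iff.2 ⟨UpperHalfPlane.mdifferentiable_iff.2 ?_, fun γ z => by rw [h1.2]⟩
    exact ((UpperHalfPlane.mdifferentiable_iff.1 h1.1).sub_const c).inv fun w _ =>
      sub_ne_zero.2 (h (ofComplex w))
  exact inv_ne_zero (sub_ne_zero.2 (h I)) (hF.eq_zero (by norm_num) (hj.tendsto_inv c) I)

def moderate : Subalgebra ℂ (ℍ → ℂ) where
  carrier := {f | MDiff f ∧ ∃ m : ℕ, IsBoundedAtImInfty (f * discriminant ^ m)}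
  mul_mem' := by
    rintro f g ⟨hf, m, hm⟩ ⟨hg, l, hl⟩
    refine ⟨hf.mul hg, m + l, ?_⟩
    rw [pow_add, mul_mul_mul_comm]
    exact (boundedAtImInftySubalgebra ℂ).mul_mem hm hl
  add_mem' := by
    rintro f g ⟨hf, m, hm⟩ ⟨hg, l, hl⟩
    have hD : discriminant ∈ boundedAtImInftySubalgebra ℂ :=
      IsZeroAtImInfty.isBoundedAtImInfty (CuspFormClass.zero_at_infty CuspForm.discriminant)
    refine ⟨hf.add hg, m + l, ?_⟩
    have : (f + g) * discriminant ^ (m + l) = f * discriminant ^ m * discriminant ^ l +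
        g * discriminant ^ l * discriminant ^ m := by ring
    rw [this]
    exact (boundedAtImInftySubalgebra ℂ).add_mem
      ((boundedAtImInftySubalgebra ℂ).mul_mem hm (pow_mem hD l))
      ((boundedAtImInftySubalgebra ℂ).mul_mem hl (pow_mem hD m))
  algebraMap_mem' c := by
    refine ⟨mdifferentiable_const, 0, ?_⟩
    rw [pow_zero, mul_one]
    exact (boundedAtImInftySubalgebra ℂ).algebraMap_mem c

lemma tendsto_of_holInv {k : ℤ} {f : ℍ → ℂ} (hf : HolInv k f) (hb : IsBoundedAtImInfty f) :
    ∃ a : ℂ, Tendsto f atImInfty (𝓝 a) ∧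
      IsBoundedAtImInfty fun z : ℍ => (f z - a) / Function.Periodic.qParam 1 (z : ℂ) := by
  have h := hasSum_modularForm (levelOneForm f hf.1 hf.2 hb)
  exact ⟨_, tendsto_of_hasSum_qParam h,
    isBoundedAtImInfty_of_hasSum_qExpansion one_pos (hasSum_div_qParam h)⟩

theorem IsModularJ.exists_polynomial {j : ℂ → ℂ} (hj : IsModularJ j) (m : ℕ) :
    ∀ f : ℍ → ℂ, HolInv 0 f → IsBoundedAtImInfty (f * discriminant ^ m) →
      ∃ p : Polynomial ℂ, ∀ z : ℍ, f z = p.eval (j z) := by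
  induction m with
  | zero =>
    intro f hf hb
    rw [pow_zero, mul_one] at hb
    obtain ⟨a, ha, -⟩ := tendsto_of_holInv hf hb
    refine ⟨Polynomial.C a, fun z => ?_⟩
    have h1 : HolInv 0 (f - fun _ => a) := by
      obtain ⟨h2, h3⟩ := holInv_zero_iff.1 hf
      exact holInv_zero_iff.2 ⟨h2.sub mdifferentiable_const, fun γ z => congrArg (· - a) (h3 γ z)⟩
    have := h1.eq_zero (by norm_num) (by simpa using! ha.sub_const a) z
    simpa [sub_eq_zero] using this
  | succ m ih =>
    intro f hf hb
    have hD : ∀ m : ℕ, HolInv (12 * m) (discriminant ^ m) := fun m => by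
      induction m with
      | zero =>
        simpa using (holInv_zero_iff (f := 1)).2 ⟨mdifferentiable_const, fun _ _ => rfl⟩
      | succ m ih =>
        rw [pow_succ, Nat.cast_succ, mul_add, mul_one]
        exact ih.mul (holInv_modularForm (CuspForm.toModularFormₗ CuspForm.discriminant))
    have hF := hf.mul (hD (m + 1))
    obtain ⟨a, ha, ha'⟩ := tendsto_of_holInv hF hb
    have hJ : ∀ m : ℕ, HolInv 0 (fun z : ℍ => j z ^ m) := fun m => by
      obtain ⟨h2, h3⟩ := holInv_zero_iff.1 hj.holInv
      exact holInv_zero_iff.2 ⟨h2.pow m, fun γ z => by rw [h3]⟩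
    have hE : ∀ z : ℍ, j z ^ (m + 1) * discriminant z ^ (m + 1) = (E₄ z ^ 3) ^ (m + 1) := fun z => by
      rw [hj.eq_div, ← mul_pow, div_mul_cancel₀ _ (discriminant_ne_zero z)]
    have hg : HolInv 0 (f + (-a) • fun z : ℍ => j z ^ (m + 1)) := hf.add ((hJ (m + 1)).const_smul _)
    have hJb : IsBoundedAtImInfty ((fun z : ℍ => j z ^ (m + 1)) * discriminant ^ (m + 1)) := by
      refine ((tendsto_E₄.pow 3).pow (m + 1)).isBigO_one ℝ |>.congr_left fun z => (hE z).symm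
    obtain ⟨b, hb, hb'⟩ := tendsto_of_holInv ((hJ (m + 1)).mul (hD (m + 1))) hJb
    obtain rfl : b = 1 := tendsto_nhds_unique hb (by
      simpa using! ((tendsto_E₄.pow 3).pow (m + 1)).congr fun z => (hE z).symm)
    obtain ⟨p, hp⟩ := ih _ hg (by
      have h1 : Tendsto (fun z : ℍ => Function.Periodic.qParam 1 (z : ℂ) / discriminant z)
          atImInfty (𝓝 1) := by
        simpa using discriminant_second_order.1.inv₀ one_ne_zero
      have h2 := (boundedAtImInftySubalgebra ℂ).mul_mem (show _ ∈ boundedAtImInftySubalgebra ℂ from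
        h1.isBigO_one ℝ) ((boundedAtImInftySubalgebra ℂ).add_mem ha'
          ((boundedAtImInftySubalgebra ℂ).smul_mem hb' (-a)))
      refine Asymptotics.IsBigO.congr_left h2 fun z => ?_
      have := discriminant_ne_zero z
      have : Function.Periodic.qParam 1 (z : ℂ) ≠ 0 := Function.Periodic.qParam_ne_zero _
      simp
      field_simp
      ring)
    refine ⟨p + Polynomial.C a * Polynomial.X ^ (m + 1), fun z => ?_⟩
    have := hp z
    simp at this ⊢
    linear_combination this

def IsPrim (g : Matrix (Fin 2) (Fin 2) ℤ) : Prop :=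
  Nat.gcd (Int.gcd (g 0 0) (g 0 1)) (Int.gcd (g 1 0) (g 1 1)) = 1

lemma isPrim_iff {g : Matrix (Fin 2) (Fin 2) ℤ} :
    IsPrim g ↔ ∀ k : ℕ, (∀ i j, (k : ℤ) ∣ g i j) → k = 1 := by
  refine ⟨fun h k hk => Nat.dvd_one.1 (h ▸ Nat.dvd_gcd (Int.dvd_gcd (hk 0 0) (hk 0 1))
    (Int.dvd_gcd (hk 1 0) (hk 1 1))), fun h => h _ fun i j => ?_⟩
  have h0 := Int.natCast_dvd_natCast.2 (Nat.gcd_dvd_left (Int.gcd (g 0 0) (g 0 1))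
    (Int.gcd (g 1 0) (g 1 1)))
  have h1 := Int.natCast_dvd_natCast.2 (Nat.gcd_dvd_right (Int.gcd (g 0 0) (g 0 1))
    (Int.gcd (g 1 0) (g 1 1)))
  fin_cases i <;> fin_cases j
  exacts [h0.trans (Int.gcd_dvd_left ..), h0.trans (Int.gcd_dvd_right ..),
    h1.trans (Int.gcd_dvd_left ..), h1.trans (Int.gcd_dvd_right ..)]

lemma IsPrim.of_mul_left {A B g : Matrix (Fin 2) (Fin 2) ℤ} (h : IsPrim (A * g * B)) : IsPrim g := by
  rw [isPrim_iff] at *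
  refine fun k hk => h k fun i l => ?_
  simp only [Matrix.mul_apply, Fin.sum_univ_two]
  have := fun x y => hk x y
  exact dvd_add (Dvd.dvd.mul_right (dvd_add ((this _ _).mul_left _) ((this _ _).mul_left _)) _)
    (Dvd.dvd.mul_right (dvd_add ((this _ _).mul_left _) ((this _ _).mul_left _)) _)

def heckeFun (j : ℂ → ℂ) (M : ℕ) : Set (ℍ → ℂ) :=
  {f | ∃ g : Matrix (Fin 2) (Fin 2) ℤ, g.det = M ∧ IsPrim g ∧ f = fun z : ℍ => j (moeb (zmat g) z)}

lemma IsModularJ.comp_mul {j : ℂ → ℂ} (hj : IsModularJ j) (γ : SL(2, ℤ))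
    {g : Matrix (Fin 2) (Fin 2) ℤ} (hg : 0 < g.det) {z : ℂ} (hz : z ∈ HH) :
    j (moeb (zmat (γ * g)) z) = j (moeb (zmat g) z) := by
  rw [zmat_mul, moeb_mul _ _ (zmat_denom_ne_zero hg.ne' hz), hj.invariant _ γ.2 _
    (moeb_zmat_mem hg hz)]

lemma exists_reduce_eq {m : ℤ} (A : FixedDetMatrix (Fin 2) ℤ m) :
    ∃ γ : SL(2, ℤ), FixedDetMatrices.reduce A = γ • A := by
  induction A using FixedDetMatrices.reduce_rec with
  | base A h =>
    by_cases h' : 0 < A.1 0 0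
    · exact ⟨_, FixedDetMatrices.reduce_of_pos h h'⟩
    · rw [FixedDetMatrices.reduce_of_not_pos h h', ← mul_smul, ← mul_smul]
      exact ⟨_, rfl⟩
  | step A h ih =>
    obtain ⟨γ, hγ⟩ := ih
    rw [FixedDetMatrices.reduce_reduceStep h, FixedDetMatrices.reduceStep, ← mul_smul, 
      ← mul_smul] at hγ
    exact ⟨_, hγ⟩

lemma IsModularJ.exists_reps {j : ℂ → ℂ} (hj : IsModularJ j) {M : ℕ} (hM : 1 ≤ M) {f : ℍ → ℂ}
    (hf : f ∈ heckeFun j M) : ∃ A ∈ FixedDetMatrices.reps (M : ℤ), f = fun z : ℍ =>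
      j (moeb (zmat A.1) z) := by
  obtain ⟨g, hg, -, rfl⟩ := hf
  obtain ⟨γ, hγ⟩ := exists_reduce_eq (⟨g, hg⟩ : FixedDetMatrix (Fin 2) ℤ M)
  refine ⟨_, FixedDetMatrices.reduce_mem_reps (by omega) ⟨g, hg⟩, funext fun z => ?_⟩
  rw [hγ]
  exact (hj.comp_mul γ (by rw [hg]; exact_mod_cast hM) z.2).symm

lemma IsModularJ.finite_heckeFun {j : ℂ → ℂ} (hj : IsModularJ j) {M : ℕ} (hM : 1 ≤ M) :
    (heckeFun j M).Finite := by
  refine ((Set.toFinite (FixedDetMatrices.reps (M : ℤ))).image fun A => fun z : ℍ =>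
      j (moeb (zmat A.1) z)).subset fun f hf => ?_
  obtain ⟨A, hA, h⟩ := hj.exists_reps hM hf
  exact ⟨A, hA, h.symm⟩

lemma IsModularJ.differentiable_comp {j : ℂ → ℂ} (hj : IsModularJ j) 
    {g : Matrix (Fin 2) (Fin 2) ℤ} (hg : 0 < g.det) :
    DifferentiableOn ℂ (fun z => j (moeb (zmat g) z)) HH := by
  refine hj.holo.comp ?_ fun z hz => moeb_zmat_mem hg hz
  exact ((differentiableOn_id.const_mul _).add_const _).div
    ((differentiableOn_id.const_mul _).add_const _) fun z hz => zmat_denom_ne_zero hg.ne' hz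

lemma IsModularJ.heckeFun_moderate {j : ℂ → ℂ} (hj : IsModularJ j) {M : ℕ} (hM : 1 ≤ M)
    {f : ℍ → ℂ} (hf : f ∈ heckeFun j M) : f ∈ moderate := by
  obtain ⟨⟨A, hdet⟩, ⟨hc, ha, -, -⟩, rfl⟩ := hj.exists_reps hM hf
  simp only at hc ha ⊢
  have hdet0 : 0 < A.det := by rw [hdet]; exact_mod_cast hM
  have hd : 0 < A 1 1 := by
    rw [Matrix.det_fin_two, hc, mul_zero, sub_zero] at hdet0
    exact (pos_iff_pos_of_mul_pos hdet0).1 ha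
  refine ⟨UpperHalfPlane.mdifferentiable_iff.2 ((hj.differentiable_comp hdet0).congr
    fun w hw => ?_), (A 0 0).toNat, ?_⟩
  · simp [ofComplex_apply_of_im_pos hw]
  let φ : ℍ → ℍ := fun z => ⟨moeb (zmat A) z, moeb_zmat_mem hdet0 z.2⟩
  have him : ∀ z, (φ z).im = A 0 0 / A 1 1 * z.im := fun z => by
    change (moeb _ _).im = _
    simp [moeb, zmat, hc, Complex.div_im]
    have : (A 1 1 : ℝ) ≠ 0 := by exact_mod_cast hd.ne'
    field_simp
  have haR : (0 : ℝ) < A 0 0 := by exact_mod_cast ha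
  have hdR : (1 : ℝ) ≤ A 1 1 := by exact_mod_cast hd
  have hφ : Tendsto φ atImInfty atImInfty := by
    rw [atImInfty, tendsto_comap_iff]
    refine Tendsto.congr (fun z => (him z).symm) ?_
    exact tendsto_comap.const_mul_atTop (div_pos haR (by linarith))
  have h1 := (hj.tendsto_mul_qParam.comp hφ).isBigO_one ℝ
  have h2 := (discriminant_second_order.1.pow (A 0 0).toNat).isBigO_one ℝ
  have h3 := h1.mul h2
  rw [show (fun _ : ℍ => (1 : ℝ) * 1) = fun _ => 1 by simp] at h3
  refine (Asymptotics.IsBigO.of_bound 1 (Eventually.of_forall fun z => ?_)).trans h3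
  have hq : ‖Function.Periodic.qParam 1 (z : ℂ)‖ ^ (A 0 0).toNat ≤
      ‖Function.Periodic.qParam 1 (φ z : ℂ)‖ := by
    rw [Function.Periodic.norm_qParam, Function.Periodic.norm_qParam, ← Real.exp_nat_mul,
      Real.exp_le_exp, UpperHalfPlane.coe_im, UpperHalfPlane.coe_im, him]
    have h4 : ((A 0 0).toNat : ℝ) = A 0 0 := by exact_mod_cast Int.toNat_of_nonneg ha.le
    have h5 : (A 0 0 / A 1 1 : ℝ) ≤ A 0 0 := div_le_self haR.le hdR
    have h6 := mul_le_mul_of_nonneg_right h5 (mul_pos Real.two_pi_pos z.im_pos).le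
    rw [h4]
    linarith
  have hq0 : 0 < ‖Function.Periodic.qParam 1 (z : ℂ)‖ :=
    norm_pos_iff.2 (Function.Periodic.qParam_ne_zero _)
  simp only [Function.comp_apply, Pi.mul_apply, Pi.pow_apply, norm_mul, norm_pow, norm_div, one_mul,
    div_pow]
  rw [mul_assoc, ← mul_div_assoc, mul_comm ‖Function.Periodic.qParam 1 (φ z : ℂ)‖,
    mul_div_assoc]
  refine mul_le_mul_of_nonneg_left ?_ (norm_nonneg _)
  exact le_mul_of_one_le_right (by positivity) ((one_le_div (by positivity)).2 hq)

def rootPoly (S : Finset (ℍ → ℂ)) (z : ℍ) : Polynomial ℂ := ∏ f ∈ S, (.X - .C (f z))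

lemma rootPoly_coeff_moderate (S : Finset (ℍ → ℂ)) (hS : ∀ f ∈ S, f ∈ moderate) (k : ℕ) :
    (fun z => (rootPoly S z).coeff k) ∈ moderate := by
  classical
  induction S using Finset.induction_on generalizing k with
  | empty => exact moderate.algebraMap_mem ((1 : Polynomial ℂ).coeff k)
  | insert f S hf ih =>
    have h1 := ih fun g hg => hS g (Finset.mem_insert_of_mem hg)
    have h2 := hS f (Finset.mem_insert_self _ _)
    have h3 : ∀ z, rootPoly (insert f S) z = .X * rootPoly S z - .C (f z) * rootPoly S z :=
      fun z => by
      rw [← sub_mul]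
      exact Finset.prod_insert hf
    simp only [h3, Polynomial.coeff_sub, Polynomial.coeff_C_mul]
    refine sub_mem ?_ (mul_mem h2 (h1 k))
    cases k with
    | zero => 
      simp only [Polynomial.coeff_X_mul_zero]
      exact moderate.zero_mem
    | succ k => simpa only [Polynomial.coeff_X_mul] using h1 k

lemma rootPoly_invariant {j : ℂ → ℂ} {M : ℕ} {S : Finset (ℍ → ℂ)} (hM : 1 ≤ M)
    (hS : ∀ f, f ∈ S ↔ f ∈ heckeFun j M) (γ : SL(2, ℤ)) (z : ℍ) :
    rootPoly S (γ • z) = rootPoly S z := by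
  classical
  have hinj : Function.Injective fun (f : ℍ → ℂ) (z : ℍ) => f (γ • z) := fun f g h => 
    funext fun z => by
      have := congrFun h (γ⁻¹ • z)
      simp only [smul_inv_smul] at this
      exact this
  have himg : S.image (fun (f : ℍ → ℂ) (z : ℍ) => f (γ • z)) = S := by
    refine Finset.eq_of_subset_of_card_le (fun f hf => ?_)
      (Finset.card_image_of_injective _ hinj).ge
    obtain ⟨f', hf', rfl⟩ := Finset.mem_image.1 hf
    obtain ⟨g, hg, hp, rfl⟩ := (hS _).1 hf'
    refine (hS _).2 ⟨g * γ, by simp [hg], ?_, ?_⟩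
    · refine IsPrim.of_mul_left (A := 1) (B := (γ⁻¹ : SL(2, ℤ))) ?_
      rwa [one_mul, mul_assoc, ← Matrix.SpecialLinearGroup.coe_mul, mul_inv_cancel,
        Matrix.SpecialLinearGroup.coe_one, mul_one]
    · funext z
      rw [zmat_mul, moeb_mul _ _ (zmat_denom_ne_zero (by simp) z.2), ← coe_SL_smul]
  have h1 := Finset.prod_image (s := S) (f := fun f : ℍ → ℂ => (.X - .C (f z) : Polynomial ℂ))
    hinj.injOn
  rw [himg] at h1
  exact h1.symm

theorem IsModularJ.exists_prod {j : ℂ → ℂ} (hj : IsModularJ j) {M : ℕ} (hM : 1 ≤ M) :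
    ∃ Φ : MvPolynomial (Fin 2) ℂ, ∀ (z : ℍ) (y : ℂ), MvPolynomial.eval ![j z, y] Φ =
      ∏ f ∈ (hj.finite_heckeFun hM).toFinset, (y - f z) := by
  generalize hS : (hj.finite_heckeFun hM).toFinset = S
  have hmem : ∀ f, f ∈ S ↔ f ∈ heckeFun j M := fun f => by rw [← hS]; simp
  have hp : ∀ k, ∃ p : Polynomial ℂ, ∀ z : ℍ, (rootPoly S z).coeff k = p.eval (j z) := fun k => by
    obtain ⟨h1, m, hm⟩ := rootPoly_coeff_moderate S
      (fun f hf => hj.heckeFun_moderate hM ((hmem f).1 hf)) k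
    exact hj.exists_polynomial m _
      (holInv_zero_iff.2 ⟨h1, fun γ z => by rw [rootPoly_invariant hM hmem]⟩) hm
  choose p hp using hp
  refine ⟨∑ k ∈ Finset.range (S.card + 1), Polynomial.aeval (.X 0) (p k) * .X 1 ^ k, fun z y => ?_⟩
  have h1 : ∀ k, MvPolynomial.eval ![j z, y] (Polynomial.aeval (.X 0) (p k)) = (p k).eval (j z) :=
    fun k => by
    rw [← MvPolynomial.aeval_eq_eval]
    simp [← Polynomial.aeval_algHom_apply]
  have h2 : (rootPoly S z).eval y = ∏ f ∈ S, (y - f z) := by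
    simp [rootPoly, Polynomial.eval_prod]
  rw [← h2, Polynomial.eval_eq_sum_range' (n := S.card + 1) (by
    rw [rootPoly, Polynomial.natDegree_finset_prod_X_sub_C_eq_card]; omega)]
  simp [h1, hp]

theorem IsModularJ.phiAlg {j : ℂ → ℂ} (hj : IsModularJ j) : PhiAlg j := by
  have key : ∀ {M : ℕ} (hM : 1 ≤ M) {Φ : MvPolynomial (Fin 2) ℂ}, (∀ (z : ℍ) (y : ℂ),
      MvPolynomial.eval ![j z, y] Φ = ∏ f ∈ (hj.finite_heckeFun hM).toFinset, (y - f z)) →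
      ∀ (z : ℍ) y, PhiRel j M (j z) y ↔ ∃ f ∈ heckeFun j M, y = f z := by
    intro M hM Φ hΦ z y
    have h1 : ∀ z : ℍ, MvPolynomial.eval ![j z, y] Φ = 0 ↔ ∃ f ∈ heckeFun j M, y = f z :=
      fun z => by rw [hΦ]; simp [Finset.prod_eq_zero_iff, sub_eq_zero]
    constructor
    · rintro ⟨z', hz', g, hg, hp, h, rfl⟩
      rw [← h1 z, h]
      exact (h1 ⟨z', hz'⟩).2 ⟨_, ⟨g, hg, hp, rfl⟩, rfl⟩
    · rintro ⟨_, ⟨g, hg, hp, rfl⟩, rfl⟩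
      exact ⟨z, z.2, g, hg, hp, rfl, rfl⟩
  refine ⟨fun M hM => ?_, fun M hM x => ?_, fun M hM x y => ?_⟩
  · obtain ⟨Φ, hΦ⟩ := hj.exists_prod hM
    refine ⟨Φ, fun x y => ?_⟩
    obtain ⟨z, rfl⟩ := hj.surj x
    rw [key hM hΦ, hΦ]
    simp [Finset.prod_eq_zero_iff, sub_eq_zero]
  · obtain ⟨Φ, hΦ⟩ := hj.exists_prod hM
    obtain ⟨z, rfl⟩ := hj.surj x
    refine ((hj.finite_heckeFun hM).image fun f => f z).subset fun y hy => ?_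
    obtain ⟨f, hf, rfl⟩ := (key hM hΦ z y).1 hy
    exact ⟨f, hf, rfl⟩
  · rintro ⟨z, hz, g, hg, hp, rfl, rfl⟩
    have hg0 : 0 < g.det := by rw [hg]; exact_mod_cast hM
    refine ⟨_, moeb_zmat_mem hg0 hz, g.adjugate, by simp [Matrix.det_adjugate, hg], ?_, rfl, ?_⟩
    · refine isPrim_iff.2 fun k hk => isPrim_iff.1 hp k fun i l => ?_
      have := hk (1 - l) (1 - i)
      fin_cases i <;> fin_cases l <;> simpa [Matrix.adjugate_fin_two] using this
    · rw [← moeb_mul _ _ (zmat_denom_ne_zero hg0.ne' hz), ← zmat_mul, Matrix.adjugate_mul]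
      congr 1
      have : (M : ℂ) ≠ 0 := by exact_mod_cast (by omega : M ≠ 0)
      simp only [moeb, zmat, hg, Matrix.map_apply, Matrix.smul_apply]
      simp [this]

end Hecke

end

section

section PlaneCurve
open MvPolynomial

lemma le_of_prime_of_le {I₁ I₂ : Ideal (MvPolynomial (Fin 2) ℂ)} [I₁.IsPrime]
    {q : MvPolynomial (Fin 2) ℂ} (hq : q ∈ I₁) (hq0 : q ≠ 0) (hle : I₁ ≤ I₂)
    (hx : ∀ r : Polynomial ℂ, r ≠ 0 → Polynomial.aeval (X 0) r ∉ I₂) : I₂ ≤ I₁ := by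
  intro p hp
  by_contra hpI
  have hmk : ∀ f, aeval (fun i => algebraMap _ (FractionRing (_ ⧸ I₁)) (Ideal.Quotient.mk I₁ (X i)))
      f = algebraMap _ (FractionRing (_ ⧸ I₁)) (Ideal.Quotient.mk I₁ f) := fun f =>
    DFunLike.congr_fun (show aeval _ = ((IsScalarTower.toAlgHom ℂ (_ ⧸ I₁)
      (FractionRing (_ ⧸ I₁))).comp (Ideal.Quotient.mkₐ ℂ I₁)) from algHom_ext fun i => by
        simp [Ideal.Quotient.mkₐ_eq_mk]) f
  have h0 : ∀ f, algebraMap _ (FractionRing (_ ⧸ I₁)) (Ideal.Quotient.mk I₁ f) = 0 ↔ f ∈ I₁ :=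
    fun f => by rw [FaithfulSMul.algebraMap_eq_zero_iff, Ideal.Quotient.eq_zero_iff_mem]
  generalize hξ : (fun i => algebraMap _ (FractionRing (_ ⧸ I₁)) (Ideal.Quotient.mk I₁ (X i))) = ξ
    at hmk
  have hs : AlgebraicIndepOn ℂ ξ {0} := by
    refine algebraicIndependent_unique_type_iff.2 fun ⟨r, hr, h⟩ => hx r hr (hle ?_)
    rw [← h0, ← hmk, ← Polynomial.aeval_algHom_apply, aeval_X]
    exact h
  have h1 : IsAlgebraic (Algebra.adjoin ℂ (ξ '' {0})) (ξ 1) := by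
    by_contra h
    have h2 := (AlgebraicIndepOn.insert_iff (i := (1 : Fin 2)) (s := {0}) (by simp)).2 ⟨hs, h⟩
    have h3 : AlgebraicIndependent ℂ ξ := by
      rw [show insert (1 : Fin 2) {0} = Set.univ by ext i; fin_cases i <;> simp] at h2
      exact h2.comp (fun i => (⟨i, trivial⟩ : (Set.univ : Set (Fin 2)))) fun i k h =>
        congrArg Subtype.val h
    exact hq0 (h3.eq_zero_of_aeval_eq_zero q (by rw [hmk, h0]; exact hq))
  obtain ⟨r, g, hr, h⟩ := exists_mvPolynomial_eq_mul hs (p := p) (fun k => by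
    fin_cases k
    · exact isAlgebraic_algebraMap (⟨_, Algebra.subset_adjoin ⟨0, rfl, rfl⟩⟩ :
        Algebra.adjoin ℂ (ξ '' {0}))
    · exact h1) (by rwa [hmk, Ne, h0])
  rw [hmk, hmk, ← sub_eq_zero, ← map_sub, ← map_sub, h0] at h
  have h2 : Polynomial.aeval (X 0) (aeval (fun _ => Polynomial.X) r : Polynomial ℂ) =
      rename ((↑) : ({0} : Set (Fin 2)) → Fin 2) r := by
    rw [← AlgHom.comp_apply]
    congr 1
    refine algHom_ext fun i => ?_
    obtain ⟨i, rfl⟩ := i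
    simp
  refine hx (aeval (fun _ => Polynomial.X) r : Polynomial ℂ) (fun h3 => hr ?_) (h2 ▸ ?_)
  · rw [h3, map_zero] at h2
    exact rename_injective _ Subtype.val_injective (by rw [← h2, map_zero])
  · exact (sub_add_cancel (rename _ r) (p * g)) ▸ I₂.add_mem (hle h) (I₂.mul_mem_right g hp)

lemma not_dvd_pderiv {Ψ : MvPolynomial (Fin 2) ℂ} (h : ∀ r : Polynomial ℂ, Polynomial.aeval (X 0) r ≠ Ψ) :
    ¬ Ψ ∣ pderiv 1 Ψ := by
  intro hd
  have h0 : pderiv 1 Ψ = 0 := by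
    by_contra h0
    obtain ⟨m, hm, hm'⟩ := Finset.exists_mem_eq_sup _ (support_nonempty.2 h0) Finsupp.degree
    have h1 := totalDegree_le_of_dvd_of_isDomain hd h0
    rw [mem_support_iff, coeff_pderiv] at hm
    have h2 := le_totalDegree (mem_support_iff.2 (left_ne_zero_of_mul hm))
    change _ = _ at hm'
    have h3 : (pderiv 1 Ψ).totalDegree = m.degree := hm'
    have h4 := map_add Finsupp.degree m (Finsupp.single (1 : Fin 2) 1)
    rw [Finsupp.degree_single] at h4
    change (m + Finsupp.single 1 1).degree ≤ _ at h2
    omega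
  have h1 : ((Ψ.vars : Finset (Fin 2)) : Set (Fin 2)) ⊆ Set.range fun _ : Unit => 0 := by
    intro i hi
    obtain ⟨m, hm, hi⟩ := (mem_vars i).1 hi
    fin_cases i
    · exact ⟨(), rfl⟩
    · obtain ⟨n, rfl⟩ : ∃ n, m = n + Finsupp.single 1 1 := ⟨m - Finsupp.single 1 1, by
        rw [tsub_add_cancel_of_le]
        simpa [Nat.one_le_iff_ne_zero] using! hi⟩
      have h2 := congrArg (coeff n) h0
      rw [coeff_pderiv, coeff_zero] at h2
      exact absurd h2 (mul_ne_zero (mem_support_iff.1 hm) (by exact_mod_cast (n 1).succ_ne_zero))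
  obtain ⟨q, hq⟩ := exists_rename_eq_of_vars_subset_range Ψ _ (fun _ _ _ => rfl) h1
  refine h (aeval (fun _ => Polynomial.X) q : Polynomial ℂ) (.trans ?_ hq)
  rw [← AlgHom.comp_apply]
  congr 1
  exact algHom_ext fun i => by simp

lemma aeval_X_notMem_ker {K : Type*} [Field K] [Algebra ℂ K] {a : K} (ha : Transcendental ℂ a) (b : K)
    {r : Polynomial ℂ} (hr : r ≠ 0) : Polynomial.aeval (X 0) r ∉
      RingHom.ker (aeval ![a, b] : MvPolynomial (Fin 2) ℂ →ₐ[ℂ] K) := fun h =>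
  ha ⟨r, hr, by simpa [← Polynomial.aeval_algHom_apply] using! (RingHom.mem_ker.1 h)⟩

lemma exists_generator {K : Type*} [Field K] [Algebra ℂ K] {a b : K} (ha : Transcendental ℂ a)
    {q : MvPolynomial (Fin 2) ℂ} (hq : q ≠ 0) (h : aeval ![a, b] q = 0) :
    ∃ Ψ : MvPolynomial (Fin 2) ℂ, Ψ ≠ 0 ∧ (∀ p, aeval ![a, b] p = 0 ↔ Ψ ∣ p) ∧
      aeval ![a, b] (pderiv 1 Ψ) ≠ 0 := by
  have hI : (RingHom.ker (aeval ![a, b] : MvPolynomial (Fin 2) ℂ →ₐ[ℂ] K)).IsPrime :=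
    RingHom.ker_isPrime _
  obtain ⟨Ψ, hΨ, hp⟩ := hI.exists_mem_prime_of_ne_bot fun hb =>
    hq ((Ideal.mem_bot (R := MvPolynomial (Fin 2) ℂ)).1 (hb ▸ h))
  have : (Ideal.span {Ψ}).IsPrime := (Ideal.span_singleton_prime hp.ne_zero).2 hp
  have hle := le_of_prime_of_le (Ideal.mem_span_singleton_self Ψ) hp.ne_zero
    ((Ideal.span_singleton_le_iff_mem _).2 hΨ) fun r => aeval_X_notMem_ker ha b
  have hd : ∀ p, aeval ![a, b] p = 0 ↔ Ψ ∣ p := fun p => ⟨fun h =>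
    Ideal.mem_span_singleton.1 (hle h), fun ⟨g, hg⟩ => by
      rw [hg, map_mul, show aeval ![a, b] Ψ = 0 from hΨ, zero_mul]⟩
  refine ⟨Ψ, hp.ne_zero, hd, fun h1 => not_dvd_pderiv (fun r hr => ?_) ((hd _).1 h1)⟩
  exact aeval_X_notMem_ker ha b (by rintro rfl; exact hp.ne_zero (by rw [← hr, map_zero])) (hr ▸ hΨ)

def schN {A : Type*} [CommRing A] (x y x1 x2 x3 y1 y2 y3 : A) : A :=
  schwPoly x x1 x2 x3 * (y ^ 2 * (y - 1) ^ 2 * y1 ^ 2) -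
    schwPoly y y1 y2 y3 * (x ^ 2 * (x - 1) ^ 2 * x1 ^ 2)

/-- The Hamiltonian vector field of `Ψ`. -/
def hamil (Ψ : MvPolynomial (Fin 2) ℂ) :
    Derivation ℂ (MvPolynomial (Fin 2) ℂ) (MvPolynomial (Fin 2) ℂ) :=
  pderiv 1 Ψ • pderiv 0 - pderiv 0 Ψ • pderiv 1

def schH (Ψ : MvPolynomial (Fin 2) ℂ) : MvPolynomial (Fin 2) ℂ :=
  schN (X 0) (X 1) (hamil Ψ (X 0)) (hamil Ψ (hamil Ψ (X 0))) (hamil Ψ (hamil Ψ (hamil Ψ (X 0))))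
    (hamil Ψ (X 1)) (hamil Ψ (hamil Ψ (X 1))) (hamil Ψ (hamil Ψ (hamil Ψ (X 1))))

structure IsDer {A : Type*} [CommRing A] [Algebra ℂ A] (E : A → A → Prop) : Prop where
  const : ∀ c, E (algebraMap ℂ A c) 0
  add : ∀ {f g f' g'}, E f f' → E g g' → E (f + g) (f' + g')
  mul : ∀ {f g f' g'}, E f f' → E g g' → E (f * g) (f' * g + f * g')
  uniq : ∀ {f g g'}, E f g → E f g' → g = g'

variable {A : Type*} [CommRing A] [Algebra ℂ A] {E : A → A → Prop}

lemma IsDer.apply_aeval (hE : IsDer E) {u u1 v v1 : A} (hu : E u u1) (hv : E v v1)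
    (p : MvPolynomial (Fin 2) ℂ) :
    E (aeval ![u, v] p) (aeval ![u, v] (pderiv 0 p) * u1 + aeval ![u, v] (pderiv 1 p) * v1) := by
  induction p using MvPolynomial.induction_on with
  | C c => simpa [← algebraMap_eq] using! hE.const c
  | add p q hp hq =>
    simp only [map_add]
    convert hE.add hp hq using 1
    ring
  | mul_X p i hp =>
    have hi : E (![u, v] i) (![u1, v1] i) := by fin_cases i <;> assumption
    have := hE.mul hp hi
    rw [map_mul, aeval_X]
    convert this using 1
    fin_cases i <;> simp <;> ring

lemma IsDer.schN_eq (hE : IsDer E) (Ψ : MvPolynomial (Fin 2) ℂ)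
    {u u1 u2 u3 v v1 v2 v3 l l1 l2 : A} (hu : E u u1) (hu1 : E u1 u2) (hu2 : E u2 u3)
    (hv : E v v1) (hv1 : E v1 v2) (hv2 : E v2 v3) (hl : E l l1) (hl1 : E l1 l2)
    (hlu : u1 = l * aeval ![u, v] (pderiv 1 Ψ))
    (hlv : v1 = -l * aeval ![u, v] (pderiv 0 Ψ)) :
    schN u v u1 u2 u3 v1 v2 v3 = l ^ 6 * aeval ![u, v] (schH Ψ) := by
  have hp : ∀ p : MvPolynomial (Fin 2) ℂ,
      E (aeval ![u, v] p) (l * aeval ![u, v] (hamil Ψ p)) := fun p => by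
    convert hE.apply_aeval hu hv p using 1
    simp [hamil, hlu, hlv]
    ring
  have h1 : ∀ {f g p}, E f g → f = l * aeval ![u, v] p →
      g = l1 * aeval ![u, v] p + l ^ 2 * aeval ![u, v] (hamil Ψ p) := fun {f g p} hf h =>
    (hE.uniq hf (h ▸ hE.mul hl (hp p))).trans (by ring)
  have h2 : ∀ {f f1 f2 f3 p}, E f f1 → E f1 f2 → E f2 f3 → f = aeval ![u, v] p →
      f1 = l * aeval ![u, v] (hamil Ψ p) ∧
      f2 = l1 * aeval ![u, v] (hamil Ψ p) + l ^ 2 * aeval ![u, v] (hamil Ψ (hamil Ψ p)) ∧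
      f3 = l2 * aeval ![u, v] (hamil Ψ p) + 3 * l * l1 * aeval ![u, v] (hamil Ψ (hamil Ψ p)) +
        l ^ 3 * aeval ![u, v] (hamil Ψ (hamil Ψ (hamil Ψ p))) := by
    intro f f1 f2 f3 p hf hf1 hf2 h
    have e1 := hE.uniq hf (h ▸ hp p)
    have e2 := h1 hf1 e1
    refine ⟨e1, e2, ?_⟩
    refine (hE.uniq hf2 (e2 ▸ hE.add (hE.mul hl1 (hp _)) (pow_two l ▸ hE.mul (hE.mul hl hl) (hp _)))).trans ?_
    ring
  obtain ⟨a1, a2, a3⟩ := h2 hu hu1 hu2 (aeval_X ![u, v] 0).symm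
  obtain ⟨b1, b2, b3⟩ := h2 hv hv1 hv2 (aeval_X ![u, v] 1).symm
  simp only [schH, schN, schwPoly, map_sub, map_mul, map_pow, map_add, map_ofNat, map_one, aeval_X,
    Matrix.cons_val_zero, Matrix.cons_val_one, a1, a2, a3, b1, b2, b3]
  ring

lemma PhiAlg.smul {j : ℂ → ℂ} (hj : PhiAlg j) {c : ℂ} (hc : c ≠ 0) : PhiAlg fun z => c * j z := by
  have h : ∀ M x y, PhiRel (fun z => c * j z) M x y ↔ PhiRel j M (c⁻¹ * x) (c⁻¹ * y) := fun M x y => by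
    rw [← phiRel_smul_iff (j := j) hc, mul_inv_cancel_left₀ hc, mul_inv_cancel_left₀ hc]
  refine ⟨fun M hM => ?_, fun M hM x => ?_, fun M hM x y => by rw [h, h]; exact hj.symm M hM _ _⟩
  · obtain ⟨Φ, hΦ⟩ := hj.alg M hM
    refine ⟨bind₁ (fun i => C c⁻¹ * X i) Φ, fun x y => ?_⟩
    rw [h, hΦ, eval_bind₁]
    congr! 3
    funext i
    fin_cases i <;> simp
  · simp only [h]
    have h1 := (hj.fin M hM (c⁻¹ * x)).preimage (f := (c⁻¹ * ·))
      (mul_right_injective₀ (inv_ne_zero hc)).injOn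
    exact h1

end PlaneCurve

end

section

section SchField
open MvPolynomial

variable {K : Type*} [Field K] [Algebra ℂ K]

lemma isDer_derivation (D : Derivation ℂ K K) : IsDer fun f g => D f = g where
  const c := D.map_algebraMap c
  add h h' := by rw [map_add, h, h']
  mul {f g _ _} h h' := by rw [D.leibniz, h, h', smul_eq_mul, smul_eq_mul]; ring
  uniq h h' := h.symm.trans h'

lemma ne_algebraMap_of_transcendental {a : K} (ha : Transcendental ℂ a) (c : ℂ) :
    a ≠ algebraMap ℂ K c := fun h => ha (h ▸ isAlgebraic_algebraMap c)

lemma schH_of_schRel [CharZero K] {a b : K} {τ : Type*} {D : τ → Derivation ℂ K K}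
    (h : SchRel (fun i => (D i).restrictScalars ℤ) a b) {i : τ} (hi : D i a ≠ 0)
    {Ψ : MvPolynomial (Fin 2) ℂ} (hΨ : aeval ![a, b] Ψ = 0) (hy : aeval ![a, b] (pderiv 1 Ψ) ≠ 0) :
    aeval ![a, b] (schH Ψ) = 0 ∧ aeval ![a, b] (pderiv 0 Ψ) ≠ 0 := by
  obtain ⟨s, p, hs, h⟩ := h
  obtain ⟨h1, h2, h3⟩ := h i
  generalize hE : D i = E at hi
  simp only [hE, Derivation.restrictScalars_apply] at h1 h2 h3
  have hb0 : E b ≠ 0 := by rw [h1]; exact mul_ne_zero (pow_ne_zero 2 hs) hi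
  have ht : ∀ {f}, E f ≠ 0 → ∀ c, f ≠ algebraMap ℂ K c := fun hf c h => hf (by rw [h, E.map_algebraMap])
  have ha0 := map_zero (algebraMap ℂ K) ▸ ht hi 0
  have ha1 := sub_ne_zero.2 (map_one (algebraMap ℂ K) ▸ ht hi 1)
  have hb0' := map_zero (algebraMap ℂ K) ▸ ht hb0 0
  have hb1' := sub_ne_zero.2 (map_one (algebraMap ℂ K) ▸ ht hb0 1)
  have hd := isDer_derivation E
  have hr := hd.apply_aeval (u := a) (v := b) rfl rfl Ψ
  change E _ = _ at hr
  rw [hΨ, map_zero] at hr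
  refine ⟨?_, fun hx => ?_⟩
  · have h4 := hd.schN_eq Ψ (u := a) (v := b) (l := E a / aeval ![a, b] (pderiv 1 Ψ)) rfl rfl rfl rfl rfl
      rfl rfl rfl (div_mul_cancel₀ _ hy).symm (by field_simp; linear_combination -hr)
    rw [show schN a b (E a) (E (E a)) (E (E (E a))) (E b) (E (E b)) (E (E (E b))) = 0 by
      have e2 : E (E b) = 2 * p * s ^ 3 * E a ^ 2 + s ^ 2 * E (E a) := by
        rw [h1]
        simp only [pow_two, Derivation.leibniz, smul_eq_mul, h2, h1]
        ring
      have e3 : E (E (E b)) = 2 * (schQ a * E a - s ^ 2 * schQ b * E b) * s ^ 2 * E a ^ 2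
          + 6 * p ^ 2 * s ^ 4 * E a ^ 3 + 6 * p * s ^ 3 * E a * E (E a) + s ^ 2 * E (E (E a)) := by
        have h5 : E (2 : K) = 0 := by simpa using! E.map_natCast 2
        rw [e2]
        simp only [pow_succ, pow_zero, one_mul, Derivation.leibniz, smul_eq_mul, h2, h3, h1, map_add, h5]
        field_simp
        ring
      rw [e3, e2, h1]
      simp only [schN, schwPoly, schQ]
      field_simp
      ring] at h4
    exact (mul_eq_zero.1 h4.symm).resolve_left (pow_ne_zero 6 (div_ne_zero hi hy))
  · rw [hx, zero_mul, zero_add] at hr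
    exact mul_ne_zero hy hb0 hr.symm

lemma schRel_of_schH [CharZero K] [IsAlgClosed K] {a b : K} (ha : Transcendental ℂ a)
    (hb : Transcendental ℂ b) {Ψ : MvPolynomial (Fin 2) ℂ} (hΨ : aeval ![a, b] Ψ = 0)
    (hy : aeval ![a, b] (pderiv 1 Ψ) ≠ 0) (hN : aeval ![a, b] (schH Ψ) = 0) {τ : Type*}
    (D : τ → Derivation ℂ K K) : SchRel (fun i => (D i).restrictScalars ℤ) a b := by
  obtain ⟨d, hd⟩ := exists_derivation_ne_zero ha
  have hder := isDer_derivation d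
  have hdp := hder.apply_aeval (u := a) (v := b) hd rfl
  have hr := hdp Ψ
  change d _ = _ at hr
  rw [hΨ, map_zero, mul_one] at hr
  have hk : ∀ E : Derivation ℂ K K, E a = 0 → E b = 0 ∧ E (d b) = 0 ∧ E (d (d b)) = 0 := by
    intro E hE
    have hp := fun c (hb : E b = c) p => (isDer_derivation E).apply_aeval (u := a) (v := b) hE hb p
    have h1 := hp _ rfl Ψ
    change E _ = _ at h1
    rw [hΨ, map_zero, mul_zero, zero_add] at h1
    have hEb := (mul_eq_zero.1 h1.symm).resolve_left hy
    have hp : ∀ p, E (aeval ![a, b] p) = 0 := fun p => (hp _ hEb p).trans (by ring)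
    have h2 := congrArg E hr
    simp only [map_add, Derivation.leibniz, hp, map_zero, smul_eq_mul, mul_zero, add_zero, zero_add] at h2
    have h2 := (mul_eq_zero.1 h2.symm).resolve_left hy
    refine ⟨hEb, h2, ?_⟩
    have h3 := congrArg E (congrArg d hr)
    have e := fun p => show d (aeval ![a, b] p) = _ from hdp p
    simp only [map_add, Derivation.leibniz, hp, map_zero, smul_eq_mul, mul_zero, add_zero, zero_add, e,
      h2, mul_one] at h3
    exact (mul_eq_zero.1 h3.symm).resolve_left hy
  have hb0 : d b ≠ 0 := fun h0 => hb (isAlgebraic_of_forall_derivation fun E => by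
    have h1 := (hk (E - E a • d) (by simp [hd])).1
    simpa [h0] using h1)
  obtain ⟨s, hs⟩ := IsAlgClosed.exists_pow_nat_eq (d b) two_pos
  have hs0 : s ≠ 0 := by rintro rfl; exact hb0 (by rw [← hs]; ring)
  have hsE : ∀ E : Derivation ℂ K K, E s = E (d b) / (2 * s) := fun E => by
    rw [← hs, pow_two, E.leibniz, smul_eq_mul]
    field_simp
    ring
  have ha0 := map_zero (algebraMap ℂ K) ▸ ne_algebraMap_of_transcendental ha 0
  have ha1 := sub_ne_zero.2 (map_one (algebraMap ℂ K) ▸ ne_algebraMap_of_transcendental ha 1)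
  have hb0' := map_zero (algebraMap ℂ K) ▸ ne_algebraMap_of_transcendental hb 0
  have hb1' := sub_ne_zero.2 (map_one (algebraMap ℂ K) ▸ ne_algebraMap_of_transcendental hb 1)
  have h4 := hder.schN_eq Ψ (u := a) (v := b) (l := 1 / aeval ![a, b] (pderiv 1 Ψ)) hd d.map_one_eq_zero
    (map_zero d) rfl rfl rfl rfl rfl (div_mul_cancel₀ _ hy).symm (by field_simp; linear_combination -hr)
  rw [hN, mul_zero] at h4
  have hp : ∀ E : Derivation ℂ K K, E (d (d b) / (2 * s ^ 3)) =
      E (d (d b)) / (2 * s ^ 3) - 3 * d (d b) * E (d b) / (4 * s ^ 5) := fun E => by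
    have h2 : E (2 : K) = 0 := by simpa using! E.map_natCast 2
    simp only [E.leibniz_div, pow_succ, pow_zero, one_mul, E.leibniz, smul_eq_mul, hsE, h2]
    field_simp
    ring
  refine ⟨s, d (d b) / (2 * s ^ 3), hs0, fun i => ?_⟩
  obtain ⟨k1, k2, k3⟩ := hk (D i - D i a • d) (by simp [hd])
  simp only [Derivation.sub_apply, Derivation.smul_apply, smul_eq_mul, sub_eq_zero] at k1 k2 k3
  simp only [Derivation.restrictScalars_apply]
  refine ⟨by rw [k1, hs]; ring, ?_, ?_⟩
  · rw [hsE, k1, k2, ← hs]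
    field_simp
  · rw [hp, k1, k2, k3]
    simp only [schN, schwPoly, schQ] at h4 ⊢
    rw [← hs] at h4 ⊢
    generalize d (s ^ 2) = y, d (d (s ^ 2)) = z at *
    field_simp
    field_simp at h4
    linear_combination -8 * D i a * h4

end SchField

end

section

section CurveODE
open MvPolynomial UpperHalfPlane

lemma isOpen_HH : IsOpen HH := isOpen_lt continuous_const Complex.continuous_im

lemma isPreconnected_HH : IsPreconnected HH := (convex_halfSpace_im_gt 0).isPreconnected

lemma isDer_fun {U : Set ℂ} (hU : IsOpen U) : IsDer fun f g : U → ℂ =>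
    ∃ F : ℂ → ℂ, (∀ z : U, F z = f z) ∧ ∀ z : U, HasDerivAt F (g z) z where
  const c := ⟨fun _ => c, fun _ => rfl, fun z => hasDerivAt_const _ _⟩
  add := fun ⟨F, hF, hF'⟩ ⟨G, hG, hG'⟩ =>
    ⟨F + G, fun z => congrArg₂ (· + ·) (hF z) (hG z), fun z => (hF' z).add (hG' z)⟩
  mul := fun ⟨F, hF, hF'⟩ ⟨G, hG, hG'⟩ => ⟨F * G, fun z => congrArg₂ (· * ·) (hF z) (hG z), fun z =>
    ((hF' z).mul (hG' z)).congr_deriv (by simp only [Pi.add_apply, Pi.mul_apply, hF, hG])⟩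
  uniq := fun ⟨F, hF, hF'⟩ ⟨G, hG, hG'⟩ => funext fun z =>
    (hF' z).unique ((hG' z).congr_of_eventuallyEq (by
      filter_upwards [hU.mem_nhds z.2] with x hx
      rw [hF ⟨x, hx⟩, hG ⟨x, hx⟩]))

lemma aeval_pi_apply {U : Set ℂ} (u v : U → ℂ) (p : MvPolynomial (Fin 2) ℂ) (z : U) :
    aeval ![u, v] p z = eval ![u z, v z] p := by
  have h : (Pi.evalAlgHom ℂ (fun _ : U => ℂ) z).comp (aeval ![u, v]) = aeval ![u z, v z] :=
    algHom_ext fun i => by fin_cases i <;> simp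
  exact (DFunLike.congr_fun h p).trans (congrFun (aeval_eq_eval _) p)

lemma hasDerivAt_eval {U : Set ℂ} (hU : IsOpen U) {u v u1 v1 : ℂ → ℂ}
    (hu : ∀ z ∈ U, HasDerivAt u (u1 z) z) (hv : ∀ z ∈ U, HasDerivAt v (v1 z) z)
    (p : MvPolynomial (Fin 2) ℂ) {z : ℂ} (hz : z ∈ U) :
    HasDerivAt (fun z => eval ![u z, v z] p) (eval ![u z, v z] (pderiv 0 p) * u1 z +
      eval ![u z, v z] (pderiv 1 p) * v1 z) z := by
  obtain ⟨F, hF, hF'⟩ := (isDer_fun hU).apply_aeval (u := fun z : U => u z) (v := fun z : U => v z)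
    ⟨u, fun _ => rfl, fun z => hu z z.2⟩ ⟨v, fun _ => rfl, fun z => hv z z.2⟩ p
  refine ((hF' ⟨z, hz⟩).congr_of_eventuallyEq ?_).congr_deriv ?_
  · filter_upwards [hU.mem_nhds hz] with x hx
    rw [hF ⟨x, hx⟩, aeval_pi_apply]
  · simp only [Pi.add_apply, Pi.mul_apply, aeval_pi_apply]

lemma analyticOnNhd_eval {U : Set ℂ} (hU : IsOpen U) {u v : ℂ → ℂ} (hu : DifferentiableOn ℂ u U)
    (hv : DifferentiableOn ℂ v U) (p : MvPolynomial (Fin 2) ℂ) :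
    AnalyticOnNhd ℂ (fun z => eval ![u z, v z] p) U :=
  DifferentiableOn.analyticOnNhd (fun z hz => (hasDerivAt_eval hU
    (fun x hx => (hu.differentiableAt (hU.mem_nhds hx)).hasDerivAt)
    (fun x hx => (hv.differentiableAt (hU.mem_nhds hx)).hasDerivAt) p
    hz).differentiableAt.differentiableWithinAt) hU

/-- The polynomials vanishing along the curve `(u, v)` on `U`. -/
def vanIdeal (u v : ℂ → ℂ) (U : Set ℂ) : Ideal (MvPolynomial (Fin 2) ℂ) where
  carrier := {p | ∀ z ∈ U, eval ![u z, v z] p = 0}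
  add_mem' h h' z hz := by rw [map_add, h z hz, h' z hz, add_zero]
  zero_mem' _ _ := map_zero _
  smul_mem' p q h z hz := by rw [smul_eq_mul, map_mul, h z hz, mul_zero]

lemma isPrime_vanIdeal {u v : ℂ → ℂ} {U : Set ℂ} (hU : IsOpen U) (hc : IsPreconnected U)
    (h0 : U.Nonempty) (hu : DifferentiableOn ℂ u U) (hv : DifferentiableOn ℂ v U) :
    (vanIdeal u v U).IsPrime := by
  refine ⟨fun h => ?_, fun {p q} h => ?_⟩
  · obtain ⟨z, hz⟩ := h0
    exact one_ne_zero ((map_one (eval ![u z, v z])).symm.trans ((Ideal.eq_top_iff_one _).1 h z hz))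
  · exact AnalyticOnNhd.eq_zero_or_eq_zero_of_mul_eq_zero (analyticOnNhd_eval hU hu hv p)
      (analyticOnNhd_eval hU hu hv q) (fun z hz => (map_mul _ _ _).symm.trans (h z hz)) hc

def SchODE (J J1 J2 J3 : ℂ → ℂ) : Prop :=
  ∀ z ∈ HH, HasDerivAt J (J1 z) z ∧ HasDerivAt J1 (J2 z) z ∧ HasDerivAt J2 (J3 z) z ∧
    schwPoly (J z) (J1 z) (J2 z) (J3 z) = 0 ∧ (J z ≠ 0 → J z ≠ 1 → J1 z ≠ 0)

lemma SchODE.schH_comp {J J1 J2 J3 : ℂ → ℂ} (hJ : SchODE J J1 J2 J3) {U : Set ℂ} (hU : IsOpen U)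
    {w w1 w2 w3 : ℂ → ℂ} (hw : ∀ z ∈ U, z ∈ HH ∧ w z ∈ HH ∧ HasDerivAt w (w1 z) z ∧
      HasDerivAt w1 (w2 z) z ∧ HasDerivAt w2 (w3 z) z) {Ψ : MvPolynomial (Fin 2) ℂ}
    (hΨ : ∀ z ∈ U, eval ![J z, J (w z)] Ψ = 0) (hy : ∀ z ∈ U, eval ![J z, J (w z)] (pderiv 1 Ψ) ≠ 0)
    {z : ℂ} (hz : z ∈ U) :
    J1 z ^ 6 * eval ![J z, J (w z)] (schH Ψ) = -eval ![J z, J (w z)] (pderiv 1 Ψ) ^ 6 *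
      (J z ^ 2 * (J z - 1) ^ 2 * J1 z ^ 2 * (J (w z) ^ 2 * (J (w z) - 1) ^ 2 * J1 (w z) ^ 2 *
        (72 * w3 z * w1 z - 108 * w2 z ^ 2))) := by
  have hu := fun z hz => (hJ z (hw z hz).1).1
  have hu1 := fun z hz => (hJ z (hw z hz).1).2.1
  have hu2 := fun z hz => (hJ z (hw z hz).1).2.2.1
  have hv : ∀ z ∈ U, HasDerivAt (fun z => J (w z)) (J1 (w z) * w1 z) z := fun z hz =>
    (hJ _ (hw z hz).2.1).1.comp z (hw z hz).2.2.1
  have hv1 : ∀ z ∈ U, HasDerivAt (fun z => J1 (w z) * w1 z) (J2 (w z) * w1 z ^ 2 + J1 (w z) * w2 z) z :=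
    fun z hz => (((hJ _ (hw z hz).2.1).2.1.comp z (hw z hz).2.2.1).mul
      (hw z hz).2.2.2.1).congr_deriv (by simp only [Function.comp_apply]; ring)
  have hv2 : ∀ z ∈ U, HasDerivAt (fun z => J2 (w z) * w1 z ^ 2 + J1 (w z) * w2 z)
      (J3 (w z) * w1 z ^ 3 + 3 * J2 (w z) * w1 z * w2 z + J1 (w z) * w3 z) z := fun z hz =>
    ((((hJ _ (hw z hz).2.1).2.2.1.comp z (hw z hz).2.2.1).mul ((hw z hz).2.2.2.1.pow 2)).add
      (((hJ _ (hw z hz).2.1).2.1.comp z (hw z hz).2.2.1).mul (hw z hz).2.2.2.2)).congr_deriv (by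
        simp only [Function.comp_apply, Pi.pow_apply]; push_cast; ring)
  obtain ⟨l, hl⟩ : ∃ l : ℂ → ℂ, l = fun z => J1 z / eval ![J z, J (w z)] (pderiv 1 Ψ) := ⟨_, rfl⟩
  have hl1 : DifferentiableOn ℂ l U := fun x hx => hl ▸ ((hu1 x hx).div
    (hasDerivAt_eval hU hu hv _ hx) (hy x hx)).differentiableAt.differentiableWithinAt
  have hl2 := hl1.deriv hU
  have hlz : ∀ z ∈ U, J1 z = l z * eval ![J z, J (w z)] (pderiv 1 Ψ) := fun z hz => by
    rw [hl, div_mul_cancel₀ _ (hy z hz)]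
  have h := congrFun ((isDer_fun hU).schN_eq Ψ (u := fun z : U => J z) (v := fun z : U => J (w z))
    (l := fun z : U => l z) ⟨J, fun _ => rfl, fun z => hu z z.2⟩ ⟨J1, fun _ => rfl, fun z => hu1 z z.2⟩
    ⟨J2, fun _ => rfl, fun z => hu2 z z.2⟩ ⟨_, fun _ => rfl, fun z => hv z z.2⟩
    ⟨_, fun _ => rfl, fun z => hv1 z z.2⟩ ⟨_, fun _ => rfl, fun z => hv2 z z.2⟩
    ⟨l, fun _ => rfl, fun z => (hl1.differentiableAt (hU.mem_nhds z.2)).hasDerivAt⟩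
    ⟨_, fun _ => rfl, fun z => (hl2.differentiableAt (hU.mem_nhds z.2)).hasDerivAt⟩
    (funext fun z => (hlz z z.2).trans (by rw [Pi.mul_apply, aeval_pi_apply]))
    (funext fun z => by
      have h1 := (hasDerivAt_eval hU hu hv Ψ z.2).unique ((hasDerivAt_const (z : ℂ) (0 : ℂ)).congr_of_eventuallyEq
        (by filter_upwards [hU.mem_nhds z.2] with x hx using hΨ x hx))
      rw [Pi.mul_apply, aeval_pi_apply, Pi.neg_apply]
      refine mul_left_cancel₀ (hy z z.2) ?_
      rw [hlz z z.2] at h1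
      linear_combination h1)) ⟨z, hz⟩
  rw [Pi.mul_apply, aeval_pi_apply] at h
  have e1 := (hJ z (hw z hz).1).2.2.2.1
  have e2 := (hJ _ (hw z hz).2.1).2.2.2.1
  simp only [schN, schwPoly, Pi.sub_apply, Pi.mul_apply, Pi.pow_apply, Pi.add_apply, Pi.one_apply,
    Pi.ofNat_apply] at h e1 e2
  have e3 := hlz z hz
  generalize eval ![J z, J (w z)] (pderiv 1 Ψ) = y, eval ![J z, J (w z)] (schH Ψ) = n at *
  have e4 : J1 z ^ 6 * n = y ^ 6 * (l z ^ 6 * n) := by rw [e3]; ring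
  rw [e4, ← h]
  linear_combination y ^ 6 * (J (w z) ^ 2 * (J (w z) - 1) ^ 2 * (J1 (w z) * w1 z) ^ 2) * e1 -
    y ^ 6 * (J z ^ 2 * (J z - 1) ^ 2 * J1 z ^ 2) * w1 z ^ 4 * e2

end CurveODE

end

section

section ModularCurve
open MvPolynomial UpperHalfPlane

lemma hasDerivAt_moeb (γ : Matrix (Fin 2) (Fin 2) ℂ) {z : ℂ} (h : γ 1 0 * z + γ 1 1 ≠ 0) :
    HasDerivAt (moeb γ) (γ.det / (γ 1 0 * z + γ 1 1) ^ 2) z ∧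
      HasDerivAt (fun z => γ.det / (γ 1 0 * z + γ 1 1) ^ 2)
        (-2 * γ 1 0 * γ.det / (γ 1 0 * z + γ 1 1) ^ 3) z ∧
      HasDerivAt (fun z => -2 * γ 1 0 * γ.det / (γ 1 0 * z + γ 1 1) ^ 3)
        (6 * γ 1 0 ^ 2 * γ.det / (γ 1 0 * z + γ 1 1) ^ 4) z := by
  have hl : ∀ i, HasDerivAt (fun z => γ i 0 * z + γ i 1) (γ i 0) z := fun i => by
    simpa using! ((hasDerivAt_id z).const_mul (γ i 0)).add_const (γ i 1)
  refine ⟨((hl 0).div (hl 1) h).congr_deriv ?_,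
    ((hasDerivAt_const z γ.det).div ((hl 1).pow 2) (pow_ne_zero 2 h)).congr_deriv ?_,
    ((hasDerivAt_const z (-2 * γ 1 0 * γ.det)).div ((hl 1).pow 3) (pow_ne_zero 3 h)).congr_deriv ?_⟩
  · rw [Matrix.det_fin_two]; ring
  all_goals simp only [Pi.pow_apply]; push_cast; field_simp; ring

lemma moeb_adjugate {A B : Matrix (Fin 2) (Fin 2) ℂ} {c : ℂ} (h : A * B = c • 1) (hc : c ≠ 0) {z : ℂ}
    (hz : B 1 0 * z + B 1 1 ≠ 0) : moeb A (moeb B z) = z := by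
  rw [← moeb_mul _ _ hz, h]
  simp [moeb, hc]

lemma IsModularJ.schODE {j : ℂ → ℂ} (hj : IsModularJ j) :
    ∃ J1 J2 J3, SchODE (fun z => (1728 : ℂ)⁻¹ * j z) J1 J2 J3 := hj.schwarz

lemma IsModularJ.surj_normalized {j : ℂ → ℂ} (hj : IsModularJ j) (c : ℂ) :
    ∃ z ∈ HH, (1728 : ℂ)⁻¹ * j z = c :=
  let ⟨z, hz⟩ := hj.surj (1728 * c)
  ⟨z, z.im_pos, by rw [hz]; ring⟩

lemma IsModularJ.schRel {j : ℂ → ℂ} (hj : IsModularJ j) {K : Type} [Field K] [CharZero K]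
    [IsAlgClosed K] [Algebra ℂ K] {τ : Type*} (D : τ → Derivation ℂ K K) {a b : K} {M : ℕ} (hM : 1 ≤ M)
    (ha : Transcendental ℂ a) (h : PhiGen (fun z => (1728 : ℂ)⁻¹ * j z) M a b) :
    SchRel (fun i => (D i).restrictScalars ℤ) a b := by
  obtain ⟨J1, J2, J3, hJ⟩ := hj.schODE
  have hP := hj.phiAlg.smul (c := (1728 : ℂ)⁻¹) (by norm_num)
  have hsurj := hj.surj_normalized
  have hdiff : ∀ {g : Matrix (Fin 2) (Fin 2) ℤ}, 0 < g.det →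
      DifferentiableOn ℂ (fun z => (1728 : ℂ)⁻¹ * j (moeb (zmat g) z)) HH := fun hg =>
    (hj.differentiable_comp hg).const_mul _
  obtain ⟨g, hg, hgM, hle⟩ : ∃ g : Matrix (Fin 2) (Fin 2) ℤ, 0 < g.det ∧
      (∀ z ∈ HH, PhiRel (fun z => (1728 : ℂ)⁻¹ * j z) M (1728⁻¹ * j z) (1728⁻¹ * j (moeb (zmat g) z))) ∧
      ∀ p ∈ vanIdeal (fun z => (1728 : ℂ)⁻¹ * j z) (fun z => 1728⁻¹ * j (moeb (zmat g) z)) HH,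
        aeval ![a, b] p = 0 := by
    by_contra! hcon
    have hp : ∀ f : ℍ → ℂ, ∃ p : MvPolynomial (Fin 2) ℂ, f ∈ heckeFun j M →
        (∀ z : ℍ, eval ![1728⁻¹ * j z, 1728⁻¹ * f z] p = 0) ∧ aeval ![a, b] p ≠ 0 := fun f => by
      by_cases hf : f ∈ heckeFun j M
      · obtain ⟨g, hg, hg', rfl⟩ := id hf
        obtain ⟨p, hp, hp'⟩ := hcon g (by rw [hg]; exact_mod_cast hM)
          fun z hz => ⟨z, hz, g, hg, hg', rfl, rfl⟩
        exact ⟨p, fun _ => ⟨fun z => hp z z.im_pos, hp'⟩⟩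
      · exact ⟨0, fun h => absurd h hf⟩
    choose p hp using hp
    have hfin := hj.finite_heckeFun hM
    have h1 := h (∏ f ∈ hfin.toFinset, p f) (by
      rintro _ _ ⟨z, hz, g, hg, hg', rfl, rfl⟩
      rw [map_prod]
      have hf : (fun z : ℍ => j (moeb (zmat g) z)) ∈ heckeFun j M := ⟨g, hg, hg', rfl⟩
      exact Finset.prod_eq_zero (hfin.mem_toFinset.2 hf) ((hp _ hf).1 ⟨z, hz⟩))
    rw [map_prod] at h1
    obtain ⟨f, hf, h2⟩ := Finset.prod_eq_zero_iff.1 h1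
    exact (hp f (hfin.mem_toFinset.1 hf)).2 h2
  have hprime := isPrime_vanIdeal isOpen_HH isPreconnected_HH ⟨Complex.I, by simp [HH]⟩
    (hj.holo.const_mul (1728 : ℂ)⁻¹) (hdiff hg)
  obtain ⟨Φ, hΦ⟩ := hP.alg M hM
  have hΦ0 : Φ ≠ 0 := by
    rintro rfl
    exact Set.infinite_univ (α := ℂ) ((hP.fin M hM 0).subset fun y _ => (hΦ 0 y).2 (map_zero _))
  have hI := le_of_prime_of_le (I₁ := vanIdeal (fun z => (1728 : ℂ)⁻¹ * j z)
    (fun z => 1728⁻¹ * j (moeb (zmat g) z)) HH) (fun z hz => (hΦ _ _).1 (hgM z hz)) hΦ0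
    (fun p hp => RingHom.mem_ker.2 (hle p hp)) fun r => aeval_X_notMem_ker ha b
  obtain ⟨Ψ, -, hΨ, hy⟩ := exists_generator ha hΦ0 (h Φ fun x y => (hΦ x y).1)
  have hΨ0 := (hΨ Ψ).2 dvd_rfl
  have hb : Transcendental ℂ b := by
    rintro ⟨r, hr, hr'⟩
    refine hr (Polynomial.funext fun y => ?_)
    obtain ⟨τ, hτ, hy⟩ := hsurj y
    have hadj : 0 < g.adjugate.det := by simpa [Matrix.det_adjugate] using hg
    have h1 := hI (x := Polynomial.aeval (X 1) r) (by
      rw [RingHom.mem_ker, ← Polynomial.aeval_algHom_apply]; simpa using! hr')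
      _ (moeb_zmat_mem hadj hτ)
    have h2 : moeb (zmat g) (moeb (zmat g.adjugate) τ) = τ :=
      moeb_adjugate (c := (g.det : ℂ)) (by
        rw [← zmat_mul, Matrix.mul_adjugate]
        ext i k
        fin_cases i <;> fin_cases k <;> simp [zmat, Matrix.intCast_apply]) (by exact_mod_cast hg.ne')
        (zmat_denom_ne_zero hadj.ne' hτ)
    rw [← coe_aeval_eq_eval, RingHom.coe_coe, ← Polynomial.aeval_algHom_apply] at h1
    simpa [h2, hy, Polynomial.aeval_def, Polynomial.eval₂_eq_eval_map] using! h1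
  refine schRel_of_schH ha hb hΨ0 hy (hle _ ?_) D
  · have hΨg := hI hΨ0
    have han := analyticOnNhd_eval isOpen_HH (hj.holo.const_mul (1728 : ℂ)⁻¹) (hdiff hg)
    have hUo := (han (pderiv 1 Ψ)).continuousOn.isOpen_inter_preimage isOpen_HH
      (isOpen_compl_singleton (x := 0))
    have hJ1 : AnalyticOnNhd ℂ J1 HH := DifferentiableOn.analyticOnNhd
      (fun z hz => (hJ z hz).2.1.differentiableAt.differentiableWithinAt) isOpen_HH
    have hz0 := fun z hz => zmat_denom_ne_zero (z := z) hg.ne' hz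
    have hmul : ∀ z ∈ HH, J1 z * (eval ![1728⁻¹ * j z, 1728⁻¹ * j (moeb (zmat g) z)] (pderiv 1 Ψ) *
        eval ![1728⁻¹ * j z, 1728⁻¹ * j (moeb (zmat g) z)] (schH Ψ)) = 0 := by
      intro z hz
      by_cases h0 : eval ![1728⁻¹ * j z, 1728⁻¹ * j (moeb (zmat g) z)] (pderiv 1 Ψ) = 0
      · rw [h0, zero_mul, mul_zero]
      have h1 := hJ.schH_comp hUo (Ψ := Ψ) (w := moeb (zmat g)) (fun z hz => ⟨hz.1,
        moeb_zmat_mem hg hz.1, hasDerivAt_moeb _ (hz0 z hz.1)⟩) (fun z hz => hΨg z hz.1)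
        (fun z hz => hz.2) ⟨hz, h0⟩
      have h2 : J1 z = 0 ∨ eval ![1728⁻¹ * j z, 1728⁻¹ * j (moeb (zmat g) z)] (schH Ψ) = 0 := by
        rw [← pow_eq_zero_iff (n := 6) (by norm_num), ← mul_eq_zero, h1]
        have hd := hz0 z hz
        field_simp
        ring
      rcases h2 with h2 | h2 <;> simp [h2]
    obtain ⟨z2, hz2, h2⟩ := hsurj 2
    have h3 := (AnalyticOnNhd.eq_zero_or_eq_zero_of_mul_eq_zero hJ1 ((han _).mul (han _)) hmul
      isPreconnected_HH).resolve_left fun h => (hJ z2 hz2).2.2.2.2 (h2.trans_ne two_ne_zero)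
      (h2.trans_ne (by norm_num)) (h z2 hz2)
    exact (AnalyticOnNhd.eq_zero_or_eq_zero_of_mul_eq_zero (han _) (han _) h3
      isPreconnected_HH).resolve_left fun h => hy (hle _ h)

end ModularCurve

end

section

section MoebBranch
open MvPolynomial Filter Topology
open scoped ContDiff

lemma eventually_eq_moeb {w w1 w2 w3 : ℂ → ℂ} {z₀ : ℂ} (h : ∀ᶠ z in 𝓝 z₀, HasDerivAt w (w1 z) z ∧
    HasDerivAt w1 (w2 z) z ∧ HasDerivAt w2 (w3 z) z ∧ 72 * w3 z * w1 z - 108 * w2 z ^ 2 = 0)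
    (h0 : w1 z₀ ≠ 0) : ∃ γ : Matrix (Fin 2) (Fin 2) ℂ, γ.det ≠ 0 ∧
      ∀ᶠ z in 𝓝 z₀, γ 1 0 * z + γ 1 1 ≠ 0 ∧ w z = moeb γ z := by
  have hc : ContinuousAt (fun p : ℂ × ℂ => 2 * w1 p.1 - w2 p.1 * (p.2 - p.1)) (z₀, z₀) := by
    have c1 := h.self_of_nhds.2.1.continuousAt.comp (x := (z₀, z₀)) continuousAt_fst
    have c2 := h.self_of_nhds.2.2.1.continuousAt.comp (x := (z₀, z₀)) continuousAt_fst
    exact (continuousAt_const.mul c1).sub (c2.mul (continuousAt_snd.sub continuousAt_fst))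
  have hne := hc.eventually_ne (y := 0) (by simpa using h0)
  rw [nhds_prod_eq, eventually_prod_self_iff (r := fun z x => 2 * w1 z - w2 z * (x - z) ≠ 0)] at hne
  obtain ⟨t, ht, hne⟩ := hne
  obtain ⟨r, hr, hU⟩ := Metric.eventually_nhds_iff_ball.1 (h.and ht)
  have hz₀ := Metric.mem_ball_self (x := z₀) hr
  refine ⟨!![2 * w1 z₀ ^ 2 - w z₀ * w2 z₀, w z₀ * (2 * w1 z₀ + w2 z₀ * z₀) - 2 * w1 z₀ ^ 2 * z₀;
    -w2 z₀, 2 * w1 z₀ + w2 z₀ * z₀], ?_, ?_⟩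
  · have : 4 * w1 z₀ ^ 3 ≠ 0 := mul_ne_zero (by norm_num) (pow_ne_zero 3 h0)
    rw [Matrix.det_fin_two_of]
    convert this using 1
    ring
  · filter_upwards [Metric.ball_mem_nhds z₀ hr] with x hx
    have hx0 := hne z₀ (hU z₀ hz₀).2 x (hU x hx).2
    have hx1 : -w2 z₀ * x + (2 * w1 z₀ + w2 z₀ * z₀) ≠ 0 := by convert hx0 using 1; ring
    refine ⟨by simpa using hx1, ?_⟩
    have hd : ∀ z ∈ Metric.ball z₀ r, HasDerivAt (fun z => w z + 2 * w1 z ^ 2 * (x - z) /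
        (2 * w1 z - w2 z * (x - z))) 0 z := fun z hz => by
      obtain ⟨⟨d0, d1, d2, d3⟩, hzt⟩ := hU z hz
      have ds := (hasDerivAt_id z).const_sub x
      have hn := hne z hzt x (hU x hx).2
      refine (d0.add ((((d1.pow 2).const_mul 2).mul ds).div
        ((d1.const_mul 2).sub (d2.mul ds)) hn)).congr_deriv ?_
      simp only [Pi.mul_apply, Pi.sub_apply, Pi.pow_apply, id] at hn ⊢
      push_cast
      rw [add_comm, ← eq_neg_iff_add_eq_zero, div_eq_iff (pow_ne_zero 2 hn)]
      linear_combination (1 / 36 : ℂ) * (x - z) ^ 2 * w1 z * d3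
    have hcst := Metric.isOpen_ball.is_const_of_deriv_eq_zero
      (convex_ball z₀ r).isPreconnected (fun z hz => (hd z hz).differentiableAt.differentiableWithinAt)
      (fun z hz => (hd z hz).deriv) hx hz₀
    simp only [sub_self, mul_zero, zero_div, add_zero] at hcst
    rw [hcst]
    simp only [moeb, Matrix.of_apply, Matrix.cons_val', Matrix.cons_val_zero, Matrix.cons_val_one,
      Matrix.cons_val_fin_one]
    rw [eq_div_iff hx1, show -w2 z₀ * x + (2 * w1 z₀ + w2 z₀ * z₀) = 2 * w1 z₀ - w2 z₀ * (x - z₀) by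
      ring, add_mul, div_mul_cancel₀ _ hx0]
    ring

lemma contDiffAt_eval {u v : ℂ × ℂ → ℂ} {x : ℂ × ℂ} (hu : ContDiffAt ℂ ω u x)
    (hv : ContDiffAt ℂ ω v x) (p : MvPolynomial (Fin 2) ℂ) :
    ContDiffAt ℂ ω (fun x => eval ![u x, v x] p) x := by
  induction p using MvPolynomial.induction_on with
  | C a => simpa using contDiffAt_const
  | add p q hp hq => simpa using! hp.add hq
  | mul_X p i hp => fin_cases i <;> simpa using! hp.mul ‹_›

lemma SchODE.exists_moeb {J J1 J2 J3 : ℂ → ℂ} (hJ : SchODE J J1 J2 J3)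
    (hsurj : ∀ c, ∃ z ∈ HH, J z = c) {K : Type*} [Field K] [CharZero K] [Algebra ℂ K] {a b : K}
    (ha : Transcendental ℂ a) (hb : Transcendental ℂ b) {Ψ : MvPolynomial (Fin 2) ℂ}
    (hΨ : ∀ p, aeval ![a, b] p = 0 ↔ Ψ ∣ p) (hx : aeval ![a, b] (pderiv 0 Ψ) ≠ 0)
    (hy : aeval ![a, b] (pderiv 1 Ψ) ≠ 0) (hN : aeval ![a, b] (schH Ψ) = 0) :
    ∃ z₀ ∈ HH, ∃ γ : Matrix (Fin 2) (Fin 2) ℂ, γ.det ≠ 0 ∧ γ 1 0 * z₀ + γ 1 1 ≠ 0 ∧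
      moeb γ z₀ ∈ HH ∧ ∀ᶠ z in 𝓝 z₀, eval ![J z, J (moeb γ z)] Ψ = 0 := by
  have hJa : AnalyticOnNhd ℂ J HH := DifferentiableOn.analyticOnNhd
    (fun z hz => (hJ z hz).1.differentiableAt.differentiableWithinAt) isOpen_HH
  have hprime : (RingHom.ker (aeval ![a, b] : MvPolynomial (Fin 2) ℂ →ₐ[ℂ] K)).IsPrime :=
    RingHom.ker_isPrime _
  obtain ⟨R, hR⟩ : ∃ R : MvPolynomial (Fin 2) ℂ, R = pderiv 0 Ψ * pderiv 1 Ψ *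
    (X 0 * (X 0 - 1) * (X 1 * (X 1 - 1))) := ⟨_, rfl⟩
  have hR0 : aeval ![a, b] R ≠ 0 := by
    have ha0 := ne_algebraMap_of_transcendental ha
    have hb0 := ne_algebraMap_of_transcendental hb
    have := fun c : K => sub_ne_zero (a := c) (b := 1)
    simp only [hR, map_mul, map_sub, aeval_X, map_one, Matrix.cons_val_zero, Matrix.cons_val_one]
    exact mul_ne_zero (mul_ne_zero hx hy) (mul_ne_zero (mul_ne_zero (by simpa using ha0 0)
      (sub_ne_zero.2 (by simpa using ha0 1))) (mul_ne_zero (by simpa using hb0 0)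
        (sub_ne_zero.2 (by simpa using hb0 1))))
  obtain ⟨P, hP, hPR⟩ : ∃ P : Fin 2 → ℂ, eval P Ψ = 0 ∧ eval P R ≠ 0 := by
    by_contra! hcon
    refine hR0 (RingHom.mem_ker.1 ?_)
    rw [← IsPrime.vanishingIdeal_zeroLocus (K := ℂ)
      (RingHom.ker (aeval ![a, b] : MvPolynomial (Fin 2) ℂ →ₐ[ℂ] K)), mem_vanishingIdeal]
    exact fun x hx => hcon x (mem_zeroLocus.1 hx _ ((hΨ Ψ).2 dvd_rfl))
  obtain ⟨z₀, hz₀, e0⟩ := hsurj (P 0)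
  obtain ⟨w₀, hw₀, e1⟩ := hsurj (P 1)
  obtain rfl : ![J z₀, J w₀] = P := by ext i; fin_cases i <;> assumption
  have hRne : ∀ {x y : ℂ}, eval ![x, y] R ≠ 0 → (eval ![x, y] (pderiv 0 Ψ) ≠ 0 ∧
      eval ![x, y] (pderiv 1 Ψ) ≠ 0) ∧ (x ≠ 0 ∧ x ≠ 1) ∧ y ≠ 0 ∧ y ≠ 1 := fun h => by
    simpa [hR, sub_eq_zero] using h
  obtain ⟨⟨hx0, hy0⟩, ⟨h00, h01⟩, h10, h11⟩ := hRne hPR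
  have hcd : ContDiffAt ℂ ω (fun x : ℂ × ℂ => eval ![J x.1, J x.2] Ψ) (z₀, w₀) :=
    contDiffAt_eval ((hJa z₀ hz₀).contDiffAt.comp (z₀, w₀) contDiffAt_fst)
      ((hJa w₀ hw₀).contDiffAt.comp (z₀, w₀) contDiffAt_snd) Ψ
  have hinv : (fderiv ℂ (fun x : ℂ × ℂ => eval ![J x.1, J x.2] Ψ) (z₀, w₀) ∘L
      .inr ℂ ℂ ℂ).IsInvertible := by
    have h1 := (hcd.differentiableAt (by simp)).hasFDerivAt.comp w₀
      ((hasFDerivAt_const z₀ w₀).prodMk (hasFDerivAt_id w₀))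
    have h2 := hasDerivAt_eval isOpen_HH (fun z _ => hasDerivAt_const z (J z₀))
      (fun z hz => (hJ z hz).1) Ψ hw₀
    have h3 : eval ![J z₀, J w₀] (pderiv 1 Ψ) * J1 w₀ ≠ 0 :=
      mul_ne_zero hy0 ((hJ w₀ hw₀).2.2.2.2 h10 h11)
    refine ⟨ContinuousLinearEquiv.unitsEquivAut ℂ (Units.mk0 _ h3), ?_⟩
    ext
    have h4 := h1.hasDerivAt.unique h2
    simpa using! h4.symm
  obtain ⟨w, hw⟩ : ∃ w, w = hcd.implicitFunction (by simp) hinv := ⟨_, rfl⟩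
  have hwz : w z₀ = w₀ := hw ▸ hcd.implicitFunction_apply_self (by simp) hinv
  have hwa : AnalyticAt ℂ w z₀ := hw ▸ (hcd.contDiffAt_implicitFunction (by simp) hinv).analyticAt
  have hwΨ : ∀ᶠ z in 𝓝 z₀, eval ![J z, J (w z)] Ψ = 0 := by
    filter_upwards [hcd.eventually_apply_implicitFunction (by simp) hinv] with z hz
    rw [hw]; exact hz.trans hP
  obtain ⟨U, hU, hUo, hzU⟩ := eventually_nhds_iff.1 ((hwa.eventually_analyticAt.and hwΨ).and
    ((isOpen_HH.eventually_mem hz₀).and (hwa.continuousAt.eventually_mem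
      (isOpen_HH.mem_nhds (hwz ▸ hw₀)))))
  have hu : ∀ z ∈ U, HasDerivAt J (J1 z) z := fun z hz => (hJ z (hU z hz).2.1).1
  have hw1 : ∀ z ∈ U, HasDerivAt w (deriv w z) z := fun z hz =>
    (hU z hz).1.1.differentiableAt.hasDerivAt
  have hv : ∀ z ∈ U, HasDerivAt (fun z => J (w z)) (J1 (w z) * deriv w z) z := fun z hz =>
    (hJ _ (hU z hz).2.2).1.comp z (hw1 z hz)
  have hVo := (show ContinuousOn (fun z => eval ![J z, J (w z)] R) U from fun z hz =>
    (hasDerivAt_eval hUo hu hv R hz).continuousAt.continuousWithinAt).isOpen_inter_preimage hUo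
      (isOpen_compl_singleton (x := 0))
  have hz₀V : z₀ ∈ U ∩ (fun z => eval ![J z, J (w z)] R) ⁻¹' {0}ᶜ := ⟨hzU, by
    rw [Set.mem_preimage, hwz]; exact hPR⟩
  obtain ⟨γ, hγ, hγw⟩ := eventually_eq_moeb (w := w) (w1 := deriv w) (w2 := deriv (deriv w))
    (w3 := deriv (deriv (deriv w))) (z₀ := z₀) (by
      filter_upwards [hVo.mem_nhds hz₀V] with z hz
      have hd := fun z hz => (show HasDerivAt _ _ _ ∧ HasDerivAt _ _ _ from
        ⟨(hU z hz).1.1.deriv.differentiableAt.hasDerivAt,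
          (hU z hz).1.1.deriv.deriv.differentiableAt.hasDerivAt⟩)
      have h1 := hJ.schH_comp hVo (w := w) (Ψ := Ψ) (fun z hz => ⟨(hU z hz.1).2.1, (hU z hz.1).2.2,
        hw1 z hz.1, hd z hz.1⟩) (fun z hz => (hU z hz.1).1.2) (fun z hz => (hRne hz.2).1.2) hz
      obtain ⟨q, hq⟩ := (hΨ _).1 hN
      obtain ⟨⟨-, k1⟩, ⟨k2, k3⟩, k4, k5⟩ := hRne hz.2
      rw [hq, map_mul, (hU z hz.1).1.2, zero_mul, mul_zero] at h1
      refine ⟨hw1 z hz.1, (hd z hz.1).1, (hd z hz.1).2, ?_⟩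
      simpa [k1, k2, k3, k4, k5, sub_eq_zero, (hJ _ (hU z hz.1).2.1).2.2.2.2 k2 k3,
        (hJ _ (hU z hz.1).2.2).2.2.2.2 k4 k5] using h1.symm) (fun h => by
      have h1 := (hasDerivAt_eval hUo hu hv Ψ hzU).unique ((hasDerivAt_const z₀ (0 : ℂ)).congr_of_eventuallyEq hwΨ)
      rw [h, hwz] at h1
      simp [hx0, (hJ _ hz₀).2.2.2.2 h00 h01] at h1)
  refine ⟨z₀, hz₀, γ, hγ, hγw.self_of_nhds.1, hγw.self_of_nhds.2 ▸ hwz ▸ hw₀, ?_⟩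
  filter_upwards [hwΨ, hγw] with z h1 h2
  rwa [← h2.2]

end MoebBranch

end

section

section CuspRelation
open MvPolynomial UpperHalfPlane Filter Topology

/-- Functions on `HH` with the analytic properties of the `j`-invariant used below. -/
structure CuspInvariant (J : ℂ → ℂ) : Prop where
  holo : DifferentiableOn ℂ J HH
  invariant : ∀ g : Matrix (Fin 2) (Fin 2) ℤ, g.det = 1 → ∀ z ∈ HH, J (moeb (zmat g) z) = J z
  surj : ∀ c, ∃ z ∈ HH, J z = c
  cusp : ∃ c ≠ 0, Tendsto (fun z : ℍ => J z * Function.Periodic.qParam 1 (z : ℂ)) atImInfty (𝓝 c)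

lemma IsModularJ.cuspInvariant {j : ℂ → ℂ} (hj : IsModularJ j) :
    CuspInvariant fun z => (1728 : ℂ)⁻¹ * j z where
  holo := hj.holo.const_mul _
  invariant g hg z hz := congrArg _ (hj.invariant g hg z hz)
  surj := hj.surj_normalized
  cusp := ⟨1728⁻¹, by norm_num, by
    simpa [mul_assoc] using hj.tendsto_mul_qParam.const_mul (1728 : ℂ)⁻¹⟩

variable {J : ℂ → ℂ}

lemma CuspInvariant.tendsto (hJ : CuspInvariant J) :
    Tendsto (fun z : ℍ => (J z)⁻¹) atImInfty (𝓝 0) ∧ ∀ᶠ z : ℍ in atImInfty, J z ≠ 0 := by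
  obtain ⟨c, hc, h⟩ := hJ.cusp
  refine ⟨?_, (h.eventually_ne hc).mono fun z hz => left_ne_zero_of_mul hz⟩
  have h1 := (qParam_tendsto_atImInfty one_pos).div h hc
  rw [zero_div] at h1
  refine h1.congr fun z => ?_
  have : Function.Periodic.qParam 1 (z : ℂ) ≠ 0 := Function.Periodic.qParam_ne_zero _
  rw [Pi.div_apply, div_mul_cancel_right₀ this]

lemma CuspInvariant.analyticOnNhd (hJ : CuspInvariant J) : AnalyticOnNhd ℂ J HH :=
  hJ.holo.analyticOnNhd isOpen_HH

lemma CuspInvariant.not_eventually_root (hJ : CuspInvariant J) {c : Polynomial ℂ} (hc : c ≠ 0) {z₀ : ℂ}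
    (hz₀ : z₀ ∈ HH) : ¬ ∀ᶠ z in 𝓝 z₀, c.eval (J z) = 0 := fun h => by
  refine hc (Polynomial.funext fun x => ?_)
  obtain ⟨z, hz, rfl⟩ := hJ.surj x
  rw [Polynomial.eval_zero]
  exact AnalyticOnNhd.eqOn_zero_of_preconnected_of_eventuallyEq_zero
    (fun z hz => (AnalyticOnNhd.eval_polynomial c _ trivial).comp (hJ.analyticOnNhd z hz))
    isPreconnected_HH hz₀ h hz

lemma exists_leading {Ψ : MvPolynomial (Fin 2) ℂ} (hΨ : Ψ ≠ 0) : ∃ c : Polynomial ℂ, c ≠ 0 ∧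
    ∀ {α : Type} (l : Filter α) [l.NeBot] (u v : α → ℂ) (x : ℂ), Tendsto u l (𝓝 x) →
      Tendsto (fun t => (v t)⁻¹) l (𝓝 0) → (∀ᶠ t in l, v t ≠ 0) →
      (∀ᶠ t in l, eval ![u t, v t] Ψ = 0) → c.eval x = 0 := by
  obtain ⟨θ, h0, h1⟩ : ∃ θ : MvPolynomial (Fin 2) ℂ →ₐ[ℂ] Polynomial (Polynomial ℂ),
      θ (X 0) = Polynomial.C Polynomial.X ∧ θ (X 1) = Polynomial.X :=
    ⟨aeval ![Polynomial.C Polynomial.X, Polynomial.X], by simp, by simp⟩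
  have hC : ∀ r, θ (C r) = Polynomial.C (Polynomial.C r) := θ.commutes
  obtain ⟨P, hP⟩ : ∃ P, P = θ Ψ := ⟨_, rfl⟩
  have hP0 : P ≠ 0 := fun hP0 => by
    have h : (Polynomial.eval₂RingHom (Polynomial.aeval (X 0 : MvPolynomial (Fin 2) ℂ)).toRingHom
        (X 1)).comp θ.toRingHom = RingHom.id _ :=
      ringHom_ext (fun r => by simp [hC, algebraMap_eq]) fun i => by fin_cases i <;> simp [h0, h1]
    refine hΨ ((DFunLike.congr_fun h Ψ).symm.trans ?_)
    simp [← hP, hP0]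
  have hev : ∀ x y, eval ![x, y] Ψ = P.eval₂ (Polynomial.evalRingHom x) y := fun x y => by
    have h : (Polynomial.eval₂RingHom (Polynomial.evalRingHom x) y).comp θ.toRingHom = eval ![x, y] :=
      ringHom_ext (fun r => by simp [hC]) fun i => by fin_cases i <;> simp [h0, h1]
    rw [hP]
    exact (DFunLike.congr_fun h Ψ).symm
  have hc : Continuous fun p : ℂ × ℂ => P.reverse.eval₂ (Polynomial.evalRingHom p.1) p.2 := by
    simp only [Polynomial.eval₂_eq_sum_range, Polynomial.coe_evalRingHom]
    fun_prop
  refine ⟨P.leadingCoeff, Polynomial.leadingCoeff_ne_zero.2 hP0, fun l _ u v x hu hv hv0 h => ?_⟩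
  have h1 := (hc.tendsto (x, 0)).comp (hu.prodMk_nhds hv)
  rw [Polynomial.eval₂_at_zero, Polynomial.coeff_zero_reverse] at h1
  refine tendsto_nhds_unique h1 (tendsto_const_nhds.congr' ?_)
  filter_upwards [hv0, h] with t ht0 ht
  let _ := invertibleOfNonzero ht0
  rw [hev, ← Polynomial.eval₂_reverse_mul_pow, invOf_eq_inv] at ht
  exact ((mul_eq_zero.1 ht).resolve_right (pow_ne_zero _ ht0)).symm

lemma continuousAt_moeb (γ : Matrix (Fin 2) (Fin 2) ℂ) {z : ℂ} (h : γ 1 0 * z + γ 1 1 ≠ 0) :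
    ContinuousAt (moeb γ) z := (hasDerivAt_moeb γ h).1.continuousAt

lemma exists_cusp (q : ℚ) : ∃ g : Matrix (Fin 2) (Fin 2) ℤ, g.det = 1 ∧
    Tendsto (fun z : ℍ => moeb (zmat g) z) atImInfty (𝓝 ((q : ℝ) : ℂ)) := by
  obtain ⟨a, b, hab⟩ := q.isCoprime_num_den
  have hdet : (!![q.num, -b; (q.den : ℤ), a]).det = 1 := by rw [Matrix.det_fin_two_of]; linarith
  refine ⟨_, hdet, ?_⟩
  have hd : (1 : ℝ) ≤ q.den := by exact_mod_cast q.pos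
  refine tendsto_iff_norm_sub_tendsto_zero.2 (squeeze_zero (fun _ => norm_nonneg _)
    (fun z => ?_) (tendsto_inv_atTop_zero.comp tendsto_comap))
  have h0 := zmat_denom_ne_zero (g := !![q.num, -b; (q.den : ℤ), a]) (hdet.trans_ne one_ne_zero) z.im_pos
  have hq : ((q : ℝ) : ℂ) = q.num / q.den := by exact_mod_cast (Rat.num_div_den q).symm
  simp only [moeb, zmat, Matrix.map_apply, Matrix.of_apply, Matrix.cons_val', Matrix.cons_val_zero,
    Matrix.cons_val_one, Matrix.cons_val_fin_one, Int.cast_natCast, Int.cast_neg] at h0 ⊢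
  have hd0 : (q.den : ℂ) ≠ 0 := by exact_mod_cast q.den_nz
  have hab' : (a * q.num + b * q.den : ℂ) = 1 := by exact_mod_cast hab
  rw [hq, show (q.num * (z : ℂ) + -b) / (q.den * z + a) - q.num / q.den =
    -((q.den : ℂ) * (q.den * z + a))⁻¹ by
      rw [div_sub_div _ _ h0 hd0, ← one_div, ← neg_div, mul_comm (q.den : ℂ) (q.den * z + a)]
      congr 1
      linear_combination -hab', norm_neg, norm_inv]
  refine inv_anti₀ z.im_pos ?_
  rw [norm_mul, Complex.norm_natCast]
  refine (le_mul_of_one_le_left z.im_pos.le hd).trans (mul_le_mul_of_nonneg_left ?_ (by positivity))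
  refine le_trans ?_ ((le_abs_self _).trans (Complex.abs_im_le_norm _))
  simpa using le_mul_of_one_le_left z.im_pos.le hd

end CuspRelation

end

section

section MoebRelation
open MvPolynomial UpperHalfPlane Filter Topology

/-- The points which `γ` maps into the upper half plane. -/
def moebDom (γ : Matrix (Fin 2) (Fin 2) ℂ) : Set ℂ := {z | γ 1 0 * z + γ 1 1 ≠ 0 ∧ moeb γ z ∈ HH}

lemma isOpen_moebDom (γ : Matrix (Fin 2) (Fin 2) ℂ) : IsOpen (moebDom γ) :=
  isOpen_iff_mem_nhds.2 fun z hz => (((continuous_const.mul continuous_id).add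
    continuous_const).continuousAt.eventually_ne hz.1).and ((continuousAt_moeb γ hz.1).eventually_mem
      (isOpen_HH.mem_nhds hz.2))

variable {J : ℂ → ℂ} {γ : Matrix (Fin 2) (Fin 2) ℂ}

lemma CuspInvariant.differentiableOn_moeb (hJ : CuspInvariant J) (γ : Matrix (Fin 2) (Fin 2) ℂ) :
    DifferentiableOn ℂ (fun z => J (moeb γ z)) (moebDom γ) :=
  hJ.holo.comp (fun z hz => (hasDerivAt_moeb γ hz.1).1.differentiableAt.differentiableWithinAt)
    fun _ hz => hz.2

lemma moeb_adjugate_moeb (hγ : γ.det ≠ 0) {z : ℂ} (hz : γ 1 0 * z + γ 1 1 ≠ 0) :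
    γ.adjugate 1 0 * moeb γ z + γ.adjugate 1 1 ≠ 0 ∧ moeb γ.adjugate (moeb γ z) = z := by
  refine ⟨?_, moeb_adjugate (Matrix.adjugate_mul γ) hγ hz⟩
  have : γ.adjugate 1 0 * moeb γ z + γ.adjugate 1 1 = γ.det / (γ 1 0 * z + γ 1 1) := by
    rw [eq_div_iff hz, add_mul, moeb, mul_assoc, div_mul_cancel₀ _ hz]
    simp only [Matrix.adjugate_fin_two, Matrix.det_fin_two, Matrix.of_apply, Matrix.cons_val',
      Matrix.cons_val_zero, Matrix.cons_val_one, Matrix.cons_val_fin_one]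
    ring
  exact this ▸ div_ne_zero hγ hz

lemma moeb_moeb_adjugate (hγ : γ.det ≠ 0) {z : ℂ} (hz : γ.adjugate 1 0 * z + γ.adjugate 1 1 ≠ 0) :
    moeb γ (moeb γ.adjugate z) = z := moeb_adjugate (Matrix.mul_adjugate γ) hγ hz

lemma CuspInvariant.im_moeb_ne_zero (hJ : CuspInvariant J) (hγ : γ.det ≠ 0) {z₀ : ℂ} (hz₀ : z₀ ∈ HH)
    (hd : γ 1 0 * z₀ + γ 1 1 ≠ 0) {Ψ : MvPolynomial (Fin 2) ℂ} (hΨ : Ψ ≠ 0)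
    (hf : ∃ᶠ z in 𝓝 z₀, moeb γ z ∈ HH ∧ ∀ᶠ x in 𝓝 z, eval ![J x, J (moeb γ x)] Ψ = 0) :
    (moeb γ z₀).im ≠ 0 := by
  intro him
  obtain ⟨r, hr⟩ : ∃ r : ℝ, (r : ℂ) = moeb γ z₀ := ⟨_, Complex.ext rfl him.symm⟩
  obtain ⟨δ, hδ⟩ : ∃ δ, δ = γ.adjugate := ⟨_, rfl⟩
  have hδγ := fun {z} => moeb_adjugate_moeb hγ (z := z)
  have hγδ := fun {z} => moeb_moeb_adjugate hγ (z := z)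
  rw [← hδ] at hδγ hγδ
  have hrd : (r : ℂ) ∈ moebDom δ := by
    rw [hr]
    exact ⟨(hδγ hd).1, by rw [(hδγ hd).2]; exact hz₀⟩
  obtain ⟨ε, hε, hB⟩ := Metric.isOpen_iff.1 (isOpen_moebDom δ) r hrd
  have hJδ := (hJ.differentiableOn_moeb δ).mono hB
  have hγc := continuousAt_moeb γ hd
  have hden : ∀ᶠ z in 𝓝 z₀, γ 1 0 * z + γ 1 1 ≠ 0 :=
    ((continuous_const.mul continuous_id).add continuous_const).continuousAt.eventually_ne hd
  have hg : ∀ τ ∈ Metric.ball (r : ℂ) ε ∩ HH, eval ![J (moeb δ τ), J τ] Ψ = 0 := by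
    obtain ⟨z, ⟨hz, hz'⟩, hzd, hzB⟩ := (hf.and_eventually (hden.and (hγc.eventually_mem
      (s := Metric.ball (r : ℂ) ε) (by rw [← hr]; exact Metric.ball_mem_nhds _ hε)))).exists
    have hzδ := hδγ hzd
    refine AnalyticOnNhd.eqOn_zero_of_preconnected_of_eventuallyEq_zero
      (analyticOnNhd_eval (Metric.isOpen_ball.inter isOpen_HH) (hJδ.mono Set.inter_subset_left)
        (hJ.holo.mono Set.inter_subset_right) Ψ)
      ((convex_ball (r : ℂ) ε).inter (convex_halfSpace_im_gt 0)).isPreconnected ⟨hzB, hz⟩ ?_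
    filter_upwards [(continuousAt_moeb δ hzδ.1).eventually (hzδ.2.symm ▸ hz'),
      Metric.isOpen_ball.mem_nhds hzB] with τ h1 h2
    rwa [hγδ (hB h2).1] at h1
  obtain ⟨c, hc, hlim⟩ := exists_leading hΨ
  have hJδa := hJδ.analyticOnNhd Metric.isOpen_ball
  have hrat : ∀ q : ℚ, ((q : ℝ) : ℂ) ∈ Metric.ball (r : ℂ) ε → c.eval (J (moeb δ ((q : ℝ) : ℂ))) = 0 := by
    intro q hq
    obtain ⟨g, hg1, hgq⟩ := exists_cusp q
    have hJg : ∀ z : ℍ, J (moeb (zmat g) z) = J z := fun z => hJ.invariant g hg1 z z.im_pos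
    refine hlim atImInfty _ (fun z : ℍ => J (moeb (zmat g) z)) _
      ((hJδa _ hq).continuousAt.tendsto.comp hgq) ?_ ?_ ?_
    · simpa only [hJg] using hJ.tendsto.1
    · simpa only [hJg] using hJ.tendsto.2
    · filter_upwards [hgq.eventually_mem (Metric.isOpen_ball.mem_nhds hq)] with z hz
      exact hg _ ⟨hz, moeb_zmat_mem (hg1 ▸ one_pos) z.im_pos⟩
  have han : AnalyticAt ℂ (fun τ => c.eval (J (moeb δ τ))) r :=
    (AnalyticOnNhd.eval_polynomial c _ trivial).comp (hJδa _ (Metric.mem_ball_self hε))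
  have h0 := han.frequently_zero_iff_eventually_zero.1 <| by
    refine ((nhdsWithin_hasBasis Metric.nhds_basis_ball _).frequently_iff).2 fun η hη => ?_
    obtain ⟨q, hq, hq'⟩ := exists_rat_btwn (lt_add_of_pos_right r (lt_min hη hε))
    have hqr : dist ((q : ℝ) : ℂ) r < min η ε := by
      rw [Complex.dist_of_im_eq (by simp)]
      simp only [Complex.ofReal_re, Real.dist_eq]
      rw [abs_of_pos (sub_pos.2 hq)]
      linarith
    exact ⟨_, ⟨hqr.trans_le (min_le_left _ _), fun h => hq.ne' (Complex.ofReal_injective h)⟩,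
      hrat q (hqr.trans_le (min_le_right _ _))⟩
  refine hJ.not_eventually_root hc hz₀ ?_
  filter_upwards [hγc.eventually (hr ▸ h0), hden] with z h1 h2
  rwa [(hδγ h2).2] at h1

/-- A Moebius transformation satisfying an algebraic relation with `J` near one point of the upper
half plane preserves the upper half plane. -/
lemma CuspInvariant.moebDom_of_relation (hJ : CuspInvariant J) (hγ : γ.det ≠ 0) {z₀ : ℂ}
    (hz₀ : z₀ ∈ HH) (hd : z₀ ∈ moebDom γ) {Ψ : MvPolynomial (Fin 2) ℂ} (hΨ : Ψ ≠ 0)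
    (hf : ∀ᶠ x in 𝓝 z₀, eval ![J x, J (moeb γ x)] Ψ = 0) :
    ∀ z ∈ HH, z ∈ moebDom γ ∧ eval ![J z, J (moeb γ z)] Ψ = 0 := by
  obtain ⟨V, hV⟩ : ∃ V, V = {z | z ∈ moebDom γ ∧ ∀ᶠ x in 𝓝 z, eval ![J x, J (moeb γ x)] Ψ = 0} :=
    ⟨_, rfl⟩
  have hVo : IsOpen V := isOpen_iff_mem_nhds.2 fun z hz => by
    rw [hV] at hz ⊢
    filter_upwards [(isOpen_moebDom γ).mem_nhds hz.1, eventually_eventually_nhds.2 hz.2] with x h1 h2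
      using ⟨h1, h2⟩
  suffices h : HH ⊆ V from fun z hz => by
    have := h hz
    rw [hV] at this
    exact ⟨this.1, this.2.self_of_nhds⟩
  refine isPreconnected_HH.subset_of_closure_inter_subset hVo ⟨z₀, hz₀, hV ▸ ⟨hd, hf⟩⟩ ?_
  rintro z ⟨hzV, hz⟩
  rw [mem_closure_iff_frequently] at hzV
  have hmem : ∀ {x}, x ∈ V → x ∈ moebDom γ ∧ ∀ᶠ x in 𝓝 x, eval ![J x, J (moeb γ x)] Ψ = 0 :=
    fun hx => by rwa [hV] at hx
  by_cases h0 : γ 1 0 * z + γ 1 1 = 0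
  · exfalso
    have h1 : γ 0 0 * z + γ 0 1 ≠ 0 := fun h1 => hγ (by
      rw [Matrix.det_fin_two]
      by_cases hc : γ 1 0 = 0
      · have h2 : γ 1 1 = 0 := by simpa [hc] using h0
        rw [hc, h2]; ring
      · refine (mul_eq_zero.1 (?_ : γ 1 0 * _ = 0)).resolve_left hc
        linear_combination γ 0 0 * γ 1 0 * h0 - γ 1 0 ^ 2 * h1)
    have hS : (zmat !![0, -1; 1, 0] * γ).det = γ.det := by simp [zmat, Matrix.det_fin_two]
    refine hJ.im_moeb_ne_zero (γ := zmat !![0, -1; 1, 0] * γ) (hS.trans_ne hγ) hz ?_ hΨ ?_ ?_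
    · simpa [zmat, Matrix.mul_apply, Fin.sum_univ_two] using h1
    · refine hzV.mono fun x hx => ?_
      have hm : ∀ x ∈ V, moeb (zmat !![0, -1; 1, 0] * γ) x = moeb (zmat !![0, -1; 1, 0]) (moeb γ x) :=
        fun x hx => moeb_mul _ _ (hmem hx).1.1
      refine ⟨hm x hx ▸ moeb_zmat_mem (by simp) (hmem hx).1.2, ?_⟩
      filter_upwards [hVo.mem_nhds hx] with y hy
      rw [hm y hy, hJ.invariant _ (by simp) _ (hmem hy).1.2]
      exact (hmem hy).2.self_of_nhds
    · simp [moeb, zmat, Matrix.mul_apply, Fin.sum_univ_two, ← neg_add, h0]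
  · have him : z ∈ moebDom γ := ⟨h0, by
      by_contra hn
      have h1 := hJ.im_moeb_ne_zero hγ hz h0 hΨ
        (hzV.mono fun x hx => ⟨(hmem hx).1.2, (hmem hx).2⟩)
      have h2 : (moeb γ z).im < 0 := lt_of_le_of_ne (not_lt.1 hn) h1
      obtain ⟨x, hx, hx'⟩ := (hzV.and_eventually ((Complex.continuous_im.continuousAt.comp
        (continuousAt_moeb γ h0)).eventually_lt_const h2)).exists
      exact absurd (hmem hx).1.2 hx'.not_gt⟩
    by_contra hn
    have hz' : ∀ᶠ x in 𝓝[≠] z, eval ![J x, J (moeb γ x)] Ψ ≠ 0 :=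
      ((analyticOnNhd_eval (isOpen_HH.inter (isOpen_moebDom γ)) (hJ.holo.mono Set.inter_subset_left)
        ((hJ.differentiableOn_moeb γ).mono Set.inter_subset_right) Ψ z
          ⟨hz, him⟩).eventually_eq_zero_or_eventually_ne_zero).resolve_left fun h => hn (hV ▸ ⟨him, h⟩)
    obtain ⟨x, hx, hx'⟩ := (hzV.and_eventually (eventually_nhdsWithin_iff.1 hz')).exists
    exact hx' (fun h => hn (h ▸ hx)) (hmem hx).2.self_of_nhds

end MoebRelation

end

section

section CuspInjective
open UpperHalfPlane Filter Topology MatrixGroups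
open Function.Periodic (qParam cuspFunction)

variable {J : ℂ → ℂ}

lemma CuspInvariant.exists_eq_add_int (hJ : CuspInvariant J) : ∃ R : ℝ, 0 < R ∧
    ∀ z w : ℂ, R < z.im → R < w.im → J z = J w → ∃ n : ℤ, z = w + n := by
  classical
  obtain ⟨f, hf⟩ : ∃ f : ℂ → ℂ, ∀ z, f z = if 0 < z.im then (J z)⁻¹ else 0 := ⟨_, fun _ => rfl⟩
  have hf' : ∀ z : ℍ, f z = (J z)⁻¹ := fun z => (hf z).trans (if_pos z.im_pos)
  have hper : Function.Periodic f (1 : ℝ) := fun z => by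
    have h : 0 < z.im → J (z + 1) = J z := fun hz => by
      simpa [moeb, zmat] using hJ.invariant !![1, 1; 0, 1] (by simp) z hz
    by_cases hz : 0 < z.im <;> simp [hf, hz, h]
  have hI : ∀ {p : ℂ → Prop}, (∀ᶠ z : ℍ in atImInfty, p z) → ∀ᶠ z in comap Complex.im atTop, p z := by
    intro p h
    obtain ⟨A, hA⟩ := (atImInfty_mem _).1 h
    filter_upwards [preimage_mem_comap (Ioi_mem_atTop A), preimage_mem_comap (Ioi_mem_atTop 0)]
      with z hz hz' using hA ⟨z, hz'⟩ hz.le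
  have hT := hJ.tendsto
  have hzero : Filter.ZeroAtFilter (comap Complex.im atTop) f :=
    fun s hs => hI ((hT.1.eventually hs).mono fun z hz => by rwa [hf'])
  have hdiff : ∀ᶠ z in comap Complex.im atTop, DifferentiableAt ℂ f z := hI <|
    hT.2.mono fun z hz => by
      have h1 := ((hJ.holo z z.im_pos).differentiableAt (isOpen_HH.mem_nhds z.im_pos)).inv hz
      refine h1.congr_of_eventuallyEq ?_
      filter_upwards [isOpen_HH.mem_nhds z.im_pos] with w hw using (hf w).trans (if_pos hw)
  obtain ⟨F, hF⟩ : ∃ F, F = cuspFunction 1 f := ⟨_, rfl⟩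
  have hFz : ∀ z : ℍ, F (qParam 1 z) = (J z)⁻¹ := fun z => by
    rw [hF, Function.Periodic.eq_cuspFunction one_ne_zero hper, hf']
  have hF0 : F 0 = 0 := hF ▸ Function.Periodic.cuspFunction_zero_of_zero_at_inf one_pos hzero
  have hFd : DifferentiableAt ℂ F 0 :=
    hF ▸ Function.Periodic.differentiableAt_cuspFunction_zero one_pos hper hdiff hzero.boundedAtFilter
  have hFa : AnalyticAt ℂ F 0 := Complex.analyticAt_iff_eventually_differentiableAt.2 <| by
    have := Function.Periodic.eventually_differentiableAt_cuspFunction_nhds_ne_zero one_pos hper hdiff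
    rw [← hF, eventually_nhdsWithin_iff] at this
    filter_upwards [this] with q hq
    by_cases h : q = 0
    · rwa [h]
    · exact hq h
  obtain ⟨c, hc, hlim⟩ := hJ.cusp
  have hq : Tendsto (fun z : ℍ => qParam 1 (z : ℂ)) atImInfty (𝓝[≠] 0) :=
    tendsto_nhdsWithin_iff.2 ⟨qParam_tendsto_atImInfty one_pos,
      .of_forall fun z => Function.Periodic.qParam_ne_zero _⟩
  have hd : deriv F 0 = c⁻¹ := by
    refine tendsto_nhds_unique ((hasDerivAt_iff_tendsto_slope.1 hFd.hasDerivAt).comp hq)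
      ((hlim.inv₀ hc).congr fun z => ?_)
    simp [slope_def_field, hF0, hFz, div_eq_mul_inv, mul_comm]
  have hinj := (hd ▸ hFa.hasStrictDerivAt).eventually_left_inverse (inv_ne_zero hc)
  obtain ⟨A, hA⟩ := (atImInfty_mem _).1 ((qParam_tendsto_atImInfty one_pos).eventually hinj)
  refine ⟨max A 1, by positivity, fun z w hz hw h => ?_⟩
  have hz0 : 0 < z.im := (lt_max_of_lt_right one_pos).trans hz
  have hw0 : 0 < w.im := (lt_max_of_lt_right one_pos).trans hw
  have h1 := hA ⟨z, hz0⟩ ((le_max_left _ _).trans hz.le)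
  have h2 := hA ⟨w, hw0⟩ ((le_max_left _ _).trans hw.le)
  rw [Set.mem_setOf_eq, hFz] at h1 h2
  have h3 : qParam 1 z = qParam 1 w := by
    rw [← show _ = qParam 1 z from h1, ← show _ = qParam 1 w from h2, h]
  obtain ⟨n, hn⟩ := Complex.exp_eq_exp_iff_exists_int.1 h3
  refine ⟨n, mul_left_cancel₀ Complex.two_pi_I_ne_zero ?_⟩
  simp only [Complex.ofReal_one, div_one] at hn
  rw [hn]; ring

lemma CuspInvariant.exists_eq_moeb (hJ : CuspInvariant J) : ∃ R : ℝ, ∀ z w : ℂ, z ∈ HH → w ∈ HH →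
    R < z.im → J w = J z → ∃ g : Matrix (Fin 2) (Fin 2) ℤ, g.det = 1 ∧ w = moeb (zmat g) z := by
  obtain ⟨R, hR, hinj⟩ := hJ.exists_eq_add_int
  have hcont : ContinuousOn (fun z : ℍ => J z) (ModularGroup.truncatedFundamentalDomain R) :=
    (hJ.holo.continuousOn.comp_continuous continuous_coe fun z => z.im_pos).continuousOn
  obtain ⟨C, hC⟩ := (ModularGroup.isCompact_truncatedFundamentalDomain R).exists_bound_of_continuousOn
    hcont
  have hC' : (0 : ℝ) < |C| + 1 := by positivity
  obtain ⟨A, hA⟩ := (atImInfty_mem _).1 ((hJ.tendsto.1.eventually (Metric.ball_mem_nhds 0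
    (inv_pos.2 hC'))).and hJ.tendsto.2)
  refine ⟨max A R, fun z w hz hw hzi h => ?_⟩
  obtain ⟨g, hg⟩ := ModularGroup.exists_smul_mem_fd ⟨w, hw⟩
  have hgw : J ((g • (⟨w, hw⟩ : ℍ) : ℍ) : ℂ) = J z := by
    rw [coe_SL_smul, hJ.invariant _ g.2 _ hw]; exact h
  have him : R < (g • (⟨w, hw⟩ : ℍ) : ℍ).im := by
    by_contra hn
    have h1 := hC _ ⟨hg, not_lt.1 hn⟩
    obtain ⟨h2, h3⟩ := hA ⟨z, hz⟩ ((le_max_left _ _).trans hzi.le)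
    change J z ≠ 0 at h3
    rw [dist_zero_right, norm_inv] at h2
    have h4 := (inv_lt_inv₀ (norm_pos_iff.2 h3) hC').1 h2
    rw [hgw] at h1
    linarith [le_abs_self C]
  obtain ⟨n, hn⟩ := hinj _ _ him ((le_max_right _ _).trans_lt hzi) hgw
  refine ⟨(g⁻¹ : SL(2, ℤ)) * !![1, n; 0, 1], by rw [Matrix.det_mul, (g⁻¹).2]; simp, ?_⟩
  rw [zmat_mul, moeb_mul _ _ (by simp [zmat]), show moeb (zmat !![1, n; 0, 1]) z = z + n by
    simp [moeb, zmat], ← hn, ← coe_SL_smul, inv_smul_smul]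

end CuspInjective

end

section

section Stabilizer
open UpperHalfPlane Filter Topology

variable {J : ℂ → ℂ}

lemma CuspInvariant.exists_eq_smul_zmat (hJ : CuspInvariant J) {h : Matrix (Fin 2) (Fin 2) ℂ}
    (hh : ∀ z ∈ HH, h 1 0 * z + h 1 1 ≠ 0 ∧ moeb h z ∈ HH ∧ J (moeb h z) = J z) :
    ∃ g : Matrix (Fin 2) (Fin 2) ℤ, g.det = 1 ∧ ∃ c : ℂ, h = c • zmat g := by
  by_contra! hn
  obtain ⟨R, hR⟩ := hJ.exists_eq_moeb
  obtain ⟨p, hp⟩ : ∃ p : Matrix (Fin 2) (Fin 2) ℤ → Polynomial ℂ, ∀ g z, (p g).eval z =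
      (h 0 0 * z + h 0 1) * (g 1 0 * z + g 1 1) - (g 0 0 * z + g 0 1) * (h 1 0 * z + h 1 1) :=
    ⟨fun g => (.C (h 0 0) * .X + .C (h 0 1)) * (.C (g 1 0 : ℂ) * .X + .C (g 1 1 : ℂ)) -
      (.C (g 0 0 : ℂ) * .X + .C (g 0 1 : ℂ)) * (.C (h 1 0) * .X + .C (h 1 1)), fun g z => by simp⟩
  have hp0 : ∀ g, g.det = 1 → p g ≠ 0 := fun g hg h0 => by
    have h1 := hp g
    simp only [h0, Polynomial.eval_zero] at h1
    have e0 := h1 0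
    have e1 := h1 1
    have e2 := h1 (-1)
    have hd : (g 0 0 * g 1 1 - g 0 1 * g 1 0 : ℂ) = 1 := by
      rw [Matrix.det_fin_two] at hg
      exact_mod_cast hg
    refine hn g hg (g 1 1 * h 0 0 - g 0 1 * h 1 0) ?_
    ext i k
    fin_cases i <;> fin_cases k <;> simp [zmat]
    · linear_combination -h 0 0 * hd + g 0 1 * ((e1 + e2) / 2 - e0)
    · linear_combination -h 0 1 * hd + g 0 1 * (e1 - e2) / 2 - g 0 0 * e0
    · linear_combination -h 1 0 * hd + g 1 1 * ((e1 + e2) / 2 - e0)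
    · linear_combination -h 1 1 * hd + g 1 1 * (e1 - e2) / 2 - g 1 0 * e0
  have : Countable (Matrix (Fin 2) (Fin 2) ℤ) := inferInstanceAs (Countable (Fin 2 → Fin 2 → ℤ))
  have hcount : (⋃ g ∈ {g : Matrix (Fin 2) (Fin 2) ℤ | g.det = 1}, {z | (p g).IsRoot z}).Countable :=
    (Set.to_countable _).biUnion fun g hg => (Polynomial.finite_setOf_isRoot (hp0 g hg)).countable
  obtain ⟨z, hz, hz'⟩ := (hcount.dense_compl ℂ).inter_open_nonempty {z : ℂ | max R 0 < z.im}
    (isOpen_lt continuous_const Complex.continuous_im) ⟨⟨0, max R 0 + 1⟩, lt_add_one (max R 0)⟩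
  have hz0 : z ∈ HH := (le_max_right R 0).trans_lt hz
  obtain ⟨h1, h2, h3⟩ := hh z hz0
  obtain ⟨g, hg, he⟩ := hR z _ hz0 h2 ((le_max_left R 0).trans_lt hz) h3
  refine hz' (Set.mem_biUnion hg ?_)
  rw [Set.mem_setOf_eq, Polynomial.IsRoot, hp, sub_eq_zero]
  exact (div_eq_div_iff h1 (zmat_denom_ne_zero (hg.trans_ne one_ne_zero) hz0)).1 he

end Stabilizer

section Pigeonhole
open MvPolynomial UpperHalfPlane Filter Topology

variable {J : ℂ → ℂ}

lemma CuspInvariant.exists_pow_invariant (hJ : CuspInvariant J) {γ : Matrix (Fin 2) (Fin 2) ℂ}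
    {Ψ : MvPolynomial (Fin 2) ℂ} (hΨ : Ψ ≠ 0) {B : ℕ} (hB : Ψ.totalDegree ≤ B)
    (h : ∀ z ∈ HH, z ∈ moebDom γ ∧ eval ![J z, J (moeb γ z)] Ψ = 0)
    {g : Matrix (Fin 2) (Fin 2) ℤ} (hg : g.det = 1) :
    ∃ k, 1 ≤ k ∧ k ≤ B ∧ ∀ z ∈ HH, J (moeb γ (moeb (zmat (g ^ k)) z)) = J (moeb γ z) := by
  have hgk : ∀ k, (g ^ k).det = 1 := fun k => by rw [Matrix.det_pow, hg, one_pow]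
  have hgm : ∀ k, ∀ z ∈ HH, moeb (zmat (g ^ k)) z ∈ HH := fun k z => moeb_zmat_mem (hgk k ▸ one_pos)
  obtain ⟨f, hf⟩ : ∃ f : ℕ → ℂ → ℂ, ∀ k z, f k z = J (moeb γ (moeb (zmat (g ^ k)) z)) :=
    ⟨_, fun _ _ => rfl⟩
  have hadd : ∀ k l, ∀ z ∈ HH, f (k + l) z = f k (moeb (zmat (g ^ l)) z) := fun k l z hz => by
    rw [hf, hf, pow_add, zmat_mul, moeb_mul _ _ (zmat_denom_ne_zero ((hgk l).trans_ne one_ne_zero) hz)]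
  suffices hs : ∃ k l : Fin (B + 1), k < l ∧ Set.EqOn (f k) (f l) HH by
    obtain ⟨k, l, hkl, hE⟩ := hs
    refine ⟨l - k, by lia, by lia, fun z hz => ?_⟩
    have h0 := (hgk k).trans_ne one_ne_zero
    obtain ⟨w, hw, rfl⟩ : ∃ w ∈ HH, moeb (zmat (g ^ (k : ℕ))) w = z :=
      ⟨moeb (zmat (g ^ (k : ℕ)).adjugate) z,
        moeb_zmat_mem (by rw [Matrix.det_adjugate, hgk]; simp) hz, by
        rw [← moeb_mul _ _ (zmat_denom_ne_zero (by rw [Matrix.det_adjugate, hgk]; simp) hz), ← zmat_mul,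
          Matrix.mul_adjugate, hgk]
        simp [moeb, zmat]⟩
    have := hE hw
    rw [show (l : ℕ) = (l - k) + k by lia, hadd _ _ _ hw, hf, hf] at this
    exact this.symm
  have hfa : ∀ k, AnalyticOnNhd ℂ (f k) HH := fun k => by
    refine DifferentiableOn.analyticOnNhd ?_ isOpen_HH
    refine (((hJ.differentiableOn_moeb γ).mono fun z hz => (h z hz).1).comp (t := HH) (fun z hz => ?_)
      (hgm k)).congr fun z _ => hf k z
    exact (hasDerivAt_moeb _ (zmat_denom_ne_zero ((hgk k).trans_ne one_ne_zero)
      hz)).1.differentiableAt.differentiableWithinAt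
  have hroot : ∀ k, ∀ z ∈ HH, eval ![J z, f k z] Ψ = 0 := fun k z hz => by
    have := (h _ (hgm k z hz)).2
    rwa [hJ.invariant _ (hgk k) z hz, ← hf] at this
  by_contra! hn
  obtain ⟨c, hc, hlim⟩ := exists_leading hΨ
  have hI : Complex.I ∈ HH := by simp [HH]
  have h1 : ∀ᶠ z in 𝓝[≠] Complex.I, c.eval (J z) ≠ 0 :=
    (((AnalyticOnNhd.eval_polynomial c _ trivial).comp
      (hJ.analyticOnNhd _ hI)).eventually_eq_zero_or_eventually_ne_zero).resolve_left
        (hJ.not_eventually_root hc hI)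
  have h2 : ∀ k l : Fin (B + 1), k < l → ∀ᶠ z in 𝓝[≠] Complex.I, f k z ≠ f l z := fun k l hkl => by
    by_contra hne
    exact hn k l hkl ((hfa k).eqOn_of_preconnected_of_frequently_eq (hfa l) isPreconnected_HH hI
      hne)
  obtain ⟨z, hz, hz1, hz2⟩ := ((eventually_nhdsWithin_of_eventually_nhds (isOpen_HH.mem_nhds hI)).and
    (h1.and (eventually_all.2 fun k => eventually_all.2 fun l => eventually_imp_distrib_left.2
      (h2 k l)))).exists
  have hP : ∀ y, (aeval ![Polynomial.C (J z), Polynomial.X] Ψ : Polynomial ℂ).eval y =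
      eval ![J z, y] Ψ := fun y => by
    have h : (Polynomial.evalRingHom y).comp (aeval ![Polynomial.C (J z), Polynomial.X] :
        MvPolynomial (Fin 2) ℂ →ₐ[ℂ] Polynomial ℂ).toRingHom = eval ![J z, y] :=
      ringHom_ext (fun r => by simp) fun i => by fin_cases i <;> simp
    exact DFunLike.congr_fun h Ψ
  have h0 := Polynomial.eq_zero_of_natDegree_lt_card_of_eval_eq_zero
    (aeval ![Polynomial.C (J z), Polynomial.X] Ψ : Polynomial ℂ) (f := fun k : Fin (B + 1) => f k z)
    (Function.Injective.of_lt_imp_ne fun k l => hz2 k l) (fun k => (hP _).trans (hroot k z hz)) ?_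
  · exact hz1 (hlim (α := ℂ) (𝓝[≠] 0) (fun _ => J z) (fun t => t⁻¹) _ tendsto_const_nhds
      (by simpa using! tendsto_nhdsWithin_of_tendsto_nhds tendsto_id)
      (eventually_mem_nhdsWithin.mono fun t ht => inv_ne_zero ht)
      (.of_forall fun t => by rw [← hP, h0, Polynomial.eval_zero]))
  · rw [Fintype.card_fin, Nat.lt_succ_iff]
    refine (aeval_natDegree_le Ψ hB _ (n := 1) fun i => ?_).trans_eq (mul_one B)
    fin_cases i <;> simp

end Pigeonhole

end

section

section Commensurator

lemma exists_isPrim {N : Matrix (Fin 2) (Fin 2) ℤ} (hN : N ≠ 0) :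
    ∃ (t : ℤ) (g : Matrix (Fin 2) (Fin 2) ℤ), IsPrim g ∧ N = t • g := by
  obtain ⟨t, ht⟩ : ∃ t, t = Nat.gcd (Int.gcd (N 0 0) (N 0 1)) (Int.gcd (N 1 0) (N 1 1)) := ⟨_, rfl⟩
  have htd : ∀ k : ℕ, (∀ i j, (k : ℤ) ∣ N i j) ↔ k ∣ t := fun k => by
    simp [ht, Fin.forall_fin_two, Nat.dvd_gcd_iff, Int.dvd_gcd_iff]
  choose g hg using (htd t).2 dvd_rfl
  refine ⟨t, g, isPrim_iff.2 fun k hk => ?_, Matrix.ext fun i j => hg i j⟩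
  have h0 : t ≠ 0 := fun h0 => hN (Matrix.ext fun i j => by rw [hg, h0]; simp)
  have h1 : t * k ∣ t * 1 := by
    rw [mul_one]
    refine (htd _).1 fun i j => ?_
    rw [hg, Nat.cast_mul]
    exact mul_dvd_mul_left _ (hk i j)
  exact Nat.dvd_one.1 (Nat.dvd_of_mul_dvd_mul_left (Nat.pos_of_ne_zero h0) h1)

lemma IsPrim.dvd_of_forall_dvd {g : Matrix (Fin 2) (Fin 2) ℤ} (hg : IsPrim g) {D c : ℤ}
    (h : ∀ i j, D ∣ c * g i j) : D ∣ c := by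
  have hD : ∀ {x y : ℤ}, D ∣ c * x → D ∣ c * y → D ∣ c * (Int.gcd x y) := fun hx hy => by
    rw [Int.gcd_eq_gcd_ab, mul_add, ← mul_assoc, ← mul_assoc]
    exact dvd_add (hx.mul_right _) (hy.mul_right _)
  have := hD (hD (h 0 0) (h 0 1)) (hD (h 1 0) (h 1 1))
  rwa [Int.gcd_natCast_natCast, show Nat.gcd _ _ = 1 from hg, Nat.cast_one, mul_one] at this

lemma exists_eq_det_smul_zmat {γ : Matrix (Fin 2) (Fin 2) ℂ} {G g : Matrix (Fin 2) (Fin 2) ℤ}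
    (hG : G.det = 1) (hg : g.det = 1) {c : ℂ} (h : γ * zmat G * γ.adjugate = c • zmat g) :
    ∃ g', γ * zmat G * γ.adjugate = γ.det • zmat g' := by
  have hz : ∀ g : Matrix (Fin 2) (Fin 2) ℤ, g.det = 1 → (zmat g).det = 1 := fun g hg => by
    rw [zmat, ← Int.coe_castRingHom, ← RingHom.mapMatrix_apply, ← RingHom.map_det, hg, map_one]
  have h1 := congrArg Matrix.det h
  rw [Matrix.det_mul, Matrix.det_mul, Matrix.det_adjugate, Matrix.det_smul, hz G hG, hz g hg] at h1
  simp only [Fintype.card_fin, Nat.add_one_sub_one, pow_one, mul_one] at h1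
  rcases mul_self_eq_mul_self_iff.1 (h1.trans (sq c)) with h2 | h2
  · exact ⟨g, by rw [h, h2]⟩
  · exact ⟨-g, by rw [h, h2]; ext i j; simp [zmat]⟩

lemma exists_isPrim_of_parabolic {γ : Matrix (Fin 2) (Fin 2) ℂ} (hγ : γ.det ≠ 0) {k l : ℤ} (hk : k ≠ 0)
    (hl : l ≠ 0) {g₁ g₂ : Matrix (Fin 2) (Fin 2) ℤ}
    (h₁ : γ * zmat !![1, k; 0, 1] * γ.adjugate = γ.det • zmat g₁)
    (h₂ : γ * zmat !![1, 0; l, 1] * γ.adjugate = γ.det • zmat g₂) :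
    ∃ g : Matrix (Fin 2) (Fin 2) ℤ, IsPrim g ∧ g.det ∣ k * l ∧ ∃ s : ℂ, s ≠ 0 ∧ γ = s • zmat g := by
  have hdet := Matrix.det_fin_two γ
  obtain ⟨δ, hδ⟩ : ∃ δ, δ = γ.det := ⟨_, rfl⟩
  rw [← hδ] at h₁ h₂ hγ hdet
  have e₁ := fun i j => congrFun (congrFun h₁ i) j
  have e₂ := fun i j => congrFun (congrFun h₂ i) j
  simp only [Fin.forall_fin_two, Matrix.adjugate_fin_two, zmat, Matrix.mul_apply, Fin.sum_univ_two,
    Matrix.map_apply, Matrix.smul_apply, Matrix.of_apply, Matrix.cons_val', Matrix.cons_val_zero,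
    Matrix.cons_val_one, Matrix.cons_val_fin_one, Int.cast_one, Int.cast_zero, smul_eq_mul] at e₁ e₂
  obtain ⟨⟨a1, a2⟩, a3, a4⟩ := e₁
  obtain ⟨⟨b1, b2⟩, b3, b4⟩ := e₂
  have hP : ∀ i m, ∃ N : ℤ, k * γ i 0 * γ m 0 = δ * N := by
    simp only [Fin.forall_fin_two]
    refine ⟨⟨⟨g₁ 0 1, ?_⟩, ⟨1 - g₁ 0 0, ?_⟩⟩, ⟨1 - g₁ 0 0, ?_⟩, ⟨-g₁ 1 0, ?_⟩⟩ <;> push_cast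
    · linear_combination a2
    · linear_combination -hdet - a1
    · linear_combination -hdet - a1
    · linear_combination -a3
  have hQ : ∀ i m, ∃ N : ℤ, l * γ i 1 * γ m 1 = δ * N := by
    simp only [Fin.forall_fin_two]
    refine ⟨⟨⟨-g₂ 0 1, ?_⟩, ⟨g₂ 0 0 - 1, ?_⟩⟩, ⟨g₂ 0 0 - 1, ?_⟩, ⟨g₂ 1 0, ?_⟩⟩ <;> push_cast
    · linear_combination -b2
    · linear_combination b1 + hdet
    · linear_combination b1 + hdet
    · linear_combination b3
  choose P hP using hP
  choose Q hQ using hQ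
  have hPQ : ∀ i m, (k * l : ℂ) * γ i 0 * γ m 1 = δ * (P i 0 * Q 1 m - P i 1 * Q 0 m : ℤ) := fun i m => by
    refine mul_left_cancel₀ hγ ?_
    push_cast
    linear_combination (k * l * γ i 0 * γ m 1) * hdet + (l * γ 1 1 * γ m 1) * hP i 0 +
      δ * P i 0 * hQ 1 m - (l * γ 0 1 * γ m 1) * hP i 1 - δ * P i 1 * hQ 0 m
  have hN : ∀ j i n m, ∃ N : ℤ, (k * l : ℂ) * γ i j * γ m n = δ * N := by
    intro j i n m
    fin_cases j <;> fin_cases n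
    · exact ⟨l * P i m, by push_cast; linear_combination l * hP i m⟩
    · exact ⟨_, hPQ i m⟩
    · exact ⟨_, (mul_right_comm _ _ _).trans (hPQ m i)⟩
    · exact ⟨k * Q i m, by push_cast; linear_combination k * hQ i m⟩
  obtain ⟨i₀, j₀, h0⟩ : ∃ i j, γ i j ≠ 0 := by
    by_contra! hn
    exact hγ (by rw [hdet]; simp [hn])
  choose N hN using hN
  have hkl : (k * l : ℂ) * γ i₀ j₀ ≠ 0 :=
    mul_ne_zero (mul_ne_zero (Int.cast_ne_zero.2 hk) (Int.cast_ne_zero.2 hl)) h0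
  obtain ⟨t, g, hg, ht⟩ := exists_isPrim (N := Matrix.of fun m n => N j₀ i₀ n m) fun hz => by
    have := hN j₀ i₀ j₀ i₀
    rw [show N j₀ i₀ j₀ i₀ = 0 from congrFun (congrFun hz i₀) j₀, Int.cast_zero, mul_zero] at this
    exact mul_ne_zero hkl h0 this
  obtain ⟨s, hs⟩ : ∃ s : ℂ, s = δ * t / ((k * l : ℂ) * γ i₀ j₀) := ⟨_, rfl⟩
  have hγs : γ = s • zmat g := by
    ext m n
    have h1 : N j₀ i₀ n m = t * g m n := congrFun (congrFun ht m) n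
    rw [Matrix.smul_apply, smul_eq_mul, hs, div_mul_eq_mul_div, eq_div_iff hkl, zmat, Matrix.map_apply,
      mul_comm, hN, h1, Int.cast_mul, mul_assoc]
  have hs0 : s ≠ 0 := fun h => h0 (by rw [hγs, h, zero_smul, Matrix.zero_apply])
  have hγg : ∀ m n, γ m n = s * g m n := fun m n => congrFun (congrFun hγs m) n
  refine ⟨g, hg, hg.dvd_of_forall_dvd fun i j => hg.dvd_of_forall_dvd fun m n => ⟨N j i n m, ?_⟩,
    s, hs0, hγs⟩
  have h1 := hN j i n m
  rw [hdet, hγg, hγg, hγg, hγg, hγg, hγg] at h1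
  rw [← Int.cast_inj (α := ℂ), Matrix.det_fin_two]
  refine mul_left_cancel₀ (pow_ne_zero 2 hs0) ?_
  push_cast
  linear_combination h1

end Commensurator

end

section

section ModularRelation
open MvPolynomial UpperHalfPlane Filter Topology

variable {J : ℂ → ℂ}

lemma mem_moebDom_mul {A B : Matrix (Fin 2) (Fin 2) ℂ} {z : ℂ} (hB : z ∈ moebDom B)
    (hA : moeb B z ∈ moebDom A) : z ∈ moebDom (A * B) := by
  refine ⟨?_, moeb_mul A B hB.1 ▸ hA.2⟩
  have : (A * B) 1 0 * z + (A * B) 1 1 = (A 1 0 * moeb B z + A 1 1) * (B 1 0 * z + B 1 1) := by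
    rw [add_mul, mul_assoc, moeb, div_mul_cancel₀ _ hB.1]
    simp only [Matrix.mul_apply, Fin.sum_univ_two]
    ring
  exact this ▸ mul_ne_zero hA.1 hB.1

lemma zmat_mem_moebDom {g : Matrix (Fin 2) (Fin 2) ℤ} (hg : 0 < g.det) {z : ℂ} (hz : z ∈ HH) :
    z ∈ moebDom (zmat g) := ⟨zmat_denom_ne_zero hg.ne' hz, moeb_zmat_mem hg hz⟩

lemma CuspInvariant.exists_isPrim_of_relation (hJ : CuspInvariant J) {γ : Matrix (Fin 2) (Fin 2) ℂ}
    (hγ : γ.det ≠ 0) {Ψ : MvPolynomial (Fin 2) ℂ} (hΨ : Ψ ≠ 0) {B : ℕ} (hB : Ψ.totalDegree ≤ B)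
    (h : ∀ z ∈ HH, z ∈ moebDom γ ∧ eval ![J z, J (moeb γ z)] Ψ = 0)
    (hadj : ∀ z ∈ HH, z ∈ moebDom γ.adjugate) :
    ∃ g : Matrix (Fin 2) (Fin 2) ℤ, IsPrim g ∧ 0 < g.det ∧ g.det ≤ B * B ∧
      ∃ s : ℂ, s ≠ 0 ∧ γ = s • zmat g := by
  have key : ∀ g : Matrix (Fin 2) (Fin 2) ℤ, g.det = 1 → ∃ k, 1 ≤ k ∧ k ≤ B ∧
      ∃ g', γ * zmat (g ^ k) * γ.adjugate = γ.det • zmat g' := fun g hg => by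
    obtain ⟨k, hk, hkB, hkJ⟩ := hJ.exists_pow_invariant hΨ hB h hg
    have hgk : (g ^ k).det = 1 := by rw [Matrix.det_pow, hg, one_pow]
    have hgk' : 0 < (g ^ k).det := hgk ▸ one_pos
    obtain ⟨g', hg', c, hc⟩ := hJ.exists_eq_smul_zmat (h := γ * zmat (g ^ k) * γ.adjugate) fun z hz => by
      have h1 := hadj z hz
      have h2 := mem_moebDom_mul (zmat_mem_moebDom hgk' h1.2) (h _ (moeb_zmat_mem hgk' h1.2)).1
      have h3 := mem_moebDom_mul h1 h2
      refine ⟨h3.1, h3.2, ?_⟩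
      rw [moeb_mul _ _ h1.1, moeb_mul _ _ (zmat_denom_ne_zero hgk'.ne' h1.2), hkJ _ h1.2,
        moeb_moeb_adjugate hγ h1.1]
    exact ⟨k, hk, hkB, exists_eq_det_smul_zmat hgk hg' hc⟩
  obtain ⟨k, hk, hkB, g₁, h₁⟩ := key !![1, 1; 0, 1] (by simp)
  obtain ⟨l, hl, hlB, g₂, h₂⟩ := key !![1, 0; 1, 1] (by simp)
  have hT : ∀ k : ℕ, (!![1, 1; 0, 1] : Matrix (Fin 2) (Fin 2) ℤ) ^ k = !![1, (k : ℤ); 0, 1] ∧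
      (!![1, 0; 1, 1] : Matrix (Fin 2) (Fin 2) ℤ) ^ k = !![1, 0; (k : ℤ), 1] := fun k => by
    induction k with
    | zero => simp [Matrix.one_fin_two]
    | succ k ih => simp [pow_succ, ih, Matrix.mul_fin_two, add_comm]
  rw [(hT k).1] at h₁
  rw [(hT l).2] at h₂
  obtain ⟨g, hg, hdvd, s, hs, hγs⟩ := exists_isPrim_of_parabolic hγ (by lia) (by lia) h₁ h₂
  have hkl : (0 : ℤ) < k * l := by positivity
  have hle := Int.le_of_dvd hkl hdvd
  refine ⟨g, hg, ?_, hle.trans (by gcongr), s, hs, hγs⟩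
  by_contra hn
  have hg0 : g.det ≠ 0 := fun h0 => hkl.ne' (zero_dvd_iff.1 (h0 ▸ hdvd))
  have hI : Complex.I ∈ HH := by simp [HH]
  have h1 := moeb_zmat_mem (g := !![-1, 0; 0, 1] * g) (by
    rw [Matrix.det_mul]; simpa using lt_of_le_of_ne (not_lt.1 hn) hg0) hI
  have h2 : moeb γ Complex.I = moeb (zmat g) Complex.I := by
    rw [hγs]
    simp only [moeb, Matrix.smul_apply, smul_eq_mul, mul_assoc, ← mul_add]
    rw [mul_div_mul_left _ _ hs]
  have h3 := (h _ hI).1.2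
  rw [zmat_mul, moeb_mul _ _ (zmat_denom_ne_zero hg0 hI), ← h2] at h1
  simp [moeb, zmat] at h1
  exact absurd h3 (by simp [HH] at h1 ⊢; exact h1.le)

end ModularRelation

section SchwarzianCharacterisation
open MvPolynomial Filter Topology

lemma IsModularJ.schPhi {j : ℂ → ℂ} (hj : IsModularJ j) : SchPhi fun z => (1728 : ℂ)⁻¹ * j z where
  schRel K _ _ _ _ r D a b M hM ha h := hj.schRel D hM ha h
  exists_phiGen B := by
    refine ⟨B * B, fun K _ _ _ _ r D a b ⟨i, hi⟩ hab P hP hPB hPab => ?_⟩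
    have ha : Transcendental ℂ a := fun h => hi (derivation_eq_zero_of_isAlgebraic (D i) h)
    have hb : Transcendental ℂ b := fun h => by
      obtain ⟨s, p, hs, h'⟩ := hab
      exact mul_ne_zero (pow_ne_zero 2 hs) hi
        ((h' i).1.symm.trans (derivation_eq_zero_of_isAlgebraic (D i) h))
    obtain ⟨Ψ, hΨ0, hΨ, hy⟩ := exists_generator ha hP hPab
    have hΨB : Ψ.totalDegree ≤ B :=
      (totalDegree_le_of_dvd_of_isDomain ((hΨ P).1 hPab) hP).trans hPB
    obtain ⟨hN, hx⟩ := schH_of_schRel hab hi ((hΨ Ψ).2 dvd_rfl) hy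
    obtain ⟨J1, J2, J3, hODE⟩ := hj.schODE
    have hJ := hj.cuspInvariant
    obtain ⟨J, hJe⟩ : ∃ J : ℂ → ℂ, J = fun z => 1728⁻¹ * j z := ⟨_, rfl⟩
    rw [← hJe] at hJ hODE ⊢
    obtain ⟨z₀, hz₀, γ, hγ, hd, hm, hf⟩ := hODE.exists_moeb hJ.surj ha hb hΨ hx hy hN
    have h := hJ.moebDom_of_relation hγ hz₀ ⟨hd, hm⟩ hΨ0 hf
    have hadj : ∀ z ∈ HH, z ∈ moebDom γ.adjugate := fun z hz => by
      have h1 := moeb_adjugate_moeb hγ hd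
      have h2 : moeb γ z₀ ∈ moebDom γ.adjugate := ⟨h1.1, h1.2.symm ▸ hz₀⟩
      refine (hJ.moebDom_of_relation (by simpa [Matrix.det_adjugate] using hγ) hm h2
        (Ψ := rename (Equiv.swap 0 1) Ψ) ?_ ?_ z hz).1
      · rwa [Ne, rename_eq_zero_iff_of_injective _ (Equiv.injective _)]
      · filter_upwards [(isOpen_moebDom γ.adjugate).mem_nhds h2] with w hw
        have h3 := (h _ hw.2).2
        rw [moeb_moeb_adjugate hγ hw.1] at h3
        rw [eval_rename, ← h3]
        congr 2
        ext i
        fin_cases i <;> simp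
    obtain ⟨g, hg, hg0, hgB, s, hs, hγs⟩ := hJ.exists_isPrim_of_relation hγ hΨ0 hΨB h hadj
    refine ⟨g.det.toNat, by lia, by lia, fun p hp => ?_⟩
    have hker : ∀ q, aeval ![a, b] q = 0 → q ∈ vanIdeal J (fun z => J (moeb γ z)) HH := fun q hq z hz => by
      obtain ⟨r, rfl⟩ := (hΨ q).1 hq
      rw [map_mul, (h z hz).2, zero_mul]
    have := RingHom.ker_isPrime (aeval ![a, b] : MvPolynomial (Fin 2) ℂ →ₐ[ℂ] K)
    refine le_of_prime_of_le (I₁ := RingHom.ker (aeval ![a, b] : MvPolynomial (Fin 2) ℂ →ₐ[ℂ] K))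
      ((hΨ Ψ).2 dvd_rfl) hΨ0 (I₂ := vanIdeal J (fun z => J (moeb γ z)) HH) hker (fun r hr hr' => ?_)
      fun z hz => hp _ _ ⟨z, hz, g, by lia, hg, rfl, ?_⟩
    · refine hr (Polynomial.funext fun x => ?_)
      obtain ⟨z, hz, rfl⟩ := hJ.surj x
      have := hr' z hz
      rw [← coe_aeval_eq_eval, RingHom.coe_coe, ← Polynomial.aeval_algHom_apply] at this
      simpa [Polynomial.aeval_def, Polynomial.eval₂_eq_eval_map] using! this
    · rw [hγs]
      simp only [moeb, Matrix.smul_apply, smul_eq_mul, mul_assoc, ← mul_add]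
      rw [mul_div_mul_left _ _ hs]

end SchwarzianCharacterisation

end

/-- (Unconditional refined weak MZP.) Let `S` be a special subvariety
of `Y(1)ⁿ` and `(U_q)_{q ∈ Q}` a parametric family of constructible subsets of `S`.
There is a finite collection `𝒮` of proper special subvarieties of `S` such that every
strongly atypical component `X` of some `U_q` in `S` is contained in a `T₀ ∈ 𝒮` with:
(b) `dim X ≤ dim (U_q ∩ T₀) + dim spcl(X) − dim T₀`, and
(c) `dim (U_q ∩ T₀) > dim U_q + dim T₀ − dim S`. -/
theorem refined_weak_MZP
    (j : ℂ → ℂ) (hj : IsModularJ j)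
    (n m : ℕ) (S : Set (Fin n → ℂ)) (hS : IsSpecial j S)
    (Q : Set (Fin m → ℂ)) (hQ : IsConstr Q)
    (F : Set ((Fin n ⊕ Fin m) → ℂ)) (hF : IsConstr F)
    (hfam : ∀ v ∈ F, (fun k => v (Sum.inr k)) ∈ Q)
    (hsub : ∀ q, fib F q ⊆ S) :
    ∃ 𝒮 : Set (Set (Fin n → ℂ)), 𝒮.Finite ∧
      (∀ T₀ ∈ 𝒮, IsSpecial j T₀ ∧ T₀ ⊆ S ∧ T₀ ≠ S) ∧
      ∀ q ∈ Q, ∀ T : Set (Fin n → ℂ), IsSpecial j T → T ⊆ S →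
        ∀ X : Set (Fin n → ℂ), IsIrrCompOf X (fib F q ∩ T) →
          (adim (fib F q) : ℤ) + (adim T : ℤ) - (adim S : ℤ) < (adim X : ℤ) →
          NoConstCoord X →
          ∃ T₀ ∈ 𝒮, X ⊆ T₀ ∧
            (adim X : ℤ) ≤ (adim (fib F q ∩ T₀) : ℤ) + (adim (spcl j X) : ℤ)
              - (adim T₀ : ℤ) ∧
            (adim (fib F q) : ℤ) + (adim T₀ : ℤ) - (adim S : ℤ)
              < (adim (fib F q ∩ T₀) : ℤ) := by
  exact refined_weak_MZP_of_boundedRelation hj.phiAlg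
    (boundedRelation_of_schPhi hj.phiAlg (by norm_num) hj.schPhi) n m S hS Q F hF hsub

end ModularJPaper
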